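/- For every r ∈ (1,∞) there exists a constant C > 0 such that the maximally modulated Hilbert transform satisfies ‖𝒞f‖_{L^r(ℝ)} ≤ C ‖f‖_{L^r(ℝ)} for all f ∈ C_0^∞(ℝ); that is, 𝒞 is bounded on every standard Lebesgue space L^r(ℝ) with 1 < r < ∞. -/

import Mathlib

open MeasureTheory Filter Set Topology
open scoped ENNReal NNReal

noncomputable section

/-- The Hilbert transform `(Hf)(x) = lim_{ε→0} (1/π) ∫_{|x-y|>ε} f(y)/(x-y) dy`. -/
def hilbert (f : ℝ → ℂ) (x : ℝ) : ℂ :=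
  limUnder (𝓝[>] (0 : ℝ))
    (fun ε => (Real.pi)⁻¹ • ∫ y in {y : ℝ | ε < |x - y|}, f y / ((x : ℂ) - (y : ℂ)))

/-- The maximally modulated Hilbert transform (Carleson operator)
`(𝒞f)(x) = sup_{α ∈ ℝ} |H(e^{-iα·} f)(x)|`. -/
def carleson (f : ℝ → ℂ) (x : ℝ) : ℝ≥0∞ :=
  ⨆ α : ℝ,
    (‖hilbert (fun y => Complex.exp (-(Complex.I * (α : ℂ) * (y : ℂ))) * f y) x‖₊ : ℝ≥0∞)

section CarlesonEstimate

open scoped FourierTransform SchwartzMap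

/-! ### Polynomial weights -/

/-- The growth function `1 + |t| / 2^k`. -/
def rho (k : ℤ) (t : ℝ) : ℝ := 1 + |t| * 2 ^ (-k)

/-- The decaying weight `(1 + |t| / 2^k)^(-n)`. -/
def dec (n : ℕ) (k : ℤ) (t : ℝ) : ℝ≥0∞ := ENNReal.ofReal ((rho k t) ^ n)⁻¹

lemma one_le_rho (k : ℤ) (t : ℝ) : 1 ≤ rho k t := by
  unfold rho; have : 0 ≤ |t| * (2 : ℝ) ^ (-k) := by positivity
  linarith

lemma rho_pos (k : ℤ) (t : ℝ) : 0 < rho k t := by linarith [one_le_rho k t]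

lemma rho_add_le (k : ℤ) (a b : ℝ) : rho k (a + b) ≤ rho k a * rho k b := by
  unfold rho
  have h : (0 : ℝ) ≤ 2 ^ (-k) := by positivity
  have h2 := mul_le_mul_of_nonneg_right (abs_add_le a b) h
  have h3 : 0 ≤ (|a| * (2 : ℝ) ^ (-k)) * (|b| * 2 ^ (-k)) := by positivity
  nlinarith

lemma rho_scale {k k' : ℤ} (h : k' ≤ k) (t : ℝ) : rho k t ≤ rho k' t := by
  unfold rho
  have : (2 : ℝ) ^ (-k) ≤ 2 ^ (-k') := zpow_le_zpow_right₀ (by norm_num) (by omega)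
  gcongr

lemma dec_mul (m n : ℕ) (k : ℤ) (t : ℝ) : dec m k t * dec n k t = dec (m + n) k t := by
  unfold dec
  have := rho_pos k t
  rw [← ENNReal.ofReal_mul (by positivity), pow_add, mul_inv]

lemma dec_pow (m n : ℕ) (k : ℤ) (t : ℝ) : dec m k t ^ n = dec (m * n) k t := by
  unfold dec
  have := rho_pos k t
  rw [← ENNReal.ofReal_pow (by positivity), pow_mul, inv_pow]

lemma dec_le_of_rho {n : ℕ} {k k' : ℤ} {s t : ℝ} (h : rho k t ≤ rho k' s) :
    dec n k' s ≤ dec n k t := by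
  unfold dec
  have := rho_pos k t
  gcongr

lemma dec_anti {m n : ℕ} (h : m ≤ n) (k : ℤ) (t : ℝ) : dec n k t ≤ dec m k t := by
  unfold dec
  have := rho_pos k t
  have := one_le_rho k t
  gcongr

lemma dec_le_one (n : ℕ) (k : ℤ) (t : ℝ) : dec n k t ≤ 1 := by
  have := dec_anti (Nat.zero_le n) k t
  simpa [dec] using this

lemma dec_ne_top (n : ℕ) (k : ℤ) (t : ℝ) : dec n k t ≠ ⊤ := ENNReal.ofReal_ne_top

lemma dec_scale {k k' : ℤ} (h : k' ≤ k) (n : ℕ) (t : ℝ) : dec n k' t ≤ dec n k t :=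
  dec_le_of_rho (rho_scale h t)

lemma dec_neg (n : ℕ) (k : ℤ) (t : ℝ) : dec n k (-t) = dec n k t := by
  simp [dec, rho]

lemma dec_sub_comm (n : ℕ) (k : ℤ) (s t : ℝ) : dec n k (s - t) = dec n k (t - s) := by
  rw [← dec_neg, neg_sub]

lemma dec_peetre (n : ℕ) (k : ℤ) (a b : ℝ) : dec n k a * dec n k b ≤ dec n k (a + b) := by
  unfold dec
  have ha := rho_pos k a
  have hb := rho_pos k b
  have hab := rho_pos k (a + b)
  rw [← ENNReal.ofReal_mul (by positivity), ← mul_inv, ← mul_pow]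
  gcongr
  exact rho_add_le k a b

lemma dec_peetre' (n : ℕ) (k : ℤ) (x y z : ℝ) :
    dec n k (x - y) * dec n k (y - z) ≤ dec n k (x - z) := by
  simpa using dec_peetre n k (x - y) (y - z)

/-- Weights at comparable points are comparable. -/
lemma dec_comp (n : ℕ) (k : ℤ) {s t : ℝ} {m : ℕ} (h : rho k s ≤ m * rho k t) :
    dec n k t ≤ (m : ℝ≥0∞) ^ n * dec n k s := by
  unfold dec
  have hs := rho_pos k s
  have ht := rho_pos k t
  have hm : (0 : ℝ) < m := by
    by_contra hc
    have : (m : ℝ) * rho k t ≤ 0 := mul_nonpos_of_nonpos_of_nonneg (not_lt.mp hc) ht.le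
    linarith
  rw [← ENNReal.ofReal_natCast, ← ENNReal.ofReal_pow (by positivity),
    ← ENNReal.ofReal_mul (by positivity)]
  apply ENNReal.ofReal_le_ofReal
  rw [← div_eq_mul_inv, le_div_iff₀ (by positivity), inv_mul_le_iff₀ (by positivity), mul_comm,
    ← mul_pow]
  gcongr

lemma rho_le_two_mul {k : ℤ} {s t : ℝ} (h : |s| ≤ |t| + max (2 ^ k) |t|) :
    rho k s ≤ (2 : ℕ) * rho k t := by
  unfold rho
  have hp : (0 : ℝ) < 2 ^ (-k) := by positivity
  have h1 : (2 : ℝ) ^ k * 2 ^ (-k) = 1 := by rw [← zpow_add₀ (by norm_num)]; simp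
  have h2 := mul_le_mul_of_nonneg_right h hp.le
  have h3 : max ((2 : ℝ) ^ k) |t| * 2 ^ (-k) ≤ 1 + |t| * 2 ^ (-k) := by
    rcases max_cases ((2 : ℝ) ^ k) |t| with h | h <;> rw [h.1] <;>
      nlinarith [abs_nonneg t, mul_nonneg (abs_nonneg t) hp.le]
  push_cast
  nlinarith

@[fun_prop]
lemma continuous_rho (k : ℤ) : Continuous (rho k) := by unfold rho; fun_prop

@[fun_prop]
lemma continuous_dec (n : ℕ) (k : ℤ) : Continuous (dec n k) := by
  unfold dec
  refine ENNReal.continuous_ofReal.comp (Continuous.inv₀ (by fun_prop) fun t => ?_)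
  have := rho_pos k t
  positivity

@[fun_prop]
lemma measurable_dec (n : ℕ) (k : ℤ) : Measurable (dec n k) := (continuous_dec n k).measurable

@[fun_prop]
lemma measurable_dec_comp {α : Type*} [MeasurableSpace α] (n : ℕ) (k : ℤ) {g : α → ℝ}
    (hg : Measurable g) : Measurable fun a => dec n k (g a) := (measurable_dec n k).comp hg

lemma ofReal_two_zpow (k : ℤ) : ENNReal.ofReal ((2 : ℝ) ^ k) = 2 ^ k := by
  cases k with
  | ofNat n => simp [ENNReal.ofReal_pow]
  | negSucc n =>
    rw [zpow_negSucc, zpow_negSucc, ENNReal.ofReal_inv_of_pos (by positivity),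
      ENNReal.ofReal_pow (by norm_num)]
    simp

/-- The mass of the unit-scale weight. -/
def decMass : ℝ≥0∞ := ∫⁻ t, dec 2 0 t

lemma decMass_ne_top : decMass ≠ ⊤ := by
  have h := finite_integral_one_add_norm (E := ℝ) (μ := volume) (r := 2) (by simp)
  refine ne_of_lt (lt_of_le_of_lt (lintegral_mono fun t => ?_) h)
  unfold dec rho
  apply ENNReal.ofReal_le_ofReal
  simp [Real.rpow_neg (by positivity : (0 : ℝ) ≤ 1 + |t|)]

lemma lintegral_dec_two (k : ℤ) : ∫⁻ t, dec 2 k t = 2 ^ k * decMass := by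
  have h : ∀ t, dec 2 k t = dec 2 0 ((2 ^ (-k) : ℝ) • t) := fun t => by
    unfold dec rho
    congr 3
    simp [abs_mul, mul_comm]
  simp_rw [h]
  have h2 : (2 : ℝ) ^ (-k) ≠ 0 := by positivity
  have := lintegral_map_equiv (μ := volume) (dec 2 0) (MeasurableEquiv.smul₀ ((2 : ℝ) ^ (-k)) h2)
  simp only [MeasurableEquiv.coe_smul₀] at this
  rw [Measure.map_addHaar_smul volume h2] at this
  rw [← this, lintegral_smul_measure]
  simp only [Module.finrank_self, pow_one, zpow_neg, inv_inv, smul_eq_mul]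
  rw [abs_of_pos (by positivity), ofReal_two_zpow, decMass]

lemma lintegral_dec_le {n : ℕ} (hn : 2 ≤ n) (k : ℤ) (c : ℝ) :
    ∫⁻ t, dec n k (t - c) ≤ 2 ^ k * decMass := by
  rw [lintegral_sub_right_eq_self (fun t => dec n k t) c, ← lintegral_dec_two]
  exact lintegral_mono fun t => dec_anti hn k t

lemma lintegral_dec_le' {n : ℕ} (hn : 2 ≤ n) (k : ℤ) (c : ℝ) :
    ∫⁻ t, dec n k (c - t) ≤ 2 ^ k * decMass := by
  simp_rw [fun t => dec_sub_comm n k c t]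
  exact lintegral_dec_le hn k c

/-! ### Powers of two in `ℝ≥0∞` -/

lemma two_zpow_ne_zero (k : ℤ) : (2 : ℝ≥0∞) ^ k ≠ 0 :=
  (ENNReal.zpow_pos (by norm_num) (by norm_num) k).ne'

lemma two_zpow_ne_top (k : ℤ) : (2 : ℝ≥0∞) ^ k ≠ ⊤ :=
  ENNReal.zpow_ne_top (by norm_num) (by norm_num) k

lemma two_zpow_add (a b : ℤ) : (2 : ℝ≥0∞) ^ (a + b) = 2 ^ a * 2 ^ b :=
  ENNReal.zpow_add (by norm_num) (by norm_num) a b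

lemma two_zpow_neg_mul (a : ℤ) : (2 : ℝ≥0∞) ^ (-a) * 2 ^ a = 1 := by
  rw [← two_zpow_add]; simp

lemma two_zpow_mul_neg (a : ℤ) : (2 : ℝ≥0∞) ^ a * 2 ^ (-a) = 1 := by
  rw [← two_zpow_add]; simp

lemma two_zpow_mono {a b : ℤ} (h : a ≤ b) : (2 : ℝ≥0∞) ^ a ≤ 2 ^ b :=
  ENNReal.zpow_le_of_le (by norm_num) h

/-- Geometric sums over scales below a given one. -/
lemma sum_two_zpow_le (s : Finset ℤ) (k₀ : ℤ) (h : ∀ k ∈ s, k ≤ k₀) :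
    ∑ k ∈ s, (2 : ℝ≥0∞) ^ k ≤ 2 * 2 ^ k₀ := by
  have hinj : Set.InjOn (fun k : ℤ => (k₀ - k).toNat) s := by
    intro a ha b hb hab
    have := h a ha; have := h b hb
    simp only at hab; omega
  calc ∑ k ∈ s, (2 : ℝ≥0∞) ^ k = ∑ k ∈ s, 2 ^ k₀ * (2⁻¹ : ℝ≥0∞) ^ (k₀ - k).toNat := by
        refine Finset.sum_congr rfl fun k hk => ?_
        have h1 : k = k₀ + -((k₀ - k).toNat : ℤ) := by have := h k hk; omega
        conv_lhs => rw [h1, two_zpow_add, ENNReal.zpow_neg, zpow_natCast, ENNReal.inv_pow]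
    _ = ∑ j ∈ s.image (fun k : ℤ => (k₀ - k).toNat), 2 ^ k₀ * (2⁻¹ : ℝ≥0∞) ^ j := by
        rw [Finset.sum_image hinj]
    _ ≤ ∑' j : ℕ, 2 ^ k₀ * (2⁻¹ : ℝ≥0∞) ^ j := ENNReal.sum_le_tsum _
    _ = 2 * 2 ^ k₀ := by
        rw [ENNReal.tsum_mul_left, ENNReal.tsum_geometric, ENNReal.one_sub_inv_two, inv_inv,
          mul_comm]

/-! ### Cauchy–Schwarz -/

lemma lintegral_mul_sq_le {α : Type*} [MeasurableSpace α] (μ : Measure α) {f g : α → ℝ≥0∞}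
    (hf : AEMeasurable f μ) (hg : AEMeasurable g μ) :
    (∫⁻ a, f a * g a ∂μ) ^ 2 ≤ (∫⁻ a, f a ^ 2 ∂μ) * ∫⁻ a, g a ^ 2 ∂μ := by
  have h := ENNReal.lintegral_mul_le_Lp_mul_Lq μ (p := 2) (q := 2)
    (by constructor <;> norm_num) hf hg
  have h2 := pow_le_pow_left' h 2
  rw [mul_pow] at h2
  simp only [Pi.mul_apply, ENNReal.rpow_two] at h2
  have e : ∀ x : ℝ≥0∞, (x ^ (1 / 2 : ℝ)) ^ 2 = x := fun x => by
    rw [← ENNReal.rpow_natCast, ← ENNReal.rpow_mul]; norm_num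
  rwa [e, e] at h2

lemma ENNReal.two_mul_le_sq_add_sq (a b : ℝ≥0∞) : 2 * (a * b) ≤ a ^ 2 + b ^ 2 := by
  rcases eq_or_ne a ⊤ with rfl | ha
  · simp
  rcases eq_or_ne b ⊤ with rfl | hb
  · simp
  lift a to ℝ≥0 using ha
  lift b to ℝ≥0 using hb
  norm_cast
  rw [← NNReal.coe_le_coe]
  push_cast
  nlinarith [sq_nonneg ((a : ℝ) - b)]

/-- A quantity whose square is at most `C` times itself is at most `C`. -/
lemma ENNReal.le_of_sq_le_mul {a C : ℝ≥0∞} (ha : a ≠ ⊤) (h : a ^ 2 ≤ C * a) : a ≤ C := by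
  rcases eq_or_ne a 0 with rfl | h0
  · simp
  rw [sq] at h
  exact (ENNReal.mul_le_mul_iff_left h0 ha).mp h

/-- Interaction of an interval with its complement at scale `2^k`. -/
lemma lintegral_cross_le (k : ℤ) (a b : ℝ) {s t : Set ℝ} (hs : s ⊆ Ico a b) (ht : t ⊆ (Ico a b)ᶜ) :
    ∫⁻ x in s, ∫⁻ z in t, dec 4 k (x - z) ≤ 2 * (2 ^ k * decMass) ^ 2 := by
  have key : ∀ x ∈ Ico a b, ∀ z ∈ (Ico a b)ᶜ,
      dec 4 k (x - z) ≤ dec 2 k (x - a) * dec 2 k (z - a) + dec 2 k (x - b) * dec 2 k (z - b) := by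
    intro x hx z hz
    have aux : ∀ c : ℝ, |x - c| + |z - c| ≤ |x - z| →
        dec 4 k (x - z) ≤ dec 2 k (x - c) * dec 2 k (z - c) := by
      intro c hc
      rw [show (4 : ℕ) = 2 + 2 from rfl, ← dec_mul]
      have hp : (0 : ℝ) ≤ 2 ^ (-k) := by positivity
      refine mul_le_mul' (dec_le_of_rho ?_) (dec_le_of_rho ?_) <;>
      · unfold rho
        have h1 := abs_nonneg (x - c)
        have h2 := abs_nonneg (z - c)
        have h3 : (0 : ℝ) < 2 ^ (-k) := by positivity
        nlinarith
    rcases lt_or_ge z a with h | h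
    · refine (aux a ?_).trans le_self_add
      rw [abs_of_nonneg (by linarith [hx.1]), abs_of_neg (by linarith),
        abs_of_nonneg (by linarith [hx.1])]
      linarith
    · have hb : b ≤ z := by
        by_contra hc
        exact hz ⟨h, not_le.mp hc⟩
      refine (aux b ?_).trans le_add_self
      rw [abs_of_nonpos (by linarith [hx.2]), abs_of_nonneg (by linarith),
        abs_of_nonpos (by linarith [hx.2])]
      linarith
  have hst : ∫⁻ x in s, ∫⁻ z in t, dec 4 k (x - z) ≤
      ∫⁻ x in Ico a b, ∫⁻ z in (Ico a b)ᶜ, dec 4 k (x - z) :=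
    (lintegral_mono_set hs).trans (lintegral_mono fun x => lintegral_mono_set ht)
  calc _ ≤ _ := hst
    _ ≤ ∫⁻ x in Ico a b, ∫⁻ z in (Ico a b)ᶜ,
          (dec 2 k (x - a) * dec 2 k (z - a) + dec 2 k (x - b) * dec 2 k (z - b)) :=
        setLIntegral_mono' measurableSet_Ico fun x hx =>
          setLIntegral_mono' measurableSet_Ico.compl fun z hz => key x hx z hz
    _ ≤ ∫⁻ x, ∫⁻ z, (dec 2 k (x - a) * dec 2 k (z - a) + dec 2 k (x - b) * dec 2 k (z - b)) :=
        (setLIntegral_le_lintegral _ _).trans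
          (lintegral_mono fun x => setLIntegral_le_lintegral _ _)
    _ = (∫⁻ x, dec 2 k (x - a)) * (∫⁻ z, dec 2 k (z - a)) +
          (∫⁻ x, dec 2 k (x - b)) * (∫⁻ z, dec 2 k (z - b)) := by
        simp_rw [fun x => lintegral_add_left (μ := volume)
          (f := fun z => dec 2 k (x - a) * dec 2 k (z - a)) (by fun_prop)
          (fun z => dec 2 k (x - b) * dec 2 k (z - b))]
        rw [lintegral_add_left]
        · congr 1 <;>
          · rw [← lintegral_mul_const _ (by fun_prop)]
            refine lintegral_congr fun x => ?_
            rw [lintegral_const_mul _ (by fun_prop)]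
        · simp_rw [fun x => lintegral_const_mul (μ := volume) (dec 2 k (x - a))
            (f := fun z => dec 2 k (z - a)) (by fun_prop)]
          fun_prop
    _ ≤ _ := by
        have ha := lintegral_dec_le le_rfl k a
        have hb := lintegral_dec_le le_rfl k b
        rw [two_mul, sq]
        gcongr

/-! ### Dyadic intervals and tiles -/

/-- The index of the dyadic interval of length `2^k` containing `x`. -/
def dy (k : ℤ) (x : ℝ) : ℤ := ⌊x * 2 ^ (-k)⌋

/-- The dyadic interval `[n 2^k, (n+1) 2^k)`. -/
def DI (k n : ℤ) : Set ℝ := {x | dy k x = n}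

/-- The centre of `DI k n`. -/
def ctr (k n : ℤ) : ℝ := (n + 1 / 2) * 2 ^ k

@[simp] lemma mem_DI {k n : ℤ} {x : ℝ} : x ∈ DI k n ↔ dy k x = n := Iff.rfl

lemma dy_eq_iff {k n : ℤ} {x : ℝ} : dy k x = n ↔ (n : ℝ) * 2 ^ k ≤ x ∧ x < ((n : ℝ) + 1) * 2 ^ k :=
    by
  unfold dy
  have h : (0 : ℝ) < 2 ^ k := by positivity
  rw [Int.floor_eq_iff, zpow_neg, ← div_eq_mul_inv, le_div_iff₀ h, div_lt_iff₀ h]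

lemma DI_eq_Ico (k n : ℤ) : DI k n = Ico ((n : ℝ) * 2 ^ k) (((n : ℝ) + 1) * 2 ^ k) := by
  ext x; simp [dy_eq_iff]

lemma measurableSet_DI (k n : ℤ) : MeasurableSet (DI k n) := by
  rw [DI_eq_Ico]; exact measurableSet_Ico

@[fun_prop]
lemma measurable_dy (k : ℤ) : Measurable (dy k) := by
  unfold dy; fun_prop

lemma volume_DI (k n : ℤ) : volume (DI k n) = 2 ^ k := by
  rw [DI_eq_Ico, Real.volume_Ico, ← ofReal_two_zpow]; congr 1; ring

lemma left_mem_DI (k n : ℤ) : ((n : ℝ) * 2 ^ k) ∈ DI k n := by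
  have h : (0 : ℝ) < 2 ^ k := by positivity
  rw [mem_DI, dy_eq_iff]; constructor <;> nlinarith

lemma DI_nonempty (k n : ℤ) : (DI k n).Nonempty := ⟨_, left_mem_DI k n⟩

lemma abs_sub_ctr_le {k n : ℤ} {x : ℝ} (h : x ∈ DI k n) : |x - ctr k n| ≤ 2 ^ k / 2 := by
  rw [mem_DI, dy_eq_iff] at h
  unfold ctr
  rw [abs_le]; constructor <;> nlinarith [h.1, h.2]

lemma abs_sub_le_of_mem_DI {k n : ℤ} {x y : ℝ} (hx : x ∈ DI k n) (hy : y ∈ DI k n) :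
    |x - y| ≤ 2 ^ k := by
  rw [mem_DI, dy_eq_iff] at hx hy
  rw [abs_le]; constructor <;> nlinarith

lemma dy_add_nat (k : ℤ) (j : ℕ) (x : ℝ) : dy (k + j) x = dy k x / 2 ^ j := by
  unfold dy
  have h : x * (2 : ℝ) ^ (-(k + (j : ℤ))) = x * 2 ^ (-k) / ((2 ^ j : ℕ) : ℝ) := by
    rw [neg_add, zpow_add₀ (by norm_num), zpow_neg _ (j : ℤ), zpow_natCast]
    push_cast
    ring
  rw [h, Int.floor_div_natCast]
  push_cast
  rfl

lemma dy_eq_of_le {k k' : ℤ} (h : k ≤ k') {x y : ℝ} (hxy : dy k x = dy k y) :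
    dy k' x = dy k' y := by
  obtain ⟨j, rfl⟩ := Int.le.dest h
  rw [dy_add_nat, dy_add_nat, hxy]

lemma dy_half (k : ℤ) (x : ℝ) : dy k x = dy (k - 1) x / 2 := by
  have := dy_add_nat (k - 1) 1 x
  simpa using this

lemma DI_subset_of_mem {k k' n n' : ℤ} {x : ℝ} (h : k' ≤ k) (hx' : x ∈ DI k' n')
    (hx : x ∈ DI k n) : DI k' n' ⊆ DI k n := by
  intro y hy
  rw [mem_DI] at *
  rw [← hx]
  exact dy_eq_of_le h (hy.trans hx'.symm)

lemma DI_subset_or_disjoint {k k' : ℤ} (h : k' ≤ k) (n n' : ℤ) :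
    DI k' n' ⊆ DI k n ∨ Disjoint (DI k' n') (DI k n) := by
  by_cases hd : Disjoint (DI k' n') (DI k n)
  · exact Or.inr hd
  · obtain ⟨x, hx, hx'⟩ := Set.not_disjoint_iff.mp hd
    exact Or.inl (DI_subset_of_mem h hx hx')

lemma scale_le_of_DI_subset {k k' n n' : ℤ} (h : DI k' n' ⊆ DI k n) : k' ≤ k := by
  have := measure_mono (μ := volume) h
  rw [volume_DI, volume_DI] at this
  by_contra hc
  have h2 : (2 : ℝ≥0∞) ^ k * 2 ≤ 2 ^ k' := by
    have := two_zpow_mono (a := k + 1) (b := k') (by omega)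
    rwa [two_zpow_add, zpow_one] at this
  have h3 : (2 : ℝ≥0∞) ^ k * 2 ≤ 2 ^ k * 1 := by rw [mul_one]; exact h2.trans this
  rw [ENNReal.mul_le_mul_iff_right (two_zpow_ne_zero k) (two_zpow_ne_top k)] at h3
  norm_num at h3

lemma DI_disjoint {k n n' : ℤ} (h : n ≠ n') : Disjoint (DI k n) (DI k n') := by
  rw [Set.disjoint_left]
  rintro x rfl hx
  exact h hx

lemma DI_left_subset (k l : ℤ) : DI (k - 1) (2 * l) ⊆ DI k l := by
  intro x hx; rw [mem_DI] at *; rw [dy_half, hx]; omega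

lemma DI_right_subset (k l : ℤ) : DI (k - 1) (2 * l + 1) ⊆ DI k l := by
  intro x hx; rw [mem_DI] at *; rw [dy_half, hx]; omega

lemma mem_left_or_right {k l : ℤ} {x : ℝ} (h : x ∈ DI k l) :
    x ∈ DI (k - 1) (2 * l) ∨ x ∈ DI (k - 1) (2 * l + 1) := by
  simp only [mem_DI] at *; rw [dy_half] at h; omega

/-- A tile: a dyadic time interval of length `2^k` and a dyadic frequency interval of
length `2^(-k)`. -/
structure Tile where
  k : ℤ
  n : ℤ
  l : ℤ

instance : DecidableEq Tile := Classical.decEq _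

namespace Tile

/-- The time interval. -/
def I (P : Tile) : Set ℝ := DI P.k P.n

/-- The frequency interval. -/
def W (P : Tile) : Set ℝ := DI (-P.k) P.l

/-- The left half of the frequency interval. -/
def L (P : Tile) : Set ℝ := DI (-P.k - 1) (2 * P.l)

/-- The right half of the frequency interval. -/
def R (P : Tile) : Set ℝ := DI (-P.k - 1) (2 * P.l + 1)

/-- The centre of the time interval. -/
def c (P : Tile) : ℝ := ctr P.k P.n

lemma L_subset_W (P : Tile) : P.L ⊆ P.W := DI_left_subset _ _

lemma R_subset_W (P : Tile) : P.R ⊆ P.W := DI_right_subset _ _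

lemma disjoint_L_R (P : Tile) : Disjoint P.L P.R := DI_disjoint (by omega)

lemma lt_of_mem_L_of_mem_R {P : Tile} {x y : ℝ} (hx : x ∈ P.L) (hy : y ∈ P.R) : x < y := by
  simp only [L, R, mem_DI, dy_eq_iff] at hx hy
  refine hx.2.trans_le (le_trans (le_of_eq ?_) hy.1)
  push_cast; ring

lemma measurableSet_I (P : Tile) : MeasurableSet P.I := measurableSet_DI _ _

lemma measurableSet_R (P : Tile) : MeasurableSet P.R := measurableSet_DI _ _

lemma measurableSet_W (P : Tile) : MeasurableSet P.W := measurableSet_DI _ _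

lemma volume_I (P : Tile) : volume P.I = 2 ^ P.k := volume_DI _ _

/-- A frequency interval of larger time scale meeting a half of a frequency interval is contained
in that half. -/
lemma W_subset_L {P P' : Tile} (h : P'.k < P.k) {x : ℝ} (hx : x ∈ P.W) (hx' : x ∈ P'.L) :
    P.W ⊆ P'.L := DI_subset_of_mem (by omega) hx hx'

lemma W_subset_W {P P' : Tile} (h : P'.k ≤ P.k) {x : ℝ} (hx : x ∈ P.W) (hx' : x ∈ P'.W) :
    P.W ⊆ P'.W := DI_subset_of_mem (by omega) hx hx'

lemma I_subset_I {P P' : Tile} (h : P'.k ≤ P.k) {x : ℝ} (hx : x ∈ P.I) (hx' : x ∈ P'.I) :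
    P'.I ⊆ P.I := DI_subset_of_mem h hx' hx

lemma W_nonempty (P : Tile) : P.W.Nonempty := DI_nonempty _ _

lemma I_nonempty (P : Tile) : P.I.Nonempty := DI_nonempty _ _

lemma eq_of_mem {P P' : Tile} (hk : P.k = P'.k) {x ξ : ℝ} (hx : x ∈ P.I) (hx' : x ∈ P'.I)
    (hξ : ξ ∈ P.W) (hξ' : ξ ∈ P'.W) : P = P' := by
  obtain ⟨k, n, l⟩ := P
  obtain ⟨k', n', l'⟩ := P'
  simp only [I, W, mem_DI] at *
  subst hk
  subst hx hξ
  simp [hx', hξ']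

end Tile

/-! ### Wave packets -/

lemma bump_hasCompactSupport {c : ℝ} (β : ContDiffBump c) (k l : ℤ) :
    HasCompactSupport (fun ξ : ℝ => ((β (2 ^ k * ξ - l) : ℝ) : ℂ)) := by
  have h : (0 : ℝ) < 2 ^ k := by positivity
  refine HasCompactSupport.of_support_subset_isCompact
    (isCompact_Icc (a := (c - β.rOut + l) / 2 ^ k) (b := (c + β.rOut + l) / 2 ^ k)) fun ξ hξ => ?_
  have h1 : (2 ^ k * ξ - l) ∈ Function.support β := by
    intro h0; exact hξ (by simp [h0])
  rw [β.support_eq, Metric.mem_ball, Real.dist_eq, abs_lt] at h1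
  constructor
  · rw [div_le_iff₀ h]; nlinarith [h1.1]
  · rw [le_div_iff₀ h]; nlinarith [h1.2]

lemma bump_contDiff {c : ℝ} (β : ContDiffBump c) (k l : ℤ) :
    ContDiff ℝ (⊤ : ℕ∞) (fun ξ : ℝ => ((β (2 ^ k * ξ - l) : ℝ) : ℂ)) := by
  have h : ContDiff ℝ (⊤ : ℕ∞) (fun ξ : ℝ => β (2 ^ k * ξ - l)) := β.contDiff.comp (by fun_prop)
  exact Complex.ofRealCLM.contDiff.comp h

/-- The wave packet whose Fourier transform is `ξ ↦ β (2^k ξ - l)`. -/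
def wp {c : ℝ} (β : ContDiffBump c) (k l : ℤ) : 𝓢(ℝ, ℂ) :=
  𝓕⁻ ((bump_hasCompactSupport β k l).toSchwartzMap (bump_contDiff β k l))

lemma fourier_wp {c : ℝ} (β : ContDiffBump c) (k l : ℤ) (ξ : ℝ) :
    𝓕 (wp β k l) ξ = ((β (2 ^ k * ξ - l) : ℝ) : ℂ) := by
  rw [wp, FourierTransform.fourier_fourierInv_eq]
  simp

lemma wp_eq_integral {c : ℝ} (β : ContDiffBump c) (k l : ℤ) (t : ℝ) :
    wp β k l t = ∫ ξ : ℝ, Complex.exp (↑(2 * Real.pi * (ξ * t)) * Complex.I) *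
      ((β (2 ^ k * ξ - l) : ℝ) : ℂ) := by
  rw [wp, SchwartzMap.fourierInv_coe, Real.fourierInv_eq']
  refine integral_congr_ae (ae_of_all _ fun ξ => ?_)
  simp [mul_comm]

lemma wp_formula {c : ℝ} (β : ContDiffBump c) (k l : ℤ) (t : ℝ) :
    wp β k l t = (2 : ℂ) ^ (-k) * Complex.exp (↑(2 * Real.pi * (l * (2 ^ (-k) * t))) * Complex.I) *
      wp β 0 0 (2 ^ (-k) * t) := by
  have hk : (0 : ℝ) < 2 ^ k := by positivity
  rw [wp_eq_integral, wp_eq_integral]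
  set F : ℝ → ℂ := fun η => Complex.exp (↑(2 * Real.pi * ((η + l) * (2 ^ (-k) * t))) * Complex.I) *
      ((β η : ℝ) : ℂ) with hF
  have h1 : ∀ ξ : ℝ, Complex.exp (↑(2 * Real.pi * (ξ * t)) * Complex.I) *
      ((β (2 ^ k * ξ - l) : ℝ) : ℂ) = (fun η => F (η - l)) (2 ^ k * ξ) := by
    intro ξ
    simp only [hF]
    congr 4
    rw [zpow_neg]
    field_simp
    ring
  simp_rw [h1]
  rw [Measure.integral_comp_mul_left (fun η => F (η - l)), integral_sub_right_eq_self F (l : ℝ),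
    abs_of_pos (by positivity), mul_assoc, ← integral_const_mul]
  have h2 : ((2 ^ k : ℝ)⁻¹ : ℝ) • ∫ y, F y = (2 : ℂ) ^ (-k) * ∫ y, F y := by
    rw [Complex.real_smul]; push_cast; rw [zpow_neg]
  rw [h2]
  congr 2
  funext η
  simp only [hF, zpow_zero, one_mul, Int.cast_zero, sub_zero]
  rw [← mul_assoc (Complex.exp _), ← Complex.exp_add]
  congr 2
  push_cast
  ring

lemma conj_wp {c : ℝ} (β : ContDiffBump c) (k l : ℤ) (t : ℝ) :
    (starRingEnd ℂ) (wp β k l t) = wp β k l (-t) := by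
  rw [wp_eq_integral, wp_eq_integral, ← integral_conj]
  refine integral_congr_ae (ae_of_all _ fun ξ => ?_)
  beta_reduce
  rw [map_mul, Complex.conj_ofReal, ← Complex.exp_conj, map_mul, Complex.conj_I,
      Complex.conj_ofReal]
  congr 2
  push_cast
  ring

lemma schwartz_decay (f : 𝓢(ℝ, ℂ)) (n : ℕ) : ∃ D : ℝ≥0, ∀ t : ℝ,
    ‖f t‖ ≤ D * ((1 + |t|) ^ n)⁻¹ := by
  refine ⟨((2 ^ n * ((Finset.Iic (n, 0)).sup fun m => SchwartzMap.seminorm ℝ m.1 m.2) f :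
      ℝ)).toNNReal,
    fun t => ?_⟩
  have h := SchwartzMap.one_add_le_sup_seminorm_apply (𝕜 := ℝ) (m := (n, 0)) le_rfl le_rfl f t
  rw [norm_iteratedFDeriv_zero, Real.norm_eq_abs] at h
  have : 0 < (1 + |t|) ^ n := by positivity
  rw [← div_eq_mul_inv, le_div_iff₀ this, mul_comm]
  exact h.trans (Real.le_coe_toNNReal _)

lemma enorm_eq_ofReal_two_zpow (k : ℤ) : ‖(2 : ℂ) ^ k‖ₑ = 2 ^ k := by
  rw [← ofReal_norm, norm_zpow, Complex.norm_ofNat, ofReal_two_zpow]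

lemma enorm_exp_mul_I (x : ℝ) : ‖Complex.exp (x * Complex.I)‖ₑ = 1 := by
  rw [← ofReal_norm, Complex.norm_exp_ofReal_mul_I, ENNReal.ofReal_one]

lemma dec_eq_unit (n : ℕ) (k : ℤ) (t : ℝ) :
    dec n k t = ENNReal.ofReal ((1 + |2 ^ (-k) * t|) ^ n)⁻¹ := by
  unfold dec rho
  rw [abs_mul, abs_of_pos (by positivity : (0 : ℝ) < 2 ^ (-k)), mul_comm]

/-- Wave packets decay rapidly away from the origin, uniformly in scale and frequency. -/
lemma wp_bound {c : ℝ} (β : ContDiffBump c) : ∃ D : ℝ≥0, ∀ (k l : ℤ) (t : ℝ),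
    ‖wp β k l t‖ₑ ≤ D * 2 ^ (-k) * dec 20 k t := by
  obtain ⟨D, hD⟩ := schwartz_decay (wp β 0 0) 20
  refine ⟨D, fun k l t => ?_⟩
  rw [wp_formula, enorm_mul, enorm_mul, enorm_exp_mul_I, enorm_eq_ofReal_two_zpow, mul_one,
    mul_comm (D : ℝ≥0∞), mul_assoc]
  gcongr
  rw [dec_eq_unit, ← ofReal_norm, ← ENNReal.ofReal_coe_nnreal, ← ENNReal.ofReal_mul (by positivity)]
  exact ENNReal.ofReal_le_ofReal (hD _)

lemma abs_exp_sub_exp_le (x y : ℝ) :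
    ‖Complex.exp (x * Complex.I) - Complex.exp (y * Complex.I)‖ ≤ |x - y| := by
  have h : Complex.exp (x * Complex.I) - Complex.exp (y * Complex.I) =
      Complex.exp (y * Complex.I) * (Complex.exp (Complex.I * ↑(x - y)) - 1) := by
    rw [mul_sub, ← Complex.exp_add]; push_cast; ring_nf
  rw [h, norm_mul, Complex.norm_exp_ofReal_mul_I, one_mul]
  exact Real.norm_exp_I_mul_ofReal_sub_one_le.trans (by simp)

lemma schwartz_lipschitz (f : 𝓢(ℝ, ℂ)) (n : ℕ) : ∃ D : ℝ≥0, ∀ (a s t : ℝ), 0 ≤ a → a ≤ 1 →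
    |s - t| ≤ 1 →
    ‖Complex.exp (↑(-(2 * Real.pi * (a * s))) * Complex.I) * f s -
      Complex.exp (↑(-(2 * Real.pi * (a * t))) * Complex.I) * f t‖ ≤
      D * |s - t| * ((1 + |t|) ^ n)⁻¹ := by
  obtain ⟨D, hD⟩ := schwartz_decay f n
  obtain ⟨D', hD'⟩ := schwartz_decay (SchwartzMap.derivCLM ℝ ℂ f) n
  refine ⟨D' * 2 ^ n + 2 * Real.pi.toNNReal * D, fun a s t ha0 ha1 hst => ?_⟩
  have h1 : ‖f s - f t‖ ≤ D' * 2 ^ n * ((1 + |t|) ^ n)⁻¹ * ‖s - t‖ := by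
    refine Convex.norm_image_sub_le_of_norm_deriv_le (s := Set.uIcc t s)
      (fun x _ => f.differentiableAt) (fun x hx => ?_) (convex_uIcc t s) left_mem_uIcc
      right_mem_uIcc
    have h2 := hD' x
    rw [SchwartzMap.derivCLM_apply] at h2
    refine h2.trans ?_
    rw [mul_assoc]
    gcongr
    rw [← div_eq_mul_inv, le_div_iff₀ (by positivity), inv_mul_le_iff₀ (by positivity), mul_comm,
      ← mul_pow]
    gcongr
    have h3 : |t - x| ≤ 1 := (Set.abs_sub_left_of_mem_uIcc hx).trans' (by rw [abs_sub_comm])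
        |>.trans hst
    have h4 : |t| ≤ |x| + |t - x| := by
      calc |t| = |x + (t - x)| := by ring_nf
        _ ≤ _ := abs_add_le _ _
    nlinarith [abs_nonneg x]
  have h5 : ‖Complex.exp (↑(-(2 * Real.pi * (a * s))) * Complex.I) -
      Complex.exp (↑(-(2 * Real.pi * (a * t))) * Complex.I)‖ ≤ 2 * Real.pi * |s - t| := by
    refine (abs_exp_sub_exp_le _ _).trans ?_
    rw [show -(2 * Real.pi * (a * s)) - -(2 * Real.pi * (a * t)) = -(2 * Real.pi * a * (s -
        t)) by ring,
      abs_neg, abs_mul, abs_of_nonneg (by positivity)]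
    have := Real.pi_pos
    have : 2 * Real.pi * a ≤ 2 * Real.pi := by nlinarith
    gcongr
  have h6 := hD t
  calc _ = ‖Complex.exp (↑(-(2 * Real.pi * (a * s))) * Complex.I) * (f s - f t) +
        (Complex.exp (↑(-(2 * Real.pi * (a * s))) * Complex.I) -
          Complex.exp (↑(-(2 * Real.pi * (a * t))) * Complex.I)) * f t‖ := by ring_nf
    _ ≤ ‖f s - f t‖ + 2 * Real.pi * |s - t| * (D * ((1 + |t|) ^ n)⁻¹) := by
        refine (norm_add_le _ _).trans ?_
        rw [norm_mul, norm_mul, Complex.norm_exp_ofReal_mul_I, one_mul]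
        gcongr
    _ ≤ _ := by
        rw [Real.norm_eq_abs] at h1
        push_cast
        rw [Real.coe_toNNReal _ Real.pi_pos.le]
        nlinarith

/-- Smoothness of wave packets after removing the oscillation at a frequency in their
frequency interval. -/
lemma wp_lipschitz {c : ℝ} (β : ContDiffBump c) : ∃ D : ℝ≥0, ∀ (k l : ℤ) (ξ s t : ℝ),
    ξ ∈ DI (-k) l → |s - t| ≤ 2 ^ k →
    ‖Complex.exp (↑(-(2 * Real.pi * (ξ * s))) * Complex.I) * wp β k l s -
      Complex.exp (↑(-(2 * Real.pi * (ξ * t))) * Complex.I) * wp β k l t‖ₑ ≤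
      D * ENNReal.ofReal (|s - t| * 2 ^ (-k)) * 2 ^ (-k) * dec 20 k t := by
  obtain ⟨D, hD⟩ := schwartz_lipschitz (wp β 0 0) 20
  refine ⟨D, fun k l ξ s t hξ hst => ?_⟩
  have hk : (0 : ℝ) < 2 ^ k := by positivity
  have hk' : (2 : ℝ) ^ k * 2 ^ (-k) = 1 := by rw [← zpow_add₀ (by norm_num)]; simp
  have hk2 : (0 : ℝ) < 2 ^ (-k) := by positivity
  rw [mem_DI, dy_eq_iff] at hξ
  have e : ∀ u : ℝ, Complex.exp (↑(-(2 * Real.pi * (ξ * u))) * Complex.I) * wp β k l u =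
      (2 : ℂ) ^ (-k) * (Complex.exp (↑(-(2 * Real.pi * ((ξ * 2 ^ k - l) * (2 ^ (-k) * u)))) *
        Complex.I) * wp β 0 0 (2 ^ (-k) * u)) := by
    intro u
    rw [wp_formula]
    have : Complex.exp (↑(-(2 * Real.pi * ((ξ * 2 ^ k - l) * (2 ^ (-k) * u)))) * Complex.I) =
        Complex.exp (↑(-(2 * Real.pi * (ξ * u))) * Complex.I) *
        Complex.exp (↑(2 * Real.pi * (l * (2 ^ (-k) * u))) * Complex.I) := by
      rw [← Complex.exp_add, ← add_mul, ← Complex.ofReal_add]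
      congr 3
      linear_combination (-2 * Real.pi * ξ * u) * hk'
    rw [this]; ring
  have e2 : |2 ^ (-k) * s - 2 ^ (-k) * t| = |s - t| * 2 ^ (-k) := by
    rw [← mul_sub, abs_mul, abs_of_pos hk2, mul_comm]
  rw [e, e, ← mul_sub, enorm_mul, enorm_eq_ofReal_two_zpow]
  calc _ ≤ 2 ^ (-k) * (D * ENNReal.ofReal (|s - t| * 2 ^ (-k)) * dec 20 k t) := ?_
    _ = _ := by ring
  refine mul_le_mul' le_rfl ?_
  rw [dec_eq_unit, ← ofReal_norm, ← ENNReal.ofReal_coe_nnreal, ← ENNReal.ofReal_mul (by positivity),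
    ← ENNReal.ofReal_mul (by positivity), ← e2]
  refine ENNReal.ofReal_le_ofReal (hD _ _ _ ?_ ?_ ?_)
  · have h := mul_le_mul_of_nonneg_right hξ.1 hk.le
    rw [mul_assoc, mul_comm (2 ^ (-k) : ℝ), hk'] at h
    linarith
  · have h := mul_le_mul_of_nonneg_right hξ.2.le hk.le
    rw [mul_assoc, mul_comm (2 ^ (-k) : ℝ), hk'] at h
    linarith
  · rw [e2]
    calc |s - t| * 2 ^ (-k) ≤ 2 ^ k * 2 ^ (-k) := by gcongr
      _ = 1 := hk'

lemma schwartz_conv_eq (f g h : 𝓢(ℝ, ℂ)) (H : ∀ ξ, 𝓕 f ξ * 𝓕 g ξ = 𝓕 h ξ) (x : ℝ) :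
    ∫ y, f y * g (x - y) = h x := by
  have h1 : SchwartzMap.convolution (ContinuousLinearMap.mul ℂ ℂ) f g = h := by
    rw [← FourierTransform.fourierInv_fourier_eq (E := 𝓢(ℝ, ℂ)) (F := 𝓢(ℝ, ℂ))
        (SchwartzMap.convolution (ContinuousLinearMap.mul ℂ ℂ) f g),
      ← FourierTransform.fourierInv_fourier_eq (E := 𝓢(ℝ, ℂ)) (F := 𝓢(ℝ, ℂ)) h]
    congr 1
    rw [SchwartzMap.fourier_convolution]
    ext ξ
    rw [← H]
    simp [SchwartzMap.pairing_apply_apply]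
  have h2 := SchwartzMap.convolution_apply (ContinuousLinearMap.mul ℂ ℂ) f g x
  rw [h1] at h2
  rw [h2]
  rfl

lemma wp_conv_eq_zero {c c' : ℝ} (β : ContDiffBump c) (β' : ContDiffBump c') {k l k' l' : ℤ}
    (H : ∀ ξ : ℝ, 2 ^ k * ξ - l ∈ Metric.ball c β.rOut →
      2 ^ k' * ξ - l' ∉ Metric.ball c' β'.rOut) (x : ℝ) :
    ∫ y, wp β k l y * wp β' k' l' (x - y) = 0 := by
  have := schwartz_conv_eq (wp β k l) (wp β' k' l') 0 (fun ξ => ?_) x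
  · simpa using this
  · rw [fourier_wp, fourier_wp, ← Complex.ofReal_mul]
    have : 𝓕 (0 : 𝓢(ℝ, ℂ)) = 0 := map_zero (FourierTransform.fourierCLM ℂ 𝓢(ℝ, ℂ))
    rw [this]
    simp only [zero_apply, Complex.ofReal_eq_zero, mul_eq_zero]
    by_contra hc
    push Not at hc
    refine H ξ ?_ ?_
    · rw [← β.support_eq]; exact hc.1
    · rw [← β'.support_eq]; exact hc.2

lemma wp_conv_eq_self {c c' : ℝ} (β : ContDiffBump c) (β' : ContDiffBump c') {k l k' l' : ℤ}
    (H : ∀ ξ : ℝ, 2 ^ k * ξ - l ∈ Metric.ball c β.rOut →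
      2 ^ k' * ξ - l' ∈ Metric.closedBall c' β'.rIn) (x : ℝ) :
    ∫ y, wp β k l y * wp β' k' l' (x - y) = wp β k l x := by
  refine schwartz_conv_eq _ _ _ (fun ξ => ?_) x
  rw [fourier_wp, fourier_wp, ← Complex.ofReal_mul]
  congr 1
  by_cases h : β (2 ^ k * ξ - l) = 0
  · rw [h, zero_mul]
  · rw [β'.one_of_mem_closedBall (H ξ _), mul_one]
    rw [← β.support_eq]; exact h

/-! ### Convolution with Schwartz functions -/

/-- Convolution. -/
def cv (u g : ℝ → ℂ) (x : ℝ) : ℂ := ∫ y, u y * g (x - y)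

lemma schwartz_bdd (g : 𝓢(ℝ, ℂ)) : ∃ D : ℝ≥0, ∀ t, ‖g t‖ ≤ D := by
  obtain ⟨D, hD⟩ := schwartz_decay g 0
  exact ⟨D, fun t => by simpa using hD t⟩

lemma integrable_cv_integrand {u : ℝ → ℂ} (hu : Integrable u) (g : 𝓢(ℝ, ℂ)) (x : ℝ) :
    Integrable fun y => u y * g (x - y) := by
  obtain ⟨D, hD⟩ := schwartz_bdd g
  refine hu.mul_bdd (c := D) ?_ (ae_of_all _ fun y => hD _)
  exact (g.continuous.comp (by fun_prop)).aestronglyMeasurable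

lemma continuous_cv {u : ℝ → ℂ} (hu : Integrable u) (g : 𝓢(ℝ, ℂ)) : Continuous (cv u g) := by
  obtain ⟨D, hD⟩ := schwartz_bdd g
  refine continuous_of_dominated (bound := fun y => ‖u y‖ * D)
    (fun x => (integrable_cv_integrand hu g x).aestronglyMeasurable) (fun x => ae_of_all _ fun y =>
        ?_)
    (hu.norm.mul_const _) (ae_of_all _ fun y => ?_)
  · rw [norm_mul]; gcongr; exact hD _
  · exact continuous_const.mul (g.continuous.comp (by fun_prop))

lemma integrable_cv {u : ℝ → ℂ} (hu : Integrable u) (g : 𝓢(ℝ, ℂ)) : Integrable (cv u g) := by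
  have h := hu.integrable_convolution (ContinuousLinearMap.mul ℂ ℂ) g.integrable
  exact h

lemma enorm_cv_le (u g : ℝ → ℂ) (x : ℝ) : ‖cv u g x‖ₑ ≤ ∫⁻ y, ‖u y‖ₑ * ‖g (x - y)‖ₑ := by
  refine (enorm_integral_le_lintegral_enorm _).trans (le_of_eq (lintegral_congr fun y => ?_))
  rw [enorm_mul]

lemma bdd_cv {u : ℝ → ℂ} (hu : Integrable u) (g : 𝓢(ℝ, ℂ)) : ∃ M : ℝ≥0, ∀ x, ‖cv u g x‖ ≤ M := by
  obtain ⟨D, hD⟩ := schwartz_bdd g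
  refine ⟨(∫ y, ‖u y‖ * D).toNNReal, fun x => ?_⟩
  refine le_trans (norm_integral_le_of_norm_le (hu.norm.mul_const _) (ae_of_all _ fun y => ?_))
    (Real.le_coe_toNNReal _)
  rw [norm_mul]; gcongr; exact hD _

/-- Associativity of convolution. -/
lemma cv_assoc {u : ℝ → ℂ} (hu : Integrable u) (g h : 𝓢(ℝ, ℂ)) (x : ℝ) :
    cv (cv u g) h x = ∫ s, u s * cv g h (x - s) := by
  obtain ⟨D, hD⟩ := schwartz_bdd g
  have hInt : Integrable (Function.uncurry fun (y s : ℝ) => u s * g (y - s) * h (x - y))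
      (volume.prod volume) := by
    have h1 : Integrable (fun z : ℝ × ℝ => h (x - z.1) * u z.2) (volume.prod volume) :=
      (h.integrable.comp_sub_left x).mul_prod hu
    have h2 := h1.mul_bdd (c := D) (g := fun z : ℝ × ℝ => g (z.1 - z.2))
      (g.continuous.comp (by fun_prop)).aestronglyMeasurable (ae_of_all _ fun y => hD _)
    refine h2.congr (ae_of_all _ fun z => ?_)
    simp only [Function.uncurry]
    ring
  unfold cv
  simp_rw [← integral_mul_const]
  rw [integral_integral_swap hInt]
  refine integral_congr_ae (ae_of_all _ fun s => ?_)
  simp_rw [mul_assoc]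
  rw [integral_const_mul]
  congr 1
  rw [← integral_sub_right_eq_self (fun y => g y * h (x - s - y)) s]
  refine integral_congr_ae (ae_of_all _ fun y => ?_)
  simp

/-! ### The coefficients of a function -/

/-- The bump defining the analysing wave packets. -/
def β0 : ContDiffBump (1 / 4 : ℝ) := ⟨1 / 16, 1 / 8, by norm_num, by norm_num⟩

/-- A bump equal to one on the support of `β0`. -/
def β1 : ContDiffBump (1 / 4 : ℝ) := ⟨1 / 8, 3 / 16, by norm_num, by norm_num⟩

/-- A bump equal to one on the unit interval. -/
def β2 : ContDiffBump (1 / 2 : ℝ) := ⟨1 / 2, 5 / 8, by norm_num, by norm_num⟩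

/-- The component of `f` in a frequency interval. -/
def hh (f : ℝ → ℂ) (k l : ℤ) : ℝ → ℂ := cv f (wp β0 k l)

/-- The squared local mass of a frequency component. -/
def Am (f : ℝ → ℂ) (P : Tile) : ℝ≥0∞ :=
  ∫⁻ z, dec 12 P.k (z - P.c) * ‖hh f P.k P.l z‖ₑ ^ 2

lemma continuous_hh {f : ℝ → ℂ} (hf : Integrable f) (k l : ℤ) : Continuous (hh f k l) :=
  continuous_cv hf _

lemma hh_eq_cv {f : ℝ → ℂ} (hf : Integrable f) (k l : ℤ) (z : ℝ) :
    cv (hh f k l) (wp β1 k l) z = hh f k l z := by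
  unfold hh
  rw [cv_assoc hf]
  have h : ∀ t, cv (wp β0 k l) (wp β1 k l) t = wp β0 k l t := fun t =>
    wp_conv_eq_self β0 β1 (fun ξ hξ => Metric.ball_subset_closedBall hξ) t
  simp_rw [h]
  rfl

lemma Am_ne_top {f : ℝ → ℂ} (hf : Integrable f) (P : Tile) : Am f P ≠ ⊤ := by
  obtain ⟨M, hM⟩ := bdd_cv hf (wp β0 P.k P.l)
  have h : Am f P ≤ ∫⁻ z, dec 12 P.k (z - P.c) * (M : ℝ≥0∞) ^ 2 := by
    refine lintegral_mono fun z => ?_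
    gcongr
    exact enorm_le_coe.2 (hM z)
  refine ne_top_of_le_ne_top ?_ h
  rw [lintegral_mul_const _ (by fun_prop)]
  refine ENNReal.mul_ne_top (ne_top_of_le_ne_top ?_ (lintegral_dec_le (by norm_num) P.k P.c))
      (by simp)
  exact ENNReal.mul_ne_top (two_zpow_ne_top _) decMass_ne_top

/-- The local `L¹` mass of a frequency component. -/
lemma lintegral_dec_mul_hh_sq_le {f : ℝ → ℂ} (hf : Integrable f) (P : Tile) {m : ℕ}
    (hm : 7 ≤ m) :
    (∫⁻ z, dec m P.k (z - P.c) * ‖hh f P.k P.l z‖ₑ) ^ 2 ≤ 2 ^ P.k * decMass * Am f P := by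
  have hc := continuous_hh hf P.k P.l
  have h1 : ∫⁻ z, dec m P.k (z - P.c) * ‖hh f P.k P.l z‖ₑ ≤
      ∫⁻ z, dec 1 P.k (z - P.c) * (dec 6 P.k (z - P.c) * ‖hh f P.k P.l z‖ₑ) := by
    refine lintegral_mono fun z => ?_
    rw [← mul_assoc, dec_mul]
    gcongr
    exact dec_anti hm _ _
  have h2 := lintegral_mul_sq_le volume (f := fun z => dec 1 P.k (z - P.c))
    (g := fun z => dec 6 P.k (z - P.c) * ‖hh f P.k P.l z‖ₑ) (by fun_prop) (by fun_prop)
  simp only [mul_pow, dec_pow] at h2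
  refine (pow_le_pow_left' h1 2).trans (h2.trans ?_)
  exact mul_le_mul' (lintegral_dec_le (by norm_num) _ _) le_rfl

/-- Pointwise control of a frequency component by its local mass. -/
lemma hh_pointwise : ∃ C : ℝ≥0, ∀ (f : ℝ → ℂ), Integrable f → ∀ (P : Tile) (z : ℝ),
    dec 12 P.k (z - P.c) * ‖hh f P.k P.l z‖ₑ ^ 2 ≤ C * 2 ^ (-P.k) * Am f P := by
  obtain ⟨D, hD⟩ := wp_bound β1
  refine ⟨D ^ 2 * decMass.toNNReal, fun f hf P z => ?_⟩
  have hc := continuous_hh hf P.k P.l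
  have h1 : dec 6 P.k (z - P.c) * ‖hh f P.k P.l z‖ₑ ≤
      D * 2 ^ (-P.k) * ∫⁻ y, dec 1 P.k (z - y) * (dec 6 P.k (y - P.c) * ‖hh f P.k P.l y‖ₑ) := by
    rw [← lintegral_const_mul _ (by fun_prop)]
    conv_lhs => rw [← hh_eq_cv hf]
    refine (mul_le_mul' le_rfl (enorm_cv_le _ _ _)).trans ?_
    rw [← lintegral_const_mul _ (by have := (wp β1 P.k P.l).continuous; fun_prop)]
    refine lintegral_mono fun y => ?_
    have h2 := hD P.k P.l (z - y)
    have h3 : dec 6 P.k (z - P.c) * dec 20 P.k (z - y) ≤ dec 1 P.k (z - y) * dec 6 P.k (y - P.c) :=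
        by
      calc _ ≤ dec 6 P.k (z - P.c) * (dec 1 P.k (z - y) * dec 6 P.k (z - y)) := by
            rw [dec_mul]; gcongr; exact dec_anti (by norm_num) _ _
        _ = dec 1 P.k (z - y) * (dec 6 P.k (y - z) * dec 6 P.k (z - P.c)) := by
            rw [dec_sub_comm 6 P.k y z]; ring
        _ ≤ _ := by gcongr; exact dec_peetre' _ _ _ _ _
    calc _ ≤ dec 6 P.k (z - P.c) * (‖hh f P.k P.l y‖ₑ * (D * 2 ^ (-P.k) * dec 20 P.k (z - y))) := by
          gcongr
      _ = D * 2 ^ (-P.k) * ‖hh f P.k P.l y‖ₑ * (dec 6 P.k (z - P.c) * dec 20 P.k (z - y)) := by ring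
      _ ≤ D * 2 ^ (-P.k) * ‖hh f P.k P.l y‖ₑ * (dec 1 P.k (z - y) * dec 6 P.k (y - P.c))
          := by gcongr
      _ = _ := by ring
  have h2 := lintegral_mul_sq_le volume (f := fun y => dec 1 P.k (z - y))
    (g := fun y => dec 6 P.k (y - P.c) * ‖hh f P.k P.l y‖ₑ) (by fun_prop) (by fun_prop)
  simp only [mul_pow, dec_pow] at h2
  have h3 := pow_le_pow_left' h1 2
  simp only [mul_pow, dec_pow] at h3
  refine h3.trans ((mul_le_mul' le_rfl h2).trans ?_)
  have h4 := lintegral_dec_le' (n := 1 * 2) (by norm_num) P.k z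
  calc _ ≤ (D : ℝ≥0∞) ^ 2 * (2 ^ (-P.k)) ^ 2 * (2 ^ P.k * decMass * Am f P) :=
        mul_le_mul' le_rfl (mul_le_mul' h4 le_rfl)
    _ = (D : ℝ≥0∞) ^ 2 * decMass * (2 ^ (-P.k) * 2 ^ P.k) * 2 ^ (-P.k) * Am f P := by ring
    _ = _ := by
      rw [two_zpow_neg_mul, mul_one]
      push_cast
      rw [ENNReal.coe_toNNReal decMass_ne_top]

/-! ### Almost orthogonality -/

/-- Decay of the convolution of two packets. -/
lemma wp_cv_bound {c : ℝ} (β : ContDiffBump c) : ∃ C : ℝ≥0, ∀ (k l k' l' : ℤ) (t : ℝ), k' ≤ k →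
    ‖cv (wp β k l) (wp β k' l') t‖ₑ ≤ C * 2 ^ (-k) * dec 18 k t ∧
    ‖cv (wp β k' l') (wp β k l) t‖ₑ ≤ C * 2 ^ (-k) * dec 18 k t := by
  obtain ⟨D, hD⟩ := wp_bound β
  have key : ∀ (k k' : ℤ) (s t : ℝ), k' ≤ k →
      dec 20 k s * dec 20 k' (t - s) ≤ dec 18 k t * dec 2 k' (t - s) := by
    intro k k' s t h
    calc dec 20 k s * dec 20 k' (t - s)
        ≤ dec 18 k s * (dec 18 k (t - s) * dec 2 k' (t - s)) := by
          rw [show (20 : ℕ) = 18 + 2 from rfl, ← dec_mul 18 2 k', ← dec_mul 18 2 k]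
          refine mul_le_mul' (mul_le_of_le_one_right' (dec_le_one _ _ _)) (mul_le_mul' (dec_scale h
              _ _) le_rfl)
      _ = (dec 18 k s * dec 18 k (t - s)) * dec 2 k' (t - s) := by ring
      _ ≤ _ := by
          gcongr
          simpa using dec_peetre 18 k s (t - s)
  have comm : ∀ g h : ℝ → ℂ, ∀ t, cv g h t = cv h g t := by
    intro g h t
    unfold cv
    rw [← integral_sub_left_eq_self (fun y => h y * g (t - y)) volume t]
    refine integral_congr_ae (ae_of_all _ fun y => ?_)
    simp [mul_comm]
  refine ⟨D ^ 2 * decMass.toNNReal, fun k l k' l' t h => ?_⟩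
  have main : ‖cv (wp β k l) (wp β k' l') t‖ₑ ≤
      ((D ^ 2 * decMass.toNNReal : ℝ≥0) : ℝ≥0∞) * 2 ^ (-k) * dec 18 k t := by
    refine (enorm_cv_le _ _ _).trans ?_
    calc _ ≤ ∫⁻ y, (D ^ 2 * 2 ^ (-k) * 2 ^ (-k') * dec 18 k t) * dec 2 k' (t - y) := by
          refine lintegral_mono fun y => ?_
          calc _ ≤ (D * 2 ^ (-k) * dec 20 k y) * (D * 2 ^ (-k') * dec 20 k' (t - y)) := by
                gcongr
                · exact hD _ _ _
                · exact hD _ _ _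
            _ = D ^ 2 * 2 ^ (-k) * 2 ^ (-k') * (dec 20 k y * dec 20 k' (t - y)) := by ring
            _ ≤ D ^ 2 * 2 ^ (-k) * 2 ^ (-k') * (dec 18 k t * dec 2 k' (t - y)) := by
                gcongr _ * ?_; exact key _ _ _ _ h
            _ = _ := by ring
      _ ≤ (D ^ 2 * 2 ^ (-k) * 2 ^ (-k') * dec 18 k t) * (2 ^ k' * decMass) := by
          rw [lintegral_const_mul _ (by fun_prop)]
          gcongr
          exact lintegral_dec_le' le_rfl _ _
      _ = D ^ 2 * decMass * (2 ^ (-k') * 2 ^ k') * 2 ^ (-k) * dec 18 k t := by ring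
      _ = _ := by
          rw [two_zpow_neg_mul, mul_one]
          push_cast
          rw [ENNReal.coe_toNNReal decMass_ne_top]
  exact ⟨main, by rw [comm]; exact main⟩

/-- Frequency support of the packets built on `β0` and `β1`. -/
lemma mem_left_half {k l : ℤ} {ξ : ℝ} (h0 : 0 ≤ 2 ^ k * ξ - l) (h1 : 2 ^ k * ξ - l < 1 / 2) :
    ξ ∈ DI (-k - 1) (2 * l) := by
  have hk : (0 : ℝ) < 2 ^ k := by positivity
  have e : (2 : ℝ) ^ (-k - 1) = (2 ^ k)⁻¹ * 2⁻¹ := by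
    rw [sub_eq_add_neg, zpow_add₀ (by norm_num), zpow_neg]; norm_num
  rw [mem_DI, dy_eq_iff, e]
  push_cast
  constructor
  · rw [show (2 * l : ℝ) * ((2 ^ k)⁻¹ * 2⁻¹) = l / 2 ^ k by field_simp, div_le_iff₀ hk]; linarith
  · rw [show (2 * l + 1 : ℝ) * ((2 ^ k)⁻¹ * 2⁻¹) = (l + 1 / 2) / 2 ^ k by field_simp, lt_div_iff₀
        hk]
    linarith

lemma wp_cv_eq_zero {β : ContDiffBump (1 / 4 : ℝ)} (hβ : β.rOut ≤ 3 / 16) {k l k' l' : ℤ}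
    (h : Disjoint (DI (-k - 1) (2 * l)) (DI (-k' - 1) (2 * l'))) (t : ℝ) :
    cv (wp β k l) (wp β k' l') t = 0 := by
  refine wp_conv_eq_zero β β (fun ξ h1 h2 => ?_) t
  rw [Metric.mem_ball, Real.dist_eq, abs_lt] at h1 h2
  exact Set.disjoint_left.mp h (mem_left_half (ξ := ξ) (by linarith [h1.1]) (by linarith [h1.2]))
    (mem_left_half (ξ := ξ) (by linarith [h2.1]) (by linarith [h2.2]))

open ComplexConjugate in
lemma conj_cv_wp {c : ℝ} (β : ContDiffBump c) (v : ℝ → ℂ) (k l : ℤ) (x : ℝ) :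
    conj (cv v (wp β k l) x) = ∫ z, conj (v z) * wp β k l (z - x) := by
  unfold cv
  rw [← integral_conj]
  refine integral_congr_ae (ae_of_all _ fun z => ?_)
  simp only [map_mul, conj_wp, neg_sub]

open ComplexConjugate in
lemma integral_mul_conj_cv {c : ℝ} (β : ContDiffBump c) {a v : ℝ → ℂ} (ha : Integrable a)
    (hv : Integrable v) (k l : ℤ) :
    ∫ x, a x * conj (cv v (wp β k l) x) = ∫ z, conj (v z) * cv a (wp β k l) z := by
  obtain ⟨D, hD⟩ := schwartz_bdd (wp β k l)
  have hInt : Integrable (Function.uncurry fun (x z : ℝ) => a x * (conj (v z) * wp β k l (z - x)))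
      (volume.prod volume) := by
    have hv' : Integrable fun z => conj (v z) :=
      hv.norm.mono' (Complex.continuous_conj.comp_aestronglyMeasurable hv.aestronglyMeasurable)
        (ae_of_all _ fun z => by simp)
    have h1 : Integrable (fun z : ℝ × ℝ => a z.1 * conj (v z.2)) (volume.prod volume) :=
      ha.mul_prod hv'
    have h2 := h1.mul_bdd (c := D) (g := fun z : ℝ × ℝ => wp β k l (z.2 - z.1))
      ((wp β k l).continuous.comp (by fun_prop)).aestronglyMeasurable (ae_of_all _ fun y => hD _)
    refine h2.congr (ae_of_all _ fun z => ?_)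
    simp only [Function.uncurry]
    ring
  simp_rw [conj_cv_wp, ← integral_const_mul]
  rw [integral_integral_swap hInt]
  refine integral_congr_ae (ae_of_all _ fun z => ?_)
  simp only [cv, ← integral_const_mul]
  refine integral_congr_ae (ae_of_all _ fun x => ?_)
  simp only; ring

open ComplexConjugate in
lemma enorm_integral_cv_pair_le {c : ℝ} (β : ContDiffBump c) {u v : ℝ → ℂ} (hu : Integrable u)
    (hv : Integrable v) (k l k' l' : ℤ) :
    ‖∫ x, cv u (wp β k l) x * conj (cv v (wp β k' l') x)‖ₑ ≤
      ∫⁻ z', ∫⁻ z, ‖v z'‖ₑ * (‖u z‖ₑ * ‖cv (wp β k l) (wp β k' l') (z' - z)‖ₑ) := by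
  rw [integral_mul_conj_cv β (integrable_cv hu _) hv]
  refine (enorm_integral_le_lintegral_enorm _).trans (lintegral_mono fun z' => ?_)
  rw [enorm_mul, lintegral_const_mul' _ _ enorm_ne_top, cv_assoc hu, RCLike.enorm_conj]
  gcongr
  refine (enorm_integral_le_lintegral_enorm _).trans (le_of_eq (lintegral_congr fun y => ?_))
  rw [enorm_mul]

/-- The square function estimate behind almost orthogonality. -/
lemma lintegral_sum_cv_sq_le {ι : Type*} {c : ℝ} (β : ContDiffBump c) (s : Finset ι)
    (u : ι → ℝ → ℂ) (hu : ∀ i ∈ s, Integrable (u i)) (k l : ι → ℤ) :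
    ∫⁻ x, ‖∑ i ∈ s, cv (u i) (wp β (k i) (l i)) x‖ₑ ^ 2 ≤
      ∑ i ∈ s, ∑ j ∈ s, ∫⁻ z', ∫⁻ z, ‖u j z'‖ₑ *
        (‖u i z‖ₑ * ‖cv (wp β (k i) (l i)) (wp β (k j) (l j)) (z' - z)‖ₑ) := by
  classical
  set a : ι → ℝ → ℂ := fun i => cv (u i) (wp β (k i) (l i)) with ha
  have hai : ∀ i ∈ s, Integrable (a i) := fun i hi => integrable_cv (hu i hi) _
  have hij : ∀ i ∈ s, ∀ j ∈ s, Integrable fun x => a i x * (starRingEnd ℂ) (a j x) := by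
    intro i hi j hj
    obtain ⟨M, hM⟩ := bdd_cv (hu j hj) (wp β (k j) (l j))
    refine (hai i hi).mul_bdd (c := M) ?_ (ae_of_all _ fun x => by simpa using hM x)
    exact (Complex.continuous_conj.comp (continuous_cv (hu j hj) _)).aestronglyMeasurable
  have hS : ∀ x, ((‖∑ i ∈ s, a i x‖ ^ 2 : ℝ) : ℂ) =
      ∑ i ∈ s, ∑ j ∈ s, a i x * (starRingEnd ℂ) (a j x) := by
    intro x
    have h := Complex.mul_conj' (∑ i ∈ s, a i x)
    push_cast
    rw [← h, map_sum, Finset.sum_mul_sum]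
  have hSint : Integrable fun x => ‖∑ i ∈ s, a i x‖ ^ 2 := by
    have : Integrable fun x => ∑ i ∈ s, ∑ j ∈ s, a i x * (starRingEnd ℂ) (a j x) :=
      integrable_finsetSum _ fun i hi => integrable_finsetSum _ fun j hj => hij i hi j hj
    simp_rw [← hS] at this
    simpa only [RCLike.re_to_complex, Complex.ofReal_re] using this.re
  calc ∫⁻ x, ‖∑ i ∈ s, a i x‖ₑ ^ 2 = ∫⁻ x, ENNReal.ofReal (‖∑ i ∈ s, a i x‖ ^ 2) := by
        refine lintegral_congr fun x => ?_
        rw [ENNReal.ofReal_pow (norm_nonneg _), ofReal_norm]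
    _ = ENNReal.ofReal (∫ x, ‖∑ i ∈ s, a i x‖ ^ 2) :=
        (ofReal_integral_eq_lintegral_ofReal hSint (ae_of_all _ fun x => by positivity)).symm
    _ = ‖∫ x, ((‖∑ i ∈ s, a i x‖ ^ 2 : ℝ) : ℂ)‖ₑ := by
        rw [integral_complex_ofReal, ← ofReal_norm, Complex.norm_real, Real.norm_of_nonneg]
        positivity
    _ = ‖∑ i ∈ s, ∑ j ∈ s, ∫ x, a i x * (starRingEnd ℂ) (a j x)‖ₑ := by
        simp_rw [hS]
        rw [integral_finsetSum _ fun i hi => integrable_finsetSum _ fun j hj => hij i hi j hj]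
        congr 1
        refine Finset.sum_congr rfl fun i hi => ?_
        rw [integral_finsetSum _ fun j hj => hij i hi j hj]
    _ ≤ _ := by
        refine (enorm_sum_le _ _).trans (Finset.sum_le_sum fun i hi => ?_)
        refine (enorm_sum_le _ _).trans (Finset.sum_le_sum fun j hj => ?_)
        exact enorm_integral_cv_pair_le β (hu i hi) (hu j hj) _ _ _ _

/-- The interaction of two tiles. -/
def inter (f : ℝ → ℂ) (P P' : Tile) : ℝ≥0∞ :=
  ∫⁻ z', ∫⁻ z, dec 12 P'.k (z' - P'.c) * ‖hh f P'.k P'.l z'‖ₑ *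
    (dec 12 P.k (z - P.c) * ‖hh f P.k P.l z‖ₑ * ‖cv (wp β0 P.k P.l) (wp β0 P'.k P'.l) (z' - z)‖ₑ)

/-- Duality: the total mass of a collection of tiles is controlled by the interactions. -/
lemma sum_Am_sq_le {f : ℝ → ℂ} (hf : Integrable f) (s : Finset Tile) :
    (∑ P ∈ s, Am f P) ^ 2 ≤ (∫⁻ x, ‖f x‖ₑ ^ 2) * ∑ P ∈ s, ∑ P' ∈ s, inter f P P' := by
  set u : Tile → ℝ → ℂ := fun P z => ((dec 12 P.k (z - P.c)).toReal : ℂ) * hh f P.k P.l z with hu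
  have hen : ∀ P z, ‖u P z‖ₑ = dec 12 P.k (z - P.c) * ‖hh f P.k P.l z‖ₑ := by
    intro P z
    rw [hu, enorm_mul, ← ofReal_norm (Complex.ofReal _), Complex.norm_real,
      Real.norm_of_nonneg ENNReal.toReal_nonneg, ENNReal.ofReal_toReal (dec_ne_top _ _ _)]
  have hui : ∀ P, Integrable (u P) := by
    intro P
    have h1 : Integrable (hh f P.k P.l) := integrable_cv hf _
    refine h1.bdd_mul (c := 1) ?_ (ae_of_all _ fun z => ?_)
    · exact Measurable.aestronglyMeasurable (by fun_prop)
    · rw [Complex.norm_real, Real.norm_of_nonneg ENNReal.toReal_nonneg]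
      exact ENNReal.toReal_le_of_le_ofReal zero_le_one (by simpa using dec_le_one _ _ _)
  have hA : ∀ P, ∃ r : ℝ, 0 ≤ r ∧ Am f P = ENNReal.ofReal r ∧
      ∫ y, (starRingEnd ℂ) (f y) * cv (u P) (wp β0 P.k P.l) y = r := by
    intro P
    rw [← integral_mul_conj_cv β0 (hui P) hf]
    have h1 : ∀ z, u P z * (starRingEnd ℂ) (cv f (wp β0 P.k P.l) z) =
        (((dec 12 P.k (z - P.c)).toReal * ‖hh f P.k P.l z‖ ^ 2 : ℝ) : ℂ) := by
      intro z
      have := Complex.mul_conj' (hh f P.k P.l z)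
      simp only [hu]
      push_cast
      rw [← this, mul_assoc]; rfl
    simp_rw [h1]
    have hInt : Integrable fun z => ((dec 12 P.k (z - P.c)).toReal * ‖hh f P.k P.l z‖ ^ 2 : ℝ) := by
      obtain ⟨M, hM⟩ := bdd_cv hf (wp β0 P.k P.l)
      have h2 : Integrable fun z => u P z * (starRingEnd ℂ) (cv f (wp β0 P.k P.l) z) := by
        refine (hui P).mul_bdd (c := M) ?_ (ae_of_all _ fun x => by simpa using hM x)
        exact (Complex.continuous_conj.comp (continuous_cv hf _)).aestronglyMeasurable
      simp_rw [h1] at h2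
      simpa only [RCLike.re_to_complex, Complex.ofReal_re] using h2.re
    refine ⟨_, integral_nonneg fun x => by positivity, ?_, integral_complex_ofReal⟩
    rw [ofReal_integral_eq_lintegral_ofReal hInt (ae_of_all _ fun x => by positivity)]
    refine lintegral_congr fun z => ?_
    rw [ENNReal.ofReal_mul ENNReal.toReal_nonneg, ENNReal.ofReal_toReal (dec_ne_top _ _ _),
      ENNReal.ofReal_pow (norm_nonneg _), ofReal_norm]
  choose r hr0 hrA hr using hA
  have hInt : ∀ P, Integrable fun y => (starRingEnd ℂ) (f y) * cv (u P) (wp β0 P.k P.l) y := by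
    intro P
    obtain ⟨M, hM⟩ := bdd_cv (hui P) (wp β0 P.k P.l)
    refine Integrable.mul_bdd (c := M) ?_ (continuous_cv (hui P) _).aestronglyMeasurable
      (ae_of_all _ hM)
    exact hf.norm.mono' (Complex.continuous_conj.comp_aestronglyMeasurable hf.aestronglyMeasurable)
      (ae_of_all _ fun z => by simp)
  have hre : ∑ P ∈ s, Am f P ≤ ∫⁻ y, ‖f y‖ₑ * ‖∑ P ∈ s, cv (u P) (wp β0 P.k P.l) y‖ₑ := by
    calc ∑ P ∈ s, Am f P = ENNReal.ofReal (∑ P ∈ s, r P) := by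
          rw [ENNReal.ofReal_sum_of_nonneg fun P _ => hr0 P]; simp_rw [hrA]
      _ = ‖((∑ P ∈ s, r P : ℝ) : ℂ)‖ₑ := by
          rw [← ofReal_norm, Complex.norm_real, Real.norm_of_nonneg (Finset.sum_nonneg fun P _ =>
              hr0 P)]
      _ = ‖∫ y, (starRingEnd ℂ) (f y) * ∑ P ∈ s, cv (u P) (wp β0 P.k P.l) y‖ₑ := by
          push_cast
          simp_rw [← hr, Finset.mul_sum]
          rw [integral_finsetSum _ fun P _ => hInt P]
      _ ≤ _ := by
          refine (enorm_integral_le_lintegral_enorm _).trans (le_of_eq (lintegral_congr fun y =>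
              ?_))
          rw [enorm_mul, RCLike.enorm_conj]
  refine (pow_le_pow_left' hre 2).trans ?_
  refine (lintegral_mul_sq_le volume hf.aestronglyMeasurable.enorm ?_).trans ?_
  · refine (Continuous.enorm ?_).aemeasurable
    exact continuous_finsetSum _ fun P _ => continuous_cv (hui P) _
  · gcongr
    refine (lintegral_sum_cv_sq_le β0 s u (fun P _ => hui P) Tile.k Tile.l).trans (le_of_eq ?_)
    simp_rw [hen]
    rfl

/-- The local `L¹` mass of a frequency component. -/
def mm (f : ℝ → ℂ) (P : Tile) : ℝ≥0∞ := ∫⁻ z, dec 8 P.k (z - P.c) * ‖hh f P.k P.l z‖ₑ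

lemma inter_eq_zero {f : ℝ → ℂ} {P P' : Tile} (h : Disjoint P.L P'.L) : inter f P P' = 0 := by
  unfold inter
  simp_rw [wp_cv_eq_zero (β := β0) (by norm_num [β0]) h]
  simp

lemma inter_le : ∃ C : ℝ≥0, ∀ (f : ℝ → ℂ), Integrable f → ∀ P P' : Tile, P'.k ≤ P.k →
    inter f P P' ≤ C * 2 ^ (-P.k) * dec 4 P.k (P.c - P'.c) * (mm f P * mm f P') ∧
    inter f P' P ≤ C * 2 ^ (-P.k) * dec 4 P.k (P.c - P'.c) * (mm f P * mm f P') := by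
  obtain ⟨C, hC⟩ := wp_cv_bound β0
  have key : ∀ (P P' : Tile) (z z' : ℝ), P'.k ≤ P.k →
      dec 12 P.k (z - P.c) * dec 12 P'.k (z' - P'.c) * dec 18 P.k (z' - z) ≤
        dec 4 P.k (P.c - P'.c) * (dec 8 P.k (z - P.c) * dec 8 P'.k (z' - P'.c)) := by
    intro P P' z z' h
    calc _ ≤ (dec 4 P.k (z - P.c) * dec 8 P.k (z - P.c)) *
          (dec 4 P.k (z' - P'.c) * dec 8 P'.k (z' - P'.c)) * dec 4 P.k (z' - z) := by
          rw [dec_mul, ← dec_mul 4 8 P'.k]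
          gcongr
          · exact dec_scale h _ _
          · exact dec_anti (by norm_num) _ _
      _ = (dec 4 P.k (P.c - z) * dec 4 P.k (z - z') * dec 4 P.k (z' - P'.c)) *
            (dec 8 P.k (z - P.c) * dec 8 P'.k (z' - P'.c)) := by
          rw [dec_sub_comm 4 P.k P.c z, dec_sub_comm 4 P.k z z']; ring
      _ ≤ _ := by
          gcongr
          exact (mul_le_mul' (dec_peetre' _ _ _ _ _) le_rfl).trans (dec_peetre' _ _ _ _ _)
  have fin : ∀ (f : ℝ → ℂ), Integrable f → ∀ (P P' : Tile) (E : ℝ≥0∞),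
      ∫⁻ z', ∫⁻ z, E * ((dec 8 P'.k (z' - P'.c) * ‖hh f P'.k P'.l z'‖ₑ) *
        (dec 8 P.k (z - P.c) * ‖hh f P.k P.l z‖ₑ)) = E * (mm f P * mm f P') := by
    intro f hf P P' E
    have h1 := continuous_hh hf P.k P.l
    have h2 := continuous_hh hf P'.k P'.l
    have : ∀ z', ∫⁻ z, E * ((dec 8 P'.k (z' - P'.c) * ‖hh f P'.k P'.l z'‖ₑ) *
        (dec 8 P.k (z - P.c) * ‖hh f P.k P.l z‖ₑ)) = (E * mm f P) *
          (dec 8 P'.k (z' - P'.c) * ‖hh f P'.k P'.l z'‖ₑ) := by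
      intro z'
      rw [lintegral_const_mul _ (by fun_prop), lintegral_const_mul _ (by fun_prop), mm]
      ring
    simp_rw [this]
    rw [lintegral_const_mul _ (by fun_prop), mul_assoc]
    rfl
  refine ⟨C, fun f hf P P' h => ⟨?_, ?_⟩⟩
  · rw [← fin f hf P P']
    refine lintegral_mono fun z' => lintegral_mono fun z => ?_
    calc _ ≤ dec 12 P'.k (z' - P'.c) * ‖hh f P'.k P'.l z'‖ₑ *
          (dec 12 P.k (z - P.c) * ‖hh f P.k P.l z‖ₑ * (C * 2 ^ (-P.k) * dec 18 P.k (z' - z))) := by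
          gcongr
          exact (hC _ _ _ _ _ h).1
      _ = C * 2 ^ (-P.k) * (‖hh f P'.k P'.l z'‖ₑ * ‖hh f P.k P.l z‖ₑ) *
          (dec 12 P.k (z - P.c) * dec 12 P'.k (z' - P'.c) * dec 18 P.k (z' - z)) := by ring
      _ ≤ _ := by
          refine (mul_le_mul' le_rfl (key P P' z z' h)).trans (le_of_eq ?_)
          ring
  · rw [mul_comm (mm f P), ← fin f hf P' P]
    refine lintegral_mono fun z' => lintegral_mono fun z => ?_
    calc _ ≤ dec 12 P.k (z' - P.c) * ‖hh f P.k P.l z'‖ₑ *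
          (dec 12 P'.k (z - P'.c) * ‖hh f P'.k P'.l z‖ₑ * (C * 2 ^ (-P.k) * dec 18 P.k (z' - z)))
              := by
          gcongr
          exact (hC _ _ _ _ _ h).2
      _ = C * 2 ^ (-P.k) * (‖hh f P'.k P'.l z‖ₑ * ‖hh f P.k P.l z'‖ₑ) *
          (dec 12 P.k (z' - P.c) * dec 12 P'.k (z - P'.c) * dec 18 P.k (z - z')) := by
          rw [dec_sub_comm 18 P.k z z']; ring
      _ ≤ _ := by
          refine (mul_le_mul' le_rfl (key P P' z' z h)).trans (le_of_eq ?_)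
          ring

lemma mm_sq_le {f : ℝ → ℂ} (hf : Integrable f) (P : Tile) :
    mm f P ^ 2 ≤ 2 ^ P.k * decMass * Am f P :=
  lintegral_dec_mul_hh_sq_le hf P (by norm_num)

lemma dec_sub_ctr_le (m : ℕ) {k n : ℤ} {z : ℝ} (hz : z ∈ DI k n) (x : ℝ) :
    dec m k (x - ctr k n) ≤ 2 ^ m * dec m k (x - z) := by
  have h := dec_comp m k (s := x - z) (t := x - ctr k n) (m := 2) (rho_le_two_mul ?_)
  · simpa using h
  · have h1 := abs_sub_ctr_le hz
    have h2 : |x - z| ≤ |x - ctr k n| + |z - ctr k n| := by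
      rw [abs_sub_comm z]
      exact abs_sub_le _ _ _
    have h3 := le_max_left ((2 : ℝ) ^ k) |x - ctr k n|
    have : (0 : ℝ) < 2 ^ k := by positivity
    linarith

lemma dec_sub_le_ctr (m : ℕ) {k n : ℤ} {z : ℝ} (hz : z ∈ DI k n) (x : ℝ) :
    dec m k (x - z) ≤ 2 ^ m * dec m k (x - ctr k n) := by
  have h := dec_comp m k (s := x - ctr k n) (t := x - z) (m := 2) (rho_le_two_mul ?_)
  · simpa using h
  · have h1 := abs_sub_ctr_le hz
    have h2 : |x - ctr k n| ≤ |x - z| + |z - ctr k n| := abs_sub_le _ _ _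
    have h3 := le_max_left ((2 : ℝ) ^ k) |x - z|
    have : (0 : ℝ) < 2 ^ k := by positivity
    linarith

/-- Averages over an interval. -/
lemma two_zpow_mul_le_setLIntegral {k n : ℤ} {E : ℝ≥0∞} {g : ℝ → ℝ≥0∞} (h : ∀ z ∈ DI k n, E ≤ g z) :
    2 ^ k * E ≤ ∫⁻ z in DI k n, g z := by
  calc 2 ^ k * E = ∫⁻ z in DI k n, E := by simp [volume_DI, mul_comm]
    _ ≤ _ := setLIntegral_mono' (measurableSet_DI _ _) h

lemma le_two_zpow_mul_setLIntegral {k n : ℤ} {E : ℝ≥0∞} {g : ℝ → ℝ≥0∞} (h : ∀ z ∈ DI k n, E ≤ g z) :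
    E ≤ 2 ^ (-k) * ∫⁻ z in DI k n, g z := by
  calc E = 2 ^ (-k) * (2 ^ k * E) := by rw [← mul_assoc, two_zpow_neg_mul, one_mul]
    _ ≤ _ := by gcongr; exact two_zpow_mul_le_setLIntegral h

lemma sum_setLIntegral_le {ι : Type*} (s : Finset ι) (t : ι → Set ℝ) (ht : ∀ i ∈ s, MeasurableSet
    (t i))
    (hd : (s : Set ι).PairwiseDisjoint t) {A : Set ℝ} (hA : ∀ i ∈ s, t i ⊆ A) (g : ℝ → ℝ≥0∞) :
    ∑ i ∈ s, ∫⁻ z in t i, g z ≤ ∫⁻ z in A, g z := by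
  rw [← lintegral_biUnion_finset hd ht]
  exact lintegral_mono_set (iUnion₂_subset hA)

lemma sum_dec_ctr_le {m : ℕ} (hm : 2 ≤ m) (k : ℤ) (x : ℝ) (s : Finset ℤ) :
    ∑ n ∈ s, dec m k (x - ctr k n) ≤ 2 ^ m * decMass := by
  calc ∑ n ∈ s, dec m k (x - ctr k n)
      ≤ ∑ n ∈ s, 2 ^ (-k) * ∫⁻ z in DI k n, 2 ^ m * dec m k (x - z) :=
        Finset.sum_le_sum fun n _ => le_two_zpow_mul_setLIntegral fun z hz => dec_sub_ctr_le m hz x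
    _ ≤ 2 ^ (-k) * ∫⁻ z in univ, 2 ^ m * dec m k (x - z) := by
        rw [← Finset.mul_sum]
        gcongr
        exact sum_setLIntegral_le s _ (fun n _ => measurableSet_DI _ _)
          (fun n _ n' _ h => DI_disjoint h) (fun _ _ => subset_univ _) _
    _ ≤ 2 ^ (-k) * (2 ^ m * (2 ^ k * decMass)) := by
        rw [Measure.restrict_univ, lintegral_const_mul _ (by fun_prop)]
        gcongr
        exact lintegral_dec_le' hm _ _
    _ = (2 ^ (-k) * 2 ^ k) * (2 ^ m * decMass) := by ring
    _ = _ := by rw [two_zpow_neg_mul, one_mul]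

lemma Tile.L_cases (P P' : Tile) : Disjoint P.L P'.L ∨ (P.k = P'.k ∧ P.l = P'.l) ∨
    (P'.k < P.k ∧ P.W ⊆ P'.L) ∨ (P.k < P'.k ∧ P'.W ⊆ P.L) := by
  by_cases hd : Disjoint P.L P'.L
  · exact Or.inl hd
  obtain ⟨x, hx, hx'⟩ := Set.not_disjoint_iff.mp hd
  rcases lt_trichotomy P'.k P.k with h | h | h
  · exact Or.inr (Or.inr (Or.inl ⟨h, Tile.W_subset_L h (P.L_subset_W hx) hx'⟩))
  · refine Or.inr (Or.inl ⟨h.symm, ?_⟩)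
    have h1 := P.L_subset_W hx
    have h2 := P'.L_subset_W hx'
    simp only [Tile.W, mem_DI, h] at h1 h2
    omega
  · exact Or.inr (Or.inr (Or.inr ⟨h, Tile.W_subset_L h (P'.L_subset_W hx') hx⟩))

/-- The interaction of nested frequency intervals. -/
def nest (f : ℝ → ℂ) (P P' : Tile) : ℝ≥0∞ :=
  2 ^ (-P.k) * dec 4 P.k (P.c - P'.c) * (mm f P * mm f P')

open Classical in
lemma sum_nest_same_le {f : ℝ → ℂ} (hf : Integrable f) (s : Finset Tile) :
    ∑ P ∈ s, ∑ P' ∈ s with P.k = P'.k ∧ P.l = P'.l, nest f P P' ≤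
      2 ^ 5 * decMass ^ 2 * ∑ P ∈ s, Am f P := by
  have hsum : ∀ P : Tile, ∑ P' ∈ s with P.k = P'.k ∧ P.l = P'.l, dec 4 P.k (P.c - P'.c) ≤
      2 ^ 4 * decMass := by
    intro P
    have hinj : Set.InjOn Tile.n (s.filter fun P' => P.k = P'.k ∧ P.l = P'.l : Finset Tile) := by
      intro a ha b hb hab
      simp only [Finset.coe_filter, Set.mem_ofPred_eq] at ha hb
      cases a; cases b
      simp_all
    refine le_trans (le_of_eq ?_) (sum_dec_ctr_le (by norm_num) P.k P.c
      ((s.filter fun P' => P.k = P'.k ∧ P.l = P'.l).image Tile.n))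
    rw [Finset.sum_image hinj]
    refine Finset.sum_congr rfl fun P' hP' => ?_
    rw [Tile.c, (Finset.mem_filter.mp hP').2.1, Tile.c]
  have hle : ∀ P P' : Tile, P.k = P'.k ∧ P.l = P'.l → nest f P P' ≤
      dec 4 P.k (P.c - P'.c) * (2 ^ (-P.k) * mm f P ^ 2) +
        dec 4 P'.k (P'.c - P.c) * (2 ^ (-P'.k) * mm f P' ^ 2) := by
    intro P P' h
    rw [nest, ← h.1, dec_sub_comm 4 P.k P'.c]
    calc _ ≤ 2 ^ (-P.k) * dec 4 P.k (P.c - P'.c) * (mm f P ^ 2 + mm f P' ^ 2) := by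
          gcongr
          refine le_trans ?_ (ENNReal.two_mul_le_sq_add_sq _ _)
          rw [two_mul]; exact le_self_add
      _ = _ := by ring
  have hA : ∑ P ∈ s, ∑ P' ∈ s with P.k = P'.k ∧ P.l = P'.l,
      dec 4 P.k (P.c - P'.c) * (2 ^ (-P.k) * mm f P ^ 2) ≤ 2 ^ 4 * decMass ^ 2 * ∑ P ∈ s, Am f P :=
          by
    rw [Finset.mul_sum]
    refine Finset.sum_le_sum fun P _ => ?_
    rw [← Finset.sum_mul]
    calc _ ≤ (2 ^ 4 * decMass) * (2 ^ (-P.k) * (2 ^ P.k * decMass * Am f P)) := by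
          gcongr
          · exact hsum P
          · exact mm_sq_le hf P
      _ = 2 ^ 4 * decMass ^ 2 * (2 ^ (-P.k) * 2 ^ P.k) * Am f P := by ring
      _ = _ := by rw [two_zpow_neg_mul, mul_one]
  have hB : ∑ P ∈ s, ∑ P' ∈ s with P.k = P'.k ∧ P.l = P'.l,
      dec 4 P'.k (P'.c - P.c) * (2 ^ (-P'.k) * mm f P' ^ 2) ≤ 2 ^ 4 * decMass ^ 2 * ∑ P ∈ s, Am f P
          := by
    refine le_trans (le_of_eq ?_) hA
    simp_rw [Finset.sum_filter]
    rw [Finset.sum_comm]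
    refine Finset.sum_congr rfl fun P _ => Finset.sum_congr rfl fun P' _ => ?_
    simp only [eq_comm]
  calc _ ≤ _ := Finset.sum_le_sum fun P _ => Finset.sum_le_sum fun P' hP' =>
          hle P P' (Finset.mem_filter.mp hP').2
    _ ≤ 2 ^ 4 * decMass ^ 2 * ∑ P ∈ s, Am f P + 2 ^ 4 * decMass ^ 2 * ∑ P ∈ s, Am f P := by
        simp_rw [Finset.sum_add_distrib]
        exact add_le_add hA hB
    _ = _ := by ring

open Classical in
/-- Almost orthogonality for collections of tiles. -/
lemma sum_Am_sq_le_nest : ∃ C : ℝ≥0, 0 < C ∧ ∀ (f : ℝ → ℂ), Integrable f → ∀ s : Finset Tile,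
    (∑ P ∈ s, Am f P) ^ 2 ≤ C * (∫⁻ x, ‖f x‖ₑ ^ 2) * (∑ P ∈ s, Am f P +
      ∑ P ∈ s, ∑ P' ∈ s with P'.k < P.k ∧ P.W ⊆ P'.L, nest f P P') := by
  obtain ⟨C, hC⟩ := inter_le
  refine ⟨2 * (C + 1) * (1 + 2 ^ 5 * decMass.toNNReal ^ 2), by positivity, fun f hf s => ?_⟩
  have hle : ∀ P P', P'.k ≤ P.k → inter f P P' ≤ C * nest f P P' ∧ inter f P' P ≤ C * nest f P P'
      := by
    intro P P' h
    have := hC f hf P P' h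
    simp only [nest, ← mul_assoc] at this ⊢
    exact this
  set N := ∑ P ∈ s, ∑ P' ∈ s with P'.k < P.k ∧ P.W ⊆ P'.L, nest f P P' with hN
  have hpt : ∀ P P', inter f P P' ≤ (if P.k = P'.k ∧ P.l = P'.l then C * nest f P P' else 0) +
      (if P'.k < P.k ∧ P.W ⊆ P'.L then C * nest f P P' else 0) +
      (if P.k < P'.k ∧ P'.W ⊆ P.L then C * nest f P' P else 0) := by
    intro P P'
    rcases Tile.L_cases P P' with h | h | h | h
    · rw [inter_eq_zero h]; exact zero_le
    · rw [if_pos h, add_assoc]; exact (hle P P' h.1.ge).1.trans le_self_add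
    · rw [if_pos h, add_comm _ (C * nest f P P'), add_assoc]
      exact (hle P P' h.1.le).1.trans le_self_add
    · rw [if_pos h, add_comm]; exact (hle P' P h.1.le).2.trans le_self_add
  have hI : ∑ P ∈ s, ∑ P' ∈ s, inter f P P' ≤
      C * (2 ^ 5 * decMass ^ 2 * ∑ P ∈ s, Am f P) + C * N + C * N := by
    calc _ ≤ _ := Finset.sum_le_sum fun P _ => Finset.sum_le_sum fun P' _ => hpt P P'
      _ = C * (∑ P ∈ s, ∑ P' ∈ s with P.k = P'.k ∧ P.l = P'.l, nest f P P') + C * N + C * N := by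
          simp_rw [Finset.sum_add_distrib, ← Finset.sum_filter, ← Finset.mul_sum]
          congr 2
          rw [hN]
          simp_rw [Finset.sum_filter]
          rw [Finset.sum_comm]
      _ ≤ _ := by
          gcongr
          exact sum_nest_same_le hf s
  refine (sum_Am_sq_le hf s).trans ((mul_le_mul' le_rfl hI).trans ?_)
  push_cast
  rw [ENNReal.coe_toNNReal decMass_ne_top]
  set D := (2 ^ 5 * decMass ^ 2 : ℝ≥0∞)
  set S := ∑ P ∈ s, Am f P
  set F := ∫⁻ x, ‖f x‖ₑ ^ 2
  calc F * (C * (D * S) + C * N + C * N) ≤ F * (C * (D * S) + C * N + C * N) +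
        F * (2 * (C * (S + D * N) + (1 + D) * (S + N)) + C * (D * S)) := le_self_add
    _ = _ := by ring

/-- Orthogonality for collections with disjoint left halves. -/
lemma sum_Am_le_of_disjoint : ∃ C : ℝ≥0, 0 < C ∧ ∀ (f : ℝ → ℂ), Integrable f → ∀ s : Finset Tile,
    (∀ P ∈ s, ∀ P' ∈ s, P'.k < P.k → ¬ P.W ⊆ P'.L) →
    ∑ P ∈ s, Am f P ≤ C * ∫⁻ x, ‖f x‖ₑ ^ 2 := by
  classical
  obtain ⟨C, hC0, hC⟩ := sum_Am_sq_le_nest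
  refine ⟨C, hC0, fun f hf s hs => ENNReal.le_of_sq_le_mul
    (ENNReal.sum_ne_top.2 fun P _ => Am_ne_top hf P) ((hC f hf s).trans (le_of_eq ?_))⟩
  have : ∑ P ∈ s, ∑ P' ∈ s with P'.k < P.k ∧ P.W ⊆ P'.L, nest f P P' = 0 := by
    refine Finset.sum_eq_zero fun P hP => ?_
    rw [Finset.filter_eq_empty_iff.2 fun P' hP' h => hs P hP P' hP' h.1 h.2, Finset.sum_empty]
  rw [this, add_zero]

/-! ### A maximal inequality -/

/-- The averaging kernel at scale `2^a`. -/
def pk (a : ℤ) (t : ℝ) : ℝ≥0∞ := 2 ^ (-a) * dec 2 a t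

@[fun_prop]
lemma measurable_pk (a : ℤ) : Measurable (pk a) := by unfold pk; fun_prop

lemma lintegral_pk_le (a : ℤ) (c : ℝ) : ∫⁻ t, pk a (c - t) ≤ decMass := by
  unfold pk
  rw [lintegral_const_mul _ (by fun_prop)]
  calc _ ≤ 2 ^ (-a) * (2 ^ a * decMass) := by gcongr; exact lintegral_dec_le' le_rfl _ _
    _ = _ := by rw [← mul_assoc, two_zpow_neg_mul, one_mul]

lemma pk_comm (a : ℤ) (s t : ℝ) : pk a (s - t) = pk a (t - s) := by
  unfold pk; rw [dec_sub_comm]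

lemma pk_le_of_abs_le {a : ℤ} {s t : ℝ} (h : |t| ≤ 2 * |s|) : pk a s ≤ 4 * pk a t := by
  unfold pk
  have := dec_comp 2 a (s := t) (t := s) (m := 2) (rho_le_two_mul (by
    have := le_max_right ((2 : ℝ) ^ a) |s|; linarith))
  calc _ ≤ 2 ^ (-a) * (((2 : ℕ) : ℝ≥0∞) ^ 2 * dec 2 a t) := by gcongr
    _ = _ := by push_cast; ring

lemma pk_mul_pk_le (a b : ℤ) (y y' z : ℝ) :
    pk a (y - z) * pk b (y' - z) ≤ 4 * (pk a (y - y') * pk b (y' - z) + pk b (y - y') * pk a (y -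
        z)) := by
  have h : |y - y'| ≤ |y - z| + |y' - z| := by
    rw [abs_sub_comm y' z]; exact abs_sub_le _ _ _
  rcases le_total |y - z| |y' - z| with h1 | h1
  · have := pk_le_of_abs_le (a := b) (s := y' - z) (t := y - y') (by linarith)
    calc _ ≤ pk a (y - z) * (4 * pk b (y - y')) := by gcongr
      _ = 4 * (pk b (y - y') * pk a (y - z)) := by ring
      _ ≤ _ := by gcongr; exact le_add_self
  · have := pk_le_of_abs_le (a := a) (s := y - z) (t := y - y') (by linarith)
    calc _ ≤ (4 * pk a (y - y')) * pk b (y' - z) := by gcongr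
      _ = 4 * (pk a (y - y') * pk b (y' - z)) := by ring
      _ ≤ _ := by gcongr; exact le_self_add

lemma lintegral_pk_mul_pk_le (a b : ℤ) (y y' : ℝ) :
    ∫⁻ z, pk a (y - z) * pk b (y' - z) ≤ 4 * decMass * (pk a (y - y') + pk b (y - y')) := by
  refine (lintegral_mono fun z => pk_mul_pk_le a b y y' z).trans ?_
  rw [lintegral_const_mul _ (by fun_prop), lintegral_add_left (by fun_prop),
    lintegral_const_mul _ (by fun_prop), lintegral_const_mul _ (by fun_prop)]
  calc _ ≤ 4 * (pk a (y - y') * decMass + pk b (y - y') * decMass) := by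
        gcongr <;> exact lintegral_pk_le _ _
    _ = _ := by ring

lemma measurable_pk_uncurry : Measurable fun z : ℤ × ℝ => pk z.1 z.2 :=
  measurable_from_prod_countable_right fun a => measurable_pk a

@[fun_prop]
lemma measurable_pk_comp {α : Type*} [MeasurableSpace α] {a : α → ℤ} {g : α → ℝ}
    (ha : Measurable a) (hg : Measurable g) : Measurable fun x => pk (a x) (g x) :=
  measurable_pk_uncurry.comp (ha.prodMk hg)

/-- The linearized maximal operator. -/
def linMax (a : ℝ → ℤ) (g : ℝ → ℝ≥0∞) (y : ℝ) : ℝ≥0∞ := ∫⁻ z, g z * pk (a y) (y - z)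

lemma measurable_linMax {a : ℝ → ℤ} (ha : Measurable a) {g : ℝ → ℝ≥0∞} (hg : Measurable g) :
    Measurable (linMax a g) := by
  unfold linMax
  exact Measurable.lintegral_prod_right' (f := fun p : ℝ × ℝ => g p.2 * pk (a p.1) (p.1 - p.2))
    (by fun_prop)

/-- A single average is a contraction up to a constant. -/
lemma lintegral_avg_sq_le (b : ℤ) {g : ℝ → ℝ≥0∞} (hg : Measurable g) :
    ∫⁻ y, (∫⁻ z, g z * pk b (y - z)) ^ 2 ≤ decMass ^ 2 * ∫⁻ z, g z ^ 2 := by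
  have h1 : ∀ y, (∫⁻ z, g z * pk b (y - z)) ^ 2 ≤ decMass * ∫⁻ z, g z ^ 2 * pk b (y - z) := by
    intro y
    have h := lintegral_mul_sq_le (volume.withDensity fun z => pk b (y - z)) (f := fun _ => 1) (g
        := g)
      aemeasurable_const hg.aemeasurable
    simp only [one_mul, one_pow] at h
    rw [lintegral_withDensity_eq_lintegral_mul _ (by fun_prop) hg,
      lintegral_withDensity_eq_lintegral_mul _ (by fun_prop) (hg.pow_const 2),
      lintegral_withDensity_eq_lintegral_mul _ (by fun_prop) measurable_const] at h
    simp only [Pi.mul_apply, mul_one] at h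
    simp_rw [mul_comm (g _), mul_comm (g _ ^ 2)]
    refine h.trans ?_
    gcongr
    exact lintegral_pk_le _ _
  refine (lintegral_mono h1).trans ?_
  rw [lintegral_const_mul' _ _ decMass_ne_top, lintegral_lintegral_swap (by fun_prop), sq,
      mul_assoc]
  gcongr
  calc _ = ∫⁻ z, g z ^ 2 * ∫⁻ y, pk b (z - y) := by
        refine lintegral_congr fun z => ?_
        rw [← lintegral_const_mul _ (by fun_prop)]
        simp_rw [pk_comm b z]
    _ ≤ ∫⁻ z, g z ^ 2 * decMass := by
        refine lintegral_mono fun z => ?_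
        gcongr; exact lintegral_pk_le _ _
    _ = _ := by rw [lintegral_mul_const _ (by fun_prop), mul_comm]

lemma linMax_apriori {a : ℝ → ℤ} (s : Finset ℤ) (has : ∀ y, a y ∈ s) {g : ℝ → ℝ≥0∞}
    (hg : Measurable g) :
    ∫⁻ y, linMax a g y ^ 2 ≤ s.card * (decMass ^ 2 * ∫⁻ z, g z ^ 2) := by
  calc _ ≤ ∫⁻ y, ∑ b ∈ s, (∫⁻ z, g z * pk b (y - z)) ^ 2 := by
        refine lintegral_mono fun y => ?_
        exact Finset.single_le_sum (f := fun b => (∫⁻ z, g z * pk b (y - z)) ^ 2)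
          (fun _ _ => zero_le) (has y)
    _ = ∑ b ∈ s, ∫⁻ y, (∫⁻ z, g z * pk b (y - z)) ^ 2 := by
        rw [lintegral_finsetSum]
        intro b _
        refine Measurable.pow_const ?_ _
        exact Measurable.lintegral_prod_right' (f := fun p : ℝ × ℝ => g p.2 * pk b (p.1 - p.2))
          (by fun_prop)
    _ ≤ ∑ b ∈ s, decMass ^ 2 * ∫⁻ z, g z ^ 2 := Finset.sum_le_sum fun b _ => lintegral_avg_sq_le b
        hg
    _ = _ := by simp

lemma linMax_self_improve {a : ℝ → ℤ} (ha : Measurable a) {B : ℝ≥0∞}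
    (hB : ∀ g : ℝ → ℝ≥0∞, Measurable g → ∫⁻ z, g z ^ 2 ≠ ⊤ →
      ∫⁻ y, linMax a g y ^ 2 ≤ B * ∫⁻ z, g z ^ 2) (hBt : B ≠ ⊤)
    {g : ℝ → ℝ≥0∞} (hg : Measurable g) (hgt : ∫⁻ z, g z ^ 2 ≠ ⊤) :
    (∫⁻ y, linMax a g y ^ 2) ^ 2 ≤ (8 * decMass) ^ 2 * B * (∫⁻ z, g z ^ 2) ^ 2 := by
  set u := linMax a g with hu
  have hum : Measurable u := measurable_linMax ha hg
  set X := ∫⁻ y, u y ^ 2 with hX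
  set G := ∫⁻ z, g z ^ 2 with hG
  have hXt : X ≠ ⊤ := ne_top_of_le_ne_top (ENNReal.mul_ne_top hBt hgt) (hB g hg hgt)
  set v : ℝ → ℝ≥0∞ := fun z => ∫⁻ y, u y * pk (a y) (y - z) with hv
  have hvm : Measurable v := Measurable.lintegral_prod_right'
    (f := fun p : ℝ × ℝ => u p.2 * pk (a p.2) (p.2 - p.1)) (by fun_prop)
  have h1 : X = ∫⁻ z, g z * v z := by
    calc X = ∫⁻ y, ∫⁻ z, u y * (g z * pk (a y) (y - z)) := by
          refine lintegral_congr fun y => ?_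
          rw [lintegral_const_mul _ (by fun_prop), sq]; rfl
      _ = ∫⁻ z, ∫⁻ y, u y * (g z * pk (a y) (y - z)) := lintegral_lintegral_swap (by fun_prop)
      _ = _ := by
          refine lintegral_congr fun z => ?_
          rw [← lintegral_const_mul _ (by fun_prop)]
          refine lintegral_congr fun y => by ring
  have h2 : ∫⁻ z, v z ^ 2 ≤ 8 * decMass * ∫⁻ y, u y * linMax a u y := by
    have e1 : ∀ z, v z ^ 2 = ∫⁻ y, ∫⁻ y', u y * u y' * (pk (a y) (y - z) * pk (a y') (y' - z)) := by
      intro z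
      rw [sq]
      simp only [hv]
      rw [← lintegral_mul_const _ (by fun_prop)]
      refine lintegral_congr fun y => ?_
      rw [← lintegral_const_mul _ (by fun_prop)]
      refine lintegral_congr fun y' => by ring
    have e2 : ∫⁻ z, v z ^ 2 = ∫⁻ y, ∫⁻ y', u y * u y' * ∫⁻ z, pk (a y) (y - z) * pk (a y') (y' - z)
        := by
      simp_rw [e1]
      rw [lintegral_lintegral_swap]
      · refine lintegral_congr fun y => ?_
        rw [lintegral_lintegral_swap (by fun_prop)]
        refine lintegral_congr fun y' => ?_
        rw [lintegral_const_mul _ (by fun_prop)]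
      · refine Measurable.aemeasurable ?_
        exact Measurable.lintegral_prod_right' (f := fun p : (ℝ × ℝ) × ℝ => u p.1.2 * u p.2 *
          (pk (a p.1.2) (p.1.2 - p.1.1) * pk (a p.2) (p.2 - p.1.1))) (by fun_prop)
    have e3 : ∫⁻ y, ∫⁻ y', u y * u y' * pk (a y) (y - y') = ∫⁻ y, u y * linMax a u y := by
      refine lintegral_congr fun y => ?_
      unfold linMax
      rw [← lintegral_const_mul _ (by fun_prop)]
      refine lintegral_congr fun y' => by ring
    have e4 : ∫⁻ y, ∫⁻ y', u y * u y' * pk (a y') (y - y') = ∫⁻ y, u y * linMax a u y := by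
      rw [lintegral_lintegral_swap (by fun_prop), ← e3]
      refine lintegral_congr fun y => lintegral_congr fun y' => ?_
      rw [pk_comm, mul_comm (u y')]
    rw [e2]
    calc _ ≤ ∫⁻ y, ∫⁻ y', 4 * decMass * (u y * u y' * pk (a y) (y - y') +
            u y * u y' * pk (a y') (y - y')) := by
          refine lintegral_mono fun y => lintegral_mono fun y' => ?_
          calc _ ≤ u y * u y' * (4 * decMass * (pk (a y) (y - y') + pk (a y') (y - y'))) := by
                gcongr; exact lintegral_pk_mul_pk_le _ _ _ _
            _ = _ := by ring
      _ = 4 * decMass * ((∫⁻ y, u y * linMax a u y) + ∫⁻ y, u y * linMax a u y) := by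
          have hd : 4 * decMass ≠ ⊤ := ENNReal.mul_ne_top (by norm_num) decMass_ne_top
          simp_rw [lintegral_const_mul' _ _ hd]
          congr 1
          nth_rw 1 [← e3]
          rw [← e4, ← lintegral_add_left]
          · refine lintegral_congr fun y => ?_
            rw [lintegral_add_left (by fun_prop)]
          · exact Measurable.lintegral_prod_right'
              (f := fun p : ℝ × ℝ => u p.1 * u p.2 * pk (a p.1) (p.1 - p.2)) (by fun_prop)
      _ = _ := by ring
  have h3 : (∫⁻ y, u y * linMax a u y) ^ 2 ≤ X * (B * X) :=
    (lintegral_mul_sq_le volume hum.aemeasurable (measurable_linMax ha hum).aemeasurable).trans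
      (mul_le_mul' le_rfl (hB u hum hXt))
  have h4 : X ^ 2 ≤ G * ∫⁻ z, v z ^ 2 := by
    conv_lhs => rw [h1]
    exact lintegral_mul_sq_le volume hg.aemeasurable hvm.aemeasurable
  rcases eq_or_ne X 0 with h0 | h0
  · simp [h0]
  have h5 : X ^ 2 * X ^ 2 ≤ X ^ 2 * ((8 * decMass) ^ 2 * B * G ^ 2) := by
    calc X ^ 2 * X ^ 2 = (X ^ 2) ^ 2 := by ring
      _ ≤ (G * (8 * decMass * ∫⁻ y, u y * linMax a u y)) ^ 2 := by
          gcongr; exact h4.trans (by gcongr)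
      _ = G ^ 2 * (8 * decMass) ^ 2 * (∫⁻ y, u y * linMax a u y) ^ 2 := by ring
      _ ≤ G ^ 2 * (8 * decMass) ^ 2 * (X * (B * X)) := by gcongr
      _ = _ := by ring
  exact (ENNReal.mul_le_mul_iff_right (pow_ne_zero 2 h0) (ENNReal.pow_ne_top hXt)).mp h5

lemma lintegral_linMax_sq_le {a : ℝ → ℤ} (ha : Measurable a) (s : Finset ℤ) (has : ∀ y, a y ∈ s)
    {g : ℝ → ℝ≥0∞} (hg : Measurable g) (hgt : ∫⁻ z, g z ^ 2 ≠ ⊤) :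
    ∫⁻ y, linMax a g y ^ 2 ≤ (8 * decMass) ^ 2 * ∫⁻ z, g z ^ 2 := by
  set V : Set ℝ≥0∞ := {B | ∀ g : ℝ → ℝ≥0∞, Measurable g → ∫⁻ z, g z ^ 2 ≠ ⊤ →
      ∫⁻ y, linMax a g y ^ 2 ≤ B * ∫⁻ z, g z ^ 2} with hV
  have h0 : (s.card * decMass ^ 2 : ℝ≥0∞) ∈ V := fun g hg _ => by
    rw [mul_assoc]; exact linMax_apriori s has hg
  have h0t : (s.card * decMass ^ 2 : ℝ≥0∞) ≠ ⊤ :=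
    ENNReal.mul_ne_top (by simp) (ENNReal.pow_ne_top decMass_ne_top)
  have hinf : sInf V ∈ V := by
    intro g hg hgt
    rw [sInf_eq_iInf', ENNReal.iInf_mul' (fun h => absurd h hgt) (fun _ => ⟨⟨_, h0⟩⟩)]
    exact le_iInf fun B => B.2 g hg hgt
  have hinft : sInf V ≠ ⊤ := ne_top_of_le_ne_top h0t (sInf_le h0)
  have himp : ∀ g : ℝ → ℝ≥0∞, Measurable g → ∫⁻ z, g z ^ 2 ≠ ⊤ →
      (∫⁻ y, linMax a g y ^ 2) ^ 2 ≤ (8 * decMass) ^ 2 * sInf V * (∫⁻ z, g z ^ 2) ^ 2 :=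
    fun g hg hgt => linMax_self_improve ha hinf hinft hg hgt
  set r : ℝ≥0∞ := ((8 * decMass) ^ 2 * sInf V) ^ (1 / 2 : ℝ) with hr
  have hr2 : r ^ 2 = (8 * decMass) ^ 2 * sInf V := by
    rw [hr, ← ENNReal.rpow_natCast, ← ENNReal.rpow_mul]; norm_num
  have hrV : r ∈ V := by
    intro g hg hgt
    have := himp g hg hgt
    rw [← hr2, ← mul_pow] at this
    exact (ENNReal.pow_le_pow_left_iff two_ne_zero).mp this
  have h1 : sInf V ^ 2 ≤ (8 * decMass) ^ 2 * sInf V := by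
    rw [← hr2]; exact pow_le_pow_left' (sInf_le hrV) 2
  exact (hinf g hg hgt).trans (by gcongr; exact ENNReal.le_of_sq_le_mul hinft h1)

/-- The maximal operator over finitely many scales. -/
def maxFn (s : Finset ℤ) (g : ℝ → ℝ≥0∞) (y : ℝ) : ℝ≥0∞ := ⨆ a ∈ s, ∫⁻ z, g z * pk a (y - z)

lemma lintegral_maxFn_sq_le (s : Finset ℤ) {g : ℝ → ℝ≥0∞} (hg : Measurable g)
    (hgt : ∫⁻ z, g z ^ 2 ≠ ⊤) :
    ∫⁻ y, maxFn s g y ^ 2 ≤ (8 * decMass) ^ 2 * ∫⁻ z, g z ^ 2 := by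
  rcases s.eq_empty_or_nonempty with rfl | hs
  · simp [maxFn]
  obtain ⟨a, ha, has, hle⟩ : ∃ a : ℝ → ℤ, Measurable a ∧ (∀ y, a y ∈ s) ∧
      ∀ y, ∀ b ∈ s, ∫⁻ z, g z * pk b (y - z) ≤ linMax a g y := by
    induction hs using Finset.Nonempty.cons_induction with
    | singleton b =>
      refine ⟨fun _ => b, measurable_const, by simp, fun y b' hb' => ?_⟩
      rw [Finset.mem_singleton.mp hb']; rfl
    | cons b s hb _ ih =>
      obtain ⟨a, ha, has, hle⟩ := ih
      have hm : MeasurableSet {y | linMax a g y ≤ ∫⁻ z, g z * pk b (y - z)} :=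
        measurableSet_le (measurable_linMax ha hg)
          (measurable_linMax (a := fun _ => b) measurable_const hg)
      classical
      set a' : ℝ → ℤ := fun y => if linMax a g y ≤ ∫⁻ z, g z * pk b (y - z) then b else a y with ha'
      refine ⟨a', Measurable.ite hm measurable_const ha, fun y => ?_, fun y b' hb' => ?_⟩
      · simp only [ha']
        split_ifs
        · simp
        · simp [has y]
      · by_cases h : linMax a g y ≤ ∫⁻ z, g z * pk b (y - z)
        · have e : linMax a' g y = ∫⁻ z, g z * pk b (y - z) := by
            rw [linMax, show a' y = b from if_pos h]
          rw [e]
          rcases Finset.mem_cons.mp hb' with rfl | hb'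
          · exact le_rfl
          · exact (hle y b' hb').trans h
        · have e : linMax a' g y = linMax a g y := by
            rw [linMax, show a' y = a y from if_neg h]; rfl
          rw [e]
          rcases Finset.mem_cons.mp hb' with rfl | hb'
          · exact (not_le.mp h).le
          · exact hle y b' hb'
  refine le_trans (lintegral_mono fun y => ?_) (lintegral_linMax_sq_le ha s has hg hgt)
  gcongr
  exact iSup₂_le (hle y)

/-! ### Telescoping of wave packets along a frequency -/

lemma mem_R_le {k l : ℤ} {η : ℝ} (h : η ∈ DI (-k - 1) (2 * l + 1)) : (l : ℝ) + 1 / 2 ≤ 2 ^ k * η :=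
    by
  rw [mem_DI, dy_eq_iff] at h
  have h1 := h.1
  have hk : (0 : ℝ) < 2 ^ k := by positivity
  have e : (2 : ℝ) ^ (-k - 1) = (2 ^ k)⁻¹ * 2⁻¹ := by
    rw [sub_eq_add_neg, zpow_add₀ (by norm_num), zpow_neg]; norm_num
  rw [e] at h1
  push_cast at h1
  rw [show (2 * l + 1 : ℝ) * ((2 ^ k)⁻¹ * 2⁻¹) = (l + 1 / 2) / 2 ^ k by field_simp, div_le_iff₀
      hk] at h1
  linarith

lemma mem_left_of_ball {k l : ℤ} {β : ContDiffBump (1 / 4 : ℝ)} (hβ : β.rOut ≤ 3 / 16) {η : ℝ}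
    (h : 2 ^ k * η - l ∈ Metric.ball (1 / 4 : ℝ) β.rOut) : η ∈ DI (-k - 1) (2 * l) := by
  rw [Metric.mem_ball, Real.dist_eq, abs_lt] at h
  exact mem_left_half (by linarith [h.1]) (by linarith [h.2])

/-- A low-pass packet keeps the packets of larger scale. -/
lemma wp_cv_lowpass_of_le {k a : ℤ} (h : a ≤ k) (ξ x : ℝ) :
    cv (wp β1 k (dy (-k) ξ)) (wp β2 a (dy (-a) ξ)) x = wp β1 k (dy (-k) ξ) x := by
  refine wp_conv_eq_self β1 β2 (fun η hη => ?_) x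
  have h1 := DI_left_subset _ _ (mem_left_of_ball (β := β1) (by norm_num [β1]) hη)
  have h2 : dy (-a) η = dy (-a) ξ := dy_eq_of_le (k := -k) (by omega) h1
  rw [← h2, Metric.mem_closedBall, Real.dist_eq, abs_le]
  have h3 := dy_eq_iff.mp (rfl : dy (-a) η = dy (-a) η)
  have ha : (0 : ℝ) < 2 ^ a := by positivity
  rw [zpow_neg, ← div_eq_mul_inv, ← div_eq_mul_inv, div_le_iff₀ ha, lt_div_iff₀ ha] at h3
  simp only [β2]
  constructor <;> linarith [h3.1, h3.2]

/-- A low-pass packet annihilates the packets of smaller scale. -/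
lemma wp_cv_lowpass_of_lt {k a : ℤ} (h : k < a) {ξ : ℝ}
    (hξ : ξ ∈ DI (-k - 1) (2 * dy (-k) ξ + 1)) (x : ℝ) :
    cv (wp β1 k (dy (-k) ξ)) (wp β2 a (dy (-a) ξ)) x = 0 := by
  refine wp_conv_eq_zero β1 β2 (fun η hη hη2 => ?_) x
  rw [Metric.mem_ball, Real.dist_eq, abs_lt] at hη hη2
  have h1 : DI (-a) (dy (-a) ξ) ⊆ DI (-k - 1) (2 * dy (-k) ξ + 1) :=
    DI_subset_of_mem (by omega) rfl hξ
  have h2 := mem_R_le (h1 (left_mem_DI (-a) (dy (-a) ξ)))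
  have h3 : (2 : ℝ) ≤ 2 ^ (a - k) := by
    calc (2 : ℝ) = 2 ^ (1 : ℤ) := by norm_num
      _ ≤ _ := zpow_le_zpow_right₀ (by norm_num) (by omega)
  have h4 : (2 : ℝ) ^ a = 2 ^ (a - k) * 2 ^ k := by rw [← zpow_add₀ (by norm_num)]; congr 1; omega
  have h5 : (2 : ℝ) ^ k * (dy (-a) ξ * 2 ^ (-a)) * 2 ^ (a - k) = dy (-a) ξ := by
    have : (2 : ℝ) ^ k * 2 ^ (-a) * 2 ^ (a - k) = 1 := by
      rw [← zpow_add₀ (by norm_num), ← zpow_add₀ (by norm_num),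
        show k + -a + (a - k) = 0 by ring, zpow_zero]
    linear_combination (dy (-a) ξ : ℝ) * this
  have h6 : (2 : ℝ) ^ k * η < dy (-k) ξ + 7 / 16 := by
    have := hη.2; simp only [β1] at this; linarith
  have h7 := hη2.1
  simp only [β2] at h7
  rw [h4, mul_assoc] at h7
  have h8 : (2 : ℝ) ^ k * η - 2 ^ k * (dy (-a) ξ * 2 ^ (-a)) < - (1 / 16) := by linarith
  nlinarith

lemma cv_sum {ι : Type*} {s : Finset ι} {u : ι → ℝ → ℂ} (hu : ∀ i ∈ s, Integrable (u i))
    (g : 𝓢(ℝ, ℂ)) (x : ℝ) : cv (fun y => ∑ i ∈ s, u i y) g x = ∑ i ∈ s, cv (u i) g x := by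
  unfold cv
  simp_rw [Finset.sum_mul]
  exact integral_finsetSum _ fun i hi => integrable_cv_integrand (hu i hi) g x

/-- The packet sum associated with a frequency. -/
def packetSum (K : Finset ℤ) (ξ : ℝ) (u : ℤ → ℝ → ℂ) (x : ℝ) : ℂ :=
  ∑ k ∈ K, cv (u k) (wp β1 k (dy (-k) ξ)) x

lemma cv_packetSum_lowpass {K : Finset ℤ} {ξ : ℝ}
    (hξ : ∀ k ∈ K, ξ ∈ DI (-k - 1) (2 * dy (-k) ξ + 1)) {u : ℤ → ℝ → ℂ}
    (hu : ∀ k ∈ K, Integrable (u k)) (a : ℤ) (x : ℝ) :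
    cv (packetSum K ξ u) (wp β2 a (dy (-a) ξ)) x = packetSum (K.filter fun k => a ≤ k) ξ u x := by
  unfold packetSum
  rw [cv_sum fun k hk => integrable_cv (hu k hk) _, Finset.sum_filter]
  refine Finset.sum_congr rfl fun k hk => ?_
  rw [cv_assoc (hu k hk)]
  split_ifs with h
  · simp_rw [wp_cv_lowpass_of_le h]; rfl
  · simp_rw [wp_cv_lowpass_of_lt (not_le.mp h) (hξ k hk)]; simp

/-- Partial sums in the scale are controlled by the maximal function. -/
lemma packetSum_partial_le : ∃ C : ℝ≥0, ∀ (K s : Finset ℤ) (ξ : ℝ),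
    (∀ k ∈ K, ξ ∈ DI (-k - 1) (2 * dy (-k) ξ + 1)) → ∀ u : ℤ → ℝ → ℂ,
    (∀ k ∈ K, Integrable (u k)) → ∀ a b b' : ℤ, a ≤ b → b ≤ b' → b ∈ s → b' ∈ s → ∀ x y : ℝ,
    |x - y| ≤ 2 ^ a → ‖packetSum (K.filter fun k => b ≤ k ∧ k < b') ξ u x‖ₑ ≤
      C * maxFn s (fun z => ‖packetSum K ξ u z‖ₑ) y := by
  obtain ⟨D, hD⟩ := wp_bound β2
  refine ⟨D * 4 + D * 4, fun K s ξ hξ u hu a b b' hab hbb hb hb' x y hxy => ?_⟩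
  set G := packetSum K ξ u
  have key : ∀ c, a ≤ c → c ∈ s → ‖cv G (wp β2 c (dy (-c) ξ)) x‖ₑ ≤
      D * 4 * maxFn s (fun z => ‖G z‖ₑ) y := by
    intro c hac hc
    calc _ ≤ ∫⁻ z, ‖G z‖ₑ * ‖wp β2 c (dy (-c) ξ) (x - z)‖ₑ := enorm_cv_le _ _ _
      _ ≤ ∫⁻ z, (D * 4 : ℝ≥0) * (‖G z‖ₑ * pk c (y - z)) := by
          refine lintegral_mono fun z => ?_
          have h1 : pk c (x - z) ≤ 4 * pk c (y - z) := by
            unfold pk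
            have h2 : (2 : ℝ) ^ a ≤ 2 ^ c := zpow_le_zpow_right₀ (by norm_num) hac
            have := dec_comp 2 c (s := y - z) (t := x - z) (m := 2) (rho_le_two_mul (by
              have h3 := le_max_left ((2 : ℝ) ^ c) |x - z|
              have h4 := abs_sub_le y x z
              rw [abs_sub_comm y x] at h4
              linarith))
            calc _ ≤ 2 ^ (-c) * (((2 : ℕ) : ℝ≥0∞) ^ 2 * dec 2 c (y - z)) := by gcongr
              _ = _ := by push_cast; ring
          calc _ ≤ ‖G z‖ₑ * (D * 2 ^ (-c) * dec 20 c (x - z)) := by gcongr; exact hD _ _ _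
            _ ≤ ‖G z‖ₑ * (D * 2 ^ (-c) * dec 2 c (x - z)) := by
                gcongr; exact dec_anti (by norm_num) _ _
            _ = D * (‖G z‖ₑ * pk c (x - z)) := by unfold pk; ring
            _ ≤ D * (‖G z‖ₑ * (4 * pk c (y - z))) := by gcongr
            _ = _ := by push_cast; ring
      _ = (D * 4 : ℝ≥0) * ∫⁻ z, ‖G z‖ₑ * pk c (y - z) := lintegral_const_mul' _ _ ENNReal.coe_ne_top
      _ ≤ _ := by
          push_cast
          gcongr
          exact le_iSup₂_of_le (f := fun a _ => ∫⁻ z, ‖G z‖ₑ * pk a (y - z)) c hc le_rfl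
  have hsplit : packetSum (K.filter fun k => b ≤ k ∧ k < b') ξ u x =
      cv G (wp β2 b (dy (-b) ξ)) x - cv G (wp β2 b' (dy (-b') ξ)) x := by
    rw [cv_packetSum_lowpass hξ hu, cv_packetSum_lowpass hξ hu, eq_sub_iff_add_eq]
    unfold packetSum
    rw [← Finset.sum_union]
    · refine Finset.sum_congr ?_ fun _ _ => rfl
      ext k
      simp only [Finset.mem_union, Finset.mem_filter]
      constructor
      · rintro (h | h)
        · exact ⟨h.1, h.2.1⟩
        · exact ⟨h.1, by omega⟩
      · intro h
        by_cases h' : k < b'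
        · exact Or.inl ⟨h.1, h.2, h'⟩
        · exact Or.inr ⟨h.1, by omega⟩
    · rw [Finset.disjoint_left]
      intro k hk hk'
      simp only [Finset.mem_filter] at hk hk'
      omega
  rw [hsplit]
  refine (enorm_sub_le).trans ?_
  push_cast
  rw [add_mul]
  exact add_le_add (key b hab hb) (key b' (by omega) hb')

/-- Orthogonality of the packets along a frequency. -/
lemma lintegral_packetSum_sq_le : ∃ C : ℝ≥0, ∀ (K : Finset ℤ) (ξ : ℝ),
    (∀ k ∈ K, ξ ∈ DI (-k - 1) (2 * dy (-k) ξ + 1)) → ∀ u : ℤ → ℝ → ℂ,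
    (∀ k ∈ K, Integrable (u k)) →
    ∫⁻ x, ‖packetSum K ξ u x‖ₑ ^ 2 ≤ C * ∑ k ∈ K, ∫⁻ z, ‖u k z‖ₑ ^ 2 := by
  obtain ⟨C, hC⟩ := wp_cv_bound β1
  refine ⟨C * (2 * decMass.toNNReal), fun K ξ hξ u hu => ?_⟩
  refine (lintegral_sum_cv_sq_le β1 K u hu id fun k => dy (-k) ξ).trans ?_
  rw [Finset.mul_sum]
  refine Finset.sum_le_sum fun k hk => ?_
  have hdisj : ∀ a ∈ K, ∀ b, b < a → Disjoint (DI (-b - 1) (2 * dy (-b) ξ)) (DI (-a - 1) (2 * dy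
      (-a) ξ))
      ∨ ξ ∉ DI (-b - 1) (2 * dy (-b) ξ + 1) := by
    intro a _ b hab
    by_cases h : ξ ∈ DI (-b - 1) (2 * dy (-b) ξ + 1)
    · left
      have h1 : DI (-a) (dy (-a) ξ) ⊆ DI (-b - 1) (2 * dy (-b) ξ + 1) :=
        DI_subset_of_mem (by omega) rfl h
      exact Disjoint.mono_right ((DI_left_subset _ _).trans h1) (DI_disjoint (by omega))
    · exact Or.inr h
  rw [Finset.sum_eq_single_of_mem k hk]
  · have hp : ∀ p : ℝ × ℝ, ‖u k p.1‖ₑ * (‖u k p.2‖ₑ * ‖cv (wp β1 k (dy (-k) ξ)) (wp β1 k (dy (-k)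
        ξ)) (p.1 - p.2)‖ₑ)
        ≤ C * (‖u k p.1‖ₑ ^ 2 * pk k (p.1 - p.2) + ‖u k p.2‖ₑ ^ 2 * pk k (p.1 - p.2)) := by
      rintro ⟨z', z⟩
      calc _ ≤ ‖u k z'‖ₑ * (‖u k z‖ₑ * (C * 2 ^ (-k) * dec 2 k (z' - z))) := by
            gcongr
            exact (hC k _ k _ _ le_rfl).1.trans (by gcongr; exact dec_anti (by norm_num) _ _)
        _ = C * pk k (z' - z) * (‖u k z'‖ₑ * ‖u k z‖ₑ) := by unfold pk; ring
        _ ≤ C * pk k (z' - z) * (2 * (‖u k z'‖ₑ * ‖u k z‖ₑ)) := by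
            refine mul_le_mul' le_rfl ?_; rw [two_mul]; exact le_self_add
        _ ≤ C * pk k (z' - z) * (‖u k z'‖ₑ ^ 2 + ‖u k z‖ₑ ^ 2) := by
            gcongr; exact ENNReal.two_mul_le_sq_add_sq _ _
        _ = _ := by ring
    have hm := (hu k hk).aestronglyMeasurable.enorm
    calc _ ≤ ∫⁻ z', ∫⁻ z, C * (‖u k z'‖ₑ ^ 2 * pk k (z' - z) + ‖u k z‖ₑ ^ 2 * pk k (z' - z)) :=
          lintegral_mono fun z' => lintegral_mono fun z => hp (z', z)
      _ = C * ((∫⁻ z', ∫⁻ z, ‖u k z'‖ₑ ^ 2 * pk k (z' - z)) +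
            ∫⁻ z', ∫⁻ z, ‖u k z‖ₑ ^ 2 * pk k (z' - z)) := by
          simp_rw [lintegral_const_mul' (C : ℝ≥0∞) _ ENNReal.coe_ne_top]
          congr 1
          rw [← lintegral_add_left']
          · refine lintegral_congr fun z' => ?_
            rw [lintegral_add_left (by fun_prop)]
          · simp_rw [fun z' : ℝ => lintegral_const_mul (μ := volume) (‖u k z'‖ₑ ^ 2)
              (f := fun z => pk k (z' - z)) (by fun_prop)]
            refine AEMeasurable.mul (hm.pow_const 2) (Measurable.aemeasurable ?_)
            exact Measurable.lintegral_prod_right' (f := fun p : ℝ × ℝ => pk k (p.1 - p.2))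
                (by fun_prop)
      _ ≤ C * ((∫⁻ z, ‖u k z‖ₑ ^ 2) * decMass + (∫⁻ z, ‖u k z‖ₑ ^ 2) * decMass) := by
          gcongr
          · rw [← lintegral_mul_const' _ _ decMass_ne_top]
            refine lintegral_mono fun z' => ?_
            rw [lintegral_const_mul _ (by fun_prop)]
            gcongr
            exact lintegral_pk_le _ _
          · rw [lintegral_lintegral_swap]
            · rw [← lintegral_mul_const' _ _ decMass_ne_top]
              refine lintegral_mono fun z => ?_
              rw [lintegral_const_mul _ (by fun_prop)]
              gcongr
              simp_rw [pk_comm k _ z]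
              exact lintegral_pk_le _ _
            · refine AEMeasurable.mul ?_ (Measurable.aemeasurable (by fun_prop))
              exact (hm.pow_const 2).comp_snd
      _ = _ := by
          push_cast
          rw [ENNReal.coe_toNNReal decMass_ne_top]
          ring
  · intro j hj hjk
    have hz : ∀ t, cv (wp β1 k (dy (-k) ξ)) (wp β1 j (dy (-j) ξ)) t = 0 := by
      intro t
      refine wp_cv_eq_zero (β := β1) (by norm_num [β1]) ?_ t
      rcases lt_or_gt_of_ne hjk with h | h
      · exact ((hdisj k hk j h).resolve_right (fun h' => h' (hξ j hj))).symm
      · exact (hdisj j hj k h).resolve_right (fun h' => h' (hξ k hk))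
    simp only [id]
    simp_rw [hz]
    simp

open scoped Classical

/-! ### Trees -/

/-- The size of a collection of tiles is at most `σ`. -/
def SizeLe (f : ℝ → ℂ) (S : Finset Tile) (σ : ℝ≥0) : Prop :=
  ∀ (k n : ℤ) (ξ : ℝ), ∑ P ∈ S with P.I ⊆ DI k n ∧ ξ ∈ P.R, Am f P ≤ (σ : ℝ≥0∞) ^ 2 * 2 ^ k

lemma SizeLe.mono {f : ℝ → ℂ} {S S' : Finset Tile} {σ : ℝ≥0} (h : SizeLe f S σ) (hS : S' ⊆ S) :
    SizeLe f S' σ := fun k n ξ =>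
  (Finset.sum_le_sum_of_subset (Finset.filter_subset_filter _ hS)).trans (h k n ξ)

lemma SizeLe.Am_le {f : ℝ → ℂ} {S : Finset Tile} {σ : ℝ≥0} (h : SizeLe f S σ) {P : Tile}
    (hP : P ∈ S) : Am f P ≤ (σ : ℝ≥0∞) ^ 2 * 2 ^ P.k := by
  obtain ⟨ξ, hξ⟩ : P.R.Nonempty := DI_nonempty _ _
  refine le_trans ?_ (h P.k P.n ξ)
  exact Finset.single_le_sum (f := fun P => Am f P) (fun _ _ => zero_le)
    (Finset.mem_filter.mpr ⟨hP, subset_rfl, hξ⟩)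

/-- The function associated with a tile. -/
def tt (N : ℝ → ℝ) (f : ℝ → ℂ) (P : Tile) : ℝ → ℂ :=
  (P.I ∩ N ⁻¹' P.R).indicator (hh f P.k P.l)

/-- The tile of scale `k` containing the point `(x, ξ)`. -/
def tileAt (ξ : ℝ) (k : ℤ) (x : ℝ) : Tile := ⟨k, dy k x, dy (-k) ξ⟩

lemma eq_tileAt {P : Tile} {x ξ : ℝ} (hx : x ∈ P.I) (hξ : ξ ∈ P.W) : P = tileAt ξ P.k x :=
  Tile.eq_of_mem rfl hx rfl hξ rfl

lemma mem_tileAt_I (ξ : ℝ) (k : ℤ) (x : ℝ) : x ∈ (tileAt ξ k x).I := rfl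

lemma mem_tileAt_W (ξ : ℝ) (k : ℤ) (x : ℝ) : ξ ∈ (tileAt ξ k x).W := rfl

/-- A convex tree with top interval `DI k₀ n₀` and frequency `ξ`. -/
structure IsTree (T : Finset Tile) (ξ : ℝ) (k₀ n₀ : ℤ) : Prop where
  mem_W : ∀ P ∈ T, ξ ∈ P.W
  top_mem : (⟨k₀, n₀, dy (-k₀) ξ⟩ : Tile) ∈ T
  I_subset : ∀ P ∈ T, P.I ⊆ DI k₀ n₀
  convex : ∀ (k m : ℤ) (x : ℝ), tileAt ξ k x ∈ T → k ≤ m → m ≤ k₀ → tileAt ξ m x ∈ T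

/-- The points covered by the tiles of scale `k`. -/
def scaleSet (T : Finset Tile) (ξ : ℝ) (k : ℤ) : Set ℝ := {x | tileAt ξ k x ∈ T}

lemma mem_scaleSet {T : Finset Tile} {ξ : ℝ} {k : ℤ} {x : ℝ} :
    x ∈ scaleSet T ξ k ↔ tileAt ξ k x ∈ T := Iff.rfl

lemma measurableSet_scaleSet (T : Finset Tile) (ξ : ℝ) (k : ℤ) :
    MeasurableSet (scaleSet T ξ k) :=
  measurable_dy k (t := {n | (⟨k, n, dy (-k) ξ⟩ : Tile) ∈ T}) (by trivial)

namespace IsTree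

lemma scaleSet_subset {T : Finset Tile} {ξ : ℝ} {k₀ n₀ : ℤ} (hT : IsTree T ξ k₀ n₀) (k : ℤ) :
    scaleSet T ξ k ⊆ DI k₀ n₀ := fun x hx =>
  hT.I_subset _ hx (mem_tileAt_I ξ k x)

lemma le_top {T : Finset Tile} {ξ : ℝ} {k₀ n₀ : ℤ} (hT : IsTree T ξ k₀ n₀) {P : Tile} (hP : P ∈ T)
    : P.k ≤ k₀ := scale_le_of_DI_subset (hT.I_subset P hP)

lemma scaleSet_mono {T : Finset Tile} {ξ : ℝ} {k₀ n₀ : ℤ} (hT : IsTree T ξ k₀ n₀) {k k' : ℤ} (h : k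
    ≤ k') (h' : k' ≤ k₀) : scaleSet T ξ k ⊆ scaleSet T ξ k' :=
  fun x hx => hT.convex k k' x hx h h'

lemma scaleSet_top {T : Finset Tile} {ξ : ℝ} {k₀ n₀ : ℤ} (hT : IsTree T ξ k₀ n₀) : scaleSet T ξ k₀
    = DI k₀ n₀ := by
  refine Subset.antisymm (hT.scaleSet_subset k₀) fun x hx => ?_
  rw [mem_scaleSet, tileAt, mem_DI.mp hx]
  exact hT.top_mem

end IsTree

/-- The maximal dyadic intervals not belonging to a tree. -/
def leaves (T : Finset Tile) (ξ : ℝ) : Finset (ℤ × ℤ) :=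
  (T.biUnion fun P => {(P.k - 1, 2 * P.n), (P.k - 1, 2 * P.n + 1)}).filter
    fun j => (⟨j.1, j.2, dy (-j.1) ξ⟩ : Tile) ∉ T

lemma mem_leaves_of_mem {T : Finset Tile} {ξ : ℝ} {j : ℤ × ℤ} (hj : j ∈ leaves T ξ)
    (hW : ∀ P ∈ T, ξ ∈ P.W) {x : ℝ} (hx : x ∈ DI j.1 j.2) :
    x ∈ scaleSet T ξ (j.1 + 1) ∧ x ∉ scaleSet T ξ j.1 := by
  unfold leaves at hj
  rw [Finset.mem_filter, Finset.mem_biUnion] at hj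
  obtain ⟨⟨P, hP, hPj⟩, hj2⟩ := hj
  constructor
  · have h1 : j.1 = P.k - 1 ∧ x ∈ P.I := by
      simp only [Finset.mem_insert, Finset.mem_singleton] at hPj
      rcases hPj with h | h
      · rw [h] at hx ⊢; exact ⟨rfl, DI_left_subset _ _ hx⟩
      · rw [h] at hx ⊢; exact ⟨rfl, DI_right_subset _ _ hx⟩
    rw [mem_scaleSet, show j.1 + 1 = P.k by omega, ← eq_tileAt h1.2 (hW P hP)]
    exact hP
  · rw [mem_scaleSet, tileAt, mem_DI.mp hx]; exact hj2

lemma mem_leaves {T : Finset Tile} {ξ : ℝ} {k : ℤ} {x : ℝ} (h1 : x ∈ scaleSet T ξ (k + 1))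
    (h2 : x ∉ scaleSet T ξ k) : (k, dy k x) ∈ leaves T ξ := by
  unfold leaves
  rw [Finset.mem_filter, Finset.mem_biUnion]
  refine ⟨⟨tileAt ξ (k + 1) x, h1, ?_⟩, h2⟩
  simp only [tileAt, add_sub_cancel_right, Finset.mem_insert, Finset.mem_singleton, Prod.mk.injEq,
    true_and]
  have := dy_half (k + 1) x
  rw [add_sub_cancel_right] at this
  omega

namespace IsTree

lemma leaf_lt {T : Finset Tile} {ξ : ℝ} {k₀ n₀ : ℤ} (hT : IsTree T ξ k₀ n₀) {j : ℤ × ℤ} (hj : j ∈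
    leaves T ξ) : j.1 < k₀ := by
  obtain ⟨x, hx⟩ := DI_nonempty j.1 j.2
  have := hT.le_top (mem_leaves_of_mem hj hT.mem_W hx).1
  simp only [tileAt] at this
  omega

lemma leaf_subset {T : Finset Tile} {ξ : ℝ} {k₀ n₀ : ℤ} (hT : IsTree T ξ k₀ n₀) {j : ℤ × ℤ} (hj : j
    ∈ leaves T ξ) : DI j.1 j.2 ⊆ DI k₀ n₀ := fun _ hx =>
  hT.scaleSet_subset _ (mem_leaves_of_mem hj hT.mem_W hx).1

lemma mem_scaleSet_iff_of_leaf {T : Finset Tile} {ξ : ℝ} {k₀ n₀ : ℤ} (hT : IsTree T ξ k₀ n₀) {j : ℤ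
    × ℤ} (hj : j ∈ leaves T ξ) {x : ℝ} (hx : x ∈ DI j.1 j.2)
    {k : ℤ} (hk : k ≤ k₀) : x ∈ scaleSet T ξ k ↔ j.1 < k := by
  have h := mem_leaves_of_mem hj hT.mem_W hx
  constructor
  · intro hxk
    by_contra hc
    exact h.2 (hT.scaleSet_mono (not_lt.mp hc) (hT.leaf_lt hj).le hxk)
  · intro hlt
    exact hT.scaleSet_mono hlt hk h.1

lemma exists_leaf {T : Finset Tile} {ξ : ℝ} {k₀ n₀ : ℤ} (hT : IsTree T ξ k₀ n₀) {x : ℝ} (hx : x ∈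
    DI k₀ n₀) : ∃ j ∈ leaves T ξ, x ∈ DI j.1 j.2 := by
  by_contra hc
  push Not at hc
  have key : ∀ m : ℕ, x ∈ scaleSet T ξ (k₀ - m) := by
    intro m
    induction m with
    | zero => simpa [hT.scaleSet_top] using hx
    | succ m ih =>
      by_contra h
      refine hc _ (mem_leaves (k := k₀ - (m + 1 : ℕ)) (x := x) ?_ h) rfl
      rwa [show k₀ - ((m + 1 : ℕ) : ℤ) + 1 = k₀ - m by push_cast; ring]
  have hinj : Function.Injective fun m : ℕ => tileAt ξ (k₀ - m) x := by
    intro a b hab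
    have := congrArg Tile.k hab
    simp only [tileAt] at this
    omega
  have : Set.Infinite (T : Set Tile) :=
    Set.infinite_of_injective_forall_mem hinj (fun m => key m)
  exact this T.finite_toSet

lemma leaves_disjoint {T : Finset Tile} {ξ : ℝ} {k₀ n₀ : ℤ} (hT : IsTree T ξ k₀ n₀) : ((leaves T ξ
    : Finset (ℤ × ℤ)) : Set (ℤ × ℤ)).PairwiseDisjoint
    fun j => DI j.1 j.2 := by
  intro j hj j' hj' hne
  rw [Function.onFun, Set.disjoint_left]
  intro x hx hx'
  have a1 := (hT.mem_scaleSet_iff_of_leaf hj' hx' (k := j.1) (hT.leaf_lt hj).le).not.mp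
    (mem_leaves_of_mem hj hT.mem_W hx).2
  have a2 := (hT.mem_scaleSet_iff_of_leaf hj hx (k := j'.1) (hT.leaf_lt hj').le).not.mp
    (mem_leaves_of_mem hj' hT.mem_W hx').2
  apply hne
  have h1 : j.1 = j'.1 := by omega
  refine Prod.ext h1 ?_
  rw [mem_DI] at hx hx'
  rw [← hx, ← hx', h1]

lemma sum_leaves_le {T : Finset Tile} {ξ : ℝ} {k₀ n₀ : ℤ} (hT : IsTree T ξ k₀ n₀) (g : ℝ → ℝ≥0∞) :
    ∑ j ∈ leaves T ξ, ∫⁻ z in DI j.1 j.2, g z ≤ ∫⁻ z in DI k₀ n₀, g z :=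
  sum_setLIntegral_le _ _ (fun _ _ => measurableSet_DI _ _) hT.leaves_disjoint
    (fun _ hj => hT.leaf_subset hj) g

lemma lintegral_le_sum_leaves {T : Finset Tile} {ξ : ℝ} {k₀ n₀ : ℤ} (hT : IsTree T ξ k₀ n₀) (g : ℝ
    → ℝ≥0∞) :
    ∫⁻ z in DI k₀ n₀, g z ≤ ∑ j ∈ leaves T ξ, ∫⁻ z in DI j.1 j.2, g z := by
  have h : DI k₀ n₀ ⊆ ⋃ j ∈ leaves T ξ, DI j.1 j.2 := fun x hx => by
    obtain ⟨j, hj, hxj⟩ := hT.exists_leaf hx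
    exact mem_biUnion hj hxj
  refine (lintegral_mono_set h).trans ?_
  rw [lintegral_biUnion_finset hT.leaves_disjoint fun _ _ => measurableSet_DI _ _]

lemma sum_leaves_volume_le {T : Finset Tile} {ξ : ℝ} {k₀ n₀ : ℤ} (hT : IsTree T ξ k₀ n₀) : ∑ j ∈
    leaves T ξ, (2 : ℝ≥0∞) ^ j.1 ≤ 2 ^ k₀ := by
  have := hT.sum_leaves_le fun _ => 1
  simpa [volume_DI] using this

end IsTree

lemma lintegral_cross_le' (k a b : ℤ) {s : Set ℝ} (hs : s ⊆ (DI a b)ᶜ) :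
    ∫⁻ x in s, ∫⁻ z in DI a b, dec 4 k (x - z) ≤ 2 * (2 ^ k * decMass) ^ 2 := by
  rw [lintegral_lintegral_swap (Measurable.aemeasurable (by fun_prop))]
  simp_rw [fun x z : ℝ => dec_sub_comm 4 k x z]
  rw [DI_eq_Ico] at hs ⊢
  exact lintegral_cross_le k _ _ subset_rfl hs

/-- The error function of a tree. -/
def treeErr (T : Finset Tile) (ξ : ℝ) (y : ℝ) : ℝ≥0∞ :=
  ∑ k ∈ T.image Tile.k, (scaleSet T ξ k).indicator
    (fun y => 2 ^ (-k) * ∫⁻ z in (scaleSet T ξ k)ᶜ, dec 4 k (y - z)) y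

lemma measurable_decInt (n : ℕ) (k : ℤ) (s : Set ℝ) :
    Measurable fun y => ∫⁻ z in s, dec n k (y - z) :=
  Measurable.lintegral_prod_right' (f := fun p : ℝ × ℝ => dec n k (p.1 - p.2)) (by fun_prop)

lemma measurable_treeErr (T : Finset Tile) (ξ : ℝ) : Measurable (treeErr T ξ) := by
  unfold treeErr
  refine Finset.measurable_fun_sum _ fun k _ => ?_
  exact ((measurable_decInt 4 k _).const_mul _).indicator (measurableSet_scaleSet _ _ _)

lemma IsTree.lintegral_treeErr_le {T : Finset Tile} {ξ : ℝ} {k₀ n₀ : ℤ} (hT : IsTree T ξ k₀ n₀) :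
    ∫⁻ y in DI k₀ n₀, treeErr T ξ y ≤ 8 * decMass ^ 2 * 2 ^ k₀ := by
  unfold treeErr
  rw [lintegral_finsetSum _ fun k _ =>
    ((measurable_decInt 4 k _).const_mul _).indicator (measurableSet_scaleSet _ _ _)]
  have h1 : ∀ k ∈ T.image Tile.k, ∫⁻ y in DI k₀ n₀, (scaleSet T ξ k).indicator
      (fun y => 2 ^ (-k) * ∫⁻ z in (scaleSet T ξ k)ᶜ, dec 4 k (y - z)) y ≤
      2 * decMass ^ 2 * (2 ^ k + ∑ j ∈ leaves T ξ with k ≤ j.1, 2 ^ k) := by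
    intro k hk
    obtain ⟨P, hP, rfl⟩ := Finset.mem_image.mp hk
    set k := P.k
    have hk0 : k ≤ k₀ := hT.le_top hP
    set U := scaleSet T ξ k
    have hU : MeasurableSet U := measurableSet_scaleSet _ _ _
    have hsub : Uᶜ ⊆ (DI k₀ n₀)ᶜ ∪ ⋃ j ∈ (leaves T ξ).filter (fun j => k ≤ j.1), DI j.1 j.2 := by
      intro z hz
      by_cases hz0 : z ∈ DI k₀ n₀
      · right
        obtain ⟨j, hj, hzj⟩ := hT.exists_leaf hz0
        refine mem_biUnion (Finset.mem_coe.mpr (Finset.mem_filter.mpr ⟨hj, ?_⟩)) hzj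
        have := (hT.mem_scaleSet_iff_of_leaf hj hzj hk0).not.mp hz
        omega
      · exact Or.inl hz0
    have hb : ∀ y, ∫⁻ z in Uᶜ, dec 4 k (y - z) ≤ (∫⁻ z in (DI k₀ n₀)ᶜ, dec 4 k (y - z)) +
        ∑ j ∈ leaves T ξ with k ≤ j.1, ∫⁻ z in DI j.1 j.2, dec 4 k (y - z) := by
      intro y
      refine (lintegral_mono_set hsub).trans ((lintegral_union_le _ _ _).trans ?_)
      gcongr
      rw [lintegral_biUnion_finset (hT.leaves_disjoint.subset fun _ h => (Finset.mem_filter.mp h).1)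
        fun _ _ => measurableSet_DI _ _]
    calc _ ≤ ∫⁻ y, U.indicator (fun y => 2 ^ (-k) * ∫⁻ z in Uᶜ, dec 4 k (y - z)) y :=
          setLIntegral_le_lintegral _ _
      _ = 2 ^ (-k) * ∫⁻ y in U, ∫⁻ z in Uᶜ, dec 4 k (y - z) := by
          rw [lintegral_indicator hU, lintegral_const_mul _ (measurable_decInt _ _ _)]
      _ ≤ 2 ^ (-k) * ∫⁻ y in U, ((∫⁻ z in (DI k₀ n₀)ᶜ, dec 4 k (y - z)) +
          ∑ j ∈ leaves T ξ with k ≤ j.1, ∫⁻ z in DI j.1 j.2, dec 4 k (y - z)) := by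
          gcongr with y; exact hb y
      _ = 2 ^ (-k) * ((∫⁻ y in U, ∫⁻ z in (DI k₀ n₀)ᶜ, dec 4 k (y - z)) +
          ∑ j ∈ leaves T ξ with k ≤ j.1, ∫⁻ y in U, ∫⁻ z in DI j.1 j.2, dec 4 k (y - z)) := by
          rw [lintegral_add_left (measurable_decInt _ _ _),
            lintegral_finsetSum _ fun _ _ => measurable_decInt _ _ _]
      _ ≤ 2 ^ (-k) * (2 * (2 ^ k * decMass) ^ 2 +
          ∑ j ∈ leaves T ξ with k ≤ j.1, 2 * (2 ^ k * decMass) ^ 2) := by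
          gcongr with j hj
          · rw [DI_eq_Ico]
            exact lintegral_cross_le k _ _ ((hT.scaleSet_subset k).trans (DI_eq_Ico _ _).le)
              subset_rfl
          · rw [Finset.mem_filter] at hj
            refine lintegral_cross_le' k _ _ fun y hy hyj => ?_
            have := (hT.mem_scaleSet_iff_of_leaf hj.1 hyj hk0).mp hy
            omega
      _ = (2 ^ (-k) * 2 ^ k) * (2 * decMass ^ 2 * (2 ^ k + ∑ j ∈ leaves T ξ with k ≤ j.1, 2 ^ k))
          := by
          rw [Finset.sum_const, Finset.sum_const, nsmul_eq_mul, nsmul_eq_mul]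
          ring
      _ = _ := by rw [two_zpow_neg_mul, one_mul]
  refine (Finset.sum_le_sum h1).trans ?_
  rw [← Finset.mul_sum, Finset.sum_add_distrib]
  have h2 : ∑ k ∈ T.image Tile.k, (2 : ℝ≥0∞) ^ k ≤ 2 * 2 ^ k₀ := by
    refine sum_two_zpow_le _ _ fun k hk => ?_
    obtain ⟨P, hP, rfl⟩ := Finset.mem_image.mp hk
    exact hT.le_top hP
  have h3 : ∑ k ∈ T.image Tile.k, ∑ j ∈ leaves T ξ with k ≤ j.1, (2 : ℝ≥0∞) ^ k ≤ 2 * 2 ^ k₀ := by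
    simp_rw [Finset.sum_filter]
    rw [Finset.sum_comm]
    calc _ ≤ ∑ j ∈ leaves T ξ, 2 * (2 : ℝ≥0∞) ^ j.1 := by
          refine Finset.sum_le_sum fun j _ => ?_
          rw [← Finset.sum_filter]
          exact sum_two_zpow_le _ _ fun k hk => (Finset.mem_filter.mp hk).2
      _ ≤ _ := by rw [← Finset.mul_sum]; gcongr; exact hT.sum_leaves_volume_le
  calc _ ≤ 2 * decMass ^ 2 * (2 * 2 ^ k₀ + 2 * 2 ^ k₀) := by gcongr
    _ = _ := by ring

/-! ### The tree estimate -/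

lemma integrable_hh {f : ℝ → ℂ} (hf : Integrable f) (k l : ℤ) : Integrable (hh f k l) :=
  integrable_cv hf _

lemma dec_mul_hh_le : ∃ C : ℝ≥0, ∀ f : ℝ → ℂ, Integrable f → ∀ (P : Tile) (σ : ℝ≥0),
    Am f P ≤ (σ : ℝ≥0∞) ^ 2 * 2 ^ P.k → ∀ z, dec 6 P.k (z - P.c) * ‖hh f P.k P.l z‖ₑ ≤ C * σ := by
  obtain ⟨C, hC⟩ := hh_pointwise
  refine ⟨C + 1, fun f hf P σ hσ z => ?_⟩
  rw [← ENNReal.pow_le_pow_left_iff two_ne_zero]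
  calc (dec 6 P.k (z - P.c) * ‖hh f P.k P.l z‖ₑ) ^ 2
      = dec 12 P.k (z - P.c) * ‖hh f P.k P.l z‖ₑ ^ 2 := by rw [mul_pow, dec_pow]
    _ ≤ C * 2 ^ (-P.k) * Am f P := hC f hf P z
    _ ≤ C * 2 ^ (-P.k) * ((σ : ℝ≥0∞) ^ 2 * 2 ^ P.k) := by gcongr
    _ = C * (σ : ℝ≥0∞) ^ 2 * (2 ^ (-P.k) * 2 ^ P.k) := by ring
    _ = C * (σ : ℝ≥0∞) ^ 2 := by rw [two_zpow_neg_mul, mul_one]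
    _ ≤ (C + 1) ^ 2 * (σ : ℝ≥0∞) ^ 2 := by
        gcongr
        rw [show ((C : ℝ≥0∞) + 1) ^ 2 = C + (C ^ 2 + C + 1) by ring]
        exact le_self_add
    _ = _ := by push_cast; ring

lemma hh_le_of_dec {f : ℝ → ℂ} {P : Tile} {B : ℝ≥0∞}
    (h : ∀ z, dec 6 P.k (z - P.c) * ‖hh f P.k P.l z‖ₑ ≤ B) {x : ℝ} (hx : x ∈ P.I) :
    ‖hh f P.k P.l x‖ₑ ≤ 2 ^ 6 * B := by
  have h1 := dec_sub_le_ctr 6 hx x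
  rw [sub_self] at h1
  calc ‖hh f P.k P.l x‖ₑ = dec 6 P.k 0 * ‖hh f P.k P.l x‖ₑ := by simp [dec, rho]
    _ ≤ 2 ^ 6 * dec 6 P.k (x - P.c) * ‖hh f P.k P.l x‖ₑ := by gcongr; exact h1
    _ ≤ _ := by rw [mul_assoc]; gcongr; exact h x

lemma hh_sub_cv_le : ∃ C : ℝ≥0, ∀ f : ℝ → ℂ, Integrable f → ∀ (P : Tile) (B : ℝ≥0∞),
    (∀ z, dec 6 P.k (z - P.c) * ‖hh f P.k P.l z‖ₑ ≤ B) → ∀ U, MeasurableSet U → ∀ x ∈ P.I,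
    ‖hh f P.k P.l x - cv (U.indicator (hh f P.k P.l)) (wp β1 P.k P.l) x‖ₑ ≤
      C * B * (2 ^ (-P.k) * ∫⁻ z in Uᶜ, dec 4 P.k (x - z)) := by
  obtain ⟨D, hD⟩ := wp_bound β1
  refine ⟨D * 2 ^ 6, fun f hf P B hB U hU x hx => ?_⟩
  have hi := integrable_hh hf P.k P.l
  have h1 : hh f P.k P.l x - cv (U.indicator (hh f P.k P.l)) (wp β1 P.k P.l) x =
      cv (Uᶜ.indicator (hh f P.k P.l)) (wp β1 P.k P.l) x := by
    rw [← hh_eq_cv hf, sub_eq_iff_eq_add]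
    unfold cv
    rw [← integral_add (integrable_cv_integrand (hi.indicator hU.compl) _ x)
      (integrable_cv_integrand (hi.indicator hU) _ x)]
    refine integral_congr_ae (.of_forall fun y => ?_)
    by_cases hy : y ∈ U <;> simp [hy]
  rw [h1]
  calc _ ≤ ∫⁻ z, ‖Uᶜ.indicator (hh f P.k P.l) z‖ₑ * ‖wp β1 P.k P.l (x - z)‖ₑ := enorm_cv_le _ _ _
    _ = ∫⁻ z in Uᶜ, ‖hh f P.k P.l z‖ₑ * ‖wp β1 P.k P.l (x - z)‖ₑ := by
        rw [← lintegral_indicator hU.compl]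
        refine lintegral_congr fun z => ?_
        by_cases hz : z ∈ U <;> simp [hz]
    _ ≤ ∫⁻ z in Uᶜ, D * 2 ^ 6 * B * 2 ^ (-P.k) * dec 4 P.k (x - z) := by
        refine lintegral_mono fun z => ?_
        calc _ ≤ ‖hh f P.k P.l z‖ₑ * (D * 2 ^ (-P.k) * dec (4 + 6) P.k (x - z)) := by
              gcongr; exact (hD _ _ _).trans (by gcongr; exact dec_anti (by norm_num) _ _)
          _ = D * 2 ^ (-P.k) * (dec 6 P.k (z - x) * ‖hh f P.k P.l z‖ₑ) * dec 4 P.k (x - z) := by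
              rw [← dec_mul, dec_sub_comm 6 P.k z x]; ring
          _ ≤ D * 2 ^ (-P.k) * (2 ^ 6 * dec 6 P.k (z - P.c) * ‖hh f P.k P.l z‖ₑ) *
                dec 4 P.k (x - z) := by gcongr; exact dec_sub_le_ctr 6 hx z
          _ = D * 2 ^ 6 * 2 ^ (-P.k) * dec 4 P.k (x - z) *
                (dec 6 P.k (z - P.c) * ‖hh f P.k P.l z‖ₑ) := by ring
          _ ≤ D * 2 ^ 6 * 2 ^ (-P.k) * dec 4 P.k (x - z) * B := by gcongr; exact hB z
          _ = _ := by ring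
    _ = _ := by
        rw [lintegral_const_mul _ (by fun_prop)]
        push_cast; ring

lemma setLIntegral_hh_sq_le (f : ℝ → ℂ) (P : Tile) :
    ∫⁻ z in P.I, ‖hh f P.k P.l z‖ₑ ^ 2 ≤ 2 ^ 12 * Am f P := by
  unfold Am
  rw [← lintegral_const_mul' _ _ (by simp)]
  refine le_trans ?_ (setLIntegral_le_lintegral P.I _)
  refine setLIntegral_mono' P.measurableSet_I fun z hz => ?_
  have h1 := dec_sub_le_ctr 12 hz z
  rw [sub_self, show dec 12 P.k 0 = 1 by simp [dec, rho]] at h1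
  rw [← mul_assoc]
  exact le_mul_of_one_le_left zero_le h1

/-- The localized functions of a tree. -/
def treeFn (f : ℝ → ℂ) (T : Finset Tile) (ξ : ℝ) (k : ℤ) : ℝ → ℂ :=
  (scaleSet T ξ k).indicator (hh f k (dy (-k) ξ))

lemma integrable_treeFn {f : ℝ → ℂ} (hf : Integrable f) (T : Finset Tile) (ξ : ℝ) (k : ℤ) :
    Integrable (treeFn f T ξ k) :=
  (integrable_hh hf _ _).indicator (measurableSet_scaleSet _ _ _)

/-- The scales at which the frequency lies in the right half. -/
def rightScales (T : Finset Tile) (ξ : ℝ) : Finset ℤ :=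
  (T.image Tile.k).filter fun k => ξ ∈ DI (-k - 1) (2 * dy (-k) ξ + 1)

lemma lintegral_treeFn_sq_le (f : ℝ → ℂ) {T : Finset Tile} {ξ : ℝ} (hW : ∀ P ∈ T, ξ ∈ P.W)
    (k : ℤ) : ∫⁻ z, ‖treeFn f T ξ k z‖ₑ ^ 2 ≤ ∑ P ∈ T with P.k = k, 2 ^ 12 * Am f P := by
  have h1 : ∀ z, ‖treeFn f T ξ k z‖ₑ ^ 2 ≤ (scaleSet T ξ k).indicator
      (fun z => ‖hh f k (dy (-k) ξ) z‖ₑ ^ 2) z := by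
    intro z
    by_cases hz : z ∈ scaleSet T ξ k <;> simp [treeFn, hz]
  have h2 : scaleSet T ξ k ⊆ ⋃ P ∈ T.filter (fun P => P.k = k), P.I := fun x hx =>
    mem_biUnion (Finset.mem_coe.mpr (Finset.mem_filter.mpr ⟨hx, rfl⟩)) (mem_tileAt_I ξ k x)
  calc _ ≤ ∫⁻ z in scaleSet T ξ k, ‖hh f k (dy (-k) ξ) z‖ₑ ^ 2 := by
        rw [← lintegral_indicator (measurableSet_scaleSet _ _ _)]; exact lintegral_mono h1
    _ ≤ ∑ P ∈ T with P.k = k, ∫⁻ z in P.I, ‖hh f k (dy (-k) ξ) z‖ₑ ^ 2 := by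
        refine (lintegral_mono_set h2).trans ?_
        rw [lintegral_biUnion_finset _ fun P _ => P.measurableSet_I]
        intro P hP P' hP' hne
        simp only [Finset.coe_filter, mem_ofPred_eq] at hP hP'
        rw [Function.onFun, Set.disjoint_left]
        intro x hx hx'
        exact hne (Tile.eq_of_mem (hP.2.trans hP'.2.symm) hx hx' (hW P hP.1) (hW P' hP'.1))
    _ ≤ _ := by
        refine Finset.sum_le_sum fun P hP => ?_
        rw [Finset.mem_filter] at hP
        have h3 : dy (-k) ξ = P.l := by rw [← hP.2]; exact hW P hP.1
        have := setLIntegral_hh_sq_le f P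
        rwa [h3, ← hP.2]

lemma lintegral_treeSum_sq_le : ∃ C : ℝ≥0, ∀ f : ℝ → ℂ, Integrable f →
    ∀ (T : Finset Tile) (ξ : ℝ) (k₀ n₀ : ℤ), IsTree T ξ k₀ n₀ → ∀ σ : ℝ≥0, SizeLe f T σ →
    ∫⁻ x, ‖packetSum (rightScales T ξ) ξ (treeFn f T ξ) x‖ₑ ^ 2 ≤ C * ((σ : ℝ≥0∞) ^ 2 * 2 ^ k₀) :=
        by
  obtain ⟨C, hC⟩ := lintegral_packetSum_sq_le
  refine ⟨C * 2 ^ 12, fun f hf T ξ k₀ n₀ hT σ hσ => ?_⟩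
  refine (hC _ ξ (fun k hk => (Finset.mem_filter.mp hk).2) _
    fun k _ => integrable_treeFn hf T ξ k).trans ?_
  calc _ ≤ (C : ℝ≥0∞) * ∑ k ∈ rightScales T ξ, ∑ P ∈ T with P.k = k, 2 ^ 12 * Am f P := by
        exact mul_le_mul_right (Finset.sum_le_sum fun k _ => lintegral_treeFn_sq_le f hT.mem_W k) _
    _ ≤ (C : ℝ≥0∞) * ∑ k ∈ rightScales T ξ, ∑ P ∈ (T.filter fun P => P.I ⊆ DI k₀ n₀ ∧ ξ ∈
        P.R) with P.k = k,
          2 ^ 12 * Am f P := by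
        refine mul_le_mul_right ?_ _
        refine Finset.sum_le_sum fun k hk => ?_
        refine Finset.sum_le_sum_of_subset fun P hP => ?_
        rw [Finset.mem_filter] at hP
        rw [Finset.mem_filter, Finset.mem_filter]
        refine ⟨⟨hP.1, hT.I_subset P hP.1, ?_⟩, hP.2⟩
        have := (Finset.mem_filter.mp hk).2
        rw [← hP.2, show dy (-P.k) ξ = P.l from hT.mem_W P hP.1] at this
        exact this
    _ ≤ (C : ℝ≥0∞) * ∑ P ∈ T with P.I ⊆ DI k₀ n₀ ∧ ξ ∈ P.R, 2 ^ 12 * Am f P := by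
        gcongr
        exact Finset.sum_fiberwise_le_sum_of_sum_fiber_nonneg (fun _ _ => zero_le)
    _ ≤ C * (2 ^ 12 * ((σ : ℝ≥0∞) ^ 2 * 2 ^ k₀)) := by
        rw [← Finset.mul_sum]; gcongr; exact hσ k₀ n₀ ξ
    _ = _ := by push_cast; ring

/-- The model sum over a collection of tiles. -/
def tileSum (N : ℝ → ℝ) (f : ℝ → ℂ) (T : Finset Tile) (x : ℝ) : ℂ := ∑ P ∈ T, tt N f P x

lemma tileSum_eq (N : ℝ → ℝ) (f : ℝ → ℂ) {T : Finset Tile} {ξ : ℝ} (hW : ∀ P ∈ T, ξ ∈ P.W) (x : ℝ) :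
    tileSum N f T x = ∑ k ∈ T.image Tile.k with x ∈ scaleSet T ξ k ∧
      N x ∈ DI (-k - 1) (2 * dy (-k) ξ + 1), hh f k (dy (-k) ξ) x := by
  have h1 : tileSum N f T x = ∑ P ∈ T with x ∈ P.I ∧ N x ∈ P.R, hh f P.k P.l x := by
    unfold tileSum tt
    rw [Finset.sum_filter]
    refine Finset.sum_congr rfl fun P _ => ?_
    rw [Set.indicator_apply]
    rfl
  rw [h1]
  refine Finset.sum_bij (fun P _ => P.k) ?_ ?_ ?_ ?_
  · intro P hP
    rw [Finset.mem_filter] at hP ⊢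
    refine ⟨Finset.mem_image_of_mem _ hP.1, ?_, ?_⟩
    · rw [mem_scaleSet, ← eq_tileAt hP.2.1 (hW P hP.1)]; exact hP.1
    · rw [show dy (-P.k) ξ = P.l from hW P hP.1]; exact hP.2.2
  · intro P hP P' hP' h
    rw [Finset.mem_filter] at hP hP'
    exact Tile.eq_of_mem h hP.2.1 hP'.2.1 (hW P hP.1) (hW P' hP'.1)
  · intro k hk
    rw [Finset.mem_filter] at hk
    exact ⟨tileAt ξ k x, Finset.mem_filter.mpr ⟨hk.2.1, mem_tileAt_I ξ k x, hk.2.2⟩, rfl⟩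
  · intro P hP
    rw [Finset.mem_filter] at hP
    rw [show dy (-P.k) ξ = P.l from hW P hP.1]

/-- Scales relevant to the maximal function of a tree. -/
def treeScales (T : Finset Tile) : Finset ℤ := T.image Tile.k ∪ (T.image Tile.k).image (· + 1)

/-- The majorant of a tree. -/
def treeMaj (f : ℝ → ℂ) (T : Finset Tile) (ξ : ℝ) (σ : ℝ≥0) (y : ℝ) : ℝ≥0∞ :=
  σ + maxFn (treeScales T) (fun z => ‖packetSum (rightScales T ξ) ξ (treeFn f T ξ) z‖ₑ) y +
    σ * treeErr T ξ y

lemma left_part_le {f : ℝ → ℂ} {ξ η x : ℝ} {B : ℝ≥0∞} (s : Finset ℤ)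
    (hB : ∀ k ∈ s, ‖hh f k (dy (-k) ξ) x‖ₑ ≤ B)
    (hξ : ∀ k ∈ s, ξ ∉ DI (-k - 1) (2 * dy (-k) ξ + 1))
    (hη : ∀ k ∈ s, η ∈ DI (-k - 1) (2 * dy (-k) ξ + 1)) :
    ‖∑ k ∈ s, hh f k (dy (-k) ξ) x‖ₑ ≤ B := by
  have huniq : ∀ k ∈ s, ∀ k' ∈ s, ¬ k < k' := by
    intro k hk k' hk' hlt
    have h1 : ξ ∈ DI (-k - 1) (2 * dy (-k) ξ) :=
      (mem_left_or_right (k := -k) (l := dy (-k) ξ) rfl).resolve_right (hξ k hk)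
    have h2 : DI (-k') (dy (-k') ξ) ⊆ DI (-k - 1) (2 * dy (-k) ξ) :=
      DI_subset_of_mem (by omega) rfl h1
    exact Set.disjoint_left.mp (DI_disjoint (by omega)) (h2 (DI_right_subset _ _ (hη k' hk'))) (hη
        k hk)
  rcases s.eq_empty_or_nonempty with rfl | ⟨k, hk⟩
  · simp
  · have : s = {k} := Finset.eq_singleton_iff_unique_mem.mpr ⟨hk, fun k' hk' => by
      have h1 := huniq k hk k' hk'
      have h2 := huniq k' hk' k hk
      omega⟩
    rw [this, Finset.sum_singleton]
    exact hB k hk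

lemma right_part_filter (K : Finset ℤ) {ξ η : ℝ}
    (hξ : ∀ k ∈ K, ξ ∈ DI (-k - 1) (2 * dy (-k) ξ + 1)) (b : ℤ)
    (hne : ∃ k ∈ K, b ≤ k ∧ η ∈ DI (-k - 1) (2 * dy (-k) ξ + 1)) :
    ∃ b', b ≤ b' ∧ b' ∈ K.image (· + 1) ∧
      K.filter (fun k => b ≤ k ∧ η ∈ DI (-k - 1) (2 * dy (-k) ξ + 1)) =
        K.filter fun k => b ≤ k ∧ k < b' := by
  set A := K.filter (fun k => b ≤ k ∧ η ∈ DI (-k - 1) (2 * dy (-k) ξ + 1)) with hA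
  have hAne : A.Nonempty := by
    obtain ⟨k, hk, h⟩ := hne
    exact ⟨k, Finset.mem_filter.mpr ⟨hk, h⟩⟩
  have hm := Finset.mem_filter.mp (A.max'_mem hAne)
  refine ⟨A.max' hAne + 1, by linarith [hm.2.1], Finset.mem_image_of_mem _ hm.1, ?_⟩
  ext k
  rw [Finset.mem_filter (s := K) (p := fun k => b ≤ k ∧ k < A.max' hAne + 1)]
  constructor
  · intro hk
    have h1 := A.le_max' k hk
    have h2 := Finset.mem_filter.mp hk
    exact ⟨h2.1, h2.2.1, by omega⟩
  · rintro ⟨hk, hbk, hlt⟩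
    refine Finset.mem_filter.mpr ⟨hk, hbk, ?_⟩
    rcases (show k ≤ A.max' hAne by omega).eq_or_lt with h | h
    · rw [h]; exact hm.2.2
    · exact DI_subset_of_mem (k' := -A.max' hAne) (by omega) rfl (hξ k hk)
        (DI_right_subset _ _ hm.2.2)

lemma norm_tileSum_le : ∃ C : ℝ≥0, ∀ f : ℝ → ℂ, Integrable f → ∀ (N : ℝ → ℝ)
    (T : Finset Tile) (ξ : ℝ) (k₀ n₀ : ℤ), IsTree T ξ k₀ n₀ → ∀ σ : ℝ≥0, SizeLe f T σ →
    ∀ j ∈ leaves T ξ, ∀ x ∈ DI j.1 j.2, ∀ y ∈ DI j.1 j.2,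
    ‖tileSum N f T x‖ₑ ≤ C * treeMaj f T ξ σ y := by
  obtain ⟨C₁, hC₁⟩ := dec_mul_hh_le
  obtain ⟨C₂, hC₂⟩ := hh_sub_cv_le
  obtain ⟨C₃, hC₃⟩ := packetSum_partial_le
  refine ⟨2 ^ 6 * C₁ + C₃ + C₂ * C₁ * 2 ^ 4, fun f hf N T ξ k₀ n₀ hT σ hσ j hj x hx y hy => ?_⟩
  set Γ := packetSum (rightScales T ξ) ξ (treeFn f T ξ)
  have hmem : ∀ k, x ∈ scaleSet T ξ k → ∀ z, dec 6 k (z - (tileAt ξ k x).c) *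
      ‖hh f k (dy (-k) ξ) z‖ₑ ≤ C₁ * σ := fun k hk => hC₁ f hf (tileAt ξ k x) σ (hσ.Am_le hk)
  rw [tileSum_eq N f hT.mem_W x]
  set s := (T.image Tile.k).filter fun k => x ∈ scaleSet T ξ k ∧
      N x ∈ DI (-k - 1) (2 * dy (-k) ξ + 1)
  rw [← Finset.sum_filter_add_sum_filter_not s
    (fun k => ξ ∈ DI (-k - 1) (2 * dy (-k) ξ + 1)), add_comm]
  have hleft : ‖∑ k ∈ s with ξ ∉ DI (-k - 1) (2 * dy (-k) ξ + 1), hh f k (dy (-k) ξ) x‖ₑ ≤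
      2 ^ 6 * (C₁ * σ) := by
    refine left_part_le (η := N x) _ (fun k hk => ?_) (fun k hk => (Finset.mem_filter.mp hk).2)
      (fun k hk => (Finset.mem_filter.mp (Finset.mem_filter.mp hk).1).2.2)
    have := (Finset.mem_filter.mp (Finset.mem_filter.mp hk).1).2.1
    exact hh_le_of_dec (P := tileAt ξ k x) (hmem k this) (mem_tileAt_I ξ k x)
  have hright : ‖∑ k ∈ s with ξ ∈ DI (-k - 1) (2 * dy (-k) ξ + 1), hh f k (dy (-k) ξ) x‖ₑ ≤
      C₃ * maxFn (treeScales T) (fun z => ‖Γ z‖ₑ) y + C₂ * C₁ * 2 ^ 4 * (σ * treeErr T ξ y) := by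
    set A := s.filter fun k => ξ ∈ DI (-k - 1) (2 * dy (-k) ξ + 1) with hA
    have hAeq : A = (rightScales T ξ).filter
        (fun k => j.1 + 1 ≤ k ∧ N x ∈ DI (-k - 1) (2 * dy (-k) ξ + 1)) := by
      ext k
      simp only [hA, s, rightScales, Finset.mem_filter]
      constructor
      · rintro ⟨⟨h1, h2, h3⟩, h4⟩
        obtain ⟨P, hP, rfl⟩ := Finset.mem_image.mp h1
        exact ⟨⟨h1, h4⟩, (hT.mem_scaleSet_iff_of_leaf hj hx (hT.le_top hP)).mp h2, h3⟩
      · rintro ⟨⟨h1, h4⟩, h2, h3⟩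
        obtain ⟨P, hP, rfl⟩ := Finset.mem_image.mp h1
        exact ⟨⟨h1, (hT.mem_scaleSet_iff_of_leaf hj hx (hT.le_top hP)).mpr h2, h3⟩, h4⟩
    rcases A.eq_empty_or_nonempty with h0 | ⟨kk, hkk⟩
    · rw [h0]; simp
    obtain ⟨b', hb', hb'm, hAb⟩ := right_part_filter (rightScales T ξ) (η := N x)
      (fun k hk => (Finset.mem_filter.mp hk).2) (j.1 + 1) (by
        rw [hAeq, Finset.mem_filter] at hkk; exact ⟨kk, hkk⟩)
    rw [← hAeq] at hAb
    have hx1 := (mem_leaves_of_mem hj hT.mem_W hx).1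
    have hmain := hC₃ (rightScales T ξ) (treeScales T) ξ (fun k hk => (Finset.mem_filter.mp hk).2)
      (treeFn f T ξ) (fun k _ => integrable_treeFn hf T ξ k) j.1 (j.1 + 1) b' (by omega) hb'
      (Finset.mem_union_left _ (Finset.mem_image.mpr ⟨_, hx1, rfl⟩))
      (Finset.mem_union_right _ (Finset.image_subset_image (Finset.filter_subset _ _) hb'm)) x y
      (abs_sub_le_of_mem_DI hx hy)
    rw [← hAb] at hmain
    have hsplit : ∑ k ∈ A, hh f k (dy (-k) ξ) x = packetSum A ξ (treeFn f T ξ) x +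
        ∑ k ∈ A, (hh f k (dy (-k) ξ) x - cv (treeFn f T ξ k) (wp β1 k (dy (-k) ξ)) x) := by
      rw [Finset.sum_sub_distrib]; unfold packetSum; ring
    rw [hsplit]
    refine (enorm_add_le _ _).trans (add_le_add hmain ?_)
    refine (enorm_sum_le _ _).trans ?_
    unfold treeErr
    rw [← mul_assoc, Finset.mul_sum]
    refine le_trans ?_ (Finset.sum_le_sum_of_subset (s := A) (fun k hk =>
      (Finset.mem_filter.mp (Finset.mem_filter.mp hk).1).1))
    refine Finset.sum_le_sum fun k hk => ?_
    have hkm := Finset.mem_filter.mp (Finset.mem_filter.mp hk).1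
    have hxk := hkm.2.1
    have hkk0 : k ≤ k₀ := by
      obtain ⟨P, hP, rfl⟩ := Finset.mem_image.mp hkm.1
      exact hT.le_top hP
    have hjk := (hT.mem_scaleSet_iff_of_leaf hj hx hkk0).mp hxk
    have hyk := (hT.mem_scaleSet_iff_of_leaf hj hy hkk0).mpr hjk
    rw [Set.indicator_of_mem hyk]
    have h1 := hC₂ f hf (tileAt ξ k x) (C₁ * σ) (hmem k hxk) _ (measurableSet_scaleSet T ξ k) x
      (mem_tileAt_I ξ k x)
    have h2 : ∫⁻ z in (scaleSet T ξ k)ᶜ, dec 4 k (x - z) ≤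
        2 ^ 4 * ∫⁻ z in (scaleSet T ξ k)ᶜ, dec 4 k (y - z) := by
      rw [← lintegral_const_mul' _ _ (by simp)]
      refine lintegral_mono fun z => ?_
      have h3 : |x - y| ≤ 2 ^ k := (abs_sub_le_of_mem_DI hx hy).trans
        (zpow_le_zpow_right₀ (by norm_num) hjk.le)
      have := dec_comp 4 k (s := y - z) (t := x - z) (m := 2) (rho_le_two_mul (by
        have h4 := le_max_left ((2 : ℝ) ^ k) |x - z|
        have h5 := abs_sub_le y x z
        rw [abs_sub_comm y x] at h5
        linarith))
      exact_mod_cast this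
    calc _ ≤ C₂ * (C₁ * σ) * (2 ^ (-k) * ∫⁻ z in (scaleSet T ξ k)ᶜ, dec 4 k (x - z)) := h1
      _ ≤ C₂ * (C₁ * σ) * (2 ^ (-k) * (2 ^ 4 * ∫⁻ z in (scaleSet T ξ k)ᶜ, dec 4 k (y - z))) := by
          gcongr
      _ = _ := by ring
  refine (enorm_add_le _ _).trans ((add_le_add hleft hright).trans ?_)
  unfold treeMaj
  push_cast
  set X := maxFn (treeScales T) (fun z => ‖Γ z‖ₑ) y
  calc _ = (2 ^ 6 * C₁) * σ + (C₃ * X + C₂ * C₁ * 2 ^ 4 * (σ * treeErr T ξ y)) := by ring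
    _ ≤ (2 ^ 6 * C₁ + C₃ + C₂ * C₁ * 2 ^ 4) * σ + ((2 ^ 6 * C₁ + C₃ + C₂ * C₁ * 2 ^ 4) * X +
        (2 ^ 6 * C₁ + C₃ + C₂ * C₁ * 2 ^ 4) * (σ * treeErr T ξ y)) := by
        gcongr
        · rw [add_assoc]; exact le_self_add
        · rw [add_right_comm]; exact le_add_self
        · exact le_add_self
    _ = _ := by ring

lemma lintegral_treeMaj_le : ∃ C : ℝ≥0, ∀ f : ℝ → ℂ, Integrable f → ∀
    (T : Finset Tile) (ξ : ℝ) (k₀ n₀ : ℤ), IsTree T ξ k₀ n₀ → ∀ σ : ℝ≥0, SizeLe f T σ →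
    ∫⁻ y in DI k₀ n₀, treeMaj f T ξ σ y ≤ C * (σ * 2 ^ k₀) := by
  obtain ⟨C, hC⟩ := lintegral_treeSum_sq_le
  set M := decMass.toNNReal
  have hM : (M : ℝ≥0∞) = decMass := ENNReal.coe_toNNReal decMass_ne_top
  refine ⟨1 + 8 * M * (C + 1) + 8 * M ^ 2, fun f hf T ξ k₀ n₀ hT σ hσ => ?_⟩
  have hG := hC f hf T ξ k₀ n₀ hT σ hσ
  set Γ := packetSum (rightScales T ξ) ξ (treeFn f T ξ)
  have hΓ : Measurable fun z => ‖Γ z‖ₑ := by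
    refine Measurable.enorm (Continuous.measurable ?_)
    exact continuous_finsetSum _ fun k _ => continuous_cv (integrable_treeFn hf T ξ k) _
  have hmax : ∫⁻ y in DI k₀ n₀, maxFn (treeScales T) (fun z => ‖Γ z‖ₑ) y ≤
      8 * M * (C + 1) * (σ * 2 ^ k₀) := by
    rw [← ENNReal.pow_le_pow_left_iff two_ne_zero]
    have hmm : Measurable (maxFn (treeScales T) (fun z => ‖Γ z‖ₑ)) := by
      unfold maxFn
      refine Measurable.biSup _ (Finset.countable_toSet _) fun a _ => ?_
      exact Measurable.lintegral_prod_right'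
        (f := fun p : ℝ × ℝ => ‖Γ p.2‖ₑ * pk a (p.1 - p.2))
        ((hΓ.comp measurable_snd).mul (by fun_prop))
    have h1 := lintegral_mul_sq_le (volume.restrict (DI k₀ n₀)) (f := fun _ => 1)
      (g := maxFn (treeScales T) (fun z => ‖Γ z‖ₑ)) (by fun_prop) hmm.aemeasurable
    simp only [one_mul, one_pow, lintegral_const, Measure.restrict_apply_univ, volume_DI] at h1
    calc _ ≤ _ := h1
      _ ≤ 2 ^ k₀ * ((8 * decMass) ^ 2 * ∫⁻ z, ‖Γ z‖ₑ ^ 2) := by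
          gcongr
          refine (setLIntegral_le_lintegral _ _).trans (lintegral_maxFn_sq_le _ hΓ ?_)
          refine ne_top_of_le_ne_top ?_ hG
          exact ENNReal.mul_ne_top (by simp) (ENNReal.mul_ne_top (by simp) (two_zpow_ne_top _))
      _ ≤ 2 ^ k₀ * ((8 * decMass) ^ 2 * (C * ((σ : ℝ≥0∞) ^ 2 * 2 ^ k₀))) := by gcongr
      _ = C * (8 * decMass * σ * 2 ^ k₀) ^ 2 := by ring
      _ ≤ (C + 1) ^ 2 * (8 * decMass * σ * 2 ^ k₀) ^ 2 := by
          gcongr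
          rw [show ((C : ℝ≥0∞) + 1) ^ 2 = C + (C ^ 2 + C + 1) by ring]
          exact le_self_add
      _ = _ := by rw [hM]; ring
  have herr : ∫⁻ y in DI k₀ n₀, σ * treeErr T ξ y ≤ 8 * M ^ 2 * (σ * 2 ^ k₀) := by
    rw [lintegral_const_mul _ (measurable_treeErr T ξ)]
    calc _ ≤ σ * (8 * decMass ^ 2 * 2 ^ k₀) := by gcongr; exact hT.lintegral_treeErr_le
      _ = _ := by rw [hM]; ring
  unfold treeMaj
  rw [lintegral_add_right _ ((measurable_treeErr T ξ).const_mul _),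
    lintegral_add_left (by fun_prop)]
  simp only [lintegral_const, Measure.restrict_apply_univ, volume_DI]
  calc _ ≤ (σ : ℝ≥0∞) * 2 ^ k₀ + 8 * M * (C + 1) * (σ * 2 ^ k₀) + 8 * M ^ 2 * (σ * 2 ^ k₀)
      := by gcongr
    _ = _ := by push_cast; ring

/-- The tree lemma. -/
lemma tree_estimate : ∃ C : ℝ≥0, ∀ f : ℝ → ℂ, Integrable f → ∀ N : ℝ → ℝ, Measurable N →
    ∀ E : Set ℝ, MeasurableSet E → ∀ (T : Finset Tile) (ξ : ℝ) (k₀ n₀ : ℤ), IsTree T ξ k₀ n₀ →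
    ∀ σ : ℝ≥0, SizeLe f T σ → ∀ δ : ℝ≥0∞,
    (∀ Q ∈ T, volume (E ∩ Q.I ∩ N ⁻¹' Q.W) ≤ δ * 2 ^ Q.k) →
    ∫⁻ x in E, ‖tileSum N f T x‖ₑ ≤ C * (δ * σ * 2 ^ k₀) := by
  obtain ⟨C₁, hC₁⟩ := norm_tileSum_le
  obtain ⟨C₂, hC₂⟩ := lintegral_treeMaj_le
  refine ⟨2 * C₁ * C₂, fun f hf N hN E hE T ξ k₀ n₀ hT σ hσ δ hδ => ?_⟩
  have hzero : ∀ x ∉ DI k₀ n₀, tileSum N f T x = 0 := fun x hx =>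
    Finset.sum_eq_zero fun P hP => Set.indicator_of_notMem
      (fun h => hx (hT.I_subset P hP h.1)) _
  have hleaf : ∀ j ∈ leaves T ξ, ∫⁻ x in DI j.1 j.2, E.indicator (fun x => ‖tileSum N f T x‖ₑ) x ≤
      2 * δ * C₁ * ∫⁻ y in DI j.1 j.2, treeMaj f T ξ σ y := by
    intro j hj
    obtain ⟨x₀, hx₀⟩ := DI_nonempty j.1 j.2
    set Q := tileAt ξ (j.1 + 1) x₀
    have hQ : Q ∈ T := (mem_leaves_of_mem hj hT.mem_W hx₀).1
    have hJQ : DI j.1 j.2 ⊆ Q.I := DI_subset_of_mem (by simp [Q, tileAt]) hx₀ (mem_tileAt_I ξ _ x₀)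
    set m := ⨅ y ∈ DI j.1 j.2, C₁ * treeMaj f T ξ σ y
    have hm : ∀ x ∈ DI j.1 j.2, ‖tileSum N f T x‖ₑ ≤ m :=
      fun x hx => le_iInf₂ fun y hy => hC₁ f hf N T ξ k₀ n₀ hT σ hσ j hj x hx y hy
    have hG : MeasurableSet (E ∩ Q.I ∩ N ⁻¹' Q.W) :=
      (hE.inter Q.measurableSet_I).inter (hN Q.measurableSet_W)
    have hpt : ∀ x ∈ DI j.1 j.2, E.indicator (fun x => ‖tileSum N f T x‖ₑ) x ≤
        (E ∩ Q.I ∩ N ⁻¹' Q.W).indicator (fun _ => m) x := by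
      intro x hx
      by_cases hxE : x ∈ E
      swap
      · rw [Set.indicator_of_notMem hxE]; exact zero_le
      rw [Set.indicator_of_mem hxE]
      by_cases h0 : tileSum N f T x = 0
      · rw [h0, enorm_zero]; exact zero_le
      obtain ⟨P, hP, hPx⟩ := Finset.exists_ne_zero_of_sum_ne_zero h0
      have hxP := Set.mem_of_indicator_ne_zero hPx
      have hPQ : Q.k ≤ P.k := by
        have h1 : x ∈ scaleSet T ξ P.k := by
          rw [mem_scaleSet, ← eq_tileAt hxP.1 (hT.mem_W P hP)]; exact hP
        exact (hT.mem_scaleSet_iff_of_leaf hj hx (hT.le_top hP)).mp h1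
      have hW : P.W ⊆ Q.W := Tile.W_subset_W hPQ (hT.mem_W P hP) (mem_tileAt_W ξ _ x₀)
      rw [Set.indicator_of_mem]
      · exact hm x hx
      · exact ⟨⟨hxE, hJQ hx⟩, hW (P.R_subset_W hxP.2)⟩
    calc _ ≤ ∫⁻ x in DI j.1 j.2, (E ∩ Q.I ∩ N ⁻¹' Q.W).indicator (fun _ => m) x :=
          setLIntegral_mono' (measurableSet_DI _ _) hpt
      _ ≤ ∫⁻ x, (E ∩ Q.I ∩ N ⁻¹' Q.W).indicator (fun _ => m) x :=
          setLIntegral_le_lintegral _ _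
      _ = m * volume (E ∩ Q.I ∩ N ⁻¹' Q.W) := lintegral_indicator_const hG _
      _ ≤ m * (δ * 2 ^ (j.1 + 1)) := by gcongr; exact hδ Q hQ
      _ = 2 * δ * (2 ^ j.1 * m) := by
          rw [two_zpow_add]; simp only [zpow_one]; ring
      _ ≤ _ := by
          rw [mul_assoc _ (C₁ : ℝ≥0∞), ← lintegral_const_mul' _ _ ENNReal.coe_ne_top]
          gcongr
          exact two_zpow_mul_le_setLIntegral fun z hz => iInf₂_le z hz
  calc ∫⁻ x in E, ‖tileSum N f T x‖ₑ
      = ∫⁻ x in DI k₀ n₀, E.indicator (fun x => ‖tileSum N f T x‖ₑ) x := by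
        rw [← lintegral_indicator hE, ← lintegral_indicator (measurableSet_DI _ _)]
        refine lintegral_congr fun x => ?_
        by_cases hx : x ∈ DI k₀ n₀
        · rw [Set.indicator_of_mem hx]
        · rw [Set.indicator_of_notMem hx]
          by_cases hxE : x ∈ E <;> simp [hxE, hzero x hx]
    _ ≤ ∑ j ∈ leaves T ξ, ∫⁻ x in DI j.1 j.2, E.indicator (fun x => ‖tileSum N f T x‖ₑ) x :=
        hT.lintegral_le_sum_leaves _
    _ ≤ ∑ j ∈ leaves T ξ, 2 * δ * C₁ * ∫⁻ y in DI j.1 j.2, treeMaj f T ξ σ y :=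
        Finset.sum_le_sum hleaf
    _ ≤ 2 * δ * C₁ * ∫⁻ y in DI k₀ n₀, treeMaj f T ξ σ y := by
        rw [← Finset.mul_sum]; gcongr; exact hT.sum_leaves_le _
    _ ≤ 2 * δ * C₁ * (C₂ * (σ * 2 ^ k₀)) := by gcongr; exact hC₂ f hf T ξ k₀ n₀ hT σ hσ
    _ = _ := by push_cast; ring

/-! ### Convex collections and coverings by trees -/

/-- The order on tiles. -/
def Tile.Le (P Q : Tile) : Prop := P.I ⊆ Q.I ∧ Q.W ⊆ P.W

lemma Tile.Le.trans {P Q S : Tile} (h : P.Le Q) (h' : Q.Le S) : P.Le S :=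
  ⟨h.1.trans h'.1, h'.2.trans h.2⟩

lemma Tile.Le.k_le {P Q : Tile} (h : P.Le Q) : P.k ≤ Q.k := scale_le_of_DI_subset h.1

lemma Tile.le_of_mem {P Q : Tile} (hk : P.k ≤ Q.k) {x ξ : ℝ} (hx : x ∈ P.I) (hx' : x ∈ Q.I)
    (hP : ξ ∈ P.W) (hQ : ξ ∈ Q.W) : P.Le Q :=
  ⟨Tile.I_subset_I hk hx' hx, Tile.W_subset_W hk hQ hP⟩

/-- A collection of tiles is convex. -/
def TileConvex (S : Finset Tile) : Prop :=
  ∀ P ∈ S, ∀ Q ∈ S, ∀ R : Tile, P.Le R → R.Le Q → R ∈ S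

/-- The tiles of a collection subordinate to an interval and a frequency. -/
def subTree (S : Finset Tile) (j : (ℤ × ℤ) × ℝ) : Finset Tile :=
  S.filter fun P => P.I ⊆ DI j.1.1 j.1.2 ∧ j.2 ∈ P.W

lemma mem_subTree {S : Finset Tile} {j : (ℤ × ℤ) × ℝ} {P : Tile} :
    P ∈ subTree S j ↔ P ∈ S ∧ P.I ⊆ DI j.1.1 j.1.2 ∧ j.2 ∈ P.W := Finset.mem_filter

lemma subTree_down {S : Finset Tile} {j : (ℤ × ℤ) × ℝ} {P Q : Tile} (hP : P ∈ S)
    (hQ : Q ∈ subTree S j) (h : P.Le Q) : P ∈ subTree S j := by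
  rw [mem_subTree] at hQ ⊢
  exact ⟨hP, h.1.trans hQ.2.1, h.2 hQ.2.2⟩

lemma TileConvex.down {S T : Finset Tile} (hS : TileConvex S) (hTS : T ⊆ S)
    (hT : ∀ P ∈ S, ∀ Q ∈ T, P.Le Q → P ∈ T) : TileConvex T := fun P hP Q hQ P' h h' =>
  hT P' (hS P (hTS hP) Q (hTS hQ) P' h h') Q hQ h'

lemma TileConvex.sdiff {S T : Finset Tile} (hS : TileConvex S)
    (hT : ∀ P ∈ S, ∀ Q ∈ T, P.Le Q → P ∈ T) : TileConvex (S \ T) := by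
  intro P hP Q hQ P' h h'
  rw [Finset.mem_sdiff] at hP hQ ⊢
  exact ⟨hS P hP.1 Q hQ.1 P' h h', fun hc => hP.2 (hT P hP.1 P' hc h)⟩

lemma TileConvex.subTree {S : Finset Tile} (hS : TileConvex S) (j : (ℤ × ℤ) × ℝ) :
    TileConvex (subTree S j) :=
  hS.down (Finset.filter_subset _ _) fun _ hP _ hQ h => subTree_down hP hQ h

lemma TileConvex.sdiff_subTree {S : Finset Tile} (hS : TileConvex S) (j : (ℤ × ℤ) × ℝ) :
    TileConvex (S \ _root_.subTree S j) := hS.sdiff fun _ hP _ hQ h => subTree_down hP hQ h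

lemma tileSum_add_sdiff (N : ℝ → ℝ) (f : ℝ → ℂ) {S T : Finset Tile} (h : T ⊆ S) (x : ℝ) :
    tileSum N f S x = tileSum N f T x + tileSum N f (S \ T) x := by
  unfold tileSum
  rw [add_comm, Finset.sum_sdiff h]

lemma measurable_tileSum {N : ℝ → ℝ} (hN : Measurable N) {f : ℝ → ℂ} (hf : Integrable f)
    (S : Finset Tile) : Measurable (tileSum N f S) := by
  unfold tileSum
  refine Finset.measurable_fun_sum _ fun P _ => ?_
  exact (continuous_hh hf _ _).measurable.indicator (P.measurableSet_I.inter (hN P.measurableSet_R))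

/-- The estimate for all tiles subordinate to an interval and a frequency. -/
lemma subTree_estimate : ∃ C : ℝ≥0, ∀ f : ℝ → ℂ, Integrable f → ∀ N : ℝ → ℝ, Measurable N →
    ∀ E : Set ℝ, MeasurableSet E → ∀ S : Finset Tile, TileConvex S →
    ∀ σ : ℝ≥0, SizeLe f S σ → ∀ δ : ℝ≥0∞,
    (∀ Q ∈ S, volume (E ∩ Q.I ∩ N ⁻¹' Q.W) ≤ δ * 2 ^ Q.k) → ∀ j : (ℤ × ℤ) × ℝ,
    ∫⁻ x in E, ‖tileSum N f (subTree S j) x‖ₑ ≤ C * (δ * σ * 2 ^ j.1.1) := by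
  obtain ⟨C, hC⟩ := tree_estimate
  refine ⟨C, fun f hf N hN E hE S hS σ hσ δ hδ j => ?_⟩
  set T := subTree S j with hTdef
  have hTc : TileConvex T := hS.subTree j
  have hTS : T ⊆ S := Finset.filter_subset _ _
  have hW : ∀ P ∈ T, j.2 ∈ P.W := fun P hP => (mem_subTree.mp hP).2.2
  set tops := T.filter fun Q => ∀ P ∈ T, Q.I ⊆ P.I → P = Q with htops
  have hdisj : ∀ Q ∈ tops, ∀ Q' ∈ tops, Q ≠ Q' → Disjoint Q.I Q'.I := by
    have key : ∀ Q ∈ tops, ∀ Q' ∈ tops, Q.k ≤ Q'.k → Q ≠ Q' → Disjoint Q.I Q'.I := by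
      intro Q hQ Q' hQ' hk hne
      rw [Finset.mem_filter] at hQ hQ'
      rcases DI_subset_or_disjoint hk Q'.n Q.n with h | h
      · exact absurd (hQ.2 Q' hQ'.1 h).symm hne
      · exact h
    intro Q hQ Q' hQ' hne
    rcases le_total Q.k Q'.k with h | h
    · exact key Q hQ Q' hQ' h hne
    · exact (key Q' hQ' Q hQ h hne.symm).symm
  have hex : ∀ P ∈ T, ∃ Q ∈ tops, P.I ⊆ Q.I := by
    intro P hP
    obtain ⟨Q, hQ, hmax⟩ := Finset.exists_max_image (T.filter fun Q => P.I ⊆ Q.I) Tile.k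
      ⟨P, Finset.mem_filter.mpr ⟨hP, subset_rfl⟩⟩
    rw [Finset.mem_filter] at hQ
    refine ⟨Q, Finset.mem_filter.mpr ⟨hQ.1, fun P' hP' h => ?_⟩, hQ.2⟩
    have h1 := hmax P' (Finset.mem_filter.mpr ⟨hP', hQ.2.trans h⟩)
    have h2 : Q.k ≤ P'.k := scale_le_of_DI_subset h
    obtain ⟨x, hx⟩ := Q.I_nonempty
    exact Tile.eq_of_mem (le_antisymm h1 h2) (h hx) hx (hW P' hP') (hW Q hQ.1)
  have hsum : ∀ x, tileSum N f T x =
      ∑ Q ∈ tops, tileSum N f (T.filter fun P => P.I ⊆ Q.I) x := by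
    intro x
    unfold tileSum
    simp_rw [Finset.sum_filter (s := T)]
    rw [Finset.sum_comm]
    refine Finset.sum_congr rfl fun P hP => ?_
    obtain ⟨Q, hQ, hPQ⟩ := hex P hP
    rw [Finset.sum_eq_single_of_mem Q hQ, if_pos hPQ]
    intro Q' hQ' hne
    rw [if_neg]
    intro hPQ'
    obtain ⟨z, hz⟩ := P.I_nonempty
    exact Set.disjoint_left.mp (hdisj Q' hQ' Q hQ hne) (hPQ' hz) (hPQ hz)
  have htree : ∀ Q ∈ tops, IsTree (T.filter fun P => P.I ⊆ Q.I) j.2 Q.k Q.n := by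
    intro Q hQ
    have hQT := (Finset.mem_filter.mp hQ).1
    refine ⟨fun P hP => hW P (Finset.mem_filter.mp hP).1, ?_,
      fun P hP => (Finset.mem_filter.mp hP).2, ?_⟩
    · have : dy (-Q.k) j.2 = Q.l := hW Q hQT
      rw [this]
      exact Finset.mem_filter.mpr ⟨hQT, subset_rfl⟩
    · intro k k' x hx hkk' hk'
      rw [Finset.mem_filter] at hx ⊢
      have hxQ : x ∈ Q.I := hx.2 (mem_tileAt_I _ k x)
      have h1 : (tileAt j.2 k x).Le (tileAt j.2 k' x) :=
        Tile.le_of_mem hkk' (mem_tileAt_I _ k x) (mem_tileAt_I _ k' x) (mem_tileAt_W _ k x)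
          (mem_tileAt_W _ k' x)
      have h2 : (tileAt j.2 k' x).Le Q :=
        Tile.le_of_mem hk' (mem_tileAt_I _ k' x) hxQ (mem_tileAt_W _ k' x) (hW Q hQT)
      exact ⟨hTc _ hx.1 Q hQT _ h1 h2, h2.1⟩
  have hvol : ∑ Q ∈ tops, (2 : ℝ≥0∞) ^ Q.k ≤ 2 ^ j.1.1 := by
    have := sum_setLIntegral_le tops (fun Q => Q.I) (fun Q _ => Q.measurableSet_I)
      (fun Q hQ Q' hQ' hne => hdisj Q hQ Q' hQ' hne) (A := DI j.1.1 j.1.2)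
      (fun Q hQ => (mem_subTree.mp (Finset.mem_filter.mp hQ).1).2.1) (fun _ => 1)
    simpa [volume_DI, Tile.volume_I] using this
  calc ∫⁻ x in E, ‖tileSum N f T x‖ₑ
      ≤ ∫⁻ x in E, ∑ Q ∈ tops, ‖tileSum N f (T.filter fun P => P.I ⊆ Q.I) x‖ₑ :=
        lintegral_mono fun x => by rw [hsum]; exact enorm_sum_le _ _
    _ = ∑ Q ∈ tops, ∫⁻ x in E, ‖tileSum N f (T.filter fun P => P.I ⊆ Q.I) x‖ₑ :=
        lintegral_finsetSum _ fun Q _ => (measurable_tileSum hN hf _).enorm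
    _ ≤ ∑ Q ∈ tops, C * (δ * σ * 2 ^ Q.k) := by
        refine Finset.sum_le_sum fun Q hQ => ?_
        have hsub : (T.filter fun P => P.I ⊆ Q.I) ⊆ S := (Finset.filter_subset _ _).trans hTS
        exact hC f hf N hN E hE _ j.2 Q.k Q.n (htree Q hQ) σ (hσ.mono hsub) δ
          fun Q' hQ' => hδ Q' (hsub hQ')
    _ ≤ _ := by
        rw [← Finset.mul_sum, ← Finset.mul_sum]
        gcongr

/-- A collection covered by trees. -/
def Covers (J : List ((ℤ × ℤ) × ℝ)) (S : Finset Tile) : Prop :=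
  ∀ P ∈ S, ∃ j ∈ J, P.I ⊆ DI j.1.1 j.1.2 ∧ j.2 ∈ P.W

/-- The total length of the intervals of a family. -/
def lenSum (J : List ((ℤ × ℤ) × ℝ)) : ℝ≥0∞ := (J.map fun j => (2 : ℝ≥0∞) ^ j.1.1).sum

lemma cover_estimate : ∃ C : ℝ≥0, ∀ f : ℝ → ℂ, Integrable f → ∀ N : ℝ → ℝ, Measurable N →
    ∀ E : Set ℝ, MeasurableSet E → ∀ (J : List ((ℤ × ℤ) × ℝ)) (S : Finset Tile), TileConvex S →
    ∀ σ : ℝ≥0, SizeLe f S σ → ∀ δ : ℝ≥0∞,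
    (∀ Q ∈ S, volume (E ∩ Q.I ∩ N ⁻¹' Q.W) ≤ δ * 2 ^ Q.k) → Covers J S →
    ∫⁻ x in E, ‖tileSum N f S x‖ₑ ≤ C * (δ * σ * lenSum J) := by
  obtain ⟨C, hC⟩ := subTree_estimate
  refine ⟨C, fun f hf N hN E hE J => ?_⟩
  induction J with
  | nil =>
    intro S _ σ _ δ _ hcov
    have : S = ∅ := Finset.eq_empty_of_forall_notMem fun P hP => by simpa using hcov P hP
    simp [this, tileSum]
  | cons j J ih =>
    intro S hS σ hσ δ hδ hcov
    have hsub : subTree S j ⊆ S := Finset.filter_subset _ _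
    have h1 := hC f hf N hN E hE S hS σ hσ δ hδ j
    have h2 := ih (S \ subTree S j) (hS.sdiff_subTree j) σ (hσ.mono Finset.sdiff_subset) δ
      (fun Q hQ => hδ Q (Finset.sdiff_subset hQ)) (by
        intro P hP
        rw [Finset.mem_sdiff] at hP
        obtain ⟨j', hj', h⟩ := hcov P hP.1
        rcases List.mem_cons.mp hj' with rfl | hj'
        · exact absurd (mem_subTree.mpr ⟨hP.1, h⟩) hP.2
        · exact ⟨j', hj', h⟩)
    calc ∫⁻ x in E, ‖tileSum N f S x‖ₑ
        ≤ ∫⁻ x in E, (‖tileSum N f (subTree S j) x‖ₑ + ‖tileSum N f (S \ subTree S j) x‖ₑ) :=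
          lintegral_mono fun x => by rw [tileSum_add_sdiff N f hsub]; exact enorm_add_le _ _
      _ = _ := lintegral_add_left (measurable_tileSum hN hf _).enorm _
      _ ≤ _ := add_le_add h1 h2
      _ = _ := by simp only [lenSum, List.map_cons, List.sum_cons]; ring

/-! ### Density of tiles -/

/-- The density of a tile with respect to a set `E` and a frequency choice `N`. -/
def dens (N : ℝ → ℝ) (E : Set ℝ) (P : Tile) : ℝ≥0∞ :=
  ⨆ Q : Tile, ⨆ _ : P.Le Q, volume (E ∩ Q.I ∩ N ⁻¹' Q.W) * 2 ^ (-Q.k)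

lemma Tile.Le.refl (P : Tile) : P.Le P := ⟨subset_rfl, subset_rfl⟩

lemma dens_anti (N : ℝ → ℝ) (E : Set ℝ) {P Q : Tile} (h : P.Le Q) : dens N E Q ≤ dens N E P :=
  iSup₂_le fun Q' h' => le_iSup₂_of_le Q' (h.trans h') le_rfl

lemma volume_le_dens (N : ℝ → ℝ) (E : Set ℝ) (P : Tile) :
    volume (E ∩ P.I ∩ N ⁻¹' P.W) ≤ dens N E P * 2 ^ P.k := by
  calc volume (E ∩ P.I ∩ N ⁻¹' P.W)
      = volume (E ∩ P.I ∩ N ⁻¹' P.W) * 2 ^ (-P.k) * 2 ^ P.k := by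
        rw [mul_assoc, two_zpow_neg_mul, mul_one]
    _ ≤ _ := mul_le_mul_left (le_iSup₂_of_le (f := fun (Q : Tile) (_ : P.Le Q) =>
        volume (E ∩ Q.I ∩ N ⁻¹' Q.W) * 2 ^ (-Q.k)) P (Tile.Le.refl P) le_rfl) _

lemma dens_le_one (N : ℝ → ℝ) (E : Set ℝ) (P : Tile) : dens N E P ≤ 1 := by
  refine iSup₂_le fun Q _ => ?_
  calc volume (E ∩ Q.I ∩ N ⁻¹' Q.W) * 2 ^ (-Q.k) ≤ volume Q.I * 2 ^ (-Q.k) :=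
        mul_le_mul_left (measure_mono fun x hx => hx.1.2) _
    _ = 1 := by rw [Q.volume_I, two_zpow_mul_neg]

/-- Tiles of density exceeding `δ` are covered by trees of total length at most `|E| / δ`. -/
lemma dens_cover {N : ℝ → ℝ} (hN : Measurable N) {E : Set ℝ} (hE : MeasurableSet E)
    (S : Finset Tile) (δ : ℝ≥0∞) (hS : ∀ P ∈ S, δ < dens N E P) :
    ∃ J, Covers J S ∧ δ * lenSum J ≤ volume E := by
  have hex : ∀ P : Tile, ∃ Q : Tile, P ∈ S → P.Le Q ∧ δ * 2 ^ Q.k ≤ volume (E ∩ Q.I ∩ N ⁻¹' Q.W) :=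
      by
    intro P
    by_cases hP : P ∈ S
    · have h := hS P hP
      simp only [dens, lt_iSup_iff] at h
      obtain ⟨Q, hQ, h⟩ := h
      refine ⟨Q, fun _ => ⟨hQ, ?_⟩⟩
      calc δ * 2 ^ Q.k ≤ volume (E ∩ Q.I ∩ N ⁻¹' Q.W) * 2 ^ (-Q.k) * 2 ^ Q.k :=
            mul_le_mul_left h.le _
        _ = _ := by rw [mul_assoc, two_zpow_neg_mul, mul_one]
    · exact ⟨P, fun h => absurd h hP⟩
  choose q hq using hex
  set M := (S.image q).filter fun Q => ∀ Q' ∈ S.image q, Q.Le Q' → Q' = Q with hM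
  have hMq : ∀ Q ∈ M, δ * 2 ^ Q.k ≤ volume (E ∩ Q.I ∩ N ⁻¹' Q.W) := by
    intro Q hQ
    obtain ⟨P, hP, rfl⟩ := Finset.mem_image.mp (Finset.filter_subset _ _ hQ)
    exact (hq P hP).2
  refine ⟨M.toList.map fun Q => ((Q.k, Q.n), (Q.l : ℝ) * 2 ^ (-Q.k)), ?_, ?_⟩
  · intro P hP
    have hne : ((S.image q).filter fun Q => (q P).Le Q).Nonempty :=
      ⟨q P, Finset.mem_filter.mpr ⟨Finset.mem_image_of_mem _ hP, Tile.Le.refl _⟩⟩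
    obtain ⟨Q, hQ, hmax⟩ := Finset.exists_max_image _ (fun Q : Tile => Q.k) hne
    rw [Finset.mem_filter] at hQ
    refine ⟨((Q.k, Q.n), (Q.l : ℝ) * 2 ^ (-Q.k)), List.mem_map.mpr ⟨Q, ?_, rfl⟩, ?_⟩
    · rw [Finset.mem_toList]
      refine Finset.mem_filter.mpr ⟨hQ.1, fun Q' hQ' h => ?_⟩
      have hk : Q'.k ≤ Q.k := hmax Q' (Finset.mem_filter.mpr ⟨hQ', hQ.2.trans h⟩)
      obtain ⟨x, hx⟩ := Q.I_nonempty
      obtain ⟨ξ, hξ⟩ := Q'.W_nonempty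
      exact Tile.eq_of_mem (le_antisymm hk h.k_le) (h.1 hx) hx hξ (h.2 hξ)
    · have h := (hq P hP).1.trans hQ.2
      exact ⟨h.1, h.2 (left_mem_DI _ _)⟩
  · have hd : (M : Set Tile).PairwiseDisjoint fun Q => E ∩ Q.I ∩ N ⁻¹' Q.W := by
      intro Q hQ Q' hQ' hne
      refine Set.disjoint_left.mpr fun x hx hx' => hne ?_
      have h1 := Finset.mem_filter.mp hQ
      have h2 := Finset.mem_filter.mp hQ'
      rcases le_total Q.k Q'.k with h | h
      · exact (h1.2 Q' h2.1 (Tile.le_of_mem h hx.1.2 hx'.1.2 hx.2 hx'.2)).symm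
      · exact h2.2 Q h1.1 (Tile.le_of_mem h hx'.1.2 hx.1.2 hx'.2 hx.2)
    have hlen : lenSum (M.toList.map fun Q => ((Q.k, Q.n), (Q.l : ℝ) * 2 ^ (-Q.k))) =
        ∑ Q ∈ M, (2 : ℝ≥0∞) ^ Q.k := by
      rw [lenSum, List.map_map, ← Finset.sum_map_toList]
      rfl
    rw [hlen, Finset.mul_sum]
    calc ∑ Q ∈ M, δ * 2 ^ Q.k ≤ ∑ Q ∈ M, volume (E ∩ Q.I ∩ N ⁻¹' Q.W) :=
          Finset.sum_le_sum hMq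
      _ = volume (⋃ Q ∈ M, E ∩ Q.I ∩ N ⁻¹' Q.W) := (measure_biUnion_finset hd fun Q _ =>
          (hE.inter Q.measurableSet_I).inter (hN Q.measurableSet_W)).symm
      _ ≤ volume E := measure_mono (iUnion₂_subset fun Q _ x hx => hx.1.1)

/-! ### Selection of trees of large size -/

/-- The tiles of a collection below an interval whose right half contains a frequency. -/
def rightTree (S : Finset Tile) (j : (ℤ × ℤ) × ℝ) : Finset Tile :=
  S.filter fun P => P.I ⊆ DI j.1.1 j.1.2 ∧ j.2 ∈ P.R

lemma mem_rightTree {S : Finset Tile} {j : (ℤ × ℤ) × ℝ} {P : Tile} :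
    P ∈ rightTree S j ↔ P ∈ S ∧ P.I ⊆ DI j.1.1 j.1.2 ∧ j.2 ∈ P.R := Finset.mem_filter

/-- A pair of an interval and a frequency at which a size bound is violated. -/
def Violates (f : ℝ → ℂ) (S : Finset Tile) (σ : ℝ≥0) (j : (ℤ × ℤ) × ℝ) : Prop :=
  (σ : ℝ≥0∞) ^ 2 * 2 ^ j.1.1 < ∑ P ∈ rightTree S j, Am f P

lemma sizeLe_of_not_violates {f : ℝ → ℂ} {S : Finset Tile} {σ : ℝ≥0}
    (h : ∀ j, ¬ Violates f S σ j) : SizeLe f S σ := fun k n ξ =>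
  not_lt.mp (h ((k, n), ξ))

lemma Violates.mono {f : ℝ → ℂ} {S S' : Finset Tile} {σ : ℝ≥0} {j : (ℤ × ℤ) × ℝ}
    (h : Violates f S' σ j) (hS : S' ⊆ S) : Violates f S σ j :=
  h.trans_le (Finset.sum_le_sum_of_subset (Finset.filter_subset_filter _ hS))

/-- If a size bound fails, it fails at a smallest frequency. -/
lemma exists_minimal_violates {f : ℝ → ℂ} {S : Finset Tile} {σ : ℝ≥0}
    (h : ∃ j, Violates f S σ j) : ∃ j, Violates f S σ j ∧ ∀ j', Violates f S σ j' → j.2 ≤ j'.2 := by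
  set e : Tile → ℝ := fun P => (2 * P.l + 1 : ℤ) * 2 ^ (-P.k - 1) with he
  have hle : ∀ (P : Tile) ξ, ξ ∈ P.R → e P ≤ ξ := fun P ξ hξ => (dy_eq_iff.mp hξ).1
  have key : ∀ j, Violates f S σ j → ∃ P ∈ S, Violates f S σ (j.1, e P) ∧ e P ≤ j.2 := by
    intro j hj
    have hne : (rightTree S j).Nonempty := by
      rw [Finset.nonempty_iff_ne_empty]
      intro h0
      rw [Violates, h0] at hj
      simp at hj
    obtain ⟨P, hP, hmax⟩ := Finset.exists_max_image _ e hne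
    rw [mem_rightTree] at hP
    refine ⟨P, hP.1, ?_, hle P _ hP.2.2⟩
    refine lt_of_lt_of_le hj (Finset.sum_le_sum_of_subset fun Q hQ => ?_)
    have hQ' := mem_rightTree.mp hQ
    refine mem_rightTree.mpr ⟨hQ'.1, hQ'.2.1, ?_⟩
    have h1 := dy_eq_iff.mp hQ'.2.2
    exact dy_eq_iff.mpr ⟨hmax Q hQ, (hle P _ hP.2.2).trans_lt h1.2⟩
  have hne : (S.filter fun P => ∃ i, Violates f S σ (i, e P)).Nonempty := by
    obtain ⟨j, hj⟩ := h
    obtain ⟨P, hP, hv, -⟩ := key j hj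
    exact ⟨P, Finset.mem_filter.mpr ⟨hP, j.1, hv⟩⟩
  obtain ⟨P, hP, hmin⟩ := Finset.exists_min_image _ e hne
  obtain ⟨i, hi⟩ := (Finset.mem_filter.mp hP).2
  refine ⟨(i, e P), hi, fun j' hj' => ?_⟩
  obtain ⟨Q, hQ, hv, hQj⟩ := key j' hj'
  exact (hmin Q (Finset.mem_filter.mpr ⟨hQ, j'.1, hv⟩)).trans hQj

/-- Iterated removal of trees of large size. -/
lemma exists_tree_selection (f : ℝ → ℂ) (σ : ℝ≥0) (S : Finset Tile) :
    ∃ (L : List (((ℤ × ℤ) × ℝ) × Finset Tile)) (S' : Finset Tile), S' ⊆ S ∧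
      SizeLe f S' σ ∧ (∀ P ∈ S, ∀ Q ∈ S \ S', P.Le Q → P ∈ S \ S') ∧
      Covers (L.map Prod.fst) (S \ S') ∧
      (∀ e ∈ L, Violates f S σ e.1) ∧
      (∀ e ∈ L, e.2 ⊆ rightTree S e.1) ∧
      (∀ e ∈ L, (σ : ℝ≥0∞) ^ 2 * 2 ^ e.1.1.1 ≤ ∑ P ∈ e.2, Am f P) ∧
      L.Pairwise (fun e e' => Disjoint e.2 e'.2) ∧
      (∀ e ∈ L, ∀ e' ∈ L, ∀ P ∈ e.2, ∀ P' ∈ e'.2, P'.k < P.k → P.W ⊆ P'.L →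
        Disjoint P'.I (DI e.1.1.1 e.1.1.2)) := by
  induction S using Finset.strongInduction with
  | H S ih =>
  by_cases hv : ∃ j, Violates f S σ j
  swap
  · refine ⟨[], S, subset_rfl, sizeLe_of_not_violates fun j hj => hv ⟨j, hj⟩, ?_, ?_, ?_⟩ <;>
      simp [Covers]
  obtain ⟨j, hj, hmin⟩ := exists_minimal_violates hv
  have hRT : rightTree S j ⊆ subTree S j := by
    intro P hP
    have := mem_rightTree.mp hP
    exact mem_subTree.mpr ⟨this.1, this.2.1, P.R_subset_W this.2.2⟩
  have hne : (subTree S j).Nonempty := by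
    have hne : (rightTree S j).Nonempty := by
      rw [Finset.nonempty_iff_ne_empty]
      intro h0
      rw [Violates, h0] at hj
      simp at hj
    exact hne.mono hRT
  have hTS : subTree S j ⊆ S := Finset.filter_subset _ _
  obtain ⟨L, S', hS', hsz, hdown, hcov, hvio, hsub, hbig, hpw, hdisj⟩ :=
    ih (S \ subTree S j) (Finset.sdiff_ssubset hTS hne)
  have hsubS : ∀ e ∈ L, ∀ P ∈ e.2, P ∈ S ∧ P ∉ subTree S j ∧ P.I ⊆ DI e.1.1.1 e.1.1.2 ∧
      e.1.2 ∈ P.R := by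
    intro e he P hP
    have := mem_rightTree.mp (hsub e he hP)
    rw [Finset.mem_sdiff] at this
    exact ⟨this.1.1, this.1.2, this.2⟩
  refine ⟨(j, rightTree S j) :: L, S', hS'.trans Finset.sdiff_subset, hsz, ?_, ?_, ?_, ?_, ?_, ?_,
      ?_⟩
  · intro P hP Q hQ hPQ
    rw [Finset.mem_sdiff] at hQ ⊢
    refine ⟨hP, fun hPS' => ?_⟩
    have hPn := Finset.mem_sdiff.mp (hS' hPS')
    by_cases hQT : Q ∈ subTree S j
    · exact hPn.2 (subTree_down hP hQT hPQ)
    · exact (Finset.mem_sdiff.mp (hdown P (hS' hPS') Q (Finset.mem_sdiff.mpr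
        ⟨Finset.mem_sdiff.mpr ⟨hQ.1, hQT⟩, hQ.2⟩) hPQ)).2 hPS'
  · intro P hP
    rw [Finset.mem_sdiff] at hP
    by_cases hPT : P ∈ subTree S j
    · exact ⟨j, by simp, (mem_subTree.mp hPT).2⟩
    · obtain ⟨i, hi, h⟩ := hcov P (Finset.mem_sdiff.mpr ⟨Finset.mem_sdiff.mpr ⟨hP.1, hPT⟩, hP.2⟩)
      exact ⟨i, by simp only [List.map_cons, List.mem_cons]; exact Or.inr hi, h⟩
  · intro e he
    rcases List.mem_cons.mp he with rfl | he
    · exact hj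
    · exact (hvio e he).mono Finset.sdiff_subset
  · intro e he
    rcases List.mem_cons.mp he with rfl | he
    · exact subset_rfl
    · exact (hsub e he).trans (Finset.filter_subset_filter _ Finset.sdiff_subset)
  · intro e he
    rcases List.mem_cons.mp he with rfl | he
    · exact hj.le
    · exact hbig e he
  · refine List.Pairwise.cons (fun e he => ?_) hpw
    refine Finset.disjoint_left.mpr fun P hP hP' => (hsubS e he P hP').2.1 (hRT hP)
  · intro e he e' he' P hP P' hP' hk hW
    rcases List.mem_cons.mp he with rfl | he <;> rcases List.mem_cons.mp he' with rfl | he'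
    · exfalso
      exact Set.disjoint_left.mp P'.disjoint_L_R
        (hW (P.R_subset_W (mem_rightTree.mp hP).2.2)) (mem_rightTree.mp hP').2.2
    · have h1 := mem_rightTree.mp hP
      have h2 := hsubS e' he' P' hP'
      have hk1 : P'.k ≤ j.1.1 := hk.le.trans (scale_le_of_DI_subset h1.2.1)
      rcases DI_subset_or_disjoint hk1 j.1.2 P'.n with h | h
      · exact absurd (mem_subTree.mpr ⟨h2.1, h, P'.L_subset_W (hW (P.R_subset_W h1.2.2))⟩) h2.2.1
      · exact h
    · exfalso
      have h1 := hsubS e he P hP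
      have h2 := mem_rightTree.mp hP'
      have := Tile.lt_of_mem_L_of_mem_R (hW (P.R_subset_W h1.2.2.2)) h2.2.2
      exact absurd (hmin e.1 ((hvio e he).mono Finset.sdiff_subset)) (not_le.mpr this)
    · exact hdisj e he e' he' P hP P' hP' hk hW

lemma SizeLe.mm_le {f : ℝ → ℂ} (hf : Integrable f) {S : Finset Tile} {σ : ℝ≥0} (h : SizeLe f S σ)
    {P : Tile} (hP : P ∈ S) : mm f P ≤ (1 + decMass) * σ * 2 ^ P.k := by
  rw [← ENNReal.pow_le_pow_left_iff two_ne_zero]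
  calc mm f P ^ 2 ≤ 2 ^ P.k * decMass * Am f P := mm_sq_le hf P
    _ ≤ 2 ^ P.k * (1 + decMass) ^ 2 * (σ ^ 2 * 2 ^ P.k) := by
        gcongr
        · calc decMass ≤ 1 + decMass := le_add_self
            _ = (1 + decMass) * 1 := by ring
            _ ≤ (1 + decMass) * (1 + decMass) := by gcongr; exact le_self_add
            _ = _ := by ring
        · exact h.Am_le hP
    _ = _ := by ring

lemma dec_ctr_le_setLIntegral {k k' n' : ℤ} (h : k' ≤ k) (m : ℕ) (c : ℝ) :
    2 ^ k' * dec m k (c - ctr k' n') ≤ 2 ^ m * ∫⁻ z in DI k' n', dec m k (c - z) := by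
  rw [← lintegral_const_mul _ (by fun_prop)]
  refine two_zpow_mul_le_setLIntegral fun z hz => ?_
  have := dec_comp m k (s := c - z) (t := c - ctr k' n') (m := 2) ?_
  · exact_mod_cast this
  · have h1 : rho k (c - z) ≤ rho k (c - ctr k' n') * rho k (ctr k' n' - z) := by
      have := rho_add_le k (c - ctr k' n') (ctr k' n' - z)
      rwa [sub_add_sub_cancel] at this
    have h2 : rho k (ctr k' n' - z) ≤ 2 := by
      have h3 := abs_sub_ctr_le hz
      rw [abs_sub_comm] at h3
      have h4 : (2 : ℝ) ^ k' ≤ 2 ^ k := zpow_le_zpow_right₀ (by norm_num) h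
      have h5 : |ctr k' n' - z| * 2 ^ (-k) ≤ 2 ^ k * 2 ^ (-k) := by
        gcongr
        have : (0 : ℝ) < 2 ^ k := by positivity
        linarith
      rw [← zpow_add₀ (by norm_num)] at h5
      simp only [add_neg_cancel, zpow_zero] at h5
      unfold rho; linarith
    calc _ ≤ _ := h1
      _ ≤ rho k (c - ctr k' n') * 2 := by gcongr; exact (rho_pos _ _).le
      _ = _ := by push_cast; ring

lemma sum_nest_tile_le {f : ℝ → ℂ} (hf : Integrable f) {S : Finset Tile} {σ : ℝ≥0}
    (h : SizeLe f S σ) {P : Tile} (hP : P ∈ S) {s : Finset Tile} (hs : s ⊆ S)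
    (hk : ∀ P' ∈ s, P'.k < P.k) (hd : (s : Set Tile).PairwiseDisjoint Tile.I) {A : Set ℝ}
    (hA : ∀ P' ∈ s, P'.I ⊆ A) :
    ∑ P' ∈ s, nest f P P' ≤ 2 ^ 8 * (1 + decMass) ^ 2 * σ ^ 2 *
      (2 ^ (-P.k) * ∫⁻ x in P.I, ∫⁻ z in A, dec 4 P.k (x - z)) := by
  calc ∑ P' ∈ s, nest f P P'
      ≤ ∑ P' ∈ s, 2 ^ 4 * (1 + decMass) ^ 2 * σ ^ 2 * ∫⁻ z in P'.I, dec 4 P.k (P.c - z) := by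
        refine Finset.sum_le_sum fun P' hP' => ?_
        calc nest f P P' ≤ 2 ^ (-P.k) * dec 4 P.k (P.c - P'.c) *
              (((1 + decMass) * σ * 2 ^ P.k) * ((1 + decMass) * σ * 2 ^ P'.k)) := by
              unfold nest
              gcongr
              · exact h.mm_le hf hP
              · exact h.mm_le hf (hs hP')
          _ = (1 + decMass) ^ 2 * σ ^ 2 * (2 ^ (-P.k) * 2 ^ P.k) *
              (2 ^ P'.k * dec 4 P.k (P.c - ctr P'.k P'.n)) := by unfold Tile.c; ring
          _ ≤ (1 + decMass) ^ 2 * σ ^ 2 * (2 ^ (-P.k) * 2 ^ P.k) *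
              (2 ^ 4 * ∫⁻ z in P'.I, dec 4 P.k (P.c - z)) := by
              exact mul_le_mul_right (dec_ctr_le_setLIntegral (hk P' hP').le 4 P.c) _
          _ = _ := by rw [two_zpow_neg_mul]; ring
    _ = 2 ^ 4 * (1 + decMass) ^ 2 * σ ^ 2 * ∑ P' ∈ s, ∫⁻ z in P'.I, dec 4 P.k (P.c - z) := by
        rw [Finset.mul_sum]
    _ ≤ 2 ^ 4 * (1 + decMass) ^ 2 * σ ^ 2 * ∫⁻ z in A, dec 4 P.k (P.c - z) := by
        gcongr
        exact sum_setLIntegral_le s _ (fun P' _ => P'.measurableSet_I) hd hA _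
    _ ≤ 2 ^ 4 * (1 + decMass) ^ 2 * σ ^ 2 *
        (2 ^ (-P.k) * ∫⁻ x in P.I, 2 ^ 4 * ∫⁻ z in A, dec 4 P.k (x - z)) := by
        gcongr
        refine le_two_zpow_mul_setLIntegral fun x hx => ?_
        rw [← lintegral_const_mul _ (by fun_prop)]
        refine lintegral_mono fun z => ?_
        have := dec_sub_ctr_le 4 hx z
        rwa [dec_sub_comm, dec_sub_comm _ _ z x] at this
    _ = _ := by
        rw [lintegral_const_mul' _ _ (by norm_num)]; ring

/-- The nested interactions of a collection of tiles with a fixed interval. -/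
lemma sum_nest_tree_le {f : ℝ → ℂ} (hf : Integrable f) {S : Finset Tile} {σ : ℝ≥0}
    (h : SizeLe f S σ) {B : Finset Tile} (hB : B ⊆ S) {k₀ n₀ : ℤ} {ξ : ℝ}
    (hBI : ∀ P ∈ B, P.I ⊆ DI k₀ n₀ ∧ ξ ∈ P.W) (s : Tile → Finset Tile)
    (hs : ∀ P ∈ B, s P ⊆ S) (hk : ∀ P ∈ B, ∀ P' ∈ s P, P'.k < P.k)
    (hd : ∀ P ∈ B, (s P : Set Tile).PairwiseDisjoint Tile.I)
    (hA : ∀ P ∈ B, ∀ P' ∈ s P, Disjoint P'.I (DI k₀ n₀)) :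
    ∑ P ∈ B, ∑ P' ∈ s P, nest f P P' ≤ 2 ^ 10 * (1 + decMass) ^ 4 * (σ ^ 2 * 2 ^ k₀) := by
  set A := (DI k₀ n₀)ᶜ
  set F : ℤ → ℝ → ℝ≥0∞ := fun k x => ∫⁻ z in A, dec 4 k (x - z)
  calc ∑ P ∈ B, ∑ P' ∈ s P, nest f P P'
      ≤ ∑ P ∈ B, 2 ^ 8 * (1 + decMass) ^ 2 * σ ^ 2 * (2 ^ (-P.k) * ∫⁻ x in P.I, F P.k x) :=
        Finset.sum_le_sum fun P hP => sum_nest_tile_le hf h (hB hP) (hs P hP) (hk P hP) (hd P hP)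
          fun P' hP' => Set.subset_compl_iff_disjoint_right.mpr (hA P hP P' hP')
    _ = 2 ^ 8 * (1 + decMass) ^ 2 * σ ^ 2 * ∑ P ∈ B, 2 ^ (-P.k) * ∫⁻ x in P.I, F P.k x := by
        rw [Finset.mul_sum]
    _ = 2 ^ 8 * (1 + decMass) ^ 2 * σ ^ 2 * ∑ k ∈ B.image Tile.k, ∑ P ∈ B with P.k = k,
          2 ^ (-P.k) * ∫⁻ x in P.I, F P.k x := by
        rw [Finset.sum_fiberwise_of_maps_to fun P hP => Finset.mem_image_of_mem _ hP]
    _ ≤ 2 ^ 8 * (1 + decMass) ^ 2 * σ ^ 2 * ∑ k ∈ B.image Tile.k, 2 * decMass ^ 2 * 2 ^ k := by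
        gcongr with k hk
        calc ∑ P ∈ B with P.k = k, 2 ^ (-P.k) * ∫⁻ x in P.I, F P.k x
            = ∑ P ∈ B with P.k = k, 2 ^ (-k) * ∫⁻ x in P.I, F k x := by
              refine Finset.sum_congr rfl fun P hP => ?_
              rw [(Finset.mem_filter.mp hP).2]
          _ = 2 ^ (-k) * ∑ P ∈ B with P.k = k, ∫⁻ x in P.I, F k x := by rw [Finset.mul_sum]
          _ ≤ 2 ^ (-k) * ∫⁻ x in DI k₀ n₀, F k x := by
              gcongr
              refine sum_setLIntegral_le _ _ (fun P _ => P.measurableSet_I) ?_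
                (fun P hP => (hBI P (Finset.mem_filter.mp hP).1).1) _
              intro P hP Q hQ hne
              have hP' := Finset.mem_filter.mp hP
              have hQ' := Finset.mem_filter.mp hQ
              refine Set.disjoint_left.mpr fun x hx hx' => hne ?_
              exact Tile.eq_of_mem (hP'.2.trans hQ'.2.symm) hx hx' (hBI P hP'.1).2 (hBI Q hQ'.1).2
          _ ≤ 2 ^ (-k) * (2 * (2 ^ k * decMass) ^ 2) := by
              gcongr
              refine lintegral_cross_le k _ _ (DI_eq_Ico k₀ n₀).subset ?_
              rw [← DI_eq_Ico]
          _ = 2 * decMass ^ 2 * 2 ^ k * (2 ^ (-k) * 2 ^ k) := by ring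
          _ = _ := by rw [two_zpow_neg_mul, mul_one]
    _ = 2 ^ 8 * (1 + decMass) ^ 2 * σ ^ 2 * (2 * decMass ^ 2 * ∑ k ∈ B.image Tile.k, 2 ^ k) := by
        rw [Finset.mul_sum (a := 2 * decMass ^ 2)]
    _ ≤ 2 ^ 8 * (1 + decMass) ^ 2 * σ ^ 2 * (2 * (1 + decMass) ^ 2 * (2 * 2 ^ k₀)) := by
        gcongr
        · exact le_add_self
        · refine sum_two_zpow_le _ _ fun k hk => ?_
          obtain ⟨P, hP, rfl⟩ := Finset.mem_image.mp hk
          exact scale_le_of_DI_subset (hBI P hP).1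
    _ = _ := by ring

/-- Removing trees of total length `≲ σ⁻² ‖f‖₂²` halves the size of a collection of tiles. -/
lemma energy_lemma : ∃ C : ℝ≥0, ∀ f : ℝ → ℂ, Integrable f → ∀ (σ : ℝ≥0) (S : Finset Tile),
    SizeLe f S σ → ∃ J S', S' ⊆ S ∧ SizeLe f S' (σ / 2) ∧
      (∀ P ∈ S, ∀ Q ∈ S \ S', P.Le Q → P ∈ S \ S') ∧ Covers J (S \ S') ∧
      σ ^ 2 * lenSum J ≤ C * ∫⁻ x, ‖f x‖ₑ ^ 2 := by
  obtain ⟨C, hC0, hC⟩ := sum_Am_sq_le_nest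
  have hCt : 4 * ((C : ℝ≥0∞) * (1 + 2 ^ 12 * (1 + decMass) ^ 4)) ≠ ⊤ := by
    have := decMass_ne_top
    finiteness
  refine ⟨(4 * ((C : ℝ≥0∞) * (1 + 2 ^ 12 * (1 + decMass) ^ 4))).toNNReal, fun f hf σ S hS => ?_⟩
  rw [ENNReal.coe_toNNReal hCt]
  obtain ⟨L, S', hS', hsz, hdown, hcov, hvio, hsub, hbig, hpw, hdisj⟩ :=
    exists_tree_selection f (σ / 2) S
  refine ⟨L.map Prod.fst, S', hS', hsz, hdown, hcov, ?_⟩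
  set ι := Fin L.length
  set B : ι → Finset Tile := fun i => L[i].2 with hBdef
  have hmem : ∀ i : ι, L[i] ∈ L := fun i => List.getElem_mem _
  have hBd : ((Finset.univ : Finset ι) : Set ι).PairwiseDisjoint B := by
    intro i _ j _ hij
    rw [List.pairwise_iff_getElem] at hpw
    rcases lt_or_gt_of_ne hij with h | h
    · exact hpw i j i.2 j.2 h
    · exact (hpw j i j.2 i.2 h).symm
  set BB := Finset.univ.biUnion B with hBB
  have hBBmem : ∀ P, P ∈ BB ↔ ∃ i, P ∈ B i := by simp [hBB]
  have hright : ∀ i, ∀ P ∈ B i, P ∈ S ∧ P.I ⊆ DI L[i].1.1.1 L[i].1.1.2 ∧ L[i].1.2 ∈ P.R :=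
    fun i P hP => mem_rightTree.mp (hsub _ (hmem i) hP)
  have hBBS : BB ⊆ S := fun P hP => by
    obtain ⟨i, hi⟩ := (hBBmem P).mp hP
    exact (hright i P hi).1
  have hlen : lenSum (L.map Prod.fst) = ∑ i : ι, (2 : ℝ≥0∞) ^ L[i].1.1.1 := by
    rw [lenSum, List.map_map, ← Fin.sum_univ_fun_getElem]
    rfl
  set X := ∑ P ∈ BB, Am f P with hX
  set ℓ := lenSum (L.map Prod.fst) with hℓ
  have h1 : σ ^ 2 * ℓ ≤ 4 * X := by
    have h2 : ((σ / 2 : ℝ≥0) : ℝ≥0∞) ^ 2 * ℓ ≤ X := by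
      rw [hlen, Finset.mul_sum, hX, hBB, Finset.sum_biUnion hBd]
      exact Finset.sum_le_sum fun i _ => hbig _ (hmem i)
    calc σ ^ 2 * ℓ = 4 * (((σ / 2 : ℝ≥0) : ℝ≥0∞) ^ 2 * ℓ) := by
          have : (σ : ℝ≥0∞) = 2 * ((σ / 2 : ℝ≥0) : ℝ≥0∞) := by
            rw [← ENNReal.coe_ofNat, ← ENNReal.coe_mul, mul_div_cancel₀ _ two_ne_zero]
          rw [this]; ring
      _ ≤ _ := by gcongr
  have h3 : ∑ P ∈ BB, ∑ P' ∈ BB with P'.k < P.k ∧ P.W ⊆ P'.L, nest f P P' ≤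
      2 ^ 10 * (1 + decMass) ^ 4 * (σ ^ 2 * ℓ) := by
    rw [hBB, Finset.sum_biUnion hBd, hlen, Finset.mul_sum, Finset.mul_sum, ← hBB]
    refine Finset.sum_le_sum fun i _ => ?_
    refine sum_nest_tree_le hf hS (ξ := L[i].1.2) (fun P hP => (hright i P hP).1)
      (n₀ := L[i].1.1.2)
      (fun P hP => ⟨(hright i P hP).2.1, P.R_subset_W (hright i P hP).2.2⟩)
      (fun P => BB.filter fun P' => P'.k < P.k ∧ P.W ⊆ P'.L)
      (fun P _ => (Finset.filter_subset _ _).trans hBBS)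
      (fun P _ P' hP' => (Finset.mem_filter.mp hP').2.1) ?_ ?_
    · intro P _ Q hQ Q' hQ' hne
      have key : ∀ {Q Q' : Tile}, Q ∈ BB → Q' ∈ BB → P.W ⊆ Q.L → P.W ⊆ Q'.L → Q'.k < Q.k →
          Disjoint Q'.I Q.I := by
        intro Q Q' hQ hQ' hW hW' hk
        obtain ⟨a, ha⟩ := (hBBmem _).mp hQ
        obtain ⟨b, hb⟩ := (hBBmem _).mp hQ'
        obtain ⟨ξ, hξ⟩ := P.W_nonempty
        have := hdisj _ (hmem a) _ (hmem b) Q ha Q' hb hk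
          (Tile.W_subset_L hk (Q.L_subset_W (hW hξ)) (hW' hξ))
        exact this.mono_right (hright a Q ha).2.1
      have hQ := Finset.mem_filter.mp hQ
      have hQ' := Finset.mem_filter.mp hQ'
      rcases lt_trichotomy Q.k Q'.k with h | h | h
      · exact key hQ'.1 hQ.1 hQ'.2.2 hQ.2.2 h
      · refine Set.disjoint_left.mpr fun x hx hx' => hne ?_
        obtain ⟨ξ, hξ⟩ := P.W_nonempty
        exact Tile.eq_of_mem h hx hx' (Q.L_subset_W (hQ.2.2 hξ)) (Q'.L_subset_W (hQ'.2.2 hξ))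
      · exact (key hQ.1 hQ'.1 hQ.2.2 hQ'.2.2 h).symm
    · intro P hP P' hP'
      have hP' := Finset.mem_filter.mp hP'
      obtain ⟨b, hb⟩ := (hBBmem _).mp hP'.1
      exact hdisj _ (hmem i) _ (hmem b) P hP P' hb hP'.2.1 hP'.2.2
  have hXt : X ≠ ⊤ := ENNReal.sum_ne_top.mpr fun P _ => Am_ne_top hf P
  have h4 : X ≤ C * (1 + 2 ^ 12 * (1 + decMass) ^ 4) * ∫⁻ x, ‖f x‖ₑ ^ 2 := by
    refine ENNReal.le_of_sq_le_mul hXt ?_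
    calc X ^ 2 ≤ C * (∫⁻ x, ‖f x‖ₑ ^ 2) * (X + 2 ^ 10 * (1 + decMass) ^ 4 * (4 * X)) :=
          (hC f hf BB).trans (by gcongr; exact h3.trans (by gcongr))
      _ = _ := by ring
  calc σ ^ 2 * ℓ ≤ 4 * X := h1
    _ ≤ 4 * (C * (1 + 2 ^ 12 * (1 + decMass) ^ 4) * ∫⁻ x, ‖f x‖ₑ ^ 2) := by gcongr
    _ = _ := by ring

/-! ### Tails of tiles -/

lemma sum_two_zpow_neg_abs_le (K : Finset ℤ) (q : ℤ) :
    ∑ k ∈ K, (2 : ℝ≥0∞) ^ (-|q - k|) ≤ 4 := by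
  have h1 : ∑ k ∈ K with k ≤ q, (2 : ℝ≥0∞) ^ (-|q - k|) ≤ 2 := by
    calc ∑ k ∈ K with k ≤ q, (2 : ℝ≥0∞) ^ (-|q - k|)
        = ∑ k ∈ K with k ≤ q, 2 ^ (-q) * (2 : ℝ≥0∞) ^ k := by
          refine Finset.sum_congr rfl fun k hk => ?_
          have := (Finset.mem_filter.mp hk).2
          rw [← two_zpow_add, abs_of_nonneg (by omega)]
          congr 1; ring
      _ = 2 ^ (-q) * ∑ k ∈ K with k ≤ q, (2 : ℝ≥0∞) ^ k := by rw [Finset.mul_sum]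
      _ ≤ 2 ^ (-q) * (2 * 2 ^ q) := by
          gcongr
          exact sum_two_zpow_le _ _ fun k hk => (Finset.mem_filter.mp hk).2
      _ = 2 * (2 ^ (-q) * 2 ^ q) := by ring
      _ = 2 := by rw [two_zpow_neg_mul, mul_one]
  have h2 : ∑ k ∈ K with ¬ k ≤ q, (2 : ℝ≥0∞) ^ (-|q - k|) ≤ 2 := by
    calc ∑ k ∈ K with ¬ k ≤ q, (2 : ℝ≥0∞) ^ (-|q - k|)
        = ∑ k ∈ K with ¬ k ≤ q, 2 ^ q * (2 : ℝ≥0∞) ^ (-k) := by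
          refine Finset.sum_congr rfl fun k hk => ?_
          have := (Finset.mem_filter.mp hk).2
          rw [← two_zpow_add, abs_of_neg (by omega)]
          congr 1; ring
      _ = 2 ^ q * ∑ k ∈ K with ¬ k ≤ q, (2 : ℝ≥0∞) ^ (-k) := by rw [Finset.mul_sum]
      _ = 2 ^ q * ∑ j ∈ (K.filter fun k => ¬ k ≤ q).image Neg.neg, (2 : ℝ≥0∞) ^ j := by
          rw [Finset.sum_image fun a _ b _ h => neg_injective h]
      _ ≤ 2 ^ q * (2 * 2 ^ (-q)) := by
          gcongr
          refine sum_two_zpow_le _ _ fun j hj => ?_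
          obtain ⟨k, hk, rfl⟩ := Finset.mem_image.mp hj
          have := (Finset.mem_filter.mp hk).2
          omega
      _ = 2 * (2 ^ q * 2 ^ (-q)) := by ring
      _ = 2 := by rw [two_zpow_mul_neg, mul_one]
  rw [← Finset.sum_filter_add_sum_filter_not K fun k => k ≤ q]
  calc _ ≤ (2 : ℝ≥0∞) + 2 := add_le_add h1 h2
    _ = 4 := by norm_num

/-- The mass of the tail of a tile, damped away from its scale. -/
def tailMass (q : ℝ → ℤ) (P : Tile) : ℝ≥0∞ :=
  ∫⁻ y, 2 ^ (-|q y - P.k|) * (2 ^ (-P.k) * dec 4 P.k (y - P.c))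

lemma measurable_two_zpow_neg_abs {q : ℝ → ℤ} (hq : Measurable q) (k : ℤ) :
    Measurable fun y => (2 : ℝ≥0∞) ^ (-|q y - k|) :=
  (measurable_from_top (f := fun j : ℤ => (2 : ℝ≥0∞) ^ (-|j - k|))).comp hq

lemma two_zpow_neg_abs_le_one (j : ℤ) : (2 : ℝ≥0∞) ^ (-|j|) ≤ 1 := by
  calc (2 : ℝ≥0∞) ^ (-|j|) ≤ 2 ^ (0 : ℤ) := two_zpow_mono (by simp)
    _ = 1 := zpow_zero _

lemma tailMass_le (q : ℝ → ℤ) (P : Tile) : tailMass q P ≤ decMass := by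
  calc tailMass q P ≤ ∫⁻ y, 1 * (2 ^ (-P.k) * dec 4 P.k (y - P.c)) :=
        lintegral_mono fun y => mul_le_mul_left (two_zpow_neg_abs_le_one _) _
    _ = 2 ^ (-P.k) * ∫⁻ y, dec 4 P.k (y - P.c) := by
        simp_rw [one_mul]
        exact lintegral_const_mul' _ _ (two_zpow_ne_top _)
    _ ≤ 2 ^ (-P.k) * (2 ^ P.k * decMass) := by
        gcongr
        exact lintegral_dec_le (by norm_num) _ _
    _ = decMass := by rw [← mul_assoc, two_zpow_neg_mul, one_mul]

lemma sum_tailMass_le {q : ℝ → ℤ} (hq : Measurable q) {T : Finset Tile} {k₀ n₀ : ℤ} {ξ : ℝ}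
    (hT : ∀ P ∈ T, P.I ⊆ DI k₀ n₀ ∧ ξ ∈ P.W) :
    ∑ P ∈ T, 2 ^ P.k * tailMass q P ≤ 2 ^ 6 * (decMass + decMass ^ 2) * 2 ^ k₀ := by
  set I₀ := DI k₀ n₀ with hI₀
  set K := T.image Tile.k with hK
  have hKk : ∀ k ∈ K, k ≤ k₀ := by
    intro k hk
    obtain ⟨P, hP, rfl⟩ := Finset.mem_image.mp hk
    exact scale_le_of_DI_subset (hT P hP).1
  set G : ℤ → ℝ → ℝ≥0∞ := fun k y => 2 ^ (-k) * ∫⁻ x in I₀, dec 4 k (y - x) with hG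
  have hGm : ∀ k, Measurable (G k) := by
    intro k
    refine Measurable.const_mul ?_ _
    exact Measurable.lintegral_prod_right' (f := fun p : ℝ × ℝ => dec 4 k (p.1 - p.2))
      (measurable_dec_comp 4 k (by fun_prop))
  have hscale : ∀ k, ∑ P ∈ T with P.k = k, 2 ^ P.k * tailMass q P ≤
      2 ^ 4 * ∫⁻ y, 2 ^ (-|q y - k|) * G k y := by
    intro k
    calc ∑ P ∈ T with P.k = k, 2 ^ P.k * tailMass q P
        = ∑ P ∈ T with P.k = k, ∫⁻ y, 2 ^ (-|q y - k|) * dec 4 k (y - P.c) := by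
          refine Finset.sum_congr rfl fun P hP => ?_
          rw [(Finset.mem_filter.mp hP).2.symm, tailMass,
            ← lintegral_const_mul' _ _ (two_zpow_ne_top _)]
          refine lintegral_congr fun y => ?_
          calc _ = 2 ^ (-|q y - P.k|) * dec 4 P.k (y - P.c) * (2 ^ P.k * 2 ^ (-P.k)) := by ring
            _ = _ := by rw [two_zpow_mul_neg, mul_one]
      _ = ∫⁻ y, ∑ P ∈ T with P.k = k, 2 ^ (-|q y - k|) * dec 4 k (y - P.c) := by
          rw [lintegral_finsetSum]
          exact fun P _ => (measurable_two_zpow_neg_abs hq k).mul (by fun_prop)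
      _ ≤ ∫⁻ y, 2 ^ 4 * (2 ^ (-|q y - k|) * G k y) := by
          refine lintegral_mono fun y => ?_
          dsimp only
          rw [← Finset.mul_sum]
          calc 2 ^ (-|q y - k|) * ∑ P ∈ T with P.k = k, dec 4 k (y - P.c)
              ≤ 2 ^ (-|q y - k|) * ∑ P ∈ T with P.k = k,
                2 ^ (-k) * (2 ^ 4 * ∫⁻ x in P.I, dec 4 k (y - x)) := by
                refine mul_le_mul_right (Finset.sum_le_sum fun P hP => ?_) _
                have hk := (Finset.mem_filter.mp hP).2
                rw [← lintegral_const_mul _ (by fun_prop), ← hk]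
                exact le_two_zpow_mul_setLIntegral fun x hx => dec_sub_ctr_le 4 hx y
            _ = 2 ^ (-|q y - k|) * (2 ^ (-k) * (2 ^ 4 *
                ∑ P ∈ T with P.k = k, ∫⁻ x in P.I, dec 4 k (y - x))) := by
                simp only [Finset.mul_sum]
            _ ≤ 2 ^ (-|q y - k|) * (2 ^ (-k) * (2 ^ 4 * ∫⁻ x in I₀, dec 4 k (y - x))) := by
                refine mul_le_mul_right (mul_le_mul_right (mul_le_mul_right ?_ _) _) _
                refine sum_setLIntegral_le _ _ (fun P _ => P.measurableSet_I) ?_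
                  (fun P hP => (hT P (Finset.mem_filter.mp hP).1).1) _
                intro P hP Q hQ hne
                have hP' := Finset.mem_filter.mp hP
                have hQ' := Finset.mem_filter.mp hQ
                refine Set.disjoint_left.mpr fun x hx hx' => hne ?_
                exact Tile.eq_of_mem (hP'.2.trans hQ'.2.symm) hx hx' (hT P hP'.1).2 (hT Q hQ'.1).2
            _ = _ := by rw [hG]; ring
      _ = _ := lintegral_const_mul' _ _ (by norm_num)
  have hin : ∑ k ∈ K, ∫⁻ y in I₀, 2 ^ (-|q y - k|) * G k y ≤ 4 * decMass * 2 ^ k₀ := by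
    calc ∑ k ∈ K, ∫⁻ y in I₀, 2 ^ (-|q y - k|) * G k y
        ≤ ∑ k ∈ K, ∫⁻ y in I₀, 2 ^ (-|q y - k|) * decMass := by
          refine Finset.sum_le_sum fun k _ => lintegral_mono fun y => mul_le_mul_right ?_ _
          calc G k y ≤ 2 ^ (-k) * (2 ^ k * decMass) := by
                refine mul_le_mul_right ?_ _
                exact (setLIntegral_le_lintegral _ _).trans (lintegral_dec_le' (by norm_num) k y)
            _ = decMass := by rw [← mul_assoc, two_zpow_neg_mul, one_mul]
      _ = ∫⁻ y in I₀, ∑ k ∈ K, 2 ^ (-|q y - k|) * decMass := by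
          rw [lintegral_finsetSum]
          exact fun k _ => (measurable_two_zpow_neg_abs hq k).mul_const _
      _ ≤ ∫⁻ _ in I₀, 4 * decMass := by
          refine lintegral_mono fun y => ?_
          dsimp only
          rw [← Finset.sum_mul]
          exact mul_le_mul_left (sum_two_zpow_neg_abs_le K (q y)) _
      _ = _ := by rw [setLIntegral_const, hI₀, volume_DI]
  have hout : ∑ k ∈ K, ∫⁻ y in I₀ᶜ, 2 ^ (-|q y - k|) * G k y ≤ 4 * decMass ^ 2 * 2 ^ k₀ := by
    calc ∑ k ∈ K, ∫⁻ y in I₀ᶜ, 2 ^ (-|q y - k|) * G k y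
        ≤ ∑ k ∈ K, 2 * decMass ^ 2 * 2 ^ k := by
          refine Finset.sum_le_sum fun k _ => ?_
          calc ∫⁻ y in I₀ᶜ, 2 ^ (-|q y - k|) * G k y ≤ ∫⁻ y in I₀ᶜ, 1 * G k y :=
                lintegral_mono fun y => mul_le_mul_left (two_zpow_neg_abs_le_one _) _
            _ = 2 ^ (-k) * ∫⁻ y in I₀ᶜ, ∫⁻ x in I₀, dec 4 k (y - x) := by
                simp_rw [one_mul, hG]
                exact lintegral_const_mul' _ _ (two_zpow_ne_top _)
            _ ≤ 2 ^ (-k) * (2 * (2 ^ k * decMass) ^ 2) := by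
                gcongr
                exact lintegral_cross_le' k k₀ n₀ subset_rfl
            _ = 2 * decMass ^ 2 * 2 ^ k * (2 ^ (-k) * 2 ^ k) := by ring
            _ = _ := by rw [two_zpow_neg_mul, mul_one]
      _ = 2 * decMass ^ 2 * ∑ k ∈ K, 2 ^ k := by rw [Finset.mul_sum]
      _ ≤ 2 * decMass ^ 2 * (2 * 2 ^ k₀) := by
          gcongr
          exact sum_two_zpow_le _ _ hKk
      _ = _ := by ring
  calc ∑ P ∈ T, 2 ^ P.k * tailMass q P
      = ∑ k ∈ K, ∑ P ∈ T with P.k = k, 2 ^ P.k * tailMass q P :=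
        (Finset.sum_fiberwise_of_maps_to (fun P hP => Finset.mem_image_of_mem _ hP) _).symm
    _ ≤ ∑ k ∈ K, 2 ^ 4 * ∫⁻ y, 2 ^ (-|q y - k|) * G k y :=
        Finset.sum_le_sum fun k _ => hscale k
    _ = 2 ^ 4 * ∑ k ∈ K, ((∫⁻ y in I₀, 2 ^ (-|q y - k|) * G k y) +
          ∫⁻ y in I₀ᶜ, 2 ^ (-|q y - k|) * G k y) := by
        rw [Finset.mul_sum]
        refine Finset.sum_congr rfl fun k _ => ?_
        rw [lintegral_add_compl _ (measurableSet_DI k₀ n₀)]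
    _ ≤ 2 ^ 4 * (4 * decMass * 2 ^ k₀ + 4 * decMass ^ 2 * 2 ^ k₀) := by
        rw [Finset.sum_add_distrib]
        gcongr
    _ = _ := by ring

/-- Functions dominated on each tile of a tree by its tail mass are summable over the tree. -/
lemma sum_lintegral_le_of_tailMass {q : ℝ → ℤ} (hq : Measurable q) {T : Finset Tile} {k₀ n₀ : ℤ}
    {ξ : ℝ} (hT : ∀ P ∈ T, P.I ⊆ DI k₀ n₀ ∧ ξ ∈ P.W) (u : Tile → ℝ → ℂ) (A : ℝ≥0∞)
    (hu : ∀ P ∈ T, ∀ z, dec 5 P.k (z - P.c) * ‖u P z‖ₑ ≤ A * tailMass q P) :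
    ∑ P ∈ T, ∫⁻ z, dec 12 P.k (z - P.c) * ‖u P z‖ₑ ^ 2 ≤
      A ^ 2 * (2 ^ 6 * decMass ^ 2 * (decMass + decMass ^ 2)) * 2 ^ k₀ := by
  calc ∑ P ∈ T, ∫⁻ z, dec 12 P.k (z - P.c) * ‖u P z‖ₑ ^ 2
      ≤ ∑ P ∈ T, A ^ 2 * decMass ^ 2 * (2 ^ P.k * tailMass q P) := by
        refine Finset.sum_le_sum fun P hP => ?_
        calc ∫⁻ z, dec 12 P.k (z - P.c) * ‖u P z‖ₑ ^ 2
            ≤ ∫⁻ z, dec 2 P.k (z - P.c) * (A * tailMass q P) ^ 2 := by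
              refine lintegral_mono fun z => ?_
              calc dec 12 P.k (z - P.c) * ‖u P z‖ₑ ^ 2
                  = dec 2 P.k (z - P.c) * (dec 5 P.k (z - P.c) * ‖u P z‖ₑ) ^ 2 := by
                    rw [mul_pow, dec_pow, ← mul_assoc, dec_mul]
                _ ≤ _ := mul_le_mul_right (pow_le_pow_left' (hu P hP z) 2) _
          _ = (∫⁻ z, dec 2 P.k (z - P.c)) * (A * tailMass q P) ^ 2 :=
              lintegral_mul_const _ (by fun_prop)
          _ ≤ (2 ^ P.k * decMass) * (A * tailMass q P) ^ 2 := by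
              gcongr
              exact lintegral_dec_le le_rfl _ _
          _ = A ^ 2 * decMass * (2 ^ P.k * tailMass q P) * tailMass q P := by ring
          _ ≤ A ^ 2 * decMass * (2 ^ P.k * tailMass q P) * decMass := by
              gcongr
              exact tailMass_le q P
          _ = _ := by ring
    _ = A ^ 2 * decMass ^ 2 * ∑ P ∈ T, 2 ^ P.k * tailMass q P := by rw [Finset.mul_sum]
    _ ≤ A ^ 2 * decMass ^ 2 * (2 ^ 6 * (decMass + decMass ^ 2) * 2 ^ k₀) := by
        gcongr
        exact sum_tailMass_le hq hT
    _ = _ := by ring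

/-! ### Averages over a dyadic partition -/

/-- The dyadic interval of scale `q y` around `y`. -/
def cell (q : ℝ → ℤ) (y : ℝ) : Set ℝ := DI (q y) (dy (q y) y)

/-- The cells of `q` form a partition. -/
def IsPartition (q : ℝ → ℤ) : Prop := ∀ y, ∀ y' ∈ cell q y, q y' = q y

lemma mem_cell_comm {q : ℝ → ℤ} (h : IsPartition q) {y y' : ℝ} (hy : y' ∈ cell q y) :
    y ∈ cell q y' := by
  have h1 := h y y' hy
  simp only [cell, mem_DI, h1] at hy ⊢
  exact hy.symm

/-- The averaging kernel of a dyadic partition. -/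
def cellKer (q : ℝ → ℤ) (p : ℝ × ℝ) : ℂ := if p.2 ∈ cell q p.1 then (2 : ℂ) ^ (-q p.1) else 0

lemma cellKer_comm {q : ℝ → ℤ} (h : IsPartition q) (y y' : ℝ) :
    cellKer q (y', y) = cellKer q (y, y') := by
  unfold cellKer
  by_cases hy : y ∈ cell q y'
  · simp [hy, mem_cell_comm h hy, h _ _ hy]
  · have : y' ∉ cell q y := fun h' => hy (mem_cell_comm h h')
    simp [hy, this]

lemma measurable_cellKer {q : ℝ → ℤ} (hq : Measurable q) : Measurable (cellKer q) := by
  have h1 : Measurable fun p : ℤ × ℝ => dy p.1 p.2 :=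
    measurable_from_prod_countable_right fun k => measurable_dy k
  refine Measurable.ite ?_ ?_ measurable_const
  · exact measurableSet_eq_fun (h1.comp ((hq.comp measurable_fst).prodMk measurable_snd))
      (h1.comp ((hq.comp measurable_fst).prodMk measurable_fst))
  · exact (measurable_from_top (f := fun j : ℤ => (2 : ℂ) ^ (-j))).comp (hq.comp measurable_fst)

lemma enorm_cellKer (q : ℝ → ℤ) (y y' : ℝ) :
    ‖cellKer q (y', y)‖ₑ = (cell q y').indicator (fun _ => (2 : ℝ≥0∞) ^ (-q y')) y := by
  unfold cellKer
  by_cases hy : y ∈ cell q y'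
  · rw [if_pos hy, Set.indicator_of_mem hy]
    exact enorm_eq_ofReal_two_zpow _
  · simp [hy]

lemma measurableSet_cell (q : ℝ → ℤ) (y : ℝ) : MeasurableSet (cell q y) := measurableSet_DI _ _

lemma lintegral_cellKer_mul (q : ℝ → ℤ) (y' : ℝ) (g : ℝ → ℝ≥0∞) :
    ∫⁻ y, ‖cellKer q (y', y)‖ₑ * g y = 2 ^ (-q y') * ∫⁻ y in cell q y', g y := by
  rw [← lintegral_const_mul' _ _ (two_zpow_ne_top _), ← lintegral_indicator (measurableSet_cell q
      y')]
  refine lintegral_congr fun y => ?_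
  rw [enorm_cellKer]
  by_cases hy : y ∈ cell q y' <;> simp [hy]

lemma lintegral_cellKer (q : ℝ → ℤ) (y : ℝ) :
    ∫⁻ y', ‖cellKer q (y, y')‖ₑ = 1 := by
  have := lintegral_cellKer_mul q y fun _ => 1
  simp only [mul_one, setLIntegral_const, one_mul] at this
  rw [this, cell, volume_DI, two_zpow_neg_mul]

lemma integral_cellKer {q : ℝ → ℤ} (h : IsPartition q) (y : ℝ) : ∫ y', cellKer q (y', y) = 1 := by
  have : (fun y' => cellKer q (y', y)) = (cell q y).indicator fun _ => (2 : ℂ) ^ (-q y) := by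
    funext y'
    rw [cellKer_comm h]
    by_cases hy : y' ∈ cell q y <;> simp [hy, cellKer]
  rw [this, integral_indicator (measurableSet_cell q y), setIntegral_const, Measure.real, cell,
    volume_DI, ← ofReal_two_zpow, ENNReal.toReal_ofReal (by positivity), Complex.real_smul]
  push_cast
  rw [← zpow_add₀ two_ne_zero]
  simp

lemma integrable_cellKer_mul {q : ℝ → ℤ} (hq : Measurable q) (h : IsPartition q) {f : ℝ → ℂ}
    (hf : Integrable f) :
    Integrable (fun p : ℝ × ℝ => cellKer q p * f p.2) (volume.prod volume) := by
  have hm : AEStronglyMeasurable (fun p : ℝ × ℝ => cellKer q p * f p.2) (volume.prod volume) :=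
    (measurable_cellKer hq).aestronglyMeasurable.mul hf.aestronglyMeasurable.comp_snd
  refine ⟨hm, ?_⟩
  rw [hasFiniteIntegral_iff_enorm, lintegral_prod_symm _ hm.enorm]
  calc ∫⁻ y, ∫⁻ y', ‖cellKer q (y', y) * f y‖ₑ = ∫⁻ y, ‖f y‖ₑ := by
        refine lintegral_congr fun y => ?_
        simp_rw [enorm_mul, cellKer_comm h y]
        rw [lintegral_mul_const' _ _ enorm_ne_top, lintegral_cellKer, one_mul]
    _ < ⊤ := hf.2

/-- The modulated average of a function over the cells of a partition. -/
def cellAvg (q : ℝ → ℤ) (ξ : ℝ) (f : ℝ → ℂ) (y' : ℝ) : ℂ :=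
  ∫ y, cellKer q (y', y) * f y * Complex.exp (↑(2 * Real.pi * (ξ * (y' - y))) * Complex.I)

lemma integrable_cellKer_mul_exp {q : ℝ → ℤ} (hq : Measurable q) (h : IsPartition q) {f : ℝ → ℂ}
    (hf : Integrable f) (ξ : ℝ) :
    Integrable (fun p : ℝ × ℝ => cellKer q p * f p.2 *
      Complex.exp (↑(2 * Real.pi * (ξ * (p.1 - p.2))) * Complex.I)) (volume.prod volume) := by
  refine (integrable_cellKer_mul hq h hf).mul_bdd (c := 1)
    (by fun_prop) (Eventually.of_forall fun p => ?_)
  rw [Complex.norm_exp_ofReal_mul_I]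

lemma integrable_cellAvg {q : ℝ → ℤ} (hq : Measurable q) (h : IsPartition q) {f : ℝ → ℂ}
    (hf : Integrable f) (ξ : ℝ) : Integrable (cellAvg q ξ f) :=
  (integrable_cellKer_mul_exp hq h hf ξ).integral_prod_left

lemma cellAvg_le {q : ℝ → ℤ} (ξ : ℝ) {f : ℝ → ℂ} {μ : ℝ≥0∞}
    (hμ : ∀ y, ∫⁻ x in cell q y, ‖f x‖ₑ ≤ μ * 2 ^ q y) (y : ℝ) : ‖cellAvg q ξ f y‖ₑ ≤ μ := by
  calc ‖cellAvg q ξ f y‖ₑ ≤ ∫⁻ x, ‖cellKer q (y, x)‖ₑ * ‖f x‖ₑ := by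
        refine (enorm_integral_le_lintegral_enorm _).trans (lintegral_mono fun x => ?_)
        rw [enorm_mul, enorm_exp_mul_I, mul_one, enorm_mul]
    _ = 2 ^ (-q y) * ∫⁻ x in cell q y, ‖f x‖ₑ := lintegral_cellKer_mul q y _
    _ ≤ 2 ^ (-q y) * (μ * 2 ^ q y) := by gcongr; exact hμ y
    _ = μ * (2 ^ (-q y) * 2 ^ q y) := by ring
    _ = μ := by rw [two_zpow_neg_mul, mul_one]

lemma hh_sub_hh_cellAvg {q : ℝ → ℤ} (hq : Measurable q) (h : IsPartition q) {f : ℝ → ℂ}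
    (hf : Integrable f) (ξ : ℝ) (k l : ℤ) (z : ℝ) :
    ‖hh f k l z - hh (cellAvg q ξ f) k l z‖ₑ ≤ ∫⁻ y', ∫⁻ y, ‖cellKer q (y', y)‖ₑ *
      (‖f y‖ₑ * ‖wp β0 k l (z - y) - Complex.exp (↑(2 * Real.pi * (ξ * (y' - y))) * Complex.I) *
        wp β0 k l (z - y')‖ₑ) := by
  obtain ⟨D, hD⟩ := schwartz_bdd (wp β0 k l)
  have hI1 : Integrable (fun p : ℝ × ℝ => cellKer q p * f p.2 * wp β0 k l (z - p.2))
      (volume.prod volume) :=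
    (integrable_cellKer_mul hq h hf).mul_bdd (c := D)
      ((wp β0 k l).continuous.comp (by fun_prop)).aestronglyMeasurable
      (Eventually.of_forall fun p => hD _)
  have hI2 : Integrable (fun p : ℝ × ℝ => cellKer q p * f p.2 *
      Complex.exp (↑(2 * Real.pi * (ξ * (p.1 - p.2))) * Complex.I) * wp β0 k l (z - p.1))
      (volume.prod volume) :=
    (integrable_cellKer_mul_exp hq h hf ξ).mul_bdd (c := D)
      ((wp β0 k l).continuous.comp (by fun_prop)).aestronglyMeasurable
      (Eventually.of_forall fun p => hD _)
  have h1 : hh f k l z = ∫ p : ℝ × ℝ, cellKer q p * f p.2 * wp β0 k l (z - p.2)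
      ∂(volume.prod volume) := by
    rw [integral_prod_symm _ hI1]
    refine integral_congr_ae (Eventually.of_forall fun y => ?_)
    simp_rw [mul_assoc]
    rw [integral_mul_const, integral_cellKer h, one_mul]
  have h2 : hh (cellAvg q ξ f) k l z = ∫ p : ℝ × ℝ, cellKer q p * f p.2 *
      Complex.exp (↑(2 * Real.pi * (ξ * (p.1 - p.2))) * Complex.I) * wp β0 k l (z - p.1)
      ∂(volume.prod volume) := by
    rw [integral_prod _ hI2]
    refine integral_congr_ae (Eventually.of_forall fun y => ?_)
    simp_rw [integral_mul_const]
    rfl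
  rw [h1, h2, ← integral_sub hI1 hI2]
  refine (enorm_integral_le_lintegral_enorm _).trans ?_
  refine (lintegral_prod _ (hI1.sub hI2).aestronglyMeasurable.enorm).trans_le ?_
  refine lintegral_mono fun y' => lintegral_mono fun y => ?_
  rw [← enorm_mul, ← enorm_mul]
  refine le_of_eq (congrArg _ ?_)
  simp only [Pi.sub_apply]
  ring

/-- Pointwise bound for the error in replacing a function by its averages. -/
lemma hh_sub_hh_cellAvg_le {q : ℝ → ℤ} (hq : Measurable q) (h : IsPartition q) {f : ℝ → ℂ}
    (hf : Integrable f) (ξ : ℝ) {μ : ℝ≥0∞}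
    (hμ : ∀ y, ∫⁻ x in cell q y, ‖f x‖ₑ ≤ μ * 2 ^ q y) (P : Tile) (z : ℝ) {D : ℝ≥0∞} (hDt : D ≠ ⊤)
    (hD : ∀ y', ∀ y ∈ cell q y', dec 5 P.k (z - P.c) * ‖wp β0 P.k P.l (z - y) -
      Complex.exp (↑(2 * Real.pi * (ξ * (y' - y))) * Complex.I) * wp β0 P.k P.l (z - y')‖ₑ ≤
      D * (2 ^ (-|q y' - P.k|) * (2 ^ (-P.k) * dec 4 P.k (y' - P.c)))) :
    dec 5 P.k (z - P.c) * ‖hh f P.k P.l z - hh (cellAvg q ξ f) P.k P.l z‖ₑ ≤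
      D * μ * tailMass q P := by
  set w : ℝ → ℝ≥0∞ := fun y' => 2 ^ (-|q y' - P.k|) * (2 ^ (-P.k) * dec 4 P.k (y' - P.c)) with hw
  have hwm : Measurable w := (measurable_two_zpow_neg_abs hq P.k).mul (by fun_prop)
  have hwt : ∀ y, w y ≠ ⊤ := fun y => ENNReal.mul_ne_top (two_zpow_ne_top _)
    (ENNReal.mul_ne_top (two_zpow_ne_top _) (dec_ne_top _ _ _))
  calc dec 5 P.k (z - P.c) * ‖hh f P.k P.l z - hh (cellAvg q ξ f) P.k P.l z‖ₑ
      ≤ dec 5 P.k (z - P.c) * ∫⁻ y', ∫⁻ y, ‖cellKer q (y', y)‖ₑ *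
      (‖f y‖ₑ * ‖wp β0 P.k P.l (z - y) -
        Complex.exp (↑(2 * Real.pi * (ξ * (y' - y))) * Complex.I) * wp β0 P.k P.l (z - y')‖ₑ) :=
        mul_le_mul_right (hh_sub_hh_cellAvg hq h hf ξ P.k P.l z) _
    _ = ∫⁻ y', ∫⁻ y, ‖cellKer q (y', y)‖ₑ *
      (‖f y‖ₑ * (dec 5 P.k (z - P.c) * ‖wp β0 P.k P.l (z - y) -
        Complex.exp (↑(2 * Real.pi * (ξ * (y' - y))) * Complex.I) * wp β0 P.k P.l (z - y')‖ₑ)) := by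
        rw [← lintegral_const_mul' _ _ (dec_ne_top _ _ _)]
        refine lintegral_congr fun y' => ?_
        rw [← lintegral_const_mul' _ _ (dec_ne_top _ _ _)]
        refine lintegral_congr fun y => ?_
        ring
    _ ≤ ∫⁻ y', ∫⁻ y, ‖cellKer q (y', y)‖ₑ * (‖f y‖ₑ * (D * w y')) := by
        refine lintegral_mono fun y' => lintegral_mono fun y => ?_
        by_cases hy : y ∈ cell q y'
        · exact mul_le_mul_right (mul_le_mul_right (hD y' y hy) _) _
        · simp [enorm_cellKer, hy]
    _ ≤ ∫⁻ y', D * μ * w y' := by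
        refine lintegral_mono fun y' => ?_
        dsimp only
        rw [lintegral_cellKer_mul, lintegral_mul_const' _ _ (ENNReal.mul_ne_top hDt (hwt y'))]
        calc 2 ^ (-q y') * ((∫⁻ y in cell q y', ‖f y‖ₑ) * (D * w y'))
            ≤ 2 ^ (-q y') * ((μ * 2 ^ q y') * (D * w y')) :=
              mul_le_mul_right (mul_le_mul_left (hμ y') _) _
          _ = 2 ^ (-q y') * 2 ^ q y' * (D * μ * w y') := by ring
          _ = D * μ * w y' := by rw [two_zpow_neg_mul, one_mul]
    _ = D * μ * tailMass q P := lintegral_const_mul _ hwm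

/-! ### The size of a function with small averages -/

lemma ctr_mem_DI (k n : ℤ) : ctr k n ∈ DI k n := by
  rw [DI_eq_Ico, ctr]
  have : (0 : ℝ) < 2 ^ k := by positivity
  constructor <;> nlinarith

lemma dec_one_le {k q : ℤ} {t : ℝ} (h : 2 ^ q ≤ |t|) : dec 1 k t ≤ 2 ^ (-(q - k)) := by
  rw [← ofReal_two_zpow, dec]
  refine ENNReal.ofReal_le_ofReal ?_
  rw [pow_one, zpow_neg]
  refine inv_anti₀ (by positivity) ?_
  calc (2 : ℝ) ^ (q - k) = 2 ^ q * 2 ^ (-k) := by rw [← zpow_add₀ two_ne_zero, sub_eq_add_neg]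
    _ ≤ |t| * 2 ^ (-k) := by gcongr
    _ ≤ rho k t := by unfold rho; linarith

lemma dec_mul_dec_le {m n j : ℕ} (hm : j ≤ m) (hn : j ≤ n) (k : ℤ) (z y c : ℝ) :
    dec m k (z - c) * dec n k (z - y) ≤ dec j k (y - c) := by
  calc dec m k (z - c) * dec n k (z - y) ≤ dec j k (z - c) * dec j k (z - y) :=
        mul_le_mul' (dec_anti hm _ _) (dec_anti hn _ _)
    _ = dec j k (y - z) * dec j k (z - c) := by rw [dec_sub_comm j k z y, mul_comm]
    _ ≤ dec j k (y - c) := dec_peetre' _ _ _ _ _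

lemma dec_five_far {k q : ℤ} {t : ℝ} (h : 2 ^ q ≤ |t|) :
    dec 5 k t ≤ 2 ^ (-(q - k)) * dec 4 k t := by
  rw [← dec_mul 1 4]
  exact mul_le_mul_left (dec_one_le h) _

/-- The cancellation of a wave packet modulated by its own frequency on the cells of a partition
which is coarse only far away from the packet. -/
lemma wp_sub_wp_le : ∃ D : ℝ≥0, ∀ (q : ℝ → ℤ), IsPartition q → ∀ (P : Tile) (ξ : ℝ), ξ ∈ P.W →
    (∀ y, P.k < q y → 2 ^ q y ≤ |y - P.c|) → ∀ z y', ∀ y ∈ cell q y',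
    dec 5 P.k (z - P.c) * ‖wp β0 P.k P.l (z - y) -
      Complex.exp (↑(2 * Real.pi * (ξ * (y' - y))) * Complex.I) * wp β0 P.k P.l (z - y')‖ₑ ≤
      D * (2 ^ (-|q y' - P.k|) * (2 ^ (-P.k) * dec 4 P.k (y' - P.c))) := by
  obtain ⟨D₁, hD₁⟩ := wp_bound β0
  obtain ⟨D₂, hD₂⟩ := wp_lipschitz β0
  refine ⟨D₂ + D₁ * 33, fun q hq P ξ hξ hfar z y' y hy => ?_⟩
  have hqy : q y = q y' := hq _ _ hy
  have hyy : |y - y'| ≤ 2 ^ q y' :=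
    abs_sub_le_of_mem_DI (k := q y') (n := dy (q y') y') hy rfl
  rcases le_or_gt (q y') P.k with hk | hk
  · have hle : |(z - y) - (z - y')| ≤ 2 ^ q y' := by
      rwa [show (z - y) - (z - y') = y' - y by ring, abs_sub_comm]
    have h1 := hD₂ P.k P.l ξ (z - y) (z - y') hξ (hle.trans (zpow_le_zpow_right₀ one_le_two hk))
    have h2 : ‖wp β0 P.k P.l (z - y) -
        Complex.exp (↑(2 * Real.pi * (ξ * (y' - y))) * Complex.I) * wp β0 P.k P.l (z - y')‖ₑ =
        ‖Complex.exp (↑(-(2 * Real.pi * (ξ * (z - y)))) * Complex.I) * wp β0 P.k P.l (z - y) -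
        Complex.exp (↑(-(2 * Real.pi * (ξ * (z - y')))) * Complex.I) * wp β0 P.k P.l (z - y')‖ₑ :=
            by
      have he : Complex.exp (↑(-(2 * Real.pi * (ξ * (z - y')))) * Complex.I) =
          Complex.exp (↑(-(2 * Real.pi * (ξ * (z - y)))) * Complex.I) *
            Complex.exp (↑(2 * Real.pi * (ξ * (y' - y))) * Complex.I) := by
        rw [← Complex.exp_add]
        congr 1
        push_cast
        ring
      rw [he, mul_assoc (Complex.exp _) (Complex.exp _), ← mul_sub, enorm_mul, enorm_exp_mul_I,
          one_mul]
    have h3 : ENNReal.ofReal (|(z - y) - (z - y')| * 2 ^ (-P.k)) ≤ 2 ^ (-|q y' - P.k|) := by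
      rw [← ofReal_two_zpow]
      refine ENNReal.ofReal_le_ofReal ?_
      rw [abs_of_nonpos (show q y' - P.k ≤ 0 by omega), neg_neg, sub_eq_add_neg (q y'),
        zpow_add₀ two_ne_zero]
      gcongr
    rw [h2]
    calc _ ≤ dec 5 P.k (z - P.c) * (D₂ * 2 ^ (-|q y' - P.k|) * 2 ^ (-P.k) * dec 20 P.k (z - y')) :=
        by
          gcongr
          refine h1.trans ?_
          gcongr
      _ = D₂ * (2 ^ (-|q y' - P.k|) * (2 ^ (-P.k) * (dec 5 P.k (z - P.c) * dec 20 P.k (z - y'))))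
          := by
          ring
      _ ≤ D₂ * (2 ^ (-|q y' - P.k|) * (2 ^ (-P.k) * dec 4 P.k (y' - P.c))) := by
          gcongr
          exact dec_mul_dec_le (by norm_num) (by norm_num) _ _ _ _
      _ ≤ _ := by
          gcongr
          exact le_self_add
  · have hy1 := hfar y (hqy ▸ hk)
    have hy2 := hfar y' hk
    rw [hqy] at hy1
    have h5 : dec 5 P.k (y - P.c) ≤ 32 * dec 5 P.k (y' - P.c) := by
      have := dec_comp 5 P.k (s := y' - P.c) (t := y - P.c) (m := 2) (rho_le_two_mul ?_)
      · norm_num at this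
        exact this
      · have : |y' - P.c| ≤ |y - P.c| + |y - y'| := by
          rw [show y' - P.c = (y - P.c) - (y - y') by ring]
          exact abs_sub _ _
        have := le_max_right ((2 : ℝ) ^ P.k) |y - P.c|
        linarith
    rw [abs_of_pos (by omega)]
    calc _ ≤ dec 5 P.k (z - P.c) * (D₁ * 2 ^ (-P.k) * dec 20 P.k (z - y) +
            D₁ * 2 ^ (-P.k) * dec 20 P.k (z - y')) := by
          gcongr
          refine (enorm_sub_le).trans (add_le_add (hD₁ _ _ _) ?_)
          rw [enorm_mul, enorm_exp_mul_I, one_mul]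
          exact hD₁ _ _ _
      _ = D₁ * 2 ^ (-P.k) * (dec 5 P.k (z - P.c) * dec 20 P.k (z - y) +
            dec 5 P.k (z - P.c) * dec 20 P.k (z - y')) := by ring
      _ ≤ D₁ * 2 ^ (-P.k) * (dec 5 P.k (y - P.c) + dec 5 P.k (y' - P.c)) := by
          gcongr <;> exact dec_mul_dec_le (by norm_num) (by norm_num) _ _ _ _
      _ ≤ D₁ * 2 ^ (-P.k) * (32 * dec 5 P.k (y' - P.c) + dec 5 P.k (y' - P.c)) := by gcongr
      _ = D₁ * 33 * 2 ^ (-P.k) * dec 5 P.k (y' - P.c) := by ring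
      _ ≤ D₁ * 33 * 2 ^ (-P.k) * (2 ^ (-(q y' - P.k)) * dec 4 P.k (y' - P.c)) := by
          gcongr
          exact dec_five_far hy2
      _ = (D₁ * 33) * (2 ^ (-(q y' - P.k)) * (2 ^ (-P.k) * dec 4 P.k (y' - P.c))) := by ring
      _ ≤ _ := by
          gcongr
          push_cast
          exact le_add_self

/-- A bounded function living far away from a tile interacts weakly with it. -/
lemma hh_far_le : ∃ D : ℝ≥0, ∀ (g : ℝ → ℂ) (μ : ℝ≥0∞), (∀ y, ‖g y‖ₑ ≤ μ) → ∀ (k₀ : ℤ) (P : Tile),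
    P.k ≤ k₀ → (∀ y, g y ≠ 0 → 2 ^ k₀ ≤ |y - P.c|) → ∀ z,
    dec 5 P.k (z - P.c) * ‖hh g P.k P.l z‖ₑ ≤ D * μ * tailMass (fun _ => k₀) P := by
  obtain ⟨D, hD⟩ := wp_bound β0
  refine ⟨D, fun g μ hμ k₀ P hk hg z => ?_⟩
  have hm : Measurable fun y => (2 : ℝ≥0∞) ^ (-|k₀ - P.k|) * (2 ^ (-P.k) * dec 4 P.k (y - P.c)) :=
      by
    fun_prop
  calc dec 5 P.k (z - P.c) * ‖hh g P.k P.l z‖ₑ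
      ≤ dec 5 P.k (z - P.c) * ∫⁻ y, ‖g y‖ₑ * ‖wp β0 P.k P.l (z - y)‖ₑ :=
        mul_le_mul_right (enorm_cv_le _ _ _) _
    _ = ∫⁻ y, dec 5 P.k (z - P.c) * (‖g y‖ₑ * ‖wp β0 P.k P.l (z - y)‖ₑ) :=
        (lintegral_const_mul' _ _ (dec_ne_top _ _ _)).symm
    _ ≤ ∫⁻ y, D * μ * (2 ^ (-|k₀ - P.k|) * (2 ^ (-P.k) * dec 4 P.k (y - P.c))) := by
        refine lintegral_mono fun y => ?_
        dsimp only
        by_cases h0 : g y = 0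
        · simp [h0]
        rw [abs_of_nonneg (by omega)]
        calc dec 5 P.k (z - P.c) * (‖g y‖ₑ * ‖wp β0 P.k P.l (z - y)‖ₑ)
            ≤ dec 5 P.k (z - P.c) * (μ * (D * 2 ^ (-P.k) * dec 20 P.k (z - y))) := by
              gcongr
              · exact hμ y
              · exact hD _ _ _
          _ = D * μ * (2 ^ (-P.k) * (dec 5 P.k (z - P.c) * dec 20 P.k (z - y))) := by ring
          _ ≤ D * μ * (2 ^ (-P.k) * (2 ^ (-(k₀ - P.k)) * dec 4 P.k (y - P.c))) := by
              refine mul_le_mul_right (mul_le_mul_right ?_ _) _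
              exact (dec_mul_dec_le le_rfl (by norm_num) _ _ _ _).trans (dec_five_far (hg y h0))
          _ = _ := by ring
    _ = D * μ * tailMass (fun _ => k₀) P := lintegral_const_mul _ hm

lemma ENNReal.sq_add_add_le (a b c : ℝ≥0∞) : (a + b + c) ^ 2 ≤ 3 * (a ^ 2 + b ^ 2 + c ^ 2) := by
  have h1 := ENNReal.two_mul_le_sq_add_sq a b
  have h2 := ENNReal.two_mul_le_sq_add_sq a c
  have h3 := ENNReal.two_mul_le_sq_add_sq b c
  calc (a + b + c) ^ 2 = a ^ 2 + b ^ 2 + c ^ 2 + (2 * (a * b) + 2 * (a * c) + 2 * (b * c))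
      := by ring
    _ ≤ a ^ 2 + b ^ 2 + c ^ 2 + ((a ^ 2 + b ^ 2) + (a ^ 2 + c ^ 2) + (b ^ 2 + c ^ 2)) := by gcongr
    _ = _ := by ring

/-- The size of a function is controlled by its averages over a partition all of whose coarse
cells are far away from the tiles. -/
lemma size_le_of_partition : ∃ C : ℝ≥0, ∀ f : ℝ → ℂ, Integrable f → ∀ q : ℝ → ℤ, Measurable q →
    IsPartition q → ∀ μ : ℝ≥0, (∀ y, ∫⁻ x in cell q y, ‖f x‖ₑ ≤ μ * 2 ^ q y) →
    ∀ S : Finset Tile, (∀ P ∈ S, ∀ y, P.k < q y → 2 ^ q y ≤ |y - P.c|) → SizeLe f S (C * μ) := by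
  obtain ⟨D₁, hD₁⟩ := wp_sub_wp_le
  obtain ⟨D₂, hD₂⟩ := hh_far_le
  obtain ⟨D₃, -, hD₃⟩ := sum_Am_le_of_disjoint
  set B : ℝ≥0∞ := 2 ^ 6 * decMass ^ 2 * (decMass + decMass ^ 2) with hB
  have hBt : B ≠ ⊤ := by have := decMass_ne_top; finiteness
  set C₀ : ℝ≥0∞ := 3 * (D₃ * 4 + D₂ ^ 2 * B + D₁ ^ 2 * B) with hC₀
  have hC₀t : C₀ ≠ ⊤ := by finiteness
  refine ⟨C₀.toNNReal + 1, fun f hf q hq hp μ hμ S hS k n ξ => ?_⟩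
  set T := S.filter fun P => P.I ⊆ DI k n ∧ ξ ∈ P.R with hTdef
  have hT : ∀ P ∈ T, P.I ⊆ DI k n ∧ ξ ∈ P.W := fun P hP =>
    ⟨(Finset.mem_filter.1 hP).2.1, P.R_subset_W (Finset.mem_filter.1 hP).2.2⟩
  set g := cellAvg q ξ f with hg
  have hgi : Integrable g := integrable_cellAvg hq hp hf ξ
  have hgμ : ∀ y, ‖g y‖ₑ ≤ μ := cellAvg_le ξ hμ
  set A : Set ℝ := Metric.closedBall (ctr k n) (2 * 2 ^ k) with hA
  have hAm : MeasurableSet A := measurableSet_closedBall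
  set g₁ := A.indicator g with hg₁
  set g₂ := Aᶜ.indicator g with hg₂
  have hg₁i : Integrable g₁ := hgi.indicator hAm
  have hg₂i : Integrable g₂ := hgi.indicator hAm.compl
  have hsplit : ∀ (k l : ℤ) (z : ℝ), hh g k l z = hh g₁ k l z + hh g₂ k l z := fun k l z => by
    unfold hh cv
    rw [← integral_add (integrable_cv_integrand hg₁i _ z) (integrable_cv_integrand hg₂i _ z)]
    refine integral_congr_ae (Eventually.of_forall fun y => ?_)
    simp only [← add_mul]
    congr 1
    exact (congrFun (Set.indicator_self_add_compl A g) y).symm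
  have e1 : ∑ P ∈ T, Am g₁ P ≤ D₃ * (μ ^ 2 * (4 * 2 ^ k)) := by
    refine (hD₃ g₁ hg₁i T fun P hP P' hP' hk hsub => ?_).trans ?_
    · exact Set.disjoint_left.1 P'.disjoint_L_R (hsub (hT P hP).2) (Finset.mem_filter.1 hP').2.2
    · gcongr
      calc ∫⁻ x, ‖g₁ x‖ₑ ^ 2 ≤ ∫⁻ x, A.indicator (fun _ => (μ : ℝ≥0∞) ^ 2) x := by
            refine lintegral_mono fun x => ?_
            by_cases hx : x ∈ A
            · simp only [hg₁, Set.indicator_of_mem hx]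
              gcongr
              exact hgμ x
            · simp [hg₁, hx]
        _ = μ ^ 2 * (4 * 2 ^ k) := by
            rw [lintegral_indicator hAm, setLIntegral_const, hA, Real.volume_closedBall,
              ← ofReal_two_zpow, show (4 : ℝ≥0∞) = ENNReal.ofReal 4 by simp,
              ← ENNReal.ofReal_mul (by norm_num)]
            ring_nf
  have e2 : ∑ P ∈ T, ∫⁻ z, dec 12 P.k (z - P.c) * ‖hh g₂ P.k P.l z‖ₑ ^ 2 ≤
      (D₂ * μ) ^ 2 * B * 2 ^ k := by
    refine sum_lintegral_le_of_tailMass (q := fun _ => k) measurable_const hT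
      (fun P => hh g₂ P.k P.l) _ fun P hP z => ?_
    refine hD₂ g₂ μ (fun y => ?_) k P (scale_le_of_DI_subset (hT P hP).1) (fun y hy => ?_) z
    · exact (enorm_indicator_le_enorm_self _ _).trans (hgμ y)
    · have hyA : y ∉ A := fun h => hy (by simp [hg₂, h])
      rw [hA, Metric.mem_closedBall, Real.dist_eq, not_le] at hyA
      have hc := abs_sub_ctr_le ((hT P hP).1 (ctr_mem_DI P.k P.n))
      change |P.c - ctr k n| ≤ _ at hc
      have := abs_sub_le y P.c (ctr k n)
      have : (0 : ℝ) < 2 ^ k := by positivity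
      linarith
  have e3 : ∑ P ∈ T, ∫⁻ z, dec 12 P.k (z - P.c) * ‖hh f P.k P.l z - hh g P.k P.l z‖ₑ ^ 2 ≤
      (D₁ * μ) ^ 2 * B * 2 ^ k := by
    refine sum_lintegral_le_of_tailMass hq hT
      (fun P z => hh f P.k P.l z - hh g P.k P.l z) _ fun P hP z => ?_
    exact hh_sub_hh_cellAvg_le hq hp hf ξ hμ P z ENNReal.coe_ne_top
      (hD₁ q hp P ξ (hT P hP).2 (hS P (Finset.mem_filter.1 hP).1) z)
  have hle : ∀ P : Tile, Am f P ≤ 3 * (Am g₁ P +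
      (∫⁻ z, dec 12 P.k (z - P.c) * ‖hh g₂ P.k P.l z‖ₑ ^ 2) +
      ∫⁻ z, dec 12 P.k (z - P.c) * ‖hh f P.k P.l z - hh g P.k P.l z‖ₑ ^ 2) := fun P => by
    have c1 := (continuous_hh hg₁i P.k P.l).measurable
    have c2 := (continuous_hh hg₂i P.k P.l).measurable
    unfold Am
    rw [← lintegral_add_left (by fun_prop), ← lintegral_add_left (by fun_prop),
      ← lintegral_const_mul' _ _ (by finiteness)]
    refine lintegral_mono fun z => ?_
    have : hh f P.k P.l z = hh g₁ P.k P.l z + hh g₂ P.k P.l z +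
        (hh f P.k P.l z - hh g P.k P.l z) := by rw [← hsplit]; ring
    calc dec 12 P.k (z - P.c) * ‖hh f P.k P.l z‖ₑ ^ 2
        ≤ dec 12 P.k (z - P.c) * (‖hh g₁ P.k P.l z‖ₑ + ‖hh g₂ P.k P.l z‖ₑ +
          ‖hh f P.k P.l z - hh g P.k P.l z‖ₑ) ^ 2 := by
          gcongr
          conv_lhs => rw [this]
          exact (enorm_add_le _ _).trans (by gcongr; exact enorm_add_le _ _)
      _ ≤ dec 12 P.k (z - P.c) * _ := mul_le_mul_right (ENNReal.sq_add_add_le _ _ _) _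
      _ = _ := by ring
  calc ∑ P ∈ T, Am f P ≤ ∑ P ∈ T, 3 * (Am g₁ P +
      (∫⁻ z, dec 12 P.k (z - P.c) * ‖hh g₂ P.k P.l z‖ₑ ^ 2) +
      ∫⁻ z, dec 12 P.k (z - P.c) * ‖hh f P.k P.l z - hh g P.k P.l z‖ₑ ^ 2) :=
        Finset.sum_le_sum fun P _ => hle P
    _ ≤ 3 * (D₃ * (μ ^ 2 * (4 * 2 ^ k)) + (D₂ * μ) ^ 2 * B * 2 ^ k + (D₁ * μ) ^ 2 * B * 2 ^ k) := by
        rw [← Finset.mul_sum, Finset.sum_add_distrib, Finset.sum_add_distrib]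
        gcongr
    _ = C₀ * (μ ^ 2 * 2 ^ k) := by rw [hC₀]; ring
    _ ≤ (C₀ + 1) ^ 2 * (μ ^ 2 * 2 ^ k) := by
        refine mul_le_mul_left ?_ _
        calc C₀ ≤ C₀ + (C₀ ^ 2 + C₀ + 1) := le_self_add
          _ = (C₀ + 1) ^ 2 := by ring
    _ = ((C₀.toNNReal + 1) * μ : ℝ≥0) ^ 2 * 2 ^ k := by
        push_cast
        rw [ENNReal.coe_toNNReal hC₀t]
        ring

/-! ### The partition adapted to the density of a set -/

/-- The dyadic interval of scale `k` around `y` has a large portion in `F`. -/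
def Heavy (F : Set ℝ) (μ : ℝ≥0) (k : ℤ) (y : ℝ) : Prop :=
  μ * 2 ^ k < volume (F ∩ DI k (dy k y))

lemma Heavy.congr {F : Set ℝ} {μ : ℝ≥0} {k : ℤ} {y y' : ℝ} (h : Heavy F μ k y)
    (hy : dy k y = dy k y') : Heavy F μ k y' := by
  unfold Heavy at *
  rwa [← hy]

lemma exists_heavy_bound {F : Set ℝ} (hF : volume F ≠ ⊤) {μ : ℝ≥0} (hμ : 0 < μ) :
    ∃ K : ℤ, ∀ k y, Heavy F μ k y → k ≤ K := by
  obtain ⟨n, hn⟩ := pow_unbounded_of_one_lt (volume F / μ).toNNReal one_lt_two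
  refine ⟨n, fun k y h => ?_⟩
  by_contra! hk
  have h1 : μ * (2 : ℝ≥0∞) ^ (n : ℤ) ≤ volume F :=
    (mul_le_mul_right (two_zpow_mono hk.le) _).trans (h.le.trans (measure_mono inter_subset_left))
  have hμ0 : (μ : ℝ≥0∞) ≠ 0 := by exact_mod_cast hμ.ne'
  have h2 : (2 : ℝ≥0∞) ^ (n : ℤ) ≤ volume F / μ := by
    rw [ENNReal.le_div_iff_mul_le (Or.inl hμ0) (Or.inl ENNReal.coe_ne_top), mul_comm]
    exact h1
  have h3 : volume F / μ < (2 : ℝ≥0∞) ^ (n : ℤ) := by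
    rw [← ENNReal.coe_toNNReal (ENNReal.div_ne_top hF hμ0), zpow_natCast]
    exact_mod_cast hn
  exact absurd h2 (not_le.2 h3)

/-- The three consecutive dyadic intervals around `DI k m`. -/
def triple (k m : ℤ) : Set ℝ := {x | |dy k x - m| ≤ 1}

lemma triple_subset (k m : ℤ) : triple k m ⊆ DI k (m - 1) ∪ DI k m ∪ DI k (m + 1) := by
  intro x hx
  simp only [triple, Set.mem_ofPred_eq, abs_le] at hx
  simp only [Set.mem_union, mem_DI]
  omega

lemma measurableSet_triple (k m : ℤ) : MeasurableSet (triple k m) :=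
  measurable_dy k (MeasurableSet.of_discrete (s := {j | |j - m| ≤ 1}))

lemma volume_triple_le (k m : ℤ) : volume (triple k m) ≤ 3 * 2 ^ k := by
  refine (measure_mono (triple_subset k m)).trans ((measure_union_le _ _).trans ?_)
  refine (add_le_add_left (measure_union_le _ _) _).trans ?_
  rw [volume_DI, volume_DI, volume_DI]
  refine le_of_eq ?_
  ring

lemma two_zpow_le_abs_sub {k m j : ℤ} {y c : ℝ} (hy : y ∈ DI k m) (hc : c ∈ DI k j)
    (h : 1 < |j - m|) : 2 ^ k ≤ |y - c| := by
  rw [DI_eq_Ico] at hy hc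
  have h2 : (0 : ℝ) < 2 ^ k := by positivity
  rcases lt_abs.1 h with h | h
  · have : (m : ℝ) + 2 ≤ j := by exact_mod_cast (by omega : m + 2 ≤ j)
    rw [abs_sub_comm]
    refine le_trans ?_ (le_abs_self _)
    nlinarith [hy.2, hc.1]
  · have : (j : ℝ) + 2 ≤ m := by exact_mod_cast (by omega : j + 2 ≤ m)
    refine le_trans ?_ (le_abs_self _)
    nlinarith [hy.1, hc.2]

lemma exists_partition {F : Set ℝ} (hF : MeasurableSet F) (hFt : volume F ≠ ⊤) {μ : ℝ≥0}
    (hμ : 0 < μ) (L : ℤ) : ∃ (q : ℝ → ℤ) (Ω : Set ℝ), Measurable q ∧ IsPartition q ∧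
      MeasurableSet Ω ∧ (∀ y, volume (F ∩ cell q y) ≤ (2 * μ : ℝ≥0) * 2 ^ q y) ∧
      μ * volume Ω ≤ 3 * volume F ∧ (1 ≤ μ → Ω = ∅) ∧
      ∀ P : Tile, L ≤ P.k → ¬ P.I ⊆ Ω → ∀ y, P.k < q y → 2 ^ q y ≤ |y - P.c| := by
  obtain ⟨K, hK⟩ := exists_heavy_bound hFt hμ
  set s : ℝ → Finset ℤ := fun y => insert L ((Finset.Icc L K).filter fun k => Heavy F μ k y) with hs
  have hne : ∀ y, (s y).Nonempty := fun y => Finset.insert_nonempty _ _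
  set q : ℝ → ℤ := fun y => (s y).max' (hne y) with hq
  have hLq : ∀ y, L ≤ q y := fun y => Finset.le_max' _ _ (Finset.mem_insert_self _ _)
  have hqle : ∀ y k, L ≤ k → Heavy F μ k y → k ≤ q y := fun y k hk h =>
    Finset.le_max' _ _ (Finset.mem_insert_of_mem (Finset.mem_filter.2
      ⟨Finset.mem_Icc.2 ⟨hk, hK k y h⟩, h⟩))
  have hqmem : ∀ y, q y = L ∨ Heavy F μ (q y) y := fun y => by
    rcases Finset.mem_insert.1 (Finset.max'_mem (s y) (hne y)) with h | h
    · exact Or.inl h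
    · exact Or.inr (Finset.mem_filter.1 h).2
  have hpart : IsPartition q := fun y y' hy => by
    have hy : dy (q y) y' = dy (q y) y := hy
    refine le_antisymm ?_ ?_
    · by_contra! hlt
      rcases hqmem y' with h | h
      · exact absurd (hLq y) (by omega)
      · exact absurd (hqle y _ (hLq y') (h.congr (dy_eq_of_le hlt.le hy))) (by omega)
    · rcases hqmem y with h | h
      · rw [h]; exact hLq y'
      · exact hqle y' _ (hLq y) (h.congr hy.symm)
  have hqm : Measurable q := by
    refine measurable_of_Iic fun j => ?_
    have : q ⁻¹' Iic j = {y | L ≤ j ∧ ∀ k ∈ Finset.Icc L K, Heavy F μ k y → k ≤ j} := by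
      ext y
      simp only [Set.mem_preimage, Set.mem_Iic, Set.mem_ofPred_eq]
      constructor
      · exact fun h => ⟨(hLq y).trans h, fun k hk hh => (hqle y k (Finset.mem_Icc.1 hk).1 hh).trans
            h⟩
      · rintro ⟨h1, h2⟩
        refine Finset.max'_le _ _ _ fun k hk => ?_
        rcases Finset.mem_insert.1 hk with h | h
        · rwa [h]
        · exact h2 k (Finset.mem_filter.1 h).1 (Finset.mem_filter.1 h).2
    rw [this]
    refine MeasurableSet.inter (MeasurableSet.const _) ?_
    have : {y | ∀ k ∈ Finset.Icc L K, Heavy F μ k y → k ≤ j} =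
        ⋂ k ∈ Finset.Icc L K, {y | Heavy F μ k y → k ≤ j} := by ext y; simp
    change MeasurableSet {y | ∀ k ∈ Finset.Icc L K, Heavy F μ k y → k ≤ j}
    rw [this]
    refine Finset.measurableSet_biInter _ fun k _ => ?_
    exact measurable_dy k
      (MeasurableSet.of_discrete (s := {m | μ * 2 ^ k < volume (F ∩ DI k m) → k ≤ j}))
  set 𝒬 : Set (ℤ × ℤ) := {j | ∃ y, q y = j.1 ∧ dy j.1 y = j.2 ∧ Heavy F μ j.1 y} with h𝒬
  refine ⟨q, ⋃ j : 𝒬, triple j.1.1 j.1.2, hqm, hpart,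
    MeasurableSet.iUnion fun j => measurableSet_triple _ _, fun y => ?_, ?_, fun h1 => ?_, ?_⟩
  · have hn : ¬ Heavy F μ (q y + 1) y := fun h =>
      absurd (hqle y _ (by have := hLq y; omega) h) (by omega)
    unfold Heavy at hn
    rw [not_lt] at hn
    calc volume (F ∩ cell q y) ≤ volume (F ∩ DI (q y + 1) (dy (q y + 1) y)) :=
          measure_mono (inter_subset_inter_right _
            (DI_subset_of_mem (x := y) (by omega) rfl rfl))
      _ ≤ μ * 2 ^ (q y + 1) := hn
      _ = (2 * μ : ℝ≥0) * 2 ^ q y := by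
          rw [two_zpow_add, zpow_one]
          push_cast
          ring
  · calc μ * volume (⋃ j : 𝒬, triple j.1.1 j.1.2)
        ≤ μ * ∑' j : 𝒬, volume (triple j.1.1 j.1.2) := by gcongr; exact measure_iUnion_le _
      _ = ∑' j : 𝒬, μ * volume (triple j.1.1 j.1.2) := ENNReal.tsum_mul_left.symm
      _ ≤ ∑' j : 𝒬, 3 * volume (F ∩ DI j.1.1 j.1.2) := by
          refine ENNReal.tsum_le_tsum fun j => ?_
          obtain ⟨y, -, hy, hh⟩ := j.2
          unfold Heavy at hh
          rw [hy] at hh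
          calc μ * volume (triple j.1.1 j.1.2) ≤ μ * (3 * 2 ^ j.1.1) := by
                gcongr; exact volume_triple_le _ _
            _ = 3 * (μ * 2 ^ j.1.1) := by ring
            _ ≤ _ := by gcongr
      _ = 3 * volume (⋃ j : 𝒬, F ∩ DI j.1.1 j.1.2) := by
          rw [ENNReal.tsum_mul_left, measure_iUnion _ fun j => hF.inter (measurableSet_DI _ _)]
          rintro ⟨j, y, hy1, hy2, hh⟩ ⟨j', y', hy1', hy2', hh'⟩ hjj
          refine Set.disjoint_left.2 fun x hx hx' => hjj ?_
          have h1 : x ∈ cell q y := by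
            rw [cell, hy1, hy2]; exact hx.2
          have h2 : x ∈ cell q y' := by
            rw [cell, hy1', hy2']; exact hx'.2
          have h3 : j.1 = j'.1 := by rw [← hy1, ← hy1', ← hpart _ _ h1, ← hpart _ _ h2]
          have h4 : j.2 = j'.2 := by
            have e1 : dy j.1 x = j.2 := hx.2
            have e2 : dy j'.1 x = j'.2 := hx'.2
            rw [← e1, ← e2, h3]
          exact Subtype.ext (Prod.ext h3 h4)
      _ ≤ 3 * volume F := by
          gcongr
          exact Set.iUnion_subset fun j => inter_subset_left
  · refine Set.iUnion_eq_empty.2 fun j => ?_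
    obtain ⟨y, -, -, hh⟩ := j.2
    refine absurd (measure_mono inter_subset_right) (not_le.2 (lt_of_le_of_lt ?_ hh))
    rw [volume_DI]
    exact le_mul_of_one_le_left' (by exact_mod_cast h1)
  · intro P hPL hPI y hy
    obtain ⟨x, hx, hxΩ⟩ := Set.not_subset.1 hPI
    have hh : Heavy F μ (q y) y := (hqmem y).resolve_left (by omega)
    have hnt : x ∉ triple (q y) (dy (q y) y) := fun h =>
      hxΩ (Set.mem_iUnion.2 ⟨⟨(q y, dy (q y) y), y, rfl, rfl, hh⟩, h⟩)
    have hc : P.c ∈ DI (q y) (dy (q y) x) :=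
      DI_subset_of_mem hy.le hx rfl (ctr_mem_DI P.k P.n)
    refine two_zpow_le_abs_sub (m := dy (q y) y) rfl hc ?_
    simpa [triple] using hnt

/-! ### Combining the mass and energy decompositions -/

lemma exists_geom {a : ℝ} (ha : 0 < a) : ∃ c : ℝ≥0, 1 + c * (2⁻¹ : ℝ≥0) ^ a ≤ c := by
  have h1 : (2⁻¹ : ℝ) ^ a < 1 := Real.rpow_lt_one (by positivity) (by norm_num) ha
  have h2 : 0 < 1 - (2⁻¹ : ℝ) ^ a := by linarith
  refine ⟨Real.toNNReal (1 - (2⁻¹ : ℝ) ^ a)⁻¹, ?_⟩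
  rw [← NNReal.coe_le_coe]
  push_cast
  rw [Real.coe_toNNReal _ (by positivity)]
  have h3 := mul_inv_cancel₀ h2.ne'
  linarith

lemma le_of_forall_le_add_half_pow {X A B : ℝ≥0∞} (hB : B ≠ ⊤)
    (h : ∀ M : ℕ, X ≤ A + B * 2⁻¹ ^ M) : X ≤ A := by
  have h1 : Tendsto (fun M : ℕ => A + B * 2⁻¹ ^ M) atTop (𝓝 (A + B * 0)) :=
    tendsto_const_nhds.add (ENNReal.Tendsto.const_mul
      (ENNReal.tendsto_pow_atTop_nhds_zero_of_lt_one (by norm_num)) (Or.inr hB))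
  rw [mul_zero, add_zero] at h1
  exact ge_of_tendsto' h1 h

lemma ENNReal.half_rpow (x : ℝ≥0∞) {a : ℝ} (ha : 0 ≤ a) :
    (x * 2⁻¹) ^ a = x ^ a * ((2⁻¹ : ℝ≥0) ^ a : ℝ≥0) := by
  rw [ENNReal.mul_rpow_of_nonneg _ _ ha, ENNReal.coe_rpow_of_nonneg _ ha,
    ENNReal.coe_inv two_ne_zero]
  rfl

lemma le_interpolate {θ : ℝ} (h0 : 0 < θ) (h1 : θ < 1) {X A B δ σ φ e : ℝ≥0∞} (hσ : σ ≠ 0)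
    (hσt : σ ≠ ⊤) (hA : X ≤ A * δ * σ⁻¹ * φ) (hB : X ≤ B * σ * e) :
    X ≤ A ^ θ * B ^ (1 - θ) * (δ ^ θ * φ ^ θ * e ^ (1 - θ)) * σ ^ (1 - 2 * θ) := by
  have h1' : 0 ≤ 1 - θ := by linarith
  calc X = X ^ θ * X ^ (1 - θ) := by
        rw [← ENNReal.rpow_add_of_nonneg _ _ h0.le h1', add_sub_cancel, ENNReal.rpow_one]
    _ ≤ (A * δ * σ⁻¹ * φ) ^ θ * (B * σ * e) ^ (1 - θ) := by gcongr
    _ = A ^ θ * B ^ (1 - θ) * (δ ^ θ * φ ^ θ * e ^ (1 - θ)) * (σ ^ (-θ) * σ ^ (1 - θ)) := by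
        simp only [ENNReal.mul_rpow_of_nonneg _ _ h0.le, ENNReal.mul_rpow_of_nonneg _ _ h1',
          ENNReal.inv_rpow, ENNReal.rpow_neg]
        ring
    _ = _ := by
        rw [← ENNReal.rpow_add _ _ hσ hσt]
        ring_nf

lemma setLIntegral_tileSum_le (N : ℝ → ℝ) (hN : Measurable N) {f : ℝ → ℂ} (hf : Integrable f)
    (E : Set ℝ) {S T : Finset Tile} (h : T ⊆ S) :
    ∫⁻ x in E, ‖tileSum N f S x‖ₑ ≤
      (∫⁻ x in E, ‖tileSum N f T x‖ₑ) + ∫⁻ x in E, ‖tileSum N f (S \ T) x‖ₑ := by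
  rw [← lintegral_add_left (measurable_tileSum hN hf T).enorm]
  refine lintegral_mono fun x => ?_
  dsimp only
  rw [tileSum_add_sdiff N f h x]
  exact enorm_add_le _ _

/-- The estimate for tiles of comparable density. -/
lemma comparable_dens_estimate {θ : ℝ} (h0 : 0 < θ) (h1 : θ < 1 / 2) : ∃ C : ℝ≥0, ∀ f : ℝ → ℂ,
    Integrable f → ∀ N : ℝ → ℝ, Measurable N → ∀ E : Set ℝ, MeasurableSet E → volume E ≠ ⊤ →
    ∀ (δ σ : ℝ≥0), δ ≠ 0 → σ ≠ 0 → ∀ S : Finset Tile, TileConvex S → SizeLe f S σ →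
    (∀ P ∈ S, dens N E P ≤ δ ∧ δ * 2⁻¹ < dens N E P) →
    ∫⁻ x in E, ‖tileSum N f S x‖ₑ ≤
      C * (δ ^ θ * (∫⁻ x, ‖f x‖ₑ ^ 2) ^ θ * volume E ^ (1 - θ)) * σ ^ (1 - 2 * θ) := by
  obtain ⟨C₀, hC₀⟩ := cover_estimate
  obtain ⟨C₁, hC₁⟩ := energy_lemma
  obtain ⟨c, hc⟩ := exists_geom (a := 1 - 2 * θ) (by linarith)
  set K : ℝ≥0∞ := (C₀ * C₁) ^ θ * (C₀ * 2) ^ (1 - θ) with hK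
  have hKt : K ≠ ⊤ := by
    refine ENNReal.mul_ne_top (ENNReal.rpow_ne_top_of_nonneg h0.le (by finiteness))
      (ENNReal.rpow_ne_top_of_nonneg (by linarith) (by finiteness))
  refine ⟨K.toNNReal * c, fun f hf N hN E hE hEt δ σ hδ hσ S hS hSσ hSd => ?_⟩
  set φ := ∫⁻ x, ‖f x‖ₑ ^ 2 with hφ
  set Y : ℝ≥0∞ := (δ : ℝ≥0∞) ^ θ * φ ^ θ * volume E ^ (1 - θ) with hY
  have hδ' : (δ : ℝ≥0∞) ≠ 0 := by exact_mod_cast hδ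
  have hcov : ∀ (σ : ℝ≥0) (S : Finset Tile), TileConvex S → SizeLe f S σ →
      (∀ P ∈ S, dens N E P ≤ δ ∧ δ * 2⁻¹ < dens N E P) → ∀ J, Covers J S →
      ∫⁻ x in E, ‖tileSum N f S x‖ₑ ≤ C₀ * (δ * σ * lenSum J) :=
    fun σ S hS hSσ hSd J hJ => hC₀ f hf N hN E hE J S hS σ hSσ δ
      (fun Q hQ => (volume_le_dens N E Q).trans (mul_le_mul_left (hSd Q hQ).1 _)) hJ
  have hmass : ∀ (σ : ℝ≥0) (S : Finset Tile), TileConvex S → SizeLe f S σ →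
      (∀ P ∈ S, dens N E P ≤ δ ∧ δ * 2⁻¹ < dens N E P) →
      ∫⁻ x in E, ‖tileSum N f S x‖ₑ ≤ (C₀ * 2) * σ * volume E := fun σ S hS hSσ hSd => by
    obtain ⟨J, hJ, hJE⟩ := dens_cover hN hE S (δ * 2⁻¹) fun P hP => (hSd P hP).2
    refine (hcov σ S hS hSσ hSd J hJ).trans ?_
    calc C₀ * (δ * σ * lenSum J) = C₀ * σ * (δ * lenSum J) := by ring
      _ = C₀ * σ * (δ * lenSum J) * (2 * 2⁻¹) := by
          rw [ENNReal.mul_inv_cancel two_ne_zero (by norm_num), mul_one]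
      _ = (C₀ * 2) * σ * (δ * 2⁻¹ * lenSum J) := by ring
      _ ≤ _ := by gcongr
  have key : ∀ (M : ℕ) (σ : ℝ≥0) (S : Finset Tile), σ ≠ 0 → TileConvex S → SizeLe f S σ →
      (∀ P ∈ S, dens N E P ≤ δ ∧ δ * 2⁻¹ < dens N E P) →
      ∫⁻ x in E, ‖tileSum N f S x‖ₑ ≤
        K * c * Y * σ ^ (1 - 2 * θ) + (C₀ * 2) * σ * volume E * 2⁻¹ ^ M := by
    intro M
    induction M with
    | zero =>
      intro σ S _ hS hSσ hSd
      refine (hmass σ S hS hSσ hSd).trans ?_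
      rw [pow_zero, mul_one]
      exact le_add_self
    | succ M ih =>
      intro σ S hσ hS hSσ hSd
      have hσ' : (σ : ℝ≥0∞) ≠ 0 := by exact_mod_cast hσ
      obtain ⟨J, S', hS', hS'σ, hdown, hJ, hJe⟩ := hC₁ f hf σ S hSσ
      have hT : S \ S' ⊆ S := Finset.sdiff_subset
      have hTc : TileConvex (S \ S') := hS.down hT hdown
      have hS'c : TileConvex S' := by
        have := hS.sdiff hdown
        rwa [Finset.sdiff_sdiff_eq_self hS'] at this
      have hTd := fun P hP => hSd P (hT hP)
      have hTle : ∫⁻ x in E, ‖tileSum N f (S \ S') x‖ₑ ≤ K * Y * σ ^ (1 - 2 * θ) := by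
        refine le_interpolate h0 (by linarith) hσ' ENNReal.coe_ne_top ?_
          (hmass σ _ hTc (hSσ.mono hT) hTd)
        refine (hcov σ _ hTc (hSσ.mono hT) hTd J hJ).trans ?_
        calc C₀ * (δ * σ * lenSum J) = C₀ * δ * (σ * lenSum J) * (σ * (σ : ℝ≥0∞)⁻¹) := by
              rw [ENNReal.mul_inv_cancel hσ' ENNReal.coe_ne_top]; ring
          _ = C₀ * δ * (σ : ℝ≥0∞)⁻¹ * (σ ^ 2 * lenSum J) := by ring
          _ ≤ C₀ * δ * (σ : ℝ≥0∞)⁻¹ * (C₁ * φ) := by gcongr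
          _ = _ := by ring
      have hS'le := ih (σ / 2) S' (by simp [hσ]) hS'c hS'σ fun P hP => hSd P (hS' hP)
      have hhalf : ((σ / 2 : ℝ≥0) : ℝ≥0∞) = σ * 2⁻¹ := by
        rw [div_eq_mul_inv, ENNReal.coe_mul, ENNReal.coe_inv two_ne_zero]
        rfl
      rw [hhalf, ENNReal.half_rpow _ (by linarith)] at hS'le
      calc ∫⁻ x in E, ‖tileSum N f S x‖ₑ ≤ _ := setLIntegral_tileSum_le N hN hf E hS'
        _ ≤ (K * c * Y * (σ ^ (1 - 2 * θ) * ((2⁻¹ : ℝ≥0) ^ (1 - 2 * θ) : ℝ≥0)) +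
              (C₀ * 2) * (σ * 2⁻¹) * volume E * 2⁻¹ ^ M) + K * Y * σ ^ (1 - 2 * θ) :=
            add_le_add hS'le hTle
        _ = K * Y * σ ^ (1 - 2 * θ) * (1 + c * (2⁻¹ : ℝ≥0) ^ (1 - 2 * θ) : ℝ≥0) +
              (C₀ * 2) * σ * volume E * 2⁻¹ ^ (M + 1) := by push_cast; ring
        _ ≤ K * Y * σ ^ (1 - 2 * θ) * c + (C₀ * 2) * σ * volume E * 2⁻¹ ^ (M + 1) := by
            gcongr
        _ = _ := by ring
  have := le_of_forall_le_add_half_pow (by finiteness) fun M => key M σ S hσ hS hSσ hSd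
  rw [ENNReal.coe_mul, ENNReal.coe_toNNReal hKt]
  exact this

/-- The trivial cover of a finite family of tiles. -/
def selfCover (S : Finset Tile) : List ((ℤ × ℤ) × ℝ) :=
  S.toList.map fun P => ((P.k, P.n), (P.l : ℝ) * 2 ^ (-P.k))

lemma covers_selfCover (S : Finset Tile) : Covers (selfCover S) S := fun P hP =>
  ⟨((P.k, P.n), (P.l : ℝ) * 2 ^ (-P.k)), List.mem_map.2 ⟨P, Finset.mem_toList.2 hP, rfl⟩,
    subset_rfl, left_mem_DI (-P.k) P.l⟩

lemma lenSum_selfCover (S : Finset Tile) : lenSum (selfCover S) = ∑ P ∈ S, (2 : ℝ≥0∞) ^ P.k := by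
  simp only [lenSum, selfCover, List.map_map]
  exact Finset.sum_map_toList S fun P : Tile => (2 : ℝ≥0∞) ^ P.k

/-- The main estimate for sums of tiles. -/
lemma tileSum_estimate {θ : ℝ} (h0 : 0 < θ) (h1 : θ < 1 / 2) : ∃ C : ℝ≥0, ∀ f : ℝ → ℂ,
    Integrable f → ∀ N : ℝ → ℝ, Measurable N → ∀ E : Set ℝ, MeasurableSet E → volume E ≠ ⊤ →
    ∀ σ : ℝ≥0, σ ≠ 0 → ∀ S : Finset Tile, TileConvex S → SizeLe f S σ →
    ∫⁻ x in E, ‖tileSum N f S x‖ₑ ≤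
      C * ((∫⁻ x, ‖f x‖ₑ ^ 2) ^ θ * volume E ^ (1 - θ) * σ ^ (1 - 2 * θ)) := by
  obtain ⟨C₀, hC₀⟩ := cover_estimate
  obtain ⟨C₁, hC₁⟩ := comparable_dens_estimate h0 h1
  obtain ⟨c, hc⟩ := exists_geom h0
  refine ⟨C₁ * c, fun f hf N hN E hE hEt σ hσ S hS hSσ => ?_⟩
  set Y : ℝ≥0∞ := (∫⁻ x, ‖f x‖ₑ ^ 2) ^ θ * volume E ^ (1 - θ) * σ ^ (1 - 2 * θ) with hY
  set Λ : ℝ≥0∞ := C₀ * (σ * ∑ P ∈ S, (2 : ℝ≥0∞) ^ P.k) with hΛ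
  have hΛt : Λ ≠ ⊤ := ENNReal.mul_ne_top ENNReal.coe_ne_top (ENNReal.mul_ne_top ENNReal.coe_ne_top
    (ENNReal.sum_ne_top.2 fun P _ => two_zpow_ne_top _))
  have key : ∀ (M : ℕ) (δ : ℝ≥0), δ ≠ 0 → ∀ S' ⊆ S, TileConvex S' → (∀ P ∈ S', dens N E P ≤ δ) →
      ∫⁻ x in E, ‖tileSum N f S' x‖ₑ ≤ C₁ * c * Y * δ ^ θ + δ * Λ * 2⁻¹ ^ M := by
    intro M
    induction M with
    | zero =>
      intro δ _ S' hS' hS'c hd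
      refine (hC₀ f hf N hN E hE _ S' hS'c σ (hSσ.mono hS') δ (fun Q hQ =>
        (volume_le_dens N E Q).trans (mul_le_mul_left (hd Q hQ) _)) (covers_selfCover S')).trans ?_
      rw [lenSum_selfCover, pow_zero, mul_one]
      calc C₀ * (δ * σ * ∑ P ∈ S', (2 : ℝ≥0∞) ^ P.k) ≤ C₀ * (δ * σ * ∑ P ∈ S, (2 : ℝ≥0∞) ^ P.k) :=
          by
            gcongr
        _ = δ * Λ := by rw [hΛ]; ring
        _ ≤ _ := le_add_self
    | succ M ih =>
      intro δ hδ S' hS' hS'c hd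
      set T := S'.filter fun P => δ * 2⁻¹ < dens N E P with hT
      have hTS : T ⊆ S' := Finset.filter_subset _ _
      have hdown : ∀ P ∈ S', ∀ Q ∈ T, P.Le Q → P ∈ T := fun P hP Q hQ hPQ =>
        Finset.mem_filter.2 ⟨hP, (Finset.mem_filter.1 hQ).2.trans_le (dens_anti N E hPQ)⟩
      have e1 := hC₁ f hf N hN E hE hEt δ σ hδ hσ T (hS'c.down hTS hdown)
        (hSσ.mono (hTS.trans hS')) fun P hP => ⟨hd P (hTS hP), (Finset.mem_filter.1 hP).2⟩
      have hhalf : ((δ / 2 : ℝ≥0) : ℝ≥0∞) = δ * 2⁻¹ := by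
        rw [div_eq_mul_inv, ENNReal.coe_mul, ENNReal.coe_inv two_ne_zero]
        rfl
      have e2 := ih (δ / 2) (by simp [hδ]) (S' \ T) (Finset.sdiff_subset.trans hS')
        (hS'c.sdiff hdown) fun P hP => by
          rw [hhalf]
          have := (Finset.mem_sdiff.1 hP)
          by_contra! h
          exact this.2 (Finset.mem_filter.2 ⟨this.1, h⟩)
      rw [hhalf, ENNReal.half_rpow _ h0.le] at e2
      calc ∫⁻ x in E, ‖tileSum N f S' x‖ₑ ≤ _ := setLIntegral_tileSum_le N hN hf E hTS
        _ ≤ _ := add_le_add e1 e2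
        _ = C₁ * Y * δ ^ θ * (1 + c * (2⁻¹ : ℝ≥0) ^ θ : ℝ≥0) + δ * Λ * 2⁻¹ ^ (M + 1) := by
            rw [hY]; push_cast; ring
        _ ≤ C₁ * Y * δ ^ θ * c + δ * Λ * 2⁻¹ ^ (M + 1) := by gcongr
        _ = _ := by ring
  have := le_of_forall_le_add_half_pow (by finiteness) fun M =>
    key M 1 one_ne_zero S subset_rfl hS fun P _ => by exact_mod_cast dens_le_one N E P
  rw [ENNReal.coe_one, ENNReal.one_rpow, mul_one] at this
  exact_mod_cast this

/-! ### The dyadic model of the Carleson operator -/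

/-- The truncated model operator with frequency `η`. -/
def modelOp (K : ℕ) (f : ℝ → ℂ) (η x : ℝ) : ℂ :=
  ∑ k ∈ Finset.Icc (-(K : ℤ)) K,
    if dy (-k - 1) η = 2 * dy (-k) η + 1 then hh f k (dy (-k) η) x else 0

lemma finite_dy_image (k : ℤ) {E : Set ℝ} (hE : Bornology.IsBounded E) : (dy k '' E).Finite := by
  obtain ⟨R, hR⟩ := hE.subset_closedBall 0
  refine (Set.finite_Icc (dy k (-R)) (dy k R)).subset ?_
  rintro _ ⟨x, hx, rfl⟩
  have h := hR hx
  rw [Metric.mem_closedBall, dist_zero_right, Real.norm_eq_abs, abs_le] at h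
  unfold dy
  exact ⟨Int.floor_le_floor (by gcongr; exact h.1), Int.floor_le_floor (by gcongr; exact h.2)⟩

lemma finite_tiles (K : ℕ) {E : Set ℝ} (hE : Bornology.IsBounded E) {N : ℝ → ℝ}
    (hN : (range N).Finite) : {P : Tile | |P.k| ≤ K ∧ (P.I ∩ E).Nonempty ∧
      (P.W ∩ range N).Nonempty}.Finite := by
  have h : (⋃ k ∈ Set.Icc (-(K : ℤ)) K, (fun p : ℤ × ℤ => (⟨k, p.1, p.2⟩ : Tile)) ''
      ((dy k '' E) ×ˢ (dy (-k) '' range N))).Finite :=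
    (Set.finite_Icc _ _).biUnion fun k _ =>
      ((finite_dy_image k hE).prod (hN.image _)).image _
  refine h.subset ?_
  rintro ⟨k, n, l⟩ ⟨hk, ⟨x, hx, hxE⟩, ⟨ξ, hξ, hξN⟩⟩
  simp only [Set.mem_iUnion]
  exact ⟨k, abs_le.1 hk, (n, l), ⟨⟨x, hxE, hx⟩, ⟨ξ, hξN, hξ⟩⟩, rfl⟩

/-- The tiles meeting a set whose frequency interval meets the range of `N`. -/
def allTiles (K : ℕ) {E : Set ℝ} (hE : Bornology.IsBounded E) {N : ℝ → ℝ}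
    (hN : (range N).Finite) : Finset Tile := (finite_tiles K hE hN).toFinset

lemma mem_allTiles {K : ℕ} {E : Set ℝ} {hE : Bornology.IsBounded E} {N : ℝ → ℝ}
    {hN : (range N).Finite} {P : Tile} : P ∈ allTiles K hE hN ↔
      |P.k| ≤ K ∧ (P.I ∩ E).Nonempty ∧ (P.W ∩ range N).Nonempty := by
  unfold allTiles
  rw [Set.Finite.mem_toFinset]
  rfl

lemma tileConvex_allTiles (K : ℕ) {E : Set ℝ} (hE : Bornology.IsBounded E) {N : ℝ → ℝ}
    (hN : (range N).Finite) : TileConvex (allTiles K hE hN) := by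
  intro P hP Q hQ P' h1 h2
  rw [mem_allTiles] at hP hQ ⊢
  have hk1 := scale_le_of_DI_subset h1.1
  have hk2 := scale_le_of_DI_subset h2.1
  exact ⟨abs_le.2 ⟨(abs_le.1 hP.1).1.trans hk1, hk2.trans (abs_le.1 hQ.1).2⟩,
    hP.2.1.mono (Set.inter_subset_inter_left _ h1.1),
    hQ.2.2.mono (Set.inter_subset_inter_left _ h2.2)⟩

lemma tileSum_allTiles (K : ℕ) {E : Set ℝ} (hE : Bornology.IsBounded E) {N : ℝ → ℝ}
    (hN : (range N).Finite) (f : ℝ → ℂ) {x : ℝ} (hx : x ∈ E) :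
    tileSum N f (allTiles K hE hN) x = modelOp K f (N x) x := by
  unfold tileSum modelOp
  rw [← Finset.sum_fiberwise_of_maps_to (t := Finset.Icc (-(K : ℤ)) K) (g := Tile.k)
    (fun P hP => Finset.mem_Icc.2 (abs_le.1 (mem_allTiles.1 hP).1))]
  refine Finset.sum_congr rfl fun k hk => ?_
  have hmem : tileAt (N x) k x ∈ (allTiles K hE hN).filter fun P => P.k = k :=
    Finset.mem_filter.2 ⟨mem_allTiles.2 ⟨abs_le.2 (Finset.mem_Icc.1 hk), ⟨x, mem_tileAt_I _ _ _,
        hx⟩,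
      ⟨N x, mem_tileAt_W _ _ _, ⟨x, rfl⟩⟩⟩, rfl⟩
  rw [Finset.sum_eq_single_of_mem _ hmem]
  · unfold tt
    by_cases h : dy (-k - 1) (N x) = 2 * dy (-k) (N x) + 1
    · rw [if_pos h, Set.indicator_of_mem]
      · rfl
      · exact ⟨mem_tileAt_I _ _ _, h⟩
    · rw [if_neg h, Set.indicator_of_notMem]
      exact fun h' => h h'.2
  · intro P hP hne
    refine Set.indicator_of_notMem (fun h => hne ?_) _
    have h2 := eq_tileAt h.1 (Tile.R_subset_W P h.2)
    rwa [(Finset.mem_filter.1 hP).2] at h2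

lemma measurable_modelOp_comp (K : ℕ) {f : ℝ → ℂ} (hf : Integrable f) {N : ℝ → ℝ}
    (hN : Measurable N) : Measurable fun x => modelOp K f (N x) x := by
  unfold modelOp
  have key : ∀ k : ℤ, Measurable fun x =>
      if dy (-k - 1) (N x) = 2 * dy (-k) (N x) + 1 then hh f k (dy (-k) (N x)) x else 0 := by
    intro k
    have h1 : Measurable fun p : ℤ × ℝ => hh f k p.1 p.2 :=
      measurable_from_prod_countable_right fun l => (continuous_hh hf k l).measurable
    have h3 : Measurable fun x => dy (-k) (N x) := (measurable_dy (-k)).comp hN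
    have h2 : Measurable fun x => hh f k (dy (-k) (N x)) x :=
      h1.comp (f := fun x => (dy (-k) (N x), x)) (h3.prodMk measurable_id)
    have h4 : Measurable fun x => 2 * dy (-k) (N x) + 1 := (h3.const_mul 2).add_const 1
    have h6 : Measurable fun x => dy (-k - 1) (N x) := (measurable_dy (-k - 1)).comp hN
    have h5 : MeasurableSet {x | dy (-k - 1) (N x) = 2 * dy (-k) (N x) + 1} :=
      measurableSet_eq_fun h6 h4
    exact Measurable.ite h5 h2 measurable_const
  exact Finset.measurable_fun_sum _ fun k _ => key k

lemma modelOp_eq_zero (K : ℕ) {f : ℝ → ℂ} (hf : f =ᵐ[volume] 0) (η x : ℝ) :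
    modelOp K f η x = 0 := by
  unfold modelOp
  refine Finset.sum_eq_zero fun k _ => ?_
  split_ifs
  · unfold hh cv
    rw [integral_congr_ae (g := 0)]
    · simp
    · filter_upwards [hf] with y hy
      simp [hy]
  · rfl

lemma exists_exceptional_set {F : Set ℝ} (hF : MeasurableSet F) (hFt : volume F ≠ ⊤)
    (hF0 : volume F ≠ 0) {E : Set ℝ} (hEt : volume E ≠ ⊤)
    (hE0 : volume E ≠ 0) (L : ℤ) : ∃ (μ : ℝ≥0) (q : ℝ → ℤ) (Ω : Set ℝ), μ ≠ 0 ∧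
      (μ : ℝ≥0∞) ≤ 1 ∧ (μ : ℝ≥0∞) * volume E ≤ 6 * volume F ∧ Measurable q ∧ IsPartition q ∧
      MeasurableSet Ω ∧ (∀ y, volume (F ∩ cell q y) ≤ (2 * μ : ℝ≥0) * 2 ^ q y) ∧
      volume E ≤ 2 * volume (E \ Ω) ∧
      ∀ P : Tile, L ≤ P.k → ¬ P.I ⊆ Ω → ∀ y, P.k < q y → 2 ^ q y ≤ |y - P.c| := by
  set μ : ℝ≥0 := min 1 (6 * (volume F).toNNReal / (volume E).toNNReal) with hμ
  have hF0' : 0 < (volume F).toNNReal := pos_of_ne_zero (by simp [ENNReal.toNNReal_eq_zero_iff,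
      hF0, hFt])
  have hE0' : 0 < (volume E).toNNReal := pos_of_ne_zero (by simp [ENNReal.toNNReal_eq_zero_iff,
      hE0, hEt])
  have hμ0 : 0 < μ := lt_min one_pos (by positivity)
  obtain ⟨q, Ω, hq, hqp, hΩ, h1, h2, h3, h4⟩ := exists_partition hF hFt hμ0 L
  have hμE : (μ : ℝ≥0∞) * volume E ≤ 6 * volume F := by
    rw [← ENNReal.coe_toNNReal hFt, ← ENNReal.coe_toNNReal hEt]
    norm_cast
    calc μ * _ ≤ _ := mul_le_mul_left (min_le_right _ _) _
      _ = _ := div_mul_cancel₀ _ hE0'.ne'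
  refine ⟨μ, q, Ω, hμ0.ne', by exact_mod_cast min_le_left _ _, hμE, hq, hqp, hΩ, h1, ?_, h4⟩
  rcases le_total 1 (6 * (volume F).toNNReal / (volume E).toNNReal) with h | h
  · rw [h3 (le_min le_rfl h), Set.sdiff_empty, two_mul]
    exact le_self_add
  · have h5 : μ = 6 * (volume F).toNNReal / (volume E).toNNReal := min_eq_right h
    have h6 : (μ : ℝ≥0∞) * (2 * volume Ω) ≤ μ * volume E := by
      calc (μ : ℝ≥0∞) * (2 * volume Ω) = 2 * (μ * volume Ω) := by ring
        _ ≤ 2 * (3 * volume F) := by gcongr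
        _ = 6 * volume F := by ring
        _ = μ * volume E := by
          rw [← ENNReal.coe_toNNReal hFt, ← ENNReal.coe_toNNReal hEt]
          norm_cast
          rw [h5, div_mul_cancel₀ _ hE0'.ne']
    rw [ENNReal.mul_le_mul_iff_right (by exact_mod_cast hμ0.ne') ENNReal.coe_ne_top] at h6
    have h7 : volume E ≤ volume (E \ Ω) + volume Ω := by
      refine (measure_mono ?_).trans (measure_union_le _ _)
      intro x hx
      by_cases hxΩ : x ∈ Ω
      · exact Or.inr hxΩ
      · exact Or.inl ⟨hx, hxΩ⟩
    have h8 : volume E + volume E ≤ 2 * volume (E \ Ω) + volume E := by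
      calc volume E + volume E = 2 * volume E := by ring
        _ ≤ 2 * (volume (E \ Ω) + volume Ω) := by gcongr
        _ = 2 * volume (E \ Ω) + 2 * volume Ω := by ring
        _ ≤ _ := by gcongr
    exact (ENNReal.add_le_add_iff_right hEt).1 h8

/-- The restricted weak type estimate with an exceptional set removed. -/
lemma modelOp_restricted {θ : ℝ} (h0 : 0 < θ) (h1 : θ < 1 / 2) : ∃ C : ℝ≥0, ∀ F : Set ℝ,
    MeasurableSet F → volume F ≠ ⊤ → ∀ f : ℝ → ℂ, Measurable f →
    (∀ y, ‖f y‖ₑ ≤ F.indicator 1 y) → ∀ N : ℝ → ℝ, Measurable N → (range N).Finite →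
    ∀ E : Set ℝ, MeasurableSet E → Bornology.IsBounded E → ∀ K : ℕ, ∃ E' ⊆ E, MeasurableSet E' ∧
      volume E ≤ 2 * volume E' ∧ ∫⁻ x in E', ‖modelOp K f (N x) x‖ₑ ≤
        C * min (volume F ^ θ * volume E ^ (1 - θ)) (volume F ^ (1 - θ) * volume E ^ θ) := by
  obtain ⟨C₁, hC₁⟩ := tileSum_estimate h0 h1
  obtain ⟨C₂, hC₂⟩ := size_le_of_partition
  set s : ℝ := 1 - 2 * θ with hs
  have hs0 : 0 < s := by rw [hs]; linarith
  set c : ℝ≥0 := (C₂ + 1) * 2 with hc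
  set B : ℝ≥0 := C₁ * c ^ s with hB
  refine ⟨B * 6 ^ s, fun F hF hFt f hf hfF N hN hNr E hE hEb K => ?_⟩
  have hEt : volume E ≠ ⊤ := hEb.measure_lt_top.ne
  rcases eq_or_ne (volume F) 0 with hF0 | hF0
  · have hf0 : f =ᵐ[volume] 0 := by
      have : ∀ᵐ y, y ∉ F := measure_eq_zero_iff_ae_notMem.1 hF0
      filter_upwards [this] with y hy
      have := hfF y
      rw [Set.indicator_of_notMem hy] at this
      simpa using this
    refine ⟨E, subset_rfl, hE, by rw [two_mul]; exact le_self_add, ?_⟩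
    simp [modelOp_eq_zero K hf0]
  rcases eq_or_ne (volume E) 0 with hE0 | hE0
  · exact ⟨∅, Set.empty_subset _, MeasurableSet.empty, by simp [hE0], by simp⟩
  have hfsq : ∫⁻ x, ‖f x‖ₑ ^ 2 ≤ volume F := by
    rw [← lintegral_indicator_one hF]
    refine lintegral_mono fun x => ?_
    refine (pow_le_pow_left₀ zero_le (hfF x) 2).trans ?_
    by_cases hx : x ∈ F <;> simp [hx]
  have hfi : Integrable f := by
    refine ⟨hf.aestronglyMeasurable, ?_⟩
    refine (lintegral_mono hfF).trans_lt ?_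
    rw [lintegral_indicator_one hF]
    exact hFt.lt_top
  obtain ⟨μ, q, Ω, hμ0, hμ1, hμE, hq, hqp, hΩ, hcell, hEΩ, hfar⟩ :=
    exists_exceptional_set hF hFt hF0 hEt hE0 (-(K : ℤ))
  have hE'b : Bornology.IsBounded (E \ Ω) := hEb.subset Set.sdiff_subset
  refine ⟨E \ Ω, Set.sdiff_subset, hE.diff hΩ, hEΩ, ?_⟩
  set S := allTiles K hE'b hNr with hS
  have hsize : SizeLe f S (C₂ * (2 * μ)) := by
    refine hC₂ f hfi q hq hqp (2 * μ) (fun y => ?_) S fun P hP => ?_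
    · refine le_trans ?_ (hcell y)
      calc ∫⁻ x in cell q y, ‖f x‖ₑ ≤ ∫⁻ x in cell q y, F.indicator 1 x :=
            lintegral_mono fun x => hfF x
        _ = _ := by
          rw [lintegral_indicator_one hF, Measure.restrict_apply hF]
    · obtain ⟨hk, ⟨x, hxI, hxE⟩, _⟩ := mem_allTiles.1 hP
      exact hfar P (abs_le.1 hk).1 fun h => hxE.2 (h hxI)
  have hsize' : SizeLe f S ((C₂ + 1) * (2 * μ)) := fun k n ξ => by
    refine (hsize k n ξ).trans ?_
    gcongr
    exact le_self_add
  have hmain := hC₁ f hfi N hN (E \ Ω) (hE.diff hΩ) hE'b.measure_lt_top.ne ((C₂ + 1) * (2 * μ))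
    (by positivity) S (tileConvex_allTiles K hE'b hNr) hsize'
  have heq : ∫⁻ x in E \ Ω, ‖modelOp K f (N x) x‖ₑ = ∫⁻ x in E \ Ω, ‖tileSum N f S x‖ₑ :=
    setLIntegral_congr_fun (hE.diff hΩ) fun x hx => by
      rw [hS, tileSum_allTiles K hE'b hNr f hx]
  rw [heq]
  have hmain' : ∫⁻ x in E \ Ω, ‖tileSum N f S x‖ₑ ≤
      B * (volume F ^ θ * volume E ^ (1 - θ) * (μ : ℝ≥0∞) ^ s) := by
    refine hmain.trans ?_
    calc (C₁ : ℝ≥0∞) * ((∫⁻ x, ‖f x‖ₑ ^ 2) ^ θ * volume (E \ Ω) ^ (1 - θ) *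
          ((((C₂ + 1) * (2 * μ) : ℝ≥0) : ℝ≥0∞)) ^ s)
        ≤ C₁ * (volume F ^ θ * volume E ^ (1 - θ) * ((((C₂ + 1) * (2 * μ) : ℝ≥0) : ℝ≥0∞)) ^ s) := by
          gcongr
          · linarith
          · exact Set.sdiff_subset
      _ = _ := by
          rw [← mul_assoc (C₂ + 1) 2 μ, ← hc, ENNReal.coe_mul c, ENNReal.mul_rpow_of_nonneg _ _
              hs0.le,
            hB, ENNReal.coe_mul C₁, ENNReal.coe_rpow_of_nonneg _ hs0.le]
          ring
  refine hmain'.trans ?_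
  have h6 : (1 : ℝ≥0∞) ≤ 6 ^ s := ENNReal.one_le_rpow (by norm_num) hs0
  rw [ENNReal.coe_mul B, mul_assoc (B : ℝ≥0∞) _ (min _ _), ENNReal.coe_rpow_of_nonneg _ hs0.le]
  refine mul_le_mul_right ?_ (B : ℝ≥0∞)
  rw [mul_min]
  refine le_min ?_ ?_
  · calc volume F ^ θ * volume E ^ (1 - θ) * (μ : ℝ≥0∞) ^ s
        ≤ volume F ^ θ * volume E ^ (1 - θ) * 6 ^ s := by
          refine mul_le_mul_right ?_ _
          exact (ENNReal.rpow_le_rpow hμ1 hs0.le).trans (by simpa using h6)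
      _ = _ := by push_cast; ring
  · have e1 : volume E ^ (1 - θ) = volume E ^ θ * volume E ^ s := by
      rw [← ENNReal.rpow_add _ _ hE0 hEt]; congr 1; rw [hs]; ring
    have e2 : volume F ^ (1 - θ) = volume F ^ θ * volume F ^ s := by
      rw [← ENNReal.rpow_add _ _ hF0 hFt]; congr 1; rw [hs]; ring
    calc volume F ^ θ * volume E ^ (1 - θ) * (μ : ℝ≥0∞) ^ s
        = volume F ^ θ * volume E ^ θ * (μ * volume E) ^ s := by
          rw [e1, ENNReal.mul_rpow_of_nonneg _ _ hs0.le]; ring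
      _ ≤ volume F ^ θ * volume E ^ θ * (6 * volume F) ^ s := by gcongr
      _ = _ := by
          rw [e2, ENNReal.mul_rpow_of_nonneg _ _ hs0.le]; push_cast; ring

/-! ### Restricted strong type estimates -/

lemma le_of_le_mul_rpow {a : ℝ} (ha : 0 < a) (ha1 : a < 1) {D φ e : ℝ≥0∞} (he : e ≠ ⊤)
    (h : e ≤ D * (φ ^ a * e ^ (1 - a))) : e ≤ D ^ (1 / a) * φ := by
  rcases eq_or_ne e 0 with rfl | he0
  · exact zero_le
  have h1 : e ^ a * e ^ (1 - a) ≤ D * φ ^ a * e ^ (1 - a) := by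
    rw [← ENNReal.rpow_add _ _ he0 he, mul_assoc]
    simpa using h
  have h2 : e ^ (1 - a) ≠ 0 := by simp [he0, he]
  have h3 : e ^ (1 - a) ≠ ⊤ := ENNReal.rpow_ne_top_of_nonneg (by linarith) he
  rw [ENNReal.mul_le_mul_iff_left h2 h3] at h1
  calc e = (e ^ a) ^ (1 / a) := by rw [← ENNReal.rpow_mul, mul_one_div_cancel ha.ne',
      ENNReal.rpow_one]
    _ ≤ (D * φ ^ a) ^ (1 / a) := by gcongr
    _ = D ^ (1 / a) * φ := by
      rw [ENNReal.mul_rpow_of_nonneg _ _ (by positivity), ← ENNReal.rpow_mul,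
        mul_one_div_cancel ha.ne', ENNReal.rpow_one]

lemma measure_le_of_forall_inter_closedBall {A : Set ℝ} {B : ℝ≥0∞}
    (h : ∀ n : ℕ, volume (A ∩ Metric.closedBall 0 n) ≤ B) : volume A ≤ B := by
  have h1 : A = ⋃ n : ℕ, A ∩ Metric.closedBall 0 n := by
    rw [← Set.inter_iUnion, Metric.iUnion_closedBall_nat, Set.inter_univ]
  have h2 : Monotone fun n : ℕ => A ∩ Metric.closedBall (0 : ℝ) n := fun m n hmn =>
    Set.inter_subset_inter_right _ (Metric.closedBall_subset_closedBall (by exact_mod_cast hmn))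
  rw [h1]
  exact le_of_tendsto' (tendsto_measure_iUnion_atTop h2) h

/-- The restricted weak type estimate at two exponents. -/
lemma modelOp_weak {θ : ℝ} (h0 : 0 < θ) (h1 : θ < 1 / 2) : ∃ C : ℝ≥0, ∀ F : Set ℝ,
    MeasurableSet F → volume F ≠ ⊤ → ∀ f : ℝ → ℂ, Measurable f →
    (∀ y, ‖f y‖ₑ ≤ F.indicator 1 y) → ∀ N : ℝ → ℝ, Measurable N → (range N).Finite →
    ∀ (K : ℕ) (t : ℝ), 0 < t → volume {x | t < ‖modelOp K f (N x) x‖} ≤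
      C * volume F * min (ENNReal.ofReal (t ^ (-(1 / θ)))) (ENNReal.ofReal (t ^ (-(1 / (1 - θ)))))
          := by
  obtain ⟨C, hC⟩ := modelOp_restricted h0 h1
  set D : ℝ≥0 := 2 * C with hD
  refine ⟨max (D ^ (1 / θ)) (D ^ (1 / (1 - θ))), fun F hF hFt f hf hfF N hN hNr K t ht => ?_⟩
  have hfi : Integrable f := by
    refine ⟨hf.aestronglyMeasurable, ?_⟩
    refine (lintegral_mono hfF).trans_lt ?_
    rw [lintegral_indicator_one hF]
    exact hFt.lt_top
  have hmeas := measurable_modelOp_comp K hfi hN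
  have hA : MeasurableSet {x | t < ‖modelOp K f (N x) x‖} := measurableSet_lt measurable_const
      hmeas.norm
  refine measure_le_of_forall_inter_closedBall fun n => ?_
  set E := {x | t < ‖modelOp K f (N x) x‖} ∩ Metric.closedBall 0 n with hE
  have hEm : MeasurableSet E := hA.inter measurableSet_closedBall
  have hEb : Bornology.IsBounded E := Metric.isBounded_closedBall.subset Set.inter_subset_right
  have hEt : volume E ≠ ⊤ := hEb.measure_lt_top.ne
  obtain ⟨E', hE'E, hE'm, hEE', hInt⟩ := hC F hF hFt f hf hfF N hN hNr E hEm hEb K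
  have ht0 : ENNReal.ofReal t ≠ 0 := by simpa using ht
  have hlow : ENNReal.ofReal t * volume E' ≤ ∫⁻ x in E', ‖modelOp K f (N x) x‖ₑ := by
    rw [← setLIntegral_const]
    refine setLIntegral_mono' hE'm fun x hx => ?_
    rw [← ofReal_norm]
    exact ENNReal.ofReal_le_ofReal (hE'E hx).1.le
  set X := min (volume F ^ θ * volume E ^ (1 - θ)) (volume F ^ (1 - θ) * volume E ^ θ) with hX
  have hkey : volume E ≤ D * ENNReal.ofReal t⁻¹ * X := by
    rw [ENNReal.ofReal_inv_of_pos ht, ← ENNReal.mul_le_mul_iff_right ht0 ENNReal.ofReal_ne_top]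
    calc ENNReal.ofReal t * volume E ≤ ENNReal.ofReal t * (2 * volume E') := by gcongr
      _ = 2 * (ENNReal.ofReal t * volume E') := by ring
      _ ≤ 2 * (C * X) := by exact mul_le_mul_right (hlow.trans hInt) _
      _ = (ENNReal.ofReal t * (ENNReal.ofReal t)⁻¹) * (D * X) := by
          rw [ENNReal.mul_inv_cancel ht0 ENNReal.ofReal_ne_top, hD]; push_cast; ring
      _ = _ := by ring
  have hfin : ∀ a : ℝ, 0 < a → a < 1 → volume E ≤ D * ENNReal.ofReal t⁻¹ *
      (volume F ^ a * volume E ^ (1 - a)) → volume E ≤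
      ((D ^ (1 / a) : ℝ≥0) : ℝ≥0∞) * volume F * ENNReal.ofReal (t ^ (-(1 / a))) := by
    intro a ha ha1 h
    refine (le_of_le_mul_rpow ha ha1 hEt h).trans ?_
    rw [ENNReal.mul_rpow_of_nonneg _ _ (by positivity), ENNReal.ofReal_rpow_of_pos (by positivity),
      Real.inv_rpow ht.le, ← Real.rpow_neg ht.le, ENNReal.coe_rpow_of_nonneg _ (by positivity)]
    exact le_of_eq (by ring)
  rw [mul_min]
  refine le_min ?_ ?_
  · refine (hfin θ h0 (by linarith) (hkey.trans (mul_le_mul_right (min_le_left _ _) _))).trans ?_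
    gcongr
    exact le_max_left _ _
  · refine (hfin (1 - θ) (by linarith) (by linarith)
      (hkey.trans (mul_le_mul_right (min_le_right _ _ |>.trans_eq (by ring_nf)) _))).trans ?_
    gcongr
    exact le_max_right _ _

lemma lintegral_min_rpow_lt_top {s p q : ℝ} (hp : p < s) (hq : s < q) :
    ∫⁻ t in Ioi (0 : ℝ), min (ENNReal.ofReal (t ^ (-q))) (ENNReal.ofReal (t ^ (-p))) *
      ENNReal.ofReal (t ^ (s - 1)) < ⊤ := by
  rw [← Ioc_union_Ioi_eq_Ioi zero_le_one]
  refine (lintegral_union_le _ _ _).trans_lt (ENNReal.add_lt_top.2 ⟨?_, ?_⟩)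
  · have h : IntegrableOn (fun t : ℝ => t ^ (s - 1 - p)) (Ioc 0 1) :=
      (intervalIntegrable_iff_integrableOn_Ioc_of_le zero_le_one).1
        (intervalIntegral.intervalIntegrable_rpow' (by linarith))
    refine (setLIntegral_mono' measurableSet_Ioc fun t ht => ?_).trans_lt h.lintegral_lt_top
    refine (mul_le_mul_left (min_le_right _ _) _).trans_eq ?_
    rw [← ENNReal.ofReal_mul (Real.rpow_nonneg ht.1.le _), ← Real.rpow_add ht.1]
    congr 2; ring
  · have h : IntegrableOn (fun t : ℝ => t ^ (s - 1 - q)) (Ioi 1) :=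
      integrableOn_Ioi_rpow_of_lt (by linarith) one_pos
    refine (setLIntegral_mono' measurableSet_Ioi fun t ht => ?_).trans_lt h.lintegral_lt_top
    have ht0 : (0 : ℝ) < t := one_pos.trans ht
    refine (mul_le_mul_left (min_le_left _ _) _).trans_eq ?_
    rw [← ENNReal.ofReal_mul (Real.rpow_nonneg ht0.le _), ← Real.rpow_add ht0]
    congr 2; ring

/-- The strong type estimate for functions bounded by indicator functions. -/
lemma modelOp_layer {s : ℝ} (hs : 1 < s) : ∃ C : ℝ≥0, ∀ F : Set ℝ,
    MeasurableSet F → volume F ≠ ⊤ → ∀ f : ℝ → ℂ, Measurable f →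
    (∀ y, ‖f y‖ₑ ≤ F.indicator 1 y) → ∀ N : ℝ → ℝ, Measurable N → (range N).Finite →
    ∀ K : ℕ, ∫⁻ x, ‖modelOp K f (N x) x‖ₑ ^ s ≤ C * volume F := by
  have hs' : 0 < s := by linarith
  have hs1 : s⁻¹ < 1 := inv_lt_one_of_one_lt₀ hs
  have hs0 : 0 < s⁻¹ := by positivity
  set θ : ℝ := min (1 - s⁻¹) s⁻¹ / 2 with hθ
  have hm1 : min (1 - s⁻¹) s⁻¹ ≤ 1 - s⁻¹ := min_le_left _ _
  have hm2 : min (1 - s⁻¹) s⁻¹ ≤ s⁻¹ := min_le_right _ _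
  have hm0 : 0 < min (1 - s⁻¹) s⁻¹ := lt_min (by linarith) hs0
  have h0 : 0 < θ := by rw [hθ]; linarith
  have h1 : θ < 1 / 2 := by rw [hθ]; linarith
  have hq : s < 1 / θ := by
    rw [one_div, lt_inv_comm₀ hs' h0, hθ]; linarith
  have hp : 1 / (1 - θ) < s := by
    rw [one_div, inv_lt_comm₀ (by linarith) hs', hθ]; linarith
  obtain ⟨C, hC⟩ := modelOp_weak h0 h1
  set B := ∫⁻ t in Ioi (0 : ℝ), min (ENNReal.ofReal (t ^ (-(1 / θ))))
    (ENNReal.ofReal (t ^ (-(1 / (1 - θ))))) * ENNReal.ofReal (t ^ (s - 1)) with hB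
  have hBt : B ≠ ⊤ := (lintegral_min_rpow_lt_top hp hq).ne
  refine ⟨Real.toNNReal s * C * B.toNNReal, fun F hF hFt f hf hfF N hN hNr K => ?_⟩
  have hfi : Integrable f := by
    refine ⟨hf.aestronglyMeasurable, ?_⟩
    refine (lintegral_mono hfF).trans_lt ?_
    rw [lintegral_indicator_one hF]
    exact hFt.lt_top
  have hmeas := measurable_modelOp_comp K hfi hN
  calc ∫⁻ x, ‖modelOp K f (N x) x‖ₑ ^ s = ∫⁻ x, ENNReal.ofReal (‖modelOp K f (N x) x‖ ^ s) := by
        refine lintegral_congr fun x => ?_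
        rw [← ENNReal.ofReal_rpow_of_nonneg (norm_nonneg _) hs'.le, ofReal_norm]
    _ = ENNReal.ofReal s * ∫⁻ t in Ioi (0 : ℝ), volume {x | t < ‖modelOp K f (N x) x‖} *
          ENNReal.ofReal (t ^ (s - 1)) :=
        lintegral_rpow_eq_lintegral_meas_lt_mul volume (Eventually.of_forall fun _ => norm_nonneg _)
          hmeas.norm.aemeasurable hs'
    _ ≤ ENNReal.ofReal s * ∫⁻ t in Ioi (0 : ℝ), C * volume F *
          (min (ENNReal.ofReal (t ^ (-(1 / θ)))) (ENNReal.ofReal (t ^ (-(1 / (1 - θ))))) *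
          ENNReal.ofReal (t ^ (s - 1))) := by
        refine mul_le_mul_right (setLIntegral_mono' measurableSet_Ioi fun t ht => ?_) _
        rw [← mul_assoc]
        exact mul_le_mul_left (hC F hF hFt f hf hfF N hN hNr K t ht) _
    _ = ENNReal.ofReal s * (C * volume F * B) := by
        rw [lintegral_const_mul' _ _ (ENNReal.mul_ne_top ENNReal.coe_ne_top hFt)]
    _ = _ := by
        push_cast
        rw [ENNReal.coe_toNNReal hBt]
        change ENNReal.ofReal s * _ = ENNReal.ofReal s * _ * _ * _
        ring

/-! ### Strong type bounds for the model operator -/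

lemma tsum_int_geometric_lt_top {ρ : ℝ≥0∞} (hρ : ρ < 1) :
    ∑' j : ℤ, ρ ^ j.natAbs < ⊤ := by
  have h1 : ∑' n : ℕ, ρ ^ n < ⊤ := by
    rw [ENNReal.tsum_geometric]
    exact ENNReal.inv_lt_top.2 (tsub_pos_of_lt hρ)
  rw [tsum_of_nat_of_neg_add_one ENNReal.summable ENNReal.summable]
  refine ENNReal.add_lt_top.2 ⟨by simpa using h1, lt_of_le_of_lt ?_ h1⟩
  refine ENNReal.tsum_le_tsum fun n => ?_
  rw [Int.natAbs_neg, show ((n : ℤ) + 1).natAbs = n + 1 by omega, pow_succ]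
  exact mul_le_of_le_one_right' hρ.le

lemma mul_le_of_rpow_mul_rpow_le {r s : ℝ} (hs : 0 < s) {j : ℤ} {X t : ℝ≥0∞}
    (h : ((2 : ℝ≥0∞) ^ j) ^ r * X ^ s ≤ t ^ r) :
    2 ^ j * X ≤ t ^ (r / s) * ((2 : ℝ≥0∞) ^ j) ^ (1 - r / s) := by
  have h1 := ENNReal.rpow_le_rpow h (show 0 ≤ 1 / s by positivity)
  rw [ENNReal.mul_rpow_of_nonneg _ _ (by positivity : 0 ≤ 1 / s), ← ENNReal.rpow_mul,
    ← ENNReal.rpow_mul, ← ENNReal.rpow_mul, mul_one_div_cancel hs.ne', ENNReal.rpow_one,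
    mul_one_div] at h1
  have h0 := two_zpow_ne_zero j
  have ht := two_zpow_ne_top j
  calc (2 : ℝ≥0∞) ^ j * X = ((2 : ℝ≥0∞) ^ j) ^ (r / s) * X * ((2 : ℝ≥0∞) ^ j) ^ (1 - r / s) := by
        rw [mul_right_comm, ← ENNReal.rpow_add _ _ h0 ht]
        simp
    _ ≤ _ := mul_le_mul_left h1 _

lemma rpow_tsum_le {r ε : ℝ} (hr : 0 < r) (h0 : 0 < ε) (h1 : ε < 1) :
    ∃ C : ℝ≥0, ∀ X : ℤ → ℝ≥0∞, (∑' j : ℤ, 2 ^ j * X j) ^ r ≤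
      C * ∑' j : ℤ, ((2 : ℝ≥0∞) ^ j) ^ r * (X j ^ (r / (1 + ε)) + X j ^ (r / (1 - ε))) := by
  set ρ : ℝ≥0∞ := (2 : ℝ≥0∞) ^ (-ε) with hρ
  have hρ1 : ρ < 1 := ENNReal.rpow_lt_one_of_one_lt_of_neg (by norm_num) (by linarith)
  set G := ∑' j : ℤ, ρ ^ j.natAbs with hG
  have hGt : G ≠ ⊤ := (tsum_int_geometric_lt_top hρ1).ne
  set D : ℝ≥0∞ := ((2 : ℝ≥0∞) ^ ε * G) ^ r with hD
  have hDt : D ≠ ⊤ := by finiteness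
  refine ⟨D.toNNReal + 1, fun X => ?_⟩
  push_cast
  rw [ENNReal.coe_toNNReal hDt]
  set S := ∑' j : ℤ, ((2 : ℝ≥0∞) ^ j) ^ r * (X j ^ (r / (1 + ε)) + X j ^ (r / (1 - ε))) with hS
  have hS' : ∀ j, ((2 : ℝ≥0∞) ^ j) ^ r * (X j ^ (r / (1 + ε)) + X j ^ (r / (1 - ε))) ≤ S :=
    fun j => ENNReal.le_tsum j
  by_cases hSt : S = ⊤
  · rw [hSt, ENNReal.mul_top (by simp)]
    exact le_top
  set t := S ^ (1 / r) with ht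
  have htr : t ^ r = S := by
    rw [ht, ← ENNReal.rpow_mul, one_div_mul_cancel hr.ne', ENNReal.rpow_one]
  have htt : t ≠ ⊤ := by rw [ht]; finiteness
  have e1 : ∀ j, 2 ^ j * X j ≤ t ^ (1 + ε) * ((2 : ℝ≥0∞) ^ j) ^ (-ε) := fun j => by
    have h := mul_le_of_rpow_mul_rpow_le (r := r) (s := r / (1 + ε)) (by positivity) (j := j)
      (X := X j) (t := t) (by
        rw [htr]; refine le_trans ?_ (hS' j); gcongr; exact le_self_add)
    rwa [div_div_cancel₀ hr.ne', show 1 - (1 + ε) = -ε by ring] at h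
  have e2 : ∀ j, 2 ^ j * X j ≤ t ^ (1 - ε) * ((2 : ℝ≥0∞) ^ j) ^ ε := fun j => by
    have h := mul_le_of_rpow_mul_rpow_le (r := r) (s := r / (1 - ε))
      (div_pos hr (by linarith)) (j := j) (X := X j) (t := t) (by
        rw [htr]; refine le_trans ?_ (hS' j); gcongr; exact le_add_self)
    rwa [div_div_cancel₀ hr.ne', show 1 - (1 - ε) = ε by ring] at h
  rcases eq_or_ne t 0 with ht0 | ht0
  · have : ∀ j, (2 : ℝ≥0∞) ^ j * X j = 0 := fun j => by
      have := e1 j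
      rw [ht0, ENNReal.zero_rpow_of_pos (by linarith), zero_mul] at this
      exact le_antisymm this bot_le
    simp [this, ENNReal.zero_rpow_of_pos hr]
  obtain ⟨m, hm1, hm2⟩ := ENNReal.exists_mem_Ico_zpow ht0 htt (y := 2) (by norm_num) (by norm_num)
  have key : ∀ j, 2 ^ j * X j ≤ t * (2 : ℝ≥0∞) ^ ε * ρ ^ (m - j).natAbs := fun j => by
    have hz : ∀ (i : ℤ) (a : ℝ), ((2 : ℝ≥0∞) ^ i) ^ a = (2 : ℝ≥0∞) ^ (i * a) := fun i a => by
      rw [← ENNReal.rpow_intCast, ← ENNReal.rpow_mul]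
    rcases le_or_gt j m with hj | hj
    · have hn : ((m - j).natAbs : ℝ) = m - j := by
        have : (((m - j).natAbs : ℤ) : ℝ) = ((m - j : ℤ) : ℝ) := by
          rw [Int.natAbs_of_nonneg (by omega)]
        simpa using this
      calc 2 ^ j * X j ≤ t ^ (1 - ε) * ((2 : ℝ≥0∞) ^ j) ^ ε := e2 j
        _ = t * t ^ (-ε) * ((2 : ℝ≥0∞) ^ j) ^ ε := by
          rw [sub_eq_add_neg, ENNReal.rpow_add _ _ ht0 htt, ENNReal.rpow_one]
        _ ≤ t * ((2 : ℝ≥0∞) ^ m) ^ (-ε) * ((2 : ℝ≥0∞) ^ j) ^ ε := by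
          refine mul_le_mul_left (mul_le_mul_right ?_ _) _
          rw [ENNReal.rpow_neg, ENNReal.rpow_neg]
          gcongr
        _ = t * ρ ^ (m - j).natAbs := by
          rw [mul_assoc, hz, hz, ← ENNReal.rpow_add _ _ (by norm_num) (by norm_num), hρ,
            ← ENNReal.rpow_natCast, ← ENNReal.rpow_mul, hn]
          congr 2
          ring
        _ ≤ _ := by
          refine mul_le_mul_left ?_ _
          refine le_mul_of_one_le_right' ?_
          exact ENNReal.one_le_rpow (by norm_num) h0
    · have hn : ((m - j).natAbs : ℝ) = j - m := by
        have : (((m - j).natAbs : ℤ) : ℝ) = ((j - m : ℤ) : ℝ) := by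
          rw [Int.ofNat_natAbs_of_nonpos (by omega)]; simp
        simpa using this
      calc 2 ^ j * X j ≤ t ^ (1 + ε) * ((2 : ℝ≥0∞) ^ j) ^ (-ε) := e1 j
        _ = t * t ^ ε * ((2 : ℝ≥0∞) ^ j) ^ (-ε) := by
          rw [ENNReal.rpow_add _ _ ht0 htt, ENNReal.rpow_one]
        _ ≤ t * ((2 : ℝ≥0∞) ^ (m + 1)) ^ ε * ((2 : ℝ≥0∞) ^ j) ^ (-ε) := by
          refine mul_le_mul_left (mul_le_mul_right ?_ _) _
          exact ENNReal.rpow_le_rpow hm2.le h0.le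
        _ = _ := by
          rw [mul_assoc, hz, hz, ← ENNReal.rpow_add _ _ (by norm_num) (by norm_num), hρ,
            ← ENNReal.rpow_natCast, ← ENNReal.rpow_mul, hn, mul_assoc,
            ← ENNReal.rpow_add _ _ (by norm_num) (by norm_num)]
          congr 2
          push_cast
          ring
  calc (∑' j : ℤ, 2 ^ j * X j) ^ r ≤ (∑' j : ℤ, t * (2 : ℝ≥0∞) ^ ε * ρ ^ (m - j).natAbs) ^ r := by
        exact ENNReal.rpow_le_rpow (ENNReal.tsum_le_tsum key) hr.le
    _ = (t * ((2 : ℝ≥0∞) ^ ε * G)) ^ r := by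
        rw [ENNReal.tsum_mul_left, hG, ← (Equiv.subLeft m).tsum_eq (fun j => ρ ^ j.natAbs),
          mul_assoc]
        rfl
    _ = D * S := by rw [ENNReal.mul_rpow_of_nonneg _ _ hr.le, htr, mul_comm]
    _ ≤ _ := by gcongr; exact le_self_add

/-- The set where `‖f‖` lies in the dyadic range `[2 ^ j, 2 ^ (j + 1))`. -/
def layer (f : ℝ → ℂ) (j : ℤ) : Set ℝ := {y | (2 : ℝ≥0∞) ^ j ≤ ‖f y‖ₑ ∧ ‖f y‖ₑ < 2 ^ (j + 1)}

/-- The normalized restriction of `f` to a dyadic layer. -/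
def layerFun (f : ℝ → ℂ) (j : ℤ) (y : ℝ) : ℂ := 2 ^ (-(j + 1)) * (layer f j).indicator f y

lemma measurableSet_layer {f : ℝ → ℂ} (hf : Measurable f) (j : ℤ) :
    MeasurableSet (layer f j) :=
  (measurableSet_le measurable_const hf.enorm).inter (measurableSet_lt hf.enorm measurable_const)

lemma pairwise_disjoint_layer (f : ℝ → ℂ) : Pairwise (Function.onFun Disjoint (layer f)) := by
  have key : ∀ i j, i < j → Disjoint (layer f i) (layer f j) := fun i j h => by
    refine Set.disjoint_left.2 fun y hi hj => ?_
    have := hi.2.trans_le ((two_zpow_mono (by omega : i + 1 ≤ j)).trans hj.1)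
    exact lt_irrefl _ this
  intro i j hij
  rcases lt_or_gt_of_ne hij with h | h
  · exact key i j h
  · exact (key j i h).symm

lemma iUnion_layer (f : ℝ → ℂ) : ⋃ j, layer f j = {y | f y ≠ 0} := by
  ext y
  simp only [Set.mem_iUnion, Set.mem_ofPred_eq]
  constructor
  · rintro ⟨j, hj⟩ h
    have h1 := hj.1
    rw [h, enorm_zero] at h1
    exact two_zpow_ne_zero j (le_antisymm h1 bot_le)
  · intro h
    obtain ⟨m, hm1, hm2⟩ := ENNReal.exists_mem_Ico_zpow (x := ‖f y‖ₑ) (by simpa using h)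
      (by finiteness) (y := 2) (by norm_num) (by norm_num)
    exact ⟨m, hm1, hm2⟩

lemma measurable_layerFun {f : ℝ → ℂ} (hf : Measurable f) (j : ℤ) : Measurable (layerFun f j) :=
  (hf.indicator (measurableSet_layer hf j)).const_mul _

lemma enorm_two_zpow_complex (j : ℤ) : ‖(2 : ℂ) ^ j‖ₑ = 2 ^ j := by
  rw [← ofReal_norm, norm_zpow, Complex.norm_ofNat, ofReal_two_zpow]

lemma enorm_layerFun_le (f : ℝ → ℂ) (j : ℤ) (y : ℝ) :
    ‖layerFun f j y‖ₑ ≤ (layer f j).indicator 1 y := by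
  unfold layerFun
  by_cases h : y ∈ layer f j
  · rw [Set.indicator_of_mem h, Set.indicator_of_mem h, enorm_mul, enorm_two_zpow_complex]
    calc _ ≤ (2 : ℝ≥0∞) ^ (-(j + 1)) * 2 ^ (j + 1) := mul_le_mul_right h.2.le _
      _ = 1 := two_zpow_neg_mul _
  · simp [Set.indicator_of_notMem h]

lemma volume_layer_ne_top {f : ℝ → ℂ} (hf : Measurable f) (hfi : Integrable f) (j : ℤ) :
    volume (layer f j) ≠ ⊤ := by
  have h := mul_meas_ge_le_lintegral (μ := volume) hf.enorm (2 ^ j)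
  have h2 : (2 : ℝ≥0∞) ^ j * volume (layer f j) < ⊤ :=
    (mul_le_mul_right (measure_mono fun y hy => hy.1) _).trans_lt (h.trans_lt hfi.2)
  intro h3
  rw [h3, ENNReal.mul_top (two_zpow_ne_zero j)] at h2
  exact lt_irrefl _ h2

lemma hasSum_hh_layer {f : ℝ → ℂ} (hf : Measurable f) (hfi : Integrable f) (k l : ℤ) (x : ℝ) :
    HasSum (fun j : ℤ => 2 ^ (j + 1) * hh (layerFun f j) k l x) (hh f k l x) := by
  have hInt := integrable_cv_integrand hfi (wp β0 k l) x
  have h := hasSum_integral_iUnion (μ := volume) (f := fun y => f y * wp β0 k l (x - y))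
    (s := layer f) (measurableSet_layer hf) (pairwise_disjoint_layer f) hInt.integrableOn
  rw [setIntegral_eq_integral_of_forall_compl_eq_zero (fun y hy => by
    rw [iUnion_layer] at hy
    have : f y = 0 := by simpa using hy
    simp [this])] at h
  suffices e : (fun j : ℤ => 2 ^ (j + 1) * hh (layerFun f j) k l x) =
      fun j => ∫ y in layer f j, f y * wp β0 k l (x - y) by
    rw [e]
    exact h
  ext j
  unfold hh cv layerFun
  rw [← integral_const_mul, ← integral_indicator (measurableSet_layer hf j)]
  congr 1
  ext y
  have h2 : (2 : ℂ) ^ (j + 1) * 2 ^ (-(j + 1)) = 1 := by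
    rw [zpow_neg, mul_inv_cancel₀ (zpow_ne_zero _ two_ne_zero)]
  by_cases hy : y ∈ layer f j
  · rw [Set.indicator_of_mem hy, Set.indicator_of_mem hy, ← mul_assoc, ← mul_assoc, h2, one_mul]
  · rw [Set.indicator_of_notMem hy, Set.indicator_of_notMem hy]
    simp

lemma modelOp_le_tsum_layer {f : ℝ → ℂ} (hf : Measurable f) (hfi : Integrable f) (K : ℕ)
    (η x : ℝ) : ‖modelOp K f η x‖ₑ ≤
      2 * ∑' j : ℤ, 2 ^ j * ‖modelOp K (layerFun f j) η x‖ₑ := by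
  have h : HasSum (fun j : ℤ => 2 ^ (j + 1) * modelOp K (layerFun f j) η x) (modelOp K f η x) := by
    unfold modelOp
    simp only [Finset.mul_sum]
    refine hasSum_sum fun k _ => ?_
    split_ifs with hk
    · exact hasSum_hh_layer hf hfi k _ x
    · simp [hasSum_zero]
  rw [← h.tsum_eq]
  refine (enorm_tsum_le_tsum_enorm).trans ?_
  rw [← ENNReal.tsum_mul_left]
  refine ENNReal.tsum_le_tsum fun j => ?_
  rw [enorm_mul, enorm_two_zpow_complex, two_zpow_add, zpow_one, mul_comm (_ ^ j), mul_assoc]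

lemma tsum_layer_le {f : ℝ → ℂ} (hf : Measurable f) {r : ℝ} (hr : 0 < r) :
    ∑' j : ℤ, ((2 : ℝ≥0∞) ^ j) ^ r * volume (layer f j) ≤ ∫⁻ x, ‖f x‖ₑ ^ r := by
  calc _ ≤ ∑' j : ℤ, ∫⁻ x in layer f j, ‖f x‖ₑ ^ r := by
        refine ENNReal.tsum_le_tsum fun j => ?_
        rw [← setLIntegral_const]
        refine setLIntegral_mono' (measurableSet_layer hf j) fun x hx => ?_
        exact ENNReal.rpow_le_rpow hx.1 hr.le
    _ = ∫⁻ x in ⋃ j, layer f j, ‖f x‖ₑ ^ r :=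
        (lintegral_iUnion (measurableSet_layer hf) (pairwise_disjoint_layer f) _).symm
    _ ≤ _ := setLIntegral_le_lintegral _ _

lemma modelOp_strong {r : ℝ} (hr : 1 < r) : ∃ C : ℝ≥0, ∀ f : ℝ → ℂ, Measurable f →
    Integrable f → ∀ N : ℝ → ℝ, Measurable N → (range N).Finite →
    ∀ K : ℕ, ∫⁻ x, ‖modelOp K f (N x) x‖ₑ ^ r ≤ C * ∫⁻ x, ‖f x‖ₑ ^ r := by
  set ε := min (r - 1) 1 / 2 with hε
  have hε0 : 0 < ε := by have := lt_min (sub_pos.2 hr) one_pos; rw [hε]; linarith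
  have hε1 : ε < 1 := by have := min_le_right (r - 1) 1; rw [hε]; linarith
  have hεr : 1 + ε < r := by have := min_le_left (r - 1) 1; rw [hε]; linarith
  have hr0 : 0 < r := by linarith
  obtain ⟨A, hA⟩ := rpow_tsum_le hr0 hε0 hε1
  obtain ⟨C₀, hC₀⟩ := modelOp_layer (s := r / (1 + ε)) (by rw [lt_div_iff₀ (by linarith)]; linarith)
  obtain ⟨C₁, hC₁⟩ := modelOp_layer (s := r / (1 - ε)) (by rw [lt_div_iff₀ (by linarith)]; linarith)
  refine ⟨(2 : ℝ≥0) ^ r * (A * (C₀ + C₁)), fun f hf hfi N hN hNf K => ?_⟩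
  have hgi : ∀ j, Integrable (layerFun f j) := fun j =>
    (hfi.indicator (measurableSet_layer hf j)).const_mul _
  have hm : ∀ j, Measurable fun x => modelOp K (layerFun f j) (N x) x := fun j =>
    measurable_modelOp_comp K (hgi j) hN
  have hl : ∀ s : ℝ, ∀ j, Measurable fun x => ‖modelOp K (layerFun f j) (N x) x‖ₑ ^ s := fun s j =>
    (hm j).enorm.pow_const s
  have hl2 : ∀ j, Measurable fun x => ‖modelOp K (layerFun f j) (N x) x‖ₑ ^ (r / (1 + ε)) +
      ‖modelOp K (layerFun f j) (N x) x‖ₑ ^ (r / (1 - ε)) := fun j => (hl _ j).add (hl _ j)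
  calc ∫⁻ x, ‖modelOp K f (N x) x‖ₑ ^ r
      ≤ ∫⁻ x, (2 : ℝ≥0∞) ^ r * (A * ∑' j : ℤ, ((2 : ℝ≥0∞) ^ j) ^ r *
          (‖modelOp K (layerFun f j) (N x) x‖ₑ ^ (r / (1 + ε)) +
            ‖modelOp K (layerFun f j) (N x) x‖ₑ ^ (r / (1 - ε)))) := by
        refine lintegral_mono fun x => ?_
        refine (ENNReal.rpow_le_rpow (modelOp_le_tsum_layer hf hfi K (N x) x) hr0.le).trans ?_
        rw [ENNReal.mul_rpow_of_nonneg _ _ hr0.le]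
        exact mul_le_mul_right (hA _) _
    _ = (2 : ℝ≥0∞) ^ r * (A * ∑' j : ℤ, ((2 : ℝ≥0∞) ^ j) ^ r *
          ((∫⁻ x, ‖modelOp K (layerFun f j) (N x) x‖ₑ ^ (r / (1 + ε))) +
            ∫⁻ x, ‖modelOp K (layerFun f j) (N x) x‖ₑ ^ (r / (1 - ε)))) := by
        rw [lintegral_const_mul' _ _ (by finiteness), lintegral_const_mul' _ _ (by finiteness),
          lintegral_tsum (fun j => ((hl2 j).const_mul _).aemeasurable)]
        congr 3
        ext j
        rw [lintegral_const_mul _ (hl2 j), lintegral_add_left (hl _ j)]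
    _ ≤ (2 : ℝ≥0∞) ^ r * (A * ∑' j : ℤ, ((2 : ℝ≥0∞) ^ j) ^ r *
          ((C₀ + C₁) * volume (layer f j))) := by
        refine mul_le_mul_right (mul_le_mul_right (ENNReal.tsum_le_tsum fun j =>
          mul_le_mul_right ?_ _) _) _
        rw [add_mul]
        have hF := measurableSet_layer hf j
        have ht := volume_layer_ne_top hf hfi j
        exact add_le_add (hC₀ _ hF ht _ (measurable_layerFun hf j) (enorm_layerFun_le f j) N hN hNf
            K)
          (hC₁ _ hF ht _ (measurable_layerFun hf j) (enorm_layerFun_le f j) N hN hNf K)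
    _ = (2 : ℝ≥0∞) ^ r * (A * (C₀ + C₁)) *
          ∑' j : ℤ, ((2 : ℝ≥0∞) ^ j) ^ r * volume (layer f j) := by
        simp only [mul_left_comm _ ((C₀ : ℝ≥0∞) + C₁), ENNReal.tsum_mul_left]
        ring
    _ ≤ (2 : ℝ≥0∞) ^ r * (A * (C₀ + C₁)) * ∫⁻ x, ‖f x‖ₑ ^ r :=
        mul_le_mul_right (tsum_layer_le hf hr0) _
    _ = _ := by
        push_cast
        rw [ENNReal.coe_rpow_of_nonneg _ hr0.le]
        norm_num

/-- The supremum of the model operator over all frequencies. -/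
def modelMax (K : ℕ) (f : ℝ → ℂ) (x : ℝ) : ℝ≥0∞ :=
  ⨆ m : ℤ, ‖modelOp K f (m * 2 ^ (-(K : ℤ) - 1)) x‖ₑ

lemma modelOp_le_modelMax (K : ℕ) (f : ℝ → ℂ) (η x : ℝ) :
    ‖modelOp K f η x‖ₑ ≤ modelMax K f x := by
  refine le_trans (le_of_eq ?_)
    (le_iSup (fun m : ℤ => ‖modelOp K f (m * 2 ^ (-(K : ℤ) - 1)) x‖ₑ) (dy (-(K : ℤ) - 1) η))
  have h0 : dy (-(K : ℤ) - 1) η = dy (-(K : ℤ) - 1)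
      ((dy (-(K : ℤ) - 1) η : ℝ) * 2 ^ (-(K : ℤ) - 1)) :=
    (left_mem_DI (-(K : ℤ) - 1) (dy (-(K : ℤ) - 1) η)).symm
  unfold modelOp
  congr 1
  refine Finset.sum_congr rfl fun k hk => ?_
  rw [Finset.mem_Icc] at hk
  rw [dy_eq_of_le (by omega : -(K : ℤ) - 1 ≤ -k - 1) h0,
    dy_eq_of_le (by omega : -(K : ℤ) - 1 ≤ -k) h0]

lemma measurable_modelOp (K : ℕ) {f : ℝ → ℂ} (hfi : Integrable f) (η : ℝ) :
    Measurable fun x => modelOp K f η x :=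
  measurable_modelOp_comp K hfi (N := fun _ => η) measurable_const

lemma measurable_modelMax (K : ℕ) {f : ℝ → ℂ} (hfi : Integrable f) : Measurable (modelMax K f) :=
  Measurable.iSup fun _ => (measurable_modelOp K hfi _).enorm

lemma exists_maximizing_frequency (K : ℕ) {f : ℝ → ℂ} (hfi : Integrable f) (H : Finset ℝ) :
    ∃ N : ℝ → ℝ, Measurable N ∧ (range N).Finite ∧
      ∀ x, ∀ η ∈ H, ‖modelOp K f η x‖ₑ ≤ ‖modelOp K f (N x) x‖ₑ := by
  induction H using Finset.induction_on with
  | empty => exact ⟨fun _ => 0, measurable_const, by simp, by simp⟩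
  | insert a H _ ih =>
    obtain ⟨N, hN, hNf, h⟩ := ih
    have hs : MeasurableSet {x | ‖modelOp K f (N x) x‖ₑ < ‖modelOp K f a x‖ₑ} :=
      measurableSet_lt (measurable_modelOp_comp K hfi hN).enorm (measurable_modelOp K hfi a).enorm
    refine ⟨fun x => if ‖modelOp K f (N x) x‖ₑ < ‖modelOp K f a x‖ₑ then a else N x,
      Measurable.ite hs measurable_const hN, ?_, fun x η hη => ?_⟩
    · refine (hNf.insert a).subset ?_
      rintro _ ⟨x, rfl⟩
      dsimp only
      split_ifs
      · exact Set.mem_insert _ _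
      · exact Set.mem_insert_of_mem _ ⟨x, rfl⟩
    · dsimp only
      rcases Finset.mem_insert.1 hη with rfl | hη
      · split_ifs with hx
        · exact le_rfl
        · exact not_lt.1 hx
      · split_ifs with hx
        · exact (h x η hη).trans hx.le
        · exact h x η hη

lemma iSup_rpow {ι : Type*} {r : ℝ} (hr : 0 < r) (a : ι → ℝ≥0∞) :
    (⨆ i, a i) ^ r = ⨆ i, a i ^ r :=
  (ENNReal.orderIsoRpow r hr).map_iSup a

lemma modelMax_strong {r : ℝ} (hr : 1 < r) : ∃ C : ℝ≥0, ∀ f : ℝ → ℂ, Measurable f →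
    Integrable f → ∀ K : ℕ, ∫⁻ x, modelMax K f x ^ r ≤ C * ∫⁻ x, ‖f x‖ₑ ^ r := by
  obtain ⟨C, hC⟩ := modelOp_strong hr
  have hr0 : 0 < r := by linarith
  refine ⟨C, fun f hf hfi K => ?_⟩
  set g : ℤ → ℝ → ℝ≥0∞ := fun m x => ‖modelOp K f (m * 2 ^ (-(K : ℤ) - 1)) x‖ₑ with hg
  have hgm : ∀ m, Measurable (g m) := fun m => (measurable_modelOp K hfi _).enorm
  set A : ℕ → ℝ → ℝ≥0∞ := fun n x => ⨆ m ∈ Finset.Icc (-(n : ℤ)) n, g m x with hA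
  have hAm : ∀ n, Measurable (A n) := fun n =>
    Measurable.iSup fun m => Measurable.iSup fun _ => hgm m
  have hmono : Monotone A := fun n n' h x =>
    biSup_mono fun _ hm => by rw [Finset.mem_Icc] at hm ⊢; omega
  have hsup : ∀ x, modelMax K f x = ⨆ n, A n x := fun x => by
    refine le_antisymm (iSup_le fun m => ?_) (iSup_le fun n => iSup₂_le fun m _ => ?_)
    · refine le_trans ?_ (le_iSup (fun n => A n x) m.natAbs)
      exact le_iSup₂ (f := fun m (_ : m ∈ Finset.Icc (-(_ : ℤ)) _) => g m x) m
        (by rw [Finset.mem_Icc]; omega)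
    · exact le_iSup (fun m => g m x) m
  simp only [hsup, iSup_rpow hr0]
  rw [lintegral_iSup (fun n => (hAm n).pow_const r)
    (fun n n' h x => ENNReal.rpow_le_rpow (hmono h x) hr0.le)]
  refine iSup_le fun n => ?_
  obtain ⟨N, hN, hNf, h⟩ := exists_maximizing_frequency K hfi
    ((Finset.Icc (-(n : ℤ)) n).image fun m : ℤ => (m : ℝ) * 2 ^ (-(K : ℤ) - 1))
  refine (lintegral_mono fun x => ?_).trans (hC f hf hfi N hN hNf K)
  exact ENNReal.rpow_le_rpow (iSup₂_le fun m hm => h x _ (Finset.mem_image_of_mem _ hm)) hr0.le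

/-! ### The averaged kernel -/

/-- The reflected average of the translates of `β0` by frequencies in `[1/2, 1]`. -/
def avgBump (ξ : ℝ) : ℝ := (∫ u in (0 : ℝ)..(1 - ξ), β0 u) - ∫ u in (0 : ℝ)..(1 / 2 - ξ), β0 u

lemma avgBump_eq (ξ : ℝ) : avgBump ξ = ∫ u in (1 / 2 - ξ)..(1 - ξ), β0 u := by
  unfold avgBump
  rw [intervalIntegral.integral_interval_sub_left] <;>
  exact (β0.continuous).intervalIntegrable _ _

lemma avgBump_eq' (ξ : ℝ) : avgBump ξ = ∫ θ in Ioc (1 / 2 : ℝ) 1, β0 (θ - ξ) := by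
  rw [avgBump_eq, ← intervalIntegral.integral_of_le (by norm_num),
    intervalIntegral.integral_comp_sub_right (fun u => β0 u)]

lemma beta0_eq_zero {u : ℝ} (h : u ≤ 1 / 8 ∨ 3 / 8 ≤ u) : β0 u = 0 := by
  refine β0.zero_of_le_dist ?_
  rw [Real.dist_eq]
  change (1 / 8 : ℝ) ≤ _
  rcases h with h | h
  · rw [abs_of_nonpos (by linarith)]; linarith
  · rw [abs_of_nonneg (by linarith)]; linarith

lemma avgBump_eq_zero {ξ : ℝ} (h : ξ ≤ 1 / 8 ∨ 7 / 8 ≤ ξ) : avgBump ξ = 0 := by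
  rw [avgBump_eq' ξ]
  refine setIntegral_eq_zero_of_forall_eq_zero fun θ hθ => beta0_eq_zero ?_
  rcases h with h | h
  · right; linarith [hθ.1]
  · left; linarith [hθ.2]

lemma avgBump_nonneg (ξ : ℝ) : 0 ≤ avgBump ξ := by
  rw [avgBump_eq' ξ]
  exact integral_nonneg fun θ => β0.nonneg

lemma avgBump_half_pos : 0 < avgBump (1 / 2) := by
  rw [avgBump_eq]
  norm_num
  rw [intervalIntegral.integral_of_le (by norm_num),
    setIntegral_eq_integral_of_forall_compl_eq_zero (fun u hu => beta0_eq_zero (by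
      by_contra h
      push Not at h
      exact hu ⟨by linarith [h.1], by linarith [h.2]⟩))]
  exact β0.integral_pos

lemma contDiff_primitive_bump : ContDiff ℝ (⊤ : ℕ∞) (fun x : ℝ => ∫ u in (0 : ℝ)..x, β0 u) := by
  have h : ∀ x : ℝ, HasDerivAt (fun x : ℝ => ∫ u in (0 : ℝ)..x, β0 u) (β0 x) x := fun x =>
    intervalIntegral.integral_hasDerivAt_right (β0.continuous.intervalIntegrable _ _)
      (β0.continuous.stronglyMeasurableAtFilter _ _) β0.continuous.continuousAt
  rw [contDiff_infty_iff_deriv]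
  refine ⟨fun x => (h x).differentiableAt, ?_⟩
  rw [show deriv (fun x : ℝ => ∫ u in (0 : ℝ)..x, β0 u) = β0 from funext fun x => (h x).deriv]
  exact β0.contDiff

lemma contDiff_avgBump : ContDiff ℝ (⊤ : ℕ∞) avgBump :=
  (contDiff_primitive_bump.comp (by fun_prop)).sub (contDiff_primitive_bump.comp (by fun_prop))

lemma contDiff_avgBump_div : ContDiff ℝ (⊤ : ℕ∞) (fun ξ => avgBump ξ / ξ) := by
  rw [contDiff_iff_contDiffAt]
  intro ξ
  rcases eq_or_ne ξ 0 with rfl | h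
  · have : (fun ξ => avgBump ξ / ξ) =ᶠ[𝓝 0] fun _ => 0 := by
      filter_upwards [Iio_mem_nhds (show (0 : ℝ) < 1 / 8 by norm_num)] with ξ hξ
      rw [avgBump_eq_zero (Or.inl (le_of_lt hξ)), zero_div]
    exact contDiffAt_const.congr_of_eventuallyEq this
  · exact contDiff_avgBump.contDiffAt.div contDiffAt_id h

lemma hasCompactSupport_avgBump_div : HasCompactSupport (fun ξ => avgBump ξ / ξ) := by
  refine HasCompactSupport.of_support_subset_isCompact
    (isCompact_Icc (a := (1 / 8 : ℝ)) (b := 7 / 8)) fun ξ hξ => ?_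
  by_contra h
  refine hξ ?_
  dsimp only
  rw [avgBump_eq_zero, zero_div]
  by_contra hn
  push Not at hn
  exact h ⟨hn.1.le, hn.2.le⟩

/-- The kernel obtained by averaging the modulated wave packets over frequency. -/
def avgKernel (t : ℝ) : ℂ :=
  wp β0 0 0 t * ∫ θ in Ioc (1 / 2 : ℝ) 1, Complex.exp (↑(-(2 * Real.pi * (θ * t))) * Complex.I)

lemma fourier_avgBump (t : ℝ) : 𝓕 (fun ξ => ((avgBump ξ : ℝ) : ℂ)) t = avgKernel t := by
  rw [Real.fourier_eq']
  have h1 : ∀ ξ : ℝ, Complex.exp (↑(-2 * Real.pi * inner ℝ ξ t) * Complex.I) • ((avgBump ξ : ℝ) : ℂ)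
      = ∫ θ in Ioc (1 / 2 : ℝ) 1, Complex.exp (↑(-2 * Real.pi * (ξ * t)) * Complex.I) *
        ((β0 (θ - ξ) : ℝ) : ℂ) := fun ξ => by
    rw [avgBump_eq' ξ, integral_const_mul, integral_complex_ofReal, smul_eq_mul]
    congr 5
    simp [mul_comm]
  simp_rw [h1]
  rw [integral_integral_swap]
  · unfold avgKernel
    rw [← integral_const_mul]
    refine integral_congr_ae (ae_of_all _ fun θ => ?_)
    dsimp only
    rw [wp_eq_integral, ← integral_mul_const, ← integral_sub_left_eq_self _ volume θ]
    refine integral_congr_ae (ae_of_all _ fun u => ?_)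
    dsimp only
    rw [mul_right_comm (Complex.exp (↑(2 * Real.pi * (u * t)) * Complex.I)), ← Complex.exp_add]
    congr 2
    · push_cast
      ring
    · simp
  · have hg : Integrable (fun p : ℝ × ℝ => (Icc (-1 : ℝ) 1).indicator (fun _ => (1 : ℝ)) p.1)
        (volume.prod (volume.restrict (Ioc (1 / 2 : ℝ) 1))) :=
      ((integrable_indicator_iff measurableSet_Icc).2 (by simp)).comp_fst _
    refine hg.mono' ?_ ?_
    · refine Continuous.aestronglyMeasurable ?_
      have := β0.continuous
      unfold Function.uncurry
      fun_prop
    · filter_upwards [Measure.quasiMeasurePreserving_snd.ae (ae_restrict_mem measurableSet_Ioc)]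
        with p hp
      simp only [Function.uncurry]
      rw [norm_mul, Complex.norm_exp_ofReal_mul_I, one_mul, Complex.norm_real, Real.norm_eq_abs,
        abs_of_nonneg β0.nonneg]
      by_cases h : p.1 ∈ Icc (-1 : ℝ) 1
      · rw [Set.indicator_of_mem h]
        exact β0.le_one
      · rw [beta0_eq_zero (by
          by_contra h'
          push Not at h'
          exact h ⟨by linarith [h'.2, hp.1], by linarith [h'.1, hp.2]⟩)]
        exact Set.indicator_nonneg (fun _ _ => zero_le_one) _

lemma exists_avgPrimitive : ∃ Θ : 𝓢(ℝ, ℂ), Θ 0 ≠ 0 ∧ ∀ t, HasDerivAt Θ (avgKernel t) t := by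
  have hc : ContDiff ℝ (⊤ : ℕ∞) (fun ξ => ((Complex.I / (2 * Real.pi)) * ((avgBump ξ / ξ : ℝ) :
      ℂ))) :=
    contDiff_const.mul (Complex.ofRealCLM.contDiff.comp contDiff_avgBump_div)
  have hs : HasCompactSupport
      (fun ξ => ((Complex.I / (2 * Real.pi)) * ((avgBump ξ / ξ : ℝ) : ℂ))) :=
    (hasCompactSupport_avgBump_div.comp_left (g := ((↑) : ℝ → ℂ)) (by simp)).mul_left
  refine ⟨𝓕 (hs.toSchwartzMap hc), ?_, fun t => ?_⟩
  · rw [SchwartzMap.fourier_coe, Real.fourier_eq']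
    have hpos : 0 < ∫ ξ, avgBump ξ / ξ := by
      refine Continuous.integral_pos_of_hasCompactSupport_nonneg_nonzero (x := 1 / 2)
        contDiff_avgBump_div.continuous hasCompactSupport_avgBump_div (fun ξ => ?_) ?_
      · rcases le_or_gt ξ 0 with h | h
        · simp [avgBump_eq_zero (Or.inl (by linarith : ξ ≤ 1 / 8))]
        · exact div_nonneg (avgBump_nonneg ξ) h.le
      · have := avgBump_half_pos
        positivity
    simp only [inner_zero_right, mul_zero, Complex.ofReal_zero, zero_mul, Complex.exp_zero,
      one_smul]
    change (∫ ξ : ℝ, (Complex.I / (2 * Real.pi)) * ((avgBump ξ / ξ : ℝ) : ℂ)) ≠ 0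
    rw [integral_const_mul, integral_complex_ofReal]
    refine mul_ne_zero (div_ne_zero Complex.I_ne_zero ?_) (by exact_mod_cast hpos.ne')
    simp [Real.pi_ne_zero]
  · have h := Real.hasDerivAt_fourier
      (f := fun ξ => ((Complex.I / (2 * Real.pi)) * ((avgBump ξ / ξ : ℝ) : ℂ)))
      (hc.continuous.integrable_of_hasCompactSupport hs)
      ((continuous_id.smul hc.continuous).integrable_of_hasCompactSupport hs.smul_left) t
    rw [← fourier_avgBump]
    suffices e : (fun ξ => ((avgBump ξ : ℝ) : ℂ)) = fun x : ℝ => (-2 * Real.pi * Complex.I * x) •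
        ((Complex.I / (2 * Real.pi)) * ((avgBump x / x : ℝ) : ℂ)) by
      rw [e]
      exact h
    ext ξ
    rcases eq_or_ne ξ 0 with rfl | hξ
    · simp [avgBump_eq_zero (Or.inl (by norm_num : (0 : ℝ) ≤ 1 / 8))]
    · have h1 : (ξ : ℂ) ≠ 0 := by exact_mod_cast hξ
      have h2 : (Real.pi : ℂ) ≠ 0 := by exact_mod_cast Real.pi_ne_zero
      push_cast
      rw [smul_eq_mul]
      field_simp
      rw [Complex.I_sq]
      ring

lemma exists_schwartz_eq_avgKernel : ∃ g : 𝓢(ℝ, ℂ), ∀ t, g t = avgKernel t := by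
  obtain ⟨Θ, -, h⟩ := exists_avgPrimitive
  exact ⟨SchwartzMap.derivCLM ℝ ℂ Θ, fun t => (h t).deriv⟩

lemma continuous_avgKernel : Continuous avgKernel := by
  obtain ⟨g, hg⟩ := exists_schwartz_eq_avgKernel
  rw [← funext hg]
  exact g.continuous

lemma exists_avgKernel_le : ∃ D : ℝ≥0, ∀ t, ‖avgKernel t‖ ≤ D := by
  obtain ⟨g, hg⟩ := exists_schwartz_eq_avgKernel
  obtain ⟨D, hD⟩ := schwartz_bdd g
  exact ⟨D, fun t => hg t ▸ hD t⟩

/-! ### Averaging the model operator -/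

lemma integral_fract_comp {g : ℝ → ℂ} (hg : Measurable g) {D : ℝ} (hD : ∀ θ, ‖g θ‖ ≤ D) (c : ℝ) {n
    : ℕ} (hn : n ≠ 0) :
    ∫ u in (0 : ℝ)..1, g (Int.fract (c + n * u)) = ∫ θ in (0 : ℝ)..1, g θ := by
  have hn' : (n : ℝ) ≠ 0 := by exact_mod_cast hn
  have hp : Function.Periodic (fun v : ℝ => g (Int.fract v)) 1 := fun v => by
    simp only [Int.fract_add_one]
  rw [intervalIntegral.integral_comp_add_mul (fun v => g (Int.fract v)) hn']
  have hi : ∀ a b, IntervalIntegrable (fun v => g (Int.fract v)) volume a b := fun a b =>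
    intervalIntegrable_const.mono_fun' (g := fun _ => D)
      (hg.comp measurable_fract).aestronglyMeasurable (ae_of_all _ fun v => hD _)
  have h := hp.intervalIntegral_add_zsmul_eq n c hi
  have h0 : ∫ v in c..c + 1, g (Int.fract v) = ∫ v in (0 : ℝ)..1, g (Int.fract v) := by
    simpa using hp.intervalIntegral_add_eq c 0
  simp only [natCast_zsmul, nsmul_eq_mul, mul_one] at h
  rw [mul_zero, add_zero, mul_one, h, h0, Complex.real_smul, ← mul_assoc]
  push_cast
  rw [inv_mul_cancel₀ (by exact_mod_cast hn), one_mul, intervalIntegral.integral_of_le zero_le_one,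
    intervalIntegral.integral_of_le zero_le_one, integral_Ioc_eq_integral_Ioo,
    integral_Ioc_eq_integral_Ioo]
  refine setIntegral_congr_fun measurableSet_Ioo fun θ hθ => ?_
  rw [Int.fract_eq_self.2 ⟨hθ.1.le, hθ.2⟩]

/-- The kernel at frequency phase `θ`, before averaging. -/
def phaseKernel (θ s : ℝ) : ℂ :=
  if 1 / 2 ≤ θ then wp β0 0 0 s * Complex.exp (↑(-(2 * Real.pi * (θ * s))) * Complex.I) else 0

lemma integral_phaseKernel (s : ℝ) : ∫ θ in (0 : ℝ)..1, phaseKernel θ s = avgKernel s := by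
  rw [intervalIntegral.integral_of_le zero_le_one]
  have h : ∀ θ, phaseKernel θ s = (Ici (1 / 2 : ℝ)).indicator (fun θ => wp β0 0 0 s *
      Complex.exp (↑(-(2 * Real.pi * (θ * s))) * Complex.I)) θ := fun θ => by
    unfold phaseKernel
    rw [Set.indicator_apply]
    rfl
  simp_rw [h]
  rw [setIntegral_indicator measurableSet_Ici, avgKernel, ← integral_const_mul,
    show Ioc (0 : ℝ) 1 ∩ Ici (1 / 2) = Icc (1 / 2) 1 by
      ext θ
      simp only [Set.mem_inter_iff, Set.mem_Ioc, Set.mem_Ici, Set.mem_Icc]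
      constructor
      · rintro ⟨⟨h1, h2⟩, h3⟩; exact ⟨h3, h2⟩
      · rintro ⟨h1, h2⟩; exact ⟨⟨by linarith, h2⟩, h1⟩, integral_Icc_eq_integral_Ioc]

lemma dy_eq_two_mul_add_one_iff (k : ℤ) (η : ℝ) :
    dy (-k - 1) η = 2 * dy (-k) η + 1 ↔ 1 / 2 ≤ Int.fract (2 ^ k * η) := by
  unfold dy
  rw [show -(-k - 1) = k + 1 by ring, neg_neg, zpow_add₀ two_ne_zero, zpow_one,
    show η * (2 ^ k * 2) = 2 * (2 ^ k * η) by ring, mul_comm η (2 ^ k), Int.floor_eq_iff]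
  have h := Int.floor_add_fract ((2 : ℝ) ^ k * η)
  have h1 := Int.fract_lt_one ((2 : ℝ) ^ k * η)
  push_cast
  constructor
  · rintro ⟨h2, h3⟩
    linarith
  · intro h2
    constructor <;> linarith

lemma model_term_eq (h : ℝ → ℂ) (k : ℤ) (η x : ℝ) :
    (if dy (-k - 1) η = 2 * dy (-k) η + 1 then hh h k (dy (-k) η) x else 0) =
      ∫ y, h y * (Complex.exp (↑(2 * Real.pi * (η * (x - y))) * Complex.I) *
        (2 ^ (-k) * phaseKernel (Int.fract (2 ^ k * η)) (2 ^ (-k) * (x - y)))) := by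
  unfold phaseKernel
  by_cases hk : 1 / 2 ≤ Int.fract (2 ^ k * η)
  · rw [if_pos ((dy_eq_two_mul_add_one_iff k η).2 hk)]
    unfold hh cv
    refine integral_congr_ae (ae_of_all _ fun y => ?_)
    dsimp only
    rw [if_pos hk, wp_formula]
    have e : Complex.exp (↑(2 * Real.pi * (dy (-k) η * (2 ^ (-k) * (x - y)))) * Complex.I) =
        Complex.exp (↑(2 * Real.pi * (η * (x - y))) * Complex.I) * Complex.exp
          (↑(-(2 * Real.pi * (Int.fract (2 ^ k * η) * (2 ^ (-k) * (x - y))))) * Complex.I) := by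
      rw [← Complex.exp_add, ← add_mul, ← Complex.ofReal_add]
      congr 3
      rw [Int.fract, show dy (-k) η = ⌊2 ^ k * η⌋ by rw [dy, neg_neg, mul_comm], zpow_neg]
      have : (2 : ℝ) ^ k ≠ 0 := by positivity
      field_simp
      ring
    rw [e]
    ring
  · rw [if_neg (fun h' => hk ((dy_eq_two_mul_add_one_iff k η).1 h'))]
    simp only [if_neg hk, mul_zero, integral_zero]

lemma measurable_phaseKernel : Measurable fun p : ℝ × ℝ => phaseKernel p.1 p.2 := by
  unfold phaseKernel
  refine Measurable.ite (measurableSet_le measurable_const measurable_fst) ?_ measurable_const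
  have := (wp β0 0 0).continuous
  fun_prop

lemma exists_phaseKernel_le : ∃ D : ℝ≥0, ∀ θ s, ‖phaseKernel θ s‖ ≤ D := by
  obtain ⟨D, hD⟩ := schwartz_bdd (wp β0 0 0)
  refine ⟨D, fun θ s => ?_⟩
  unfold phaseKernel
  split_ifs
  · rw [norm_mul, Complex.norm_exp_ofReal_mul_I, mul_one]
    exact hD s
  · simp

/-- Modulation by the frequency `w`. -/
def modulate (w : ℝ) (h : ℝ → ℂ) (y : ℝ) : ℂ := Complex.exp (↑(2 * Real.pi * (w * y)) * Complex.I)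
    * h y

lemma modelOp_modulate (K : ℕ) (h : ℝ → ℂ) (η w x : ℝ) :
    Complex.exp (↑(-(2 * Real.pi * (w * x))) * Complex.I) * modelOp K (modulate w h) (η + w) x =
      ∑ k ∈ Finset.Icc (-(K : ℤ)) K, ∫ y, h y * (Complex.exp (↑(2 * Real.pi * (η * (x - y))) *
        Complex.I) * (2 ^ (-k) *
          phaseKernel (Int.fract (2 ^ k * (η + w))) (2 ^ (-k) * (x - y)))) := by
  unfold modelOp
  rw [Finset.mul_sum]
  refine Finset.sum_congr rfl fun k _ => ?_
  rw [model_term_eq, ← integral_const_mul]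
  refine integral_congr_ae (ae_of_all _ fun y => ?_)
  dsimp only [modulate]
  have e : Complex.exp (↑(2 * Real.pi * (η * (x - y))) * Complex.I) =
      Complex.exp (↑(-(2 * Real.pi * (w * x))) * Complex.I) *
        Complex.exp (↑(2 * Real.pi * (w * y)) * Complex.I) *
        Complex.exp (↑(2 * Real.pi * ((η + w) * (x - y))) * Complex.I) := by
    rw [← Complex.exp_add, ← Complex.exp_add, ← add_mul, ← add_mul, ← Complex.ofReal_add,
      ← Complex.ofReal_add]
    congr 3
    ring
  rw [e]
  ring

lemma integral_modelOp_modulate (K : ℕ) {h : ℝ → ℂ} (hh : Integrable h) (η x : ℝ) :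
    ∫ u in (0 : ℝ)..1, Complex.exp (↑(-(2 * Real.pi * (2 ^ K * u * x))) * Complex.I) *
        modelOp K (modulate (2 ^ K * u) h) (η + 2 ^ K * u) x =
      ∫ y, h y * (Complex.exp (↑(2 * Real.pi * (η * (x - y))) * Complex.I) *
        ∑ k ∈ Finset.Icc (-(K : ℤ)) K, 2 ^ (-k) * avgKernel (2 ^ (-k) * (x - y))) := by
  obtain ⟨D, hD⟩ := exists_phaseKernel_le
  simp_rw [modelOp_modulate]
  have hInt : ∀ k : ℤ, Integrable (Function.uncurry fun u y : ℝ => h y *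
      (Complex.exp (↑(2 * Real.pi * (η * (x - y))) * Complex.I) * (2 ^ (-k) *
        phaseKernel (Int.fract (2 ^ k * (η + 2 ^ K * u))) (2 ^ (-k) * (x - y)))))
      ((volume.restrict (Ioc (0 : ℝ) 1)).prod volume) := fun k => by
    unfold Function.uncurry
    refine (hh.comp_snd (volume.restrict (Ioc (0 : ℝ) 1))).mul_bdd (c := 2 ^ (-k) * D) ?_ ?_
    · refine Measurable.aestronglyMeasurable ?_
      have h1 : Measurable fun p : ℝ × ℝ => phaseKernel (Int.fract (2 ^ k * (η + 2 ^ K * p.1)))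
          (2 ^ (-k) * (x - p.2)) := by
        refine measurable_phaseKernel.comp (f := fun p : ℝ × ℝ =>
          (Int.fract (2 ^ k * (η + 2 ^ K * p.1)), 2 ^ (-k) * (x - p.2))) ?_
        exact (measurable_fract.comp (by fun_prop)).prodMk (by fun_prop)
      have h2 : Measurable fun p : ℝ × ℝ =>
          Complex.exp (↑(2 * Real.pi * (η * (x - p.2))) * Complex.I) := by fun_prop
      exact h2.mul (h1.const_mul _)
    · refine ae_of_all _ fun p => ?_
      rw [norm_mul, Complex.norm_exp_ofReal_mul_I, one_mul, norm_mul, norm_zpow,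
        Complex.norm_ofNat]
      exact mul_le_mul_of_nonneg_left (hD _ _) (by positivity)
  rw [intervalIntegral.integral_of_le zero_le_one,
    integral_finsetSum _ fun k _ => by simpa only [Function.uncurry] using! (hInt
        k).integral_prod_left]
  have hterm : ∀ k ∈ Finset.Icc (-(K : ℤ)) K, ∫ u in Ioc (0 : ℝ) 1, ∫ y, h y *
      (Complex.exp (↑(2 * Real.pi * (η * (x - y))) * Complex.I) * (2 ^ (-k) *
        phaseKernel (Int.fract (2 ^ k * (η + 2 ^ K * u))) (2 ^ (-k) * (x - y)))) =
      ∫ y, h y * (Complex.exp (↑(2 * Real.pi * (η * (x - y))) * Complex.I) *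
        (2 ^ (-k) * avgKernel (2 ^ (-k) * (x - y)))) := fun k hk => by
    rw [integral_integral_swap (hInt k)]
    refine integral_congr_ae (ae_of_all _ fun y => ?_)
    dsimp only
    rw [integral_const_mul, integral_const_mul, integral_const_mul]
    congr 3
    rw [← intervalIntegral.integral_of_le zero_le_one, ← integral_phaseKernel]
    rw [Finset.mem_Icc] at hk
    have h3 : (2 : ℝ) ^ k * 2 ^ K = ((2 ^ (k + K).toNat : ℕ) : ℝ) := by
      push_cast
      rw [← zpow_natCast, ← zpow_natCast, ← zpow_add₀ two_ne_zero, Int.toNat_of_nonneg (by omega)]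
    rw [← integral_fract_comp (g := fun θ => phaseKernel θ (2 ^ (-k) * (x - y)))
      (measurable_phaseKernel.comp (f := fun θ : ℝ => (θ, 2 ^ (-k) * (x - y))) (by fun_prop))
      (fun θ => hD θ _) (2 ^ k * η)
      (n := 2 ^ (k + K).toNat) (by positivity)]
    refine intervalIntegral.integral_congr fun u _ => ?_
    rw [← h3]
    congr 2
    ring
  rw [Finset.sum_congr rfl hterm, ← integral_finsetSum]
  · refine integral_congr_ae (ae_of_all _ fun y => ?_)
    dsimp only
    rw [Finset.mul_sum, Finset.mul_sum]
  · intro k _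
    obtain ⟨D', hD'⟩ := exists_avgKernel_le
    refine hh.mul_bdd (c := 2 ^ (-k) * D') ?_ ?_
    · have := continuous_avgKernel
      exact Continuous.aestronglyMeasurable (by fun_prop)
    · refine ae_of_all _ fun p => ?_
      rw [norm_mul, Complex.norm_exp_ofReal_mul_I, one_mul, norm_mul, norm_zpow,
        Complex.norm_ofNat]
      exact mul_le_mul_of_nonneg_left (hD' _) (by positivity)

lemma integral_dilate_avgKernel {Θ : 𝓢(ℝ, ℂ)} (hΘ : ∀ t, HasDerivAt Θ (avgKernel t) t) (k : ℤ)
    {t : ℝ} (ht : t ≠ 0) :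
    ∫ l in (1 : ℝ)..2, ((l ^ 2)⁻¹ : ℝ) * (2 ^ (-k) * avgKernel (2 ^ (-k) * (t / l))) =
      (Θ (2 ^ (-k) * t) - Θ (2 ^ (-k - 1) * t)) / t := by
  have htc : (t : ℂ) ≠ 0 := by exact_mod_cast ht
  have hd : ∀ l ∈ uIcc (1 : ℝ) 2, HasDerivAt (fun l : ℝ => -(Θ (2 ^ (-k) * (t / l)) / t))
      (((l ^ 2)⁻¹ : ℝ) * (2 ^ (-k) * avgKernel (2 ^ (-k) * (t / l)))) l := fun l hl => by
    rw [uIcc_of_le (by norm_num)] at hl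
    have hl0 : l ≠ 0 := by linarith [hl.1]
    have h1 : HasDerivAt (fun l : ℝ => 2 ^ (-k) * (t / l)) (2 ^ (-k) * (-(t * (l ^ 2)⁻¹))) l := by
      have := ((hasDerivAt_inv hl0).const_mul t).const_mul ((2 : ℝ) ^ (-k))
      simp only [div_eq_mul_inv]
      refine this.congr_deriv ?_
      ring
    have h2 := (((hΘ (2 ^ (-k) * (t / l))).scomp l h1).div_const (t : ℂ)).neg
    refine h2.congr_deriv ?_
    rw [Complex.real_smul]
    push_cast
    field_simp
  rw [intervalIntegral.integral_eq_sub_of_hasDerivAt hd]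
  · have : (2 : ℝ) ^ (-k) * (t / 2) = 2 ^ (-k - 1) * t := by
      rw [zpow_sub_one₀ two_ne_zero]
      ring
    rw [this, div_one]
    ring
  · refine ContinuousOn.intervalIntegrable fun l hl => ?_
    rw [uIcc_of_le (by norm_num)] at hl
    have hl0 : l ≠ 0 := by linarith [hl.1]
    refine ContinuousAt.continuousWithinAt ?_
    have h1 : ContinuousAt (fun l : ℝ => 2 ^ (-k) * (t / l)) l :=
      continuousAt_const.mul (continuousAt_const.div continuousAt_id hl0)
    have h2 : ContinuousAt (fun l : ℝ => (((l ^ 2)⁻¹ : ℝ) : ℂ)) l :=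
      Complex.continuous_ofReal.continuousAt.comp
        (((continuous_pow 2).continuousAt).inv₀ (by positivity))
    exact h2.mul (continuousAt_const.mul (ContinuousAt.comp (f := fun l : ℝ => 2 ^ (-k) * (t / l))
      continuous_avgKernel.continuousAt h1))

/-- The kernel obtained from the frequency-averaged model operator. -/
def scaleKernel (K : ℕ) (s : ℝ) : ℂ :=
  ∑ k ∈ Finset.Icc (-(K : ℤ)) K, 2 ^ (-k) * avgKernel (2 ^ (-k) * s)

lemma continuous_scaleKernel (K : ℕ) : Continuous (scaleKernel K) := by
  have := continuous_avgKernel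
  unfold scaleKernel
  fun_prop

lemma exists_scaleKernel_le (K : ℕ) : ∃ D : ℝ≥0, ∀ s, ‖scaleKernel K s‖ ≤ D := by
  obtain ⟨D, hD⟩ := exists_avgKernel_le
  refine ⟨∑ k ∈ Finset.Icc (-(K : ℤ)) K, 2 ^ (-k) * D, fun s => ?_⟩
  push_cast
  refine norm_sum_le_of_le _ fun k _ => ?_
  rw [norm_mul, norm_zpow, Complex.norm_ofNat]
  exact mul_le_mul_of_nonneg_left (hD _) (by positivity)

lemma sum_Icc_telescope (a : ℤ → ℂ) (K : ℕ) :
    ∑ k ∈ Finset.Icc (-(K : ℤ)) K, (a (-k) - a (-k - 1)) = a K - a (-(K : ℤ) - 1) := by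
  induction K with
  | zero => simp
  | succ n ih =>
    have : Finset.Icc (-((n + 1 : ℕ) : ℤ)) (n + 1 : ℕ) =
        insert (-((n : ℤ) + 1)) (insert ((n : ℤ) + 1) (Finset.Icc (-(n : ℤ)) n)) := by
      ext k
      simp only [Finset.mem_insert, Finset.mem_Icc]
      push_cast
      omega
    rw [this, Finset.sum_insert, Finset.sum_insert, ih]
    · have e : -(-((n : ℤ) + 1)) - 1 = n := by ring
      rw [e]
      push_cast
      rw [neg_neg, show -((n : ℤ) + 1) = -(n : ℤ) - 1 by ring]
      ring
    · simp
    · simp only [Finset.mem_insert, Finset.mem_Icc]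
      omega

lemma integral_dilate_scaleKernel {Θ : 𝓢(ℝ, ℂ)} (hΘ : ∀ t, HasDerivAt Θ (avgKernel t) t) (K : ℕ)
    {t : ℝ} (ht : t ≠ 0) :
    ∫ l in (1 : ℝ)..2, ((l ^ 2)⁻¹ : ℝ) * scaleKernel K (t / l) =
      (Θ (2 ^ (K : ℤ) * t) - Θ (2 ^ (-(K : ℤ) - 1) * t)) / t := by
  unfold scaleKernel
  simp_rw [Finset.mul_sum]
  rw [intervalIntegral.integral_finsetSum]
  · rw [Finset.sum_congr rfl fun k _ => integral_dilate_avgKernel hΘ k ht, ← Finset.sum_div,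
      sum_Icc_telescope fun k => Θ (2 ^ k * t)]
  · intro k _
    refine ContinuousOn.intervalIntegrable fun l hl => ?_
    rw [uIcc_of_le (by norm_num)] at hl
    have hl0 : l ≠ 0 := by linarith [hl.1]
    refine ContinuousAt.continuousWithinAt ?_
    have h1 : ContinuousAt (fun l : ℝ => 2 ^ (-k) * (t / l)) l :=
      continuousAt_const.mul (continuousAt_const.div continuousAt_id hl0)
    have h2 : ContinuousAt (fun l : ℝ => (((l ^ 2)⁻¹ : ℝ) : ℂ)) l :=
      Complex.continuous_ofReal.continuousAt.comp
        (((continuous_pow 2).continuousAt).inv₀ (by positivity))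
    exact h2.mul (continuousAt_const.mul (ContinuousAt.comp (f := fun l : ℝ => 2 ^ (-k) * (t / l))
      continuous_avgKernel.continuousAt h1))

/-- The average of the modulated and dilated model operator. -/
lemma integral_modelOp_dilate {Θ : 𝓢(ℝ, ℂ)} (hΘ : ∀ t, HasDerivAt Θ (avgKernel t) t) (K : ℕ)
    {f : ℝ → ℂ} (hf : Integrable f) (η x : ℝ) :
    ∫ l in (1 : ℝ)..2, ((l⁻¹ : ℝ) : ℂ) * ∫ u in (0 : ℝ)..1,
      Complex.exp (↑(-(2 * Real.pi * (2 ^ K * u * (x / l)))) * Complex.I) *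
        modelOp K (modulate (2 ^ K * u) fun y => f (l * y)) (l * η + 2 ^ K * u) (x / l) =
      ∫ z, f z * (Complex.exp (↑(2 * Real.pi * (η * (x - z))) * Complex.I) *
        ((Θ (2 ^ (K : ℤ) * (x - z)) - Θ (2 ^ (-(K : ℤ) - 1) * (x - z))) / (x - z : ℝ))) := by
  obtain ⟨D, hD⟩ := exists_scaleKernel_le K
  have hsk := continuous_scaleKernel K
  have h1 : ∀ l ∈ uIcc (1 : ℝ) 2, ((l⁻¹ : ℝ) : ℂ) * ∫ u in (0 : ℝ)..1,
      Complex.exp (↑(-(2 * Real.pi * (2 ^ K * u * (x / l)))) * Complex.I) *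
        modelOp K (modulate (2 ^ K * u) fun y => f (l * y)) (l * η + 2 ^ K * u) (x / l) =
      ∫ z, f z * (Complex.exp (↑(2 * Real.pi * (η * (x - z))) * Complex.I) *
        (((l ^ 2)⁻¹ : ℝ) * scaleKernel K ((x - z) / l))) := fun l hl => by
    rw [uIcc_of_le (by norm_num)] at hl
    have hl0 : 0 < l := by linarith [hl.1]
    rw [integral_modelOp_modulate K (hf.comp_mul_left' hl0.ne')]
    have h2 := Measure.integral_comp_mul_left (fun z => f z *
      (Complex.exp (↑(2 * Real.pi * (η * (x - z))) * Complex.I) *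
        (((l⁻¹ : ℝ) : ℂ) * scaleKernel K ((x - z) / l)))) l
    rw [abs_of_pos (inv_pos.2 hl0), Complex.real_smul] at h2
    rw [← integral_const_mul] at h2 ⊢
    refine Eq.trans (integral_congr_ae (ae_of_all _ fun y => ?_)) (h2.trans
      (integral_congr_ae (ae_of_all _ fun y => ?_)))
    · dsimp only
      rw [show l * η * (x / l - y) = η * (x - l * y) by field_simp,
        show x / l - y = (x - l * y) / l by field_simp]
      unfold scaleKernel
      ring
    · dsimp only
      push_cast
      ring
  rw [intervalIntegral.integral_congr h1, intervalIntegral.integral_of_le (by norm_num),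
    integral_integral_swap]
  · refine integral_congr_ae ?_
    filter_upwards [(measure_singleton x : volume {x} = 0) |> compl_mem_ae_iff.2] with z hz
    have hz' : x - z ≠ 0 := sub_ne_zero.2 fun h => hz h.symm
    rw [integral_const_mul, integral_const_mul, ← intervalIntegral.integral_of_le (by norm_num),
      integral_dilate_scaleKernel hΘ K hz']
  · unfold Function.uncurry
    refine (hf.comp_snd (volume.restrict (Ioc (1 : ℝ) 2))).mul_bdd (c := 1 * D) ?_ ?_
    · refine Measurable.aestronglyMeasurable ?_
      have h3 : Measurable fun p : ℝ × ℝ => scaleKernel K ((x - p.2) / p.1) :=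
        hsk.measurable.comp (f := fun p : ℝ × ℝ => (x - p.2) / p.1) (by fun_prop)
      have h2 : Measurable fun p : ℝ × ℝ =>
          Complex.exp (↑(2 * Real.pi * (η * (x - p.2))) * Complex.I) := by fun_prop
      have h4 : Measurable fun p : ℝ × ℝ => (((p.1 ^ 2)⁻¹ : ℝ) : ℂ) := by fun_prop
      exact h2.mul (h4.mul h3)
    · filter_upwards [Measure.quasiMeasurePreserving_fst.ae (ae_restrict_mem measurableSet_Ioc)]
        with p hp
      rw [norm_mul, Complex.norm_exp_ofReal_mul_I, one_mul, norm_mul]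
      refine mul_le_mul ?_ (hD _) (norm_nonneg _) zero_le_one
      rw [Complex.norm_real, Real.norm_of_nonneg (by positivity)]
      exact inv_le_one_of_one_le₀ (one_le_pow₀ hp.1.le)

/-! ### The averaged maximal operator -/

/-- The parameter measure of dilations and modulations. -/
def dilMeasure : Measure (ℝ × ℝ) :=
  (volume.restrict (Ioc (1 : ℝ) 2)).prod (volume.restrict (Ioc (0 : ℝ) 1))

instance : IsProbabilityMeasure dilMeasure := by
  have h1 : IsProbabilityMeasure (volume.restrict (Ioc (1 : ℝ) 2)) := ⟨by simp; norm_num⟩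
  have h2 : IsProbabilityMeasure (volume.restrict (Ioc (0 : ℝ) 1)) := ⟨by simp⟩
  unfold dilMeasure
  infer_instance

/-- The dilated and modulated model maximal operator. -/
def dilModelMax (K : ℕ) (f : ℝ → ℂ) (p : ℝ × ℝ) (x : ℝ) : ℝ≥0∞ :=
  modelMax K (modulate (2 ^ K * p.2) fun y => f (p.1 * y)) (x / p.1)

/-- The average of the dilated and modulated model maximal operators. -/
def avgModelMax (K : ℕ) (f : ℝ → ℂ) (x : ℝ) : ℝ≥0∞ := ∫⁻ p, dilModelMax K f p x ∂dilMeasure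

lemma measurable_modulate (w : ℝ) {h : ℝ → ℂ} (hm : Measurable h) : Measurable (modulate w h) := by
  unfold modulate
  fun_prop

lemma enorm_modulate (w : ℝ) (h : ℝ → ℂ) (y : ℝ) : ‖modulate w h y‖ₑ = ‖h y‖ₑ := by
  rw [modulate, enorm_mul, ← ofReal_norm, Complex.norm_exp_ofReal_mul_I, ENNReal.ofReal_one,
    one_mul]

lemma integrable_modulate (w : ℝ) {h : ℝ → ℂ} (hm : Measurable h) (hi : Integrable h) :
    Integrable (modulate w h) :=
  hi.mono (measurable_modulate w hm).aestronglyMeasurable (ae_of_all _ fun y => by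
    rw [← toReal_enorm, ← toReal_enorm, enorm_modulate])

lemma measurable_dilModelMax (K : ℕ) {f : ℝ → ℂ} (hf : Measurable f) :
    Measurable fun q : (ℝ × ℝ) × ℝ => dilModelMax K f q.1 q.2 := by
  have hcv : ∀ k l : ℤ, Measurable fun q : (ℝ × ℝ) × ℝ =>
      hh (modulate (2 ^ K * q.1.2) fun y => f (q.1.1 * y)) k l (q.2 / q.1.1) := fun k l => by
    unfold hh cv modulate
    have hw := (wp β0 k l).continuous.measurable
    refine (StronglyMeasurable.integral_prod_right' (ν := volume)
      (f := fun z : ((ℝ × ℝ) × ℝ) × ℝ =>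
        Complex.exp (↑(2 * Real.pi * (2 ^ K * z.1.1.2 * z.2)) * Complex.I) * f (z.1.1.1 * z.2) *
          wp β0 k l (z.1.2 / z.1.1.1 - z.2)) ?_).measurable
    refine Measurable.stronglyMeasurable ?_
    have h1 : Measurable fun z : ((ℝ × ℝ) × ℝ) × ℝ => f (z.1.1.1 * z.2) :=
      hf.comp (f := fun z : ((ℝ × ℝ) × ℝ) × ℝ => z.1.1.1 * z.2) (by fun_prop)
    have h2 : Measurable fun z : ((ℝ × ℝ) × ℝ) × ℝ => wp β0 k l (z.1.2 / z.1.1.1 - z.2) :=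
      hw.comp (f := fun z : ((ℝ × ℝ) × ℝ) × ℝ => z.1.2 / z.1.1.1 - z.2) (by fun_prop)
    have h3 : Measurable fun z : ((ℝ × ℝ) × ℝ) × ℝ =>
        Complex.exp (↑(2 * Real.pi * (2 ^ K * z.1.1.2 * z.2)) * Complex.I) := by fun_prop
    exact (h3.mul h1).mul h2
  unfold dilModelMax modelMax modelOp
  refine Measurable.iSup fun m => Measurable.enorm ?_
  refine Finset.measurable_fun_sum _ fun k _ => ?_
  split_ifs
  · exact hcv _ _
  · exact measurable_const

lemma measurable_avgModelMax (K : ℕ) {f : ℝ → ℂ} (hf : Measurable f) :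
    Measurable (avgModelMax K f) := by
  unfold avgModelMax
  exact Measurable.lintegral_prod_left' (f := fun q : (ℝ × ℝ) × ℝ => dilModelMax K f q.1 q.2)
    (measurable_dilModelMax K hf)

lemma lintegral_rpow_le_of_isProbabilityMeasure {α : Type*} [MeasurableSpace α] {μ : Measure α}
    [IsProbabilityMeasure μ] {r : ℝ} (hr : 1 < r) {F : α → ℝ≥0∞} (hF : AEMeasurable F μ) :
    (∫⁻ a, F a ∂μ) ^ r ≤ ∫⁻ a, F a ^ r ∂μ := by
  have hr0 : 0 < r := by linarith
  have h := ENNReal.lintegral_mul_le_Lp_mul_Lq μ (Real.HolderConjugate.conjExponent hr) hF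
    (aemeasurable_const (b := 1))
  simp only [Pi.mul_apply, mul_one, ENNReal.one_rpow, lintegral_const, measure_univ] at h
  calc _ ≤ ((∫⁻ a, F a ^ r ∂μ) ^ (1 / r)) ^ r := ENNReal.rpow_le_rpow h hr0.le
    _ = _ := by rw [← ENNReal.rpow_mul, one_div_mul_cancel hr0.ne', ENNReal.rpow_one]

lemma lintegral_comp_mul_left_real (F : ℝ → ℝ≥0∞) (hF : Measurable F) {a : ℝ} (ha : 0 < a) :
    ∫⁻ x, F (a * x) = ENNReal.ofReal a⁻¹ * ∫⁻ x, F x := by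
  rw [← lintegral_map hF (measurable_const_mul a), Real.map_volume_mul_left ha.ne',
    lintegral_smul_measure, abs_of_pos (inv_pos.2 ha), smul_eq_mul]

/-- The strong bound for the averaged maximal operator. -/
lemma avgModelMax_strong {r : ℝ} (hr : 1 < r) : ∃ C : ℝ≥0, ∀ f : ℝ → ℂ, Measurable f →
    Integrable f → ∀ K : ℕ, ∫⁻ x, avgModelMax K f x ^ r ≤ C * ∫⁻ x, ‖f x‖ₑ ^ r := by
  obtain ⟨C, hC⟩ := modelMax_strong hr
  refine ⟨C, fun f hf hfi K => ?_⟩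
  have hm := measurable_dilModelMax K hf
  have hp : ∀ p : ℝ × ℝ, 0 < p.1 →
      ∫⁻ x, dilModelMax K f p x ^ r ≤ C * ∫⁻ x, ‖f x‖ₑ ^ r := fun p hp0 => by
    have hg : Measurable fun y => f (p.1 * y) := by fun_prop
    have hgi := hfi.comp_mul_left' hp0.ne'
    have h1 := hC _ (measurable_modulate (2 ^ K * p.2) hg) (integrable_modulate _ hg hgi) K
    have hmm := measurable_modelMax K (integrable_modulate (2 ^ K * p.2) hg hgi)
    simp_rw [enorm_modulate] at h1
    rw [lintegral_comp_mul_left_real (fun y => ‖f y‖ₑ ^ r) (by fun_prop) hp0] at h1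
    have h2 := lintegral_comp_mul_left_real (fun x => modelMax K (modulate (2 ^ K * p.2)
      fun y => f (p.1 * y)) x ^ r) (hmm.pow_const r) (inv_pos.2 hp0)
    unfold dilModelMax
    simp_rw [div_eq_inv_mul]
    rw [h2, inv_inv]
    calc _ ≤ ENNReal.ofReal p.1 * (C * (ENNReal.ofReal p.1⁻¹ * ∫⁻ x, ‖f x‖ₑ ^ r)) :=
          mul_le_mul_right h1 _
      _ = (ENNReal.ofReal p.1 * ENNReal.ofReal p.1⁻¹) * (C * ∫⁻ x, ‖f x‖ₑ ^ r) := by ring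
      _ = _ := by
          rw [← ENNReal.ofReal_mul hp0.le, mul_inv_cancel₀ hp0.ne', ENNReal.ofReal_one, one_mul]
  calc ∫⁻ x, avgModelMax K f x ^ r ≤ ∫⁻ x, (∫⁻ p, dilModelMax K f p x ^ r ∂dilMeasure) := by
        refine lintegral_mono fun x => lintegral_rpow_le_of_isProbabilityMeasure hr ?_
        exact (hm.comp (f := fun p : ℝ × ℝ => (p, x)) (by fun_prop)).aemeasurable
    _ = ∫⁻ p, (∫⁻ x, dilModelMax K f p x ^ r) ∂dilMeasure := by
        refine lintegral_lintegral_swap (f := fun x p => dilModelMax K f p x ^ r) ?_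
        exact ((hm.comp (f := fun q : ℝ × (ℝ × ℝ) => (q.2, q.1))
          (by fun_prop)).pow_const r).aemeasurable
    _ ≤ ∫⁻ _, (C * ∫⁻ x, ‖f x‖ₑ ^ r) ∂dilMeasure := by
        refine lintegral_mono_ae ?_
        filter_upwards [Measure.quasiMeasurePreserving_fst.ae
          (ae_restrict_mem measurableSet_Ioc)] with p hp1
        exact hp p (by linarith [hp1.1])
    _ = _ := by rw [lintegral_const, measure_univ, mul_one]

/-- The averaged maximal operator controls the truncated modulated kernels. -/
lemma enorm_truncated_le_avgModelMax {Θ : 𝓢(ℝ, ℂ)} (hΘ : ∀ t, HasDerivAt Θ (avgKernel t) t) (K : ℕ)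
    {f : ℝ → ℂ} (hfm : Measurable f) (hf : Integrable f) (η x : ℝ) :
    ‖∫ z, f z * (Complex.exp (↑(2 * Real.pi * (η * (x - z))) * Complex.I) *
      ((Θ (2 ^ (K : ℤ) * (x - z)) - Θ (2 ^ (-(K : ℤ) - 1) * (x - z))) / (x - z : ℝ)))‖ₑ ≤
      avgModelMax K f x := by
  have hm : Measurable fun p : ℝ × ℝ => dilModelMax K f p x :=
    (measurable_dilModelMax K hfm).comp (f := fun p : ℝ × ℝ => (p, x)) (by fun_prop)
  rw [← integral_modelOp_dilate hΘ K hf, intervalIntegral.integral_of_le (by norm_num), avgModelMax,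
    dilMeasure, lintegral_prod _ hm.aemeasurable]
  refine (enorm_integral_le_lintegral_enorm _).trans ?_
  refine setLIntegral_mono' measurableSet_Ioc fun l hl => ?_
  rw [enorm_mul]
  have h1 : ‖((l⁻¹ : ℝ) : ℂ)‖ₑ ≤ 1 := by
    rw [← ofReal_norm, Complex.norm_real, Real.norm_of_nonneg (inv_nonneg.2 (by linarith [hl.1]))]
    exact ENNReal.ofReal_le_one.2 (inv_le_one_of_one_le₀ hl.1.le)
  refine (mul_le_mul' h1 le_rfl).trans ?_
  rw [one_mul, intervalIntegral.integral_of_le zero_le_one]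
  refine (enorm_integral_le_lintegral_enorm _).trans (lintegral_mono fun u => ?_)
  rw [enorm_mul, ← ofReal_norm, Complex.norm_exp_ofReal_mul_I, ENNReal.ofReal_one, one_mul]
  exact modelOp_le_modelMax _ _ _ _

/-! ### Principal values -/

lemma mem_Icc_neg_one_one_iff {t : ℝ} : t ∈ Icc (-1 : ℝ) 1 ↔ |t| ≤ 1 := abs_le.symm

/-- The regularised quotient `(φ t - φ 0) / t`, with the subtraction performed only on `|t| ≤ 1`. -/
def regQuot (φ : ℝ → ℂ) (t : ℝ) : ℂ := (φ t - if |t| ≤ 1 then φ 0 else 0) / t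

lemma measurable_regQuot {φ : ℝ → ℂ} (hφ : Measurable φ) : Measurable (regQuot φ) := by
  unfold regQuot
  refine Measurable.div (hφ.sub (Measurable.ite ?_ measurable_const measurable_const)) (by fun_prop)
  exact measurableSet_le (by fun_prop) measurable_const

lemma integrable_regQuot {φ : ℝ → ℂ} {L : ℝ≥0} (hL : LipschitzWith L φ) (hφ : Integrable φ) :
    Integrable (regQuot φ) := by
  have h1 : Integrable ((Icc (-1 : ℝ) 1).indicator fun _ => (L : ℝ)) :=
    (integrable_indicator_iff measurableSet_Icc).2 (by simp)
  refine (h1.add hφ.norm).mono' (measurable_regQuot hL.continuous.measurable).aestronglyMeasurable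
    (ae_of_all _ fun t => ?_)
  simp only [Pi.add_apply]
  unfold regQuot
  rw [norm_div, Complex.norm_real, Real.norm_eq_abs]
  by_cases ht : |t| ≤ 1
  · rw [if_pos ht, indicator_of_mem (mem_Icc_neg_one_one_iff.2 ht)]
    have h2 : ‖φ t - φ 0‖ ≤ L * |t| := by
      have := hL.dist_le_mul t 0
      rwa [dist_eq_norm, Real.dist_eq, sub_zero] at this
    have h3 : ‖φ t - φ 0‖ / |t| ≤ L := div_le_of_le_mul₀ (abs_nonneg _) L.2 h2
    linarith [norm_nonneg (φ t)]
  · rw [if_neg ht, sub_zero]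
    have h3 : ‖φ t‖ / |t| ≤ ‖φ t‖ := div_le_self (norm_nonneg _) (not_le.1 ht).le
    have h4 : 0 ≤ (Icc (-1 : ℝ) 1).indicator (fun _ => (L : ℝ)) t :=
      indicator_nonneg (fun _ _ => L.2) _
    linarith

lemma integrable_div_of_lipschitz {φ : ℝ → ℂ} {L : ℝ≥0} (hL : LipschitzWith L φ)
    (hφ : Integrable φ) (h0 : φ 0 = 0) : Integrable fun t : ℝ => φ t / t := by
  have := integrable_regQuot hL hφ
  unfold regQuot at this
  simpa only [h0, ite_self, sub_zero] using this

lemma integral_eq_zero_of_odd {h : ℝ → ℂ} (hodd : ∀ t, h (-t) = -h t) : ∫ t, h t = 0 := by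
  have h1 := integral_neg_eq_self h volume
  simp_rw [hodd, integral_neg] at h1
  exact self_eq_neg.1 h1.symm

/-- The principal value of `φ t / t` is the integral of the regularised quotient. -/
lemma tendsto_truncated_integral {φ : ℝ → ℂ} {L : ℝ≥0} (hL : LipschitzWith L φ)
    (hφ : Integrable φ) :
    Tendsto (fun ε : ℝ => ∫ t, {t : ℝ | ε < |t|}.indicator (fun t : ℝ => φ t / t) t) (𝓝[>] 0)
      (𝓝 (∫ t, regQuot φ t)) := by
  have hms : ∀ ε : ℝ, MeasurableSet {t : ℝ | ε < |t|} := fun ε =>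
    measurableSet_lt measurable_const (by fun_prop)
  have hI := integrable_regQuot hL hφ
  have h1 : Tendsto (fun ε : ℝ => ∫ t, {t : ℝ | ε < |t|}.indicator (regQuot φ) t) (𝓝[>] 0)
      (𝓝 (∫ t, regQuot φ t)) := by
    refine tendsto_integral_filter_of_dominated_convergence (fun t => ‖regQuot φ t‖) ?_ ?_
      hI.norm ?_
    · exact Eventually.of_forall fun ε => (hI.indicator (hms ε)).aestronglyMeasurable
    · exact Eventually.of_forall fun ε => ae_of_all _ fun t => norm_indicator_le_norm_self _ _
    · filter_upwards [(measure_singleton (0 : ℝ) : volume {(0 : ℝ)} = 0) |> compl_mem_ae_iff.2]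
        with t ht
      refine tendsto_const_nhds.congr' ?_
      have : 0 < |t| := abs_pos.2 ht
      filter_upwards [mem_nhdsWithin_of_mem_nhds (Iio_mem_nhds this)] with ε hε
      rw [indicator_of_mem (show t ∈ {t : ℝ | ε < |t|} from hε)]
  refine h1.congr' ?_
  filter_upwards [self_mem_nhdsWithin] with ε hε
  rw [mem_Ioi] at hε
  let h : ℝ → ℂ := fun t => if ε < |t| ∧ |t| ≤ 1 then φ 0 / t else 0
  have hm : Measurable h := by
    refine Measurable.ite ?_ (by fun_prop) measurable_const
    exact (hms ε).inter (measurableSet_le (f := fun t : ℝ => |t|) (by fun_prop) measurable_const)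
  have hi : Integrable h := by
    have h2 : Integrable ((Icc (-1 : ℝ) 1).indicator fun _ => ‖φ 0‖ / ε) :=
      (integrable_indicator_iff measurableSet_Icc).2 (by simp)
    refine h2.mono' hm.aestronglyMeasurable (ae_of_all _ fun t => ?_)
    by_cases ht : ε < |t| ∧ |t| ≤ 1
    · rw [indicator_of_mem (mem_Icc_neg_one_one_iff.2 ht.2)]
      simp only [h]
      rw [if_pos ht, norm_div, Complex.norm_real, Real.norm_eq_abs]
      exact div_le_div_of_nonneg_left (norm_nonneg _) hε ht.1.le
    · simp only [h]
      rw [if_neg ht, norm_zero]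
      exact indicator_nonneg (fun _ _ => by positivity) _
  have h0 : ∫ t, h t = 0 := integral_eq_zero_of_odd fun t => by
    simp only [h]
    rw [abs_neg]
    split_ifs
    · push_cast
      rw [div_neg]
    · simp
  have h3 := integral_add (hI.indicator (hms ε)) hi
  rw [h0, add_zero] at h3
  rw [← h3]
  refine integral_congr_ae (ae_of_all _ fun t => ?_)
  simp only [h]
  by_cases ht : ε < |t|
  · rw [indicator_of_mem (show t ∈ {t : ℝ | ε < |t|} from ht),
      indicator_of_mem (show t ∈ {t : ℝ | ε < |t|} from ht), regQuot]
    by_cases ht1 : |t| ≤ 1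
    · rw [if_pos ht1, if_pos ⟨ht, ht1⟩]
      ring
    · rw [if_neg ht1, if_neg fun h => ht1 h.2]
      ring
  · rw [indicator_of_notMem (show t ∉ {t : ℝ | ε < |t|} from ht),
      indicator_of_notMem (show t ∉ {t : ℝ | ε < |t|} from ht), if_neg fun h => ht h.1, add_zero]

/-- The smooth truncation at scales between `2 ^ (-K)` and `2 ^ (K + 1)`. -/
def smoothTrunc (Θ : 𝓢(ℝ, ℂ)) (K : ℕ) (t : ℝ) : ℂ :=
  Θ (2 ^ (K : ℤ) * t) - Θ (2 ^ (-(K : ℤ) - 1) * t)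

lemma exists_lipschitz {Θ : 𝓢(ℝ, ℂ)} (hΘ : ∀ t, HasDerivAt Θ (avgKernel t) t) :
    ∃ L : ℝ≥0, LipschitzWith L Θ := by
  obtain ⟨D, hD⟩ := exists_avgKernel_le
  refine ⟨D, lipschitzWith_of_nnnorm_deriv_le (fun t => (hΘ t).differentiableAt) fun t => ?_⟩
  rw [(hΘ t).deriv]
  exact hD t

lemma exists_lipschitz_comp_mul {Θ : ℝ → ℂ} {L : ℝ≥0} (hL : LipschitzWith L Θ) (a : ℝ) :
    ∃ L' : ℝ≥0, LipschitzWith L' fun t => Θ (a * t) := by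
  refine ⟨L * ‖a‖₊, hL.comp (LipschitzWith.of_dist_le_mul fun x y => ?_)⟩
  rw [Real.dist_eq, Real.dist_eq, ← mul_sub, abs_mul]
  rfl

lemma integrable_smoothTrunc (Θ : 𝓢(ℝ, ℂ)) (K : ℕ) : Integrable (smoothTrunc Θ K) := by
  have h : Integrable Θ := Θ.integrable
  exact (h.comp_mul_left' (by positivity)).sub (h.comp_mul_left' (by positivity))

lemma integrable_smoothTrunc_div {Θ : 𝓢(ℝ, ℂ)} (hΘ : ∀ t, HasDerivAt Θ (avgKernel t) t) (K : ℕ) :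
    Integrable fun t : ℝ => smoothTrunc Θ K t / t := by
  obtain ⟨L, hL⟩ := exists_lipschitz hΘ
  obtain ⟨L1, hL1⟩ := exists_lipschitz_comp_mul hL (2 ^ (K : ℤ))
  obtain ⟨L2, hL2⟩ := exists_lipschitz_comp_mul hL (2 ^ (-(K : ℤ) - 1))
  exact integrable_div_of_lipschitz (hL1.sub hL2) (integrable_smoothTrunc Θ K)
    (by simp [smoothTrunc])

lemma lintegral_dilate_div {o : ℝ → ℂ} (ho : Measurable o) {a : ℝ} (ha : 0 < a) :
    ∫⁻ t : ℝ, ‖o (a * t) / t‖ₑ = ∫⁻ t : ℝ, ‖o t / t‖ₑ := by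
  have h1 : ∀ t : ℝ, ‖o (a * t) / t‖ₑ = ENNReal.ofReal a * ‖o (a * t) / (a * t : ℝ)‖ₑ := fun t => by
    rw [← Real.enorm_of_nonneg ha.le, ← ofReal_norm, ← ofReal_norm, ← ofReal_norm,
      ← ENNReal.ofReal_mul (norm_nonneg _), norm_div, norm_div, Complex.norm_real,
      Complex.norm_real, norm_mul]
    congr 1
    have : ‖a‖ ≠ 0 := norm_ne_zero_iff.2 ha.ne'
    field_simp
  simp_rw [h1]
  rw [lintegral_const_mul' _ _ ENNReal.ofReal_ne_top,
    lintegral_comp_mul_left_real (fun t : ℝ => ‖o t / t‖ₑ) (by fun_prop) ha, ← mul_assoc,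
    ← ENNReal.ofReal_mul ha.le, mul_inv_cancel₀ ha.ne', ENNReal.ofReal_one, one_mul]

lemma exists_smoothTrunc_integral_le {Θ : 𝓢(ℝ, ℂ)} (hΘ : ∀ t, HasDerivAt Θ (avgKernel t) t) :
    ∃ A : ℝ≥0, ∀ K : ℕ,
      ‖∫ t : ℝ, (Icc (-1 : ℝ) 1).indicator (fun t : ℝ => smoothTrunc Θ K t / t) t‖ₑ ≤ A := by
  obtain ⟨L, hL⟩ := exists_lipschitz hΘ
  obtain ⟨L1, hL1⟩ := exists_lipschitz_comp_mul hL (-1)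
  let o : ℝ → ℂ := fun t => Θ t - Θ (-1 * t)
  have hΘi : Integrable Θ := Θ.integrable
  have ho : Integrable fun t : ℝ => o t / t := integrable_div_of_lipschitz (hL.sub hL1)
    (hΘi.sub (hΘi.comp_mul_left' (by norm_num))) (by simp [o])
  have hom : Measurable o := (hL.sub hL1).continuous.measurable
  have hA : ∫⁻ t : ℝ, ‖o t / t‖ₑ ≠ ⊤ := ho.2.ne
  refine ⟨((∫⁻ t : ℝ, ‖o t / t‖ₑ) + ∫⁻ t : ℝ, ‖o t / t‖ₑ).toNNReal, fun K => ?_⟩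
  rw [ENNReal.coe_toNNReal (by finiteness)]
  set h : ℝ → ℂ := (Icc (-1 : ℝ) 1).indicator (fun t : ℝ => smoothTrunc Θ K t / t) with hh
  have hi : Integrable h := (integrable_smoothTrunc_div hΘ K).indicator measurableSet_Icc
  have h1 : (2 : ℂ) * ∫ t, h t = ∫ t, (h t + h (-t)) := by
    rw [integral_add hi hi.comp_neg, integral_neg_eq_self h volume, two_mul]
  have h2 : ‖∫ t, h t‖ₑ ≤ ‖(2 : ℂ) * ∫ t, h t‖ₑ := by
    rw [enorm_mul]
    refine le_mul_of_one_le_left zero_le ?_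
    rw [← ofReal_norm]
    simp
  refine h2.trans ?_
  rw [h1]
  refine (enorm_integral_le_lintegral_enorm _).trans ?_
  have h3 : ∀ t : ℝ, ‖h t + h (-t)‖ₑ ≤
      ‖o (2 ^ (K : ℤ) * t) / t‖ₑ + ‖o (2 ^ (-(K : ℤ) - 1) * t) / t‖ₑ := fun t => by
    have hneg : -t ∈ Icc (-1 : ℝ) 1 ↔ t ∈ Icc (-1 : ℝ) 1 := by
      rw [mem_Icc, mem_Icc]
      constructor <;> rintro ⟨h, h'⟩ <;> constructor <;> linarith
    by_cases ht : t ∈ Icc (-1 : ℝ) 1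
    · have : h t + h (-t) =
          o (2 ^ (K : ℤ) * t) / t - o (2 ^ (-(K : ℤ) - 1) * t) / t := by
        rw [hh, indicator_of_mem ht, indicator_of_mem (hneg.2 ht)]
        simp only [o, smoothTrunc]
        push_cast
        rw [div_neg, neg_one_mul, neg_one_mul, mul_neg, mul_neg]
        ring
      rw [this]
      exact enorm_sub_le
    · rw [hh, indicator_of_notMem ht, indicator_of_notMem (fun h => ht (hneg.1 h))]
      simp
  refine (lintegral_mono h3).trans ?_
  have hpos : ∀ k : ℤ, (0 : ℝ) < 2 ^ k := fun k => by positivity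
  rw [lintegral_add_left (by fun_prop), lintegral_dilate_div hom (hpos _),
    lintegral_dilate_div hom (hpos _)]

lemma tendsto_smoothTrunc (Θ : 𝓢(ℝ, ℂ)) {t : ℝ} (ht : t ≠ 0) :
    Tendsto (fun K : ℕ => smoothTrunc Θ K t) atTop (𝓝 (-Θ 0)) := by
  have h1 : Tendsto (fun K : ℕ => (2 : ℝ) ^ (-(K : ℤ) - 1) * t) atTop (𝓝 0) := by
    have : Tendsto (fun K : ℕ => (2⁻¹ : ℝ) ^ K * (2⁻¹ * t)) atTop (𝓝 (0 * (2⁻¹ * t))) :=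
      (tendsto_pow_atTop_nhds_zero_of_lt_one (by norm_num) (by norm_num)).mul_const _
    rw [zero_mul] at this
    refine this.congr fun K => ?_
    rw [zpow_sub_one₀ two_ne_zero, zpow_neg, zpow_natCast, inv_pow]
    ring
  have h2 : Tendsto (fun K : ℕ => Θ ((2 : ℝ) ^ (-(K : ℤ) - 1) * t)) atTop (𝓝 (Θ 0)) :=
    (Θ.continuous.tendsto 0).comp h1
  have h3 : Tendsto (fun K : ℕ => Θ ((2 : ℝ) ^ (K : ℤ) * t)) atTop (𝓝 0) := by
    have hz : Tendsto Θ (cocompact ℝ) (𝓝 0) := Θ.toZeroAtInfty.zero_at_infty'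
    refine hz.comp ?_
    rw [← Metric.cobounded_eq_cocompact, ← tendsto_norm_atTop_iff_cobounded]
    simp_rw [norm_mul, norm_zpow, Real.norm_ofNat, zpow_natCast]
    exact (tendsto_pow_atTop_atTop_of_one_lt one_lt_two).atTop_mul_const (norm_pos_iff.2 ht)
  simpa [smoothTrunc] using h3.sub h2

/-- The principal value is controlled by the smooth truncations. -/
lemma exists_enorm_principal_value_le {Θ : 𝓢(ℝ, ℂ)} (hΘ0 : Θ 0 ≠ 0)
    (hΘ : ∀ t, HasDerivAt Θ (avgKernel t) t) : ∃ A B : ℝ≥0, ∀ (φ : ℝ → ℂ) (L : ℝ≥0),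
      LipschitzWith L φ → Integrable φ → ∀ q : ℕ → ℝ≥0∞,
        (∀ K, ‖∫ t : ℝ, φ t * (smoothTrunc Θ K t / t)‖ₑ ≤ q K) →
        ‖∫ t, regQuot φ t‖ₑ ≤ B * liminf (fun K => q K + A * ‖φ 0‖ₑ) atTop := by
  obtain ⟨A, hA⟩ := exists_smoothTrunc_integral_le hΘ
  obtain ⟨D, hD⟩ := schwartz_bdd Θ
  refine ⟨A, ‖(Θ 0)⁻¹‖₊, fun φ L hL hφ q hq => ?_⟩
  have hI := integrable_regQuot hL hφ
  have hsm : ∀ K, Continuous (smoothTrunc Θ K) := fun K => by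
    have := Θ.continuous
    unfold smoothTrunc
    fun_prop
  have hsb : ∀ K t, ‖smoothTrunc Θ K t‖ ≤ D + D := fun K t =>
    (norm_sub_le _ _).trans (add_le_add (hD _) (hD _))
  have hGi : ∀ K, Integrable fun t => regQuot φ t * smoothTrunc Θ K t := fun K =>
    hI.mul_bdd (c := D + D) (hsm K).aestronglyMeasurable (ae_of_all _ (hsb K))
  have hlim : Tendsto (fun K => ∫ t, regQuot φ t * smoothTrunc Θ K t) atTop
      (𝓝 (∫ t, regQuot φ t * -Θ 0)) := by
    refine tendsto_integral_of_dominated_convergence (fun t => ‖regQuot φ t‖ * (D + D))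
      (fun K => (hGi K).aestronglyMeasurable) (hI.norm.mul_const _) (fun K => ?_) ?_
    · refine ae_of_all _ fun t => ?_
      rw [norm_mul]
      exact mul_le_mul_of_nonneg_left (hsb K t) (norm_nonneg _)
    · filter_upwards [(measure_singleton (0 : ℝ) : volume {(0 : ℝ)} = 0) |> compl_mem_ae_iff.2]
        with t ht
      exact (tendsto_smoothTrunc Θ ht).const_mul _
  rw [integral_mul_const] at hlim
  have hbound : ∀ K, ‖∫ t, regQuot φ t * smoothTrunc Θ K t‖ₑ ≤ q K + A * ‖φ 0‖ₑ := fun K => by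
    have hind := ((integrable_smoothTrunc_div hΘ K).indicator
      (measurableSet_Icc (a := (-1 : ℝ)) (b := 1))).const_mul (φ 0)
    have h1 := integral_add (hGi K) hind
    have h2 : ∀ t : ℝ, regQuot φ t * smoothTrunc Θ K t + φ 0 *
        (Icc (-1 : ℝ) 1).indicator (fun t : ℝ => smoothTrunc Θ K t / t) t =
        φ t * (smoothTrunc Θ K t / t) := fun t => by
      unfold regQuot
      by_cases ht : |t| ≤ 1
      · rw [if_pos ht, indicator_of_mem (mem_Icc_neg_one_one_iff.2 ht)]
        ring
      · rw [if_neg ht, indicator_of_notMem fun h => ht (mem_Icc_neg_one_one_iff.1 h)]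
        ring
    simp_rw [h2] at h1
    rw [integral_const_mul] at h1
    rw [← sub_eq_iff_eq_add] at h1
    rw [← h1]
    refine enorm_sub_le.trans (add_le_add (hq K) ?_)
    rw [enorm_mul, mul_comm]
    exact mul_le_mul_left (hA K) _
  have h3 := ((continuous_enorm.tendsto _).comp hlim).liminf_eq
  have h4 : ‖(∫ t, regQuot φ t) * -Θ 0‖ₑ ≤ liminf (fun K => q K + A * ‖φ 0‖ₑ) atTop := by
    rw [← h3]
    exact liminf_le_liminf (Eventually.of_forall hbound)
  calc ‖∫ t, regQuot φ t‖ₑ = ‖(Θ 0)⁻¹‖ₑ * ‖(∫ t, regQuot φ t) * -Θ 0‖ₑ := by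
        rw [← enorm_mul, mul_comm, mul_assoc, neg_mul, mul_inv_cancel₀ hΘ0, mul_neg_one, enorm_neg]
    _ ≤ _ := mul_le_mul_right h4 _

/-! ### The Carleson operator -/

lemma hilbert_eq_integral_regQuot {g : ℝ → ℂ} (x : ℝ) {L : ℝ≥0}
    (hL : LipschitzWith L fun t => g (x - t)) (hg : Integrable g) :
    hilbert g x = (Real.pi)⁻¹ • ∫ t, regQuot (fun t => g (x - t)) t := by
  have h := (tendsto_truncated_integral hL (hg.comp_sub_left x)).const_smul (Real.pi)⁻¹
  refine (h.congr fun ε => ?_).limUnder_eq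
  congr 1
  rw [← integral_indicator (measurableSet_lt measurable_const (by fun_prop)),
    ← integral_sub_left_eq_self ({y : ℝ | ε < |x - y|}.indicator _) volume x]
  refine integral_congr_ae (ae_of_all _ fun t => ?_)
  dsimp only
  by_cases ht : ε < |t|
  · rw [indicator_of_mem (show t ∈ {t : ℝ | ε < |t|} from ht), indicator_of_mem]
    · push_cast
      rw [sub_sub_cancel]
    · rwa [mem_ofPred_eq, sub_sub_cancel]
  · rw [indicator_of_notMem (show t ∉ {t : ℝ | ε < |t|} from ht), indicator_of_notMem]
    rwa [mem_ofPred_eq, sub_sub_cancel]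

lemma exists_carleson_le : ∃ A B : ℝ≥0, ∀ f : ℝ → ℂ, ContDiff ℝ (⊤ : ℕ∞) f →
    HasCompactSupport f → ∀ x,
      carleson f x ≤ B * liminf (fun K => avgModelMax K f x + A * ‖f x‖ₑ) atTop := by
  obtain ⟨Θ, hΘ0, hΘ⟩ := exists_avgPrimitive
  obtain ⟨A, B, hAB⟩ := exists_enorm_principal_value_le hΘ0 hΘ
  refine ⟨A, B, fun f hf hfc x => iSup_le fun α => ?_⟩
  set g : ℝ → ℂ := fun y => Complex.exp (-(Complex.I * (α : ℂ) * (y : ℂ))) * f y with hg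
  have hfi : Integrable f := hf.continuous.integrable_of_hasCompactSupport hfc
  have hgd : ContDiff ℝ (⊤ : ℕ∞) g := by
    have : ContDiff ℝ (⊤ : ℕ∞) fun y : ℝ => (y : ℂ) := Complex.ofRealCLM.contDiff
    fun_prop
  have hgc : HasCompactSupport g := hfc.mul_left
  have hgi : Integrable g := hgd.continuous.integrable_of_hasCompactSupport hgc
  obtain ⟨L, hL⟩ := hgd.lipschitzWith_of_hasCompactSupport hgc (by simp)
  have hL' : LipschitzWith L fun t => g (x - t) := by
    have := hL.comp (LipschitzWith.of_dist_le_mul (K := 1) (f := fun t : ℝ => x - t)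
      fun s t => by rw [dist_sub_left, NNReal.coe_one, one_mul])
    rwa [mul_one] at this
  have hnorm : ∀ y, ‖g y‖ₑ = ‖f y‖ₑ := fun y => by
    rw [hg, enorm_mul, ← ofReal_norm, show -(Complex.I * (α : ℂ) * (y : ℂ)) =
      ((-(α * y) : ℝ) : ℂ) * Complex.I by push_cast; ring, Complex.norm_exp_ofReal_mul_I,
      ENNReal.ofReal_one, one_mul]
  have hq : ∀ K, ‖∫ t : ℝ, g (x - t) * (smoothTrunc Θ K t / t)‖ₑ ≤ avgModelMax K f x := fun K => by
    refine le_trans (le_of_eq ?_) (enorm_truncated_le_avgModelMax hΘ K hf.continuous.measurable hfi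
      (α / (2 * Real.pi)) x)
    have h1 : ∫ z, f z * (Complex.exp (↑(2 * Real.pi * (α / (2 * Real.pi) * (x - z))) * Complex.I) *
        ((Θ (2 ^ (K : ℤ) * (x - z)) - Θ (2 ^ (-(K : ℤ) - 1) * (x - z))) / (x - z : ℝ))) =
        Complex.exp (↑(α * x) * Complex.I) * ∫ t : ℝ, g (x - t) * (smoothTrunc Θ K t / t) := by
      rw [← integral_const_mul, ← integral_sub_left_eq_self _ volume x]
      refine integral_congr_ae (ae_of_all _ fun t => ?_)
      simp only [hg, smoothTrunc, sub_sub_cancel]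
      have h2 : Complex.exp (↑(2 * Real.pi * (α / (2 * Real.pi) * t)) * Complex.I) =
          Complex.exp (↑(α * x) * Complex.I) *
            Complex.exp (-(Complex.I * (α : ℂ) * ((x - t : ℝ) : ℂ))) := by
        rw [← Complex.exp_add]
        congr 1
        have : 2 * Real.pi * (α / (2 * Real.pi) * t) = α * t := by
          have := Real.pi_ne_zero
          field_simp
        rw [this]
        push_cast
        ring
      rw [h2]
      ring
    rw [h1, enorm_mul, ← ofReal_norm (Complex.exp _), Complex.norm_exp_ofReal_mul_I,
      ENNReal.ofReal_one, one_mul]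
  have h := hAB (fun t => g (x - t)) L hL' (hgi.comp_sub_left x) _ hq
  simp only [sub_zero, hnorm] at h
  refine le_trans ?_ h
  rw [hilbert_eq_integral_regQuot x hL' hgi]
  rw [← enorm_eq_nnnorm, enorm_smul]
  refine mul_le_of_le_one_left zero_le ?_
  rw [← ofReal_norm, Real.norm_of_nonneg (inv_nonneg.2 Real.pi_pos.le)]
  exact ENNReal.ofReal_le_one.2 (inv_le_one_of_one_le₀ (by linarith [Real.pi_gt_three]))

end CarlesonEstimate

/-- The maximally modulated Hilbert transform `𝒞` is bounded
on every standard Lebesgue space `L^r(ℝ)` with `1 < r < ∞`. -/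
theorem carleson_bounded_on_Lr :
    ∀ r : ℝ, 1 < r → ∃ C : ℝ≥0, 0 < C ∧
      ∀ f : ℝ → ℂ, ContDiff ℝ (⊤ : ℕ∞) f → HasCompactSupport f →
        (∫⁻ x, carleson f x ^ r) ^ (1 / r) ≤
          C * (∫⁻ x, (‖f x‖₊ : ℝ≥0∞) ^ r) ^ (1 / r) := by
  intro r hr
  have hr0 : 0 < r := by linarith
  obtain ⟨A, B, hAB⟩ := exists_carleson_le
  obtain ⟨C, hC⟩ := avgModelMax_strong hr
  set E : ℝ≥0 := B ^ r * (2 ^ (r - 1) * (C + A ^ r)) with hE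
  refine ⟨E ^ (1 / r) + 1, by positivity, fun f hf hfc => ?_⟩
  have hfm := hf.continuous.measurable
  have hfi : Integrable f := hf.continuous.integrable_of_hasCompactSupport hfc
  have hmain : ∫⁻ x, carleson f x ^ r ≤ E * ∫⁻ x, ‖f x‖ₑ ^ r := by
    calc ∫⁻ x, carleson f x ^ r
        ≤ ∫⁻ x, (B : ℝ≥0∞) ^ r *
            liminf (fun K => (avgModelMax K f x + A * ‖f x‖ₑ) ^ r) atTop := by
          refine lintegral_mono fun x => ?_
          refine (ENNReal.rpow_le_rpow (hAB f hf hfc x) hr0.le).trans_eq ?_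
          rw [ENNReal.mul_rpow_of_nonneg _ _ hr0.le]
          congr 1
          exact (ENNReal.monotone_rpow_of_nonneg hr0.le).map_liminf_of_continuousAt _
            ENNReal.continuous_rpow_const.continuousAt
      _ = (B : ℝ≥0∞) ^ r *
            ∫⁻ x, liminf (fun K => (avgModelMax K f x + A * ‖f x‖ₑ) ^ r) atTop :=
          lintegral_const_mul' _ _ (by finiteness)
      _ ≤ (B : ℝ≥0∞) ^ r *
            liminf (fun K => ∫⁻ x, (avgModelMax K f x + A * ‖f x‖ₑ) ^ r) atTop := by
          refine mul_le_mul_right (lintegral_liminf_le fun K => ?_) _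
          have := measurable_avgModelMax K hfm
          fun_prop
      _ ≤ (B : ℝ≥0∞) ^ r *
            liminf (fun _ : ℕ => 2 ^ (r - 1) * ((C + A ^ r) * ∫⁻ x, ‖f x‖ₑ ^ r)) atTop := by
          refine mul_le_mul_right (liminf_le_liminf (Eventually.of_forall fun K => ?_)) _
          calc ∫⁻ x, (avgModelMax K f x + A * ‖f x‖ₑ) ^ r
              ≤ ∫⁻ x, 2 ^ (r - 1) * (avgModelMax K f x ^ r + A ^ r * ‖f x‖ₑ ^ r) := by
                refine lintegral_mono fun x => ?_
                rw [← ENNReal.mul_rpow_of_nonneg _ _ hr0.le]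
                exact ENNReal.rpow_add_le_mul_rpow_add_rpow _ _ hr.le
            _ = 2 ^ (r - 1) * ((∫⁻ x, avgModelMax K f x ^ r) + A ^ r * ∫⁻ x, ‖f x‖ₑ ^ r) := by
                rw [lintegral_const_mul' _ _ (by finiteness),
                  lintegral_add_left ((measurable_avgModelMax K hfm).pow_const r),
                  lintegral_const_mul' _ _ (by finiteness)]
            _ ≤ _ := by
                rw [add_mul]
                exact mul_le_mul_right (add_le_add_left (hC f hfm hfi K) _) _
      _ = E * ∫⁻ x, ‖f x‖ₑ ^ r := by
          rw [liminf_const, hE]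
          push_cast
          rw [ENNReal.coe_rpow_of_nonneg _ hr0.le, ENNReal.coe_rpow_of_nonneg _ hr0.le,
            ENNReal.coe_rpow_of_nonneg _ (by linarith)]
          push_cast
          ring
  change _ ≤ _ * (∫⁻ x, ‖f x‖ₑ ^ r) ^ (1 / r)
  refine (ENNReal.rpow_le_rpow hmain (by positivity)).trans ?_
  rw [ENNReal.mul_rpow_of_nonneg _ _ (by positivity)]
  refine mul_le_mul_left ?_ _
  push_cast
  rw [ENNReal.coe_rpow_of_nonneg _ (by positivity)]
  exact le_self_add
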